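/- Let f, g ∈ ℂ[x, y, z] be nonconstant squarefree polynomials, defining complex algebraic surfaces V(f), V(g) ⊆ ℂ³. If V(f) and V(g) are outer bi-Lipschitz homeomorphic at infinity, then the total degree of f equals the total degree of g. -/

import Mathlib

open Filter Topology MvPolynomial

/-- The tangent cone at infinity of a subset `A` of a normed space: `v` is a tangent
vector at infinity if there are points `x i ∈ A` with `‖x i‖ → ∞` and positive reals
`t i` with `x i / t i → v`. -/
def TangentConeAtInfty {E : Type*} [NormedAddCommGroup E] [NormedSpace ℝ E]
    (A : Set E) : Set E :=
  {v | ∃ (x : ℕ → E) (t : ℕ → ℝ), (∀ i, x i ∈ A) ∧ (∀ i, 0 < t i) ∧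
    Tendsto (fun i => ‖x i‖) atTop atTop ∧
    Tendsto (fun i => (t i)⁻¹ • x i) atTop (𝓝 v)}

/-- `X` and `Y` are outer bi-Lipschitz homeomorphic at infinity: there are compact sets
`K`, `K'` and a bijection `φ : X \ K → Y \ K'` which is Lipschitz with Lipschitz inverse,
with respect to the Euclidean (outer) distance. -/
def OuterBiLipAtInfty {E F : Type*} [NormedAddCommGroup E] [NormedAddCommGroup F]
    (X : Set E) (Y : Set F) : Prop :=
  ∃ (K : Set E) (K' : Set F) (φ : E → F),
    IsCompact K ∧ IsCompact K' ∧ Set.BijOn φ (X \ K) (Y \ K') ∧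
    (∃ C > (0:ℝ), ∀ a ∈ X \ K, ∀ b ∈ X \ K, dist (φ a) (φ b) ≤ C * dist a b) ∧
    (∃ c > (0:ℝ), ∀ a ∈ X \ K, ∀ b ∈ X \ K, dist a b ≤ c * dist (φ a) (φ b))

/-- The germs `(X,0)` and `(Y,0)` are outer bi-Lipschitz homeomorphic: there are
`ε, δ > 0` and a bijection `φ : X ∩ B̄_ε(0) → Y ∩ B̄_δ(0)` with `φ 0 = 0` which is
Lipschitz with Lipschitz inverse for the Euclidean (outer) distance. -/
def OuterBiLipGerm {E F : Type*} [NormedAddCommGroup E] [NormedAddCommGroup F]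
    (X : Set E) (Y : Set F) : Prop :=
  ∃ ε > (0:ℝ), ∃ δ > (0:ℝ), ∃ φ : E → F,
    Set.BijOn φ (X ∩ Metric.closedBall 0 ε) (Y ∩ Metric.closedBall 0 δ) ∧ φ 0 = 0 ∧
    (∃ C > (0:ℝ), ∀ a ∈ X ∩ Metric.closedBall 0 ε, ∀ b ∈ X ∩ Metric.closedBall 0 ε,
      dist (φ a) (φ b) ≤ C * dist a b) ∧
    (∃ c > (0:ℝ), ∀ a ∈ X ∩ Metric.closedBall 0 ε, ∀ b ∈ X ∩ Metric.closedBall 0 ε,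
      dist a b ≤ c * dist (φ a) (φ b))

/-- The zero set in `ℂⁿ` (with the Euclidean norm) of a polynomial. -/
noncomputable def mvZeroSet {n : ℕ} (f : MvPolynomial (Fin n) ℂ) :
    Set (EuclideanSpace ℂ (Fin n)) :=
  {x | MvPolynomial.eval (x : Fin n → ℂ) f = 0}

/-- Two vectors are `ε`-near if their distance is small relative to both norms. -/
def RelNear {E : Type*} [NormedAddCommGroup E] (ε : ℝ) (a b : E) : Prop :=
  ‖a - b‖ < ε * ‖a‖ ∧ ‖a - b‖ < ε * ‖b‖

section RelNear

variable {E : Type*} [NormedAddCommGroup E] {ε δ : ℝ} {a b c : E}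

theorem RelNear.symm (h : RelNear ε a b) : RelNear ε b a :=
  ⟨by rw [norm_sub_rev]; exact h.2, by rw [norm_sub_rev]; exact h.1⟩

theorem RelNear.mono (h : RelNear ε a b) (hle : ε ≤ δ) : RelNear δ a b :=
  ⟨h.1.trans_le (by gcongr), h.2.trans_le (by gcongr)⟩

theorem RelNear.refl (hε : 0 < ε) (ha : a ≠ 0) : RelNear ε a a := by
  have := norm_pos_iff.2 ha
  constructor <;> simp <;> positivity

theorem RelNear.trans (h : RelNear ε a b) (h' : RelNear ε b c) (hε : ε ≤ 1) :
    RelNear (3 * ε) a c := by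
  have h1 : ‖a - c‖ ≤ ‖a - b‖ + ‖b - c‖ := norm_sub_le_norm_sub_add_norm_sub _ _ _
  have h2 : ‖b‖ ≤ ‖a‖ + ‖a - b‖ := by
    have := norm_sub_le a (a - b); rwa [sub_sub_cancel] at this
  have h3 : ‖b‖ ≤ ‖c‖ + ‖b - c‖ := by
    have := norm_add_le c (b - c); rwa [add_sub_cancel] at this
  have hpos : 0 < ε := by
    by_contra hn
    have := h.1
    nlinarith [norm_nonneg (a - b), norm_nonneg a]
  have := h.1; have := h.2; have := h'.1; have := h'.2
  have h4 : ‖b‖ ≤ 2 * ‖a‖ := by nlinarith [norm_nonneg a]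
  have h5 : ‖b‖ ≤ 2 * ‖c‖ := by nlinarith [norm_nonneg c]
  constructor <;> nlinarith

theorem RelNear.pos (h : RelNear ε a b) : 0 < ε := by
  by_contra hn
  have := h.1
  nlinarith [norm_nonneg (a - b), norm_nonneg a]

theorem RelNear.ne_zero (h : RelNear ε a b) : a ≠ 0 := by
  rintro rfl
  have := h.1
  simp at this
  linarith [norm_nonneg b]

theorem RelNear.smul {𝕜 : Type*} [NormedField 𝕜] [NormedSpace 𝕜 E] (h : RelNear ε a b)
    {r : 𝕜} (hr : r ≠ 0) : RelNear ε (r • a) (r • b) := by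
  have := norm_pos_iff.2 hr
  unfold RelNear at *
  rw [← smul_sub, norm_smul, norm_smul, norm_smul]
  constructor
  · nlinarith [h.1]
  · nlinarith [h.2]

end RelNear

/-- Small-scale 1-cocycles on a set, with values in an abelian group. -/
def IsCocycle {E A : Type*} [NormedAddCommGroup E] [AddCommGroup A] (W : Set E) (ε : ℝ)
    (κ : E → E → A) : Prop :=
  ∀ a ∈ W, ∀ b ∈ W, ∀ c ∈ W, RelNear ε a b → RelNear ε b c → RelNear ε a c →
    κ a b + κ b c = κ a c

section IsCocycle

variable {E A : Type*} [NormedAddCommGroup E] [AddCommGroup A] {W : Set E} {ε δ : ℝ}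
  {κ : E → E → A} {a b c : E}

theorem IsCocycle.mono (h : IsCocycle W ε κ) (hle : δ ≤ ε) : IsCocycle W δ κ :=
  fun a ha b hb c hc h1 h2 h3 =>
    h a ha b hb c hc (h1.mono hle) (h2.mono hle) (h3.mono hle)

theorem IsCocycle.self (h : IsCocycle W ε κ) (hε : 0 < ε) (ha : a ∈ W) (h0 : a ≠ 0) :
    κ a a = 0 := by
  have hn := RelNear.refl hε h0
  simpa using h a ha a ha a ha hn hn hn

theorem IsCocycle.symm (h : IsCocycle W ε κ) (ha : a ∈ W) (hb : b ∈ W)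
    (hab : RelNear ε a b) : κ b a = - κ a b := by
  have h1 := h a ha b hb a ha hab hab.symm (RelNear.refl hab.pos hab.ne_zero)
  rw [h.self hab.pos ha hab.ne_zero] at h1
  exact eq_neg_of_add_eq_zero_right h1

end IsCocycle

/-- `e` annihilates the obstruction to lifting circle-valued cocycles to real cocycles. -/
def TorsionExponent {E : Type*} [NormedAddCommGroup E] (W : Set E) (e : ℕ) : Prop :=
  ∀ ε > 0, ∀ χ : E → E → ℝ, IsCocycle W ε (fun a b => (χ a b : UnitAddCircle)) →
    ∃ ε' > 0, ∃ n : E → E → ℤ, IsCocycle W ε' (fun a b => (e : ℝ) * χ a b - n a b)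

theorem UnitAddCircle.exists_int_of_coe_eq_zero {x : ℝ} (h : (x : UnitAddCircle) = 0) :
    ∃ n : ℤ, x = n := by
  obtain ⟨n, hn⟩ := (AddCircle.coe_eq_zero_iff (1 : ℝ)).1 h
  exact ⟨n, by simpa using hn.symm⟩

theorem TorsionExponent.transport {E F : Type*} [NormedAddCommGroup E] [NormedAddCommGroup F]
    {W₁ : Set E} {W₂ : Set F} {e : ℕ}
    (h : ∀ ε > 0, ∃ s : E → F, (∀ a ∈ W₁, s a ∈ W₂) ∧
      (∃ δ > 0, ∀ a ∈ W₁, ∀ b ∈ W₁, RelNear δ a b → RelNear ε (s a) (s b)) ∧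
      ∀ ε' > 0, ∃ r : F → E, (∀ p ∈ W₂, r p ∈ W₁) ∧
        (∃ δ' > 0, ∀ p ∈ W₂, ∀ q ∈ W₂, RelNear δ' p q → RelNear ε' (r p) (r q)) ∧
        ∀ p ∈ W₂, RelNear ε (s (r p)) p)
    (ht : TorsionExponent W₁ e) : TorsionExponent W₂ e := by
  intro ε₀ hε₀ χ hχ
  obtain ⟨ε, hε, hε1, hε9⟩ : ∃ ε : ℝ, 0 < ε ∧ 3 * ε ≤ 1 ∧ 3 * (3 * ε) ≤ ε₀ :=
    ⟨min (1 / 3) (ε₀ / 9), by positivity, by linarith [min_le_left (1 / 3 : ℝ) (ε₀ / 9)],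
      by linarith [min_le_right (1 / 3 : ℝ) (ε₀ / 9)]⟩
  obtain ⟨s, hsW, ⟨δ, hδ, hs⟩, hr⟩ := h ε hε
  have hc1 : IsCocycle W₁ δ (fun a b => (χ (s a) (s b) : UnitAddCircle)) := by
    intro a ha b hb c hc h1 h2 h3
    refine hχ _ (hsW a ha) _ (hsW b hb) _ (hsW c hc) ((hs a ha b hb h1).mono (by linarith))
      ((hs b hb c hc h2).mono (by linarith)) ((hs a ha c hc h3).mono (by linarith))
  obtain ⟨ε', hε', n₁, hn₁⟩ := ht δ hδ (fun a b => χ (s a) (s b)) hc1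
  obtain ⟨r, hrW, ⟨δ', hδ', hr'⟩, hsr⟩ := hr (min ε' δ) (by positivity)
  have hm : ∀ p ∈ W₂, ∀ q ∈ W₂, RelNear (min δ' ε) p q → ∃ m : ℤ,
      χ p q + χ q (s (r q)) - χ p (s (r p)) - χ (s (r p)) (s (r q)) = m := by
    intro p hp q hq hpq
    have hpq1 := hpq.mono (min_le_right _ _)
    have hpq2 := hpq.mono (min_le_left _ _)
    apply UnitAddCircle.exists_int_of_coe_eq_zero
    have hP := hsW _ (hrW p hp)
    have hQ := hsW _ (hrW q hq)
    have hPp := hsr p hp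
    have hQq := hsr q hq
    have hPQ : RelNear ε (s (r p)) (s (r q)) :=
      hs _ (hrW p hp) _ (hrW q hq) ((hr' p hp q hq hpq2).mono (min_le_right _ _))
    have h0 : RelNear ε₀ p (s (r q)) := (hpq1.trans hQq.symm (by linarith)).mono (by linarith)
    have e1 := hχ p hp q hq _ hQ (hpq1.mono (by linarith)) (hQq.symm.mono (by linarith)) h0
    have e2 := hχ p hp _ hP _ hQ (hPp.symm.mono (by linarith)) (hPQ.mono (by linarith)) h0
    simp only [AddCircle.coe_sub, AddCircle.coe_add]
    rw [e1, ← e2]; abel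
  classical
  let m : F → F → ℤ := fun p q => if h : ∃ m : ℤ,
      χ p q + χ q (s (r q)) - χ p (s (r p)) - χ (s (r p)) (s (r q)) = m then h.choose else 0
  have hm' : ∀ p ∈ W₂, ∀ q ∈ W₂, RelNear (min δ' ε) p q →
      χ p q + χ q (s (r q)) - χ p (s (r p)) - χ (s (r p)) (s (r q)) = m p q := by
    intro p hp q hq hpq
    have hex := hm p hp q hq hpq
    simp only [m, dif_pos hex]
    exact hex.choose_spec
  refine ⟨min δ' ε, by positivity, fun p q => e * m p q + n₁ (r p) (r q), ?_⟩
  intro a ha b hb c hc h1 h2 h3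
  have hr1 := hn₁ _ (hrW a ha) _ (hrW b hb) _ (hrW c hc)
    ((hr' a ha b hb (h1.mono (min_le_left _ _))).mono (min_le_left _ _))
    ((hr' b hb c hc (h2.mono (min_le_left _ _))).mono (min_le_left _ _))
    ((hr' a ha c hc (h3.mono (min_le_left _ _))).mono (min_le_left _ _))
  have m1 := hm' a ha b hb h1
  have m2 := hm' b hb c hc h2
  have m3 := hm' a ha c hc h3
  push_cast
  rw [← m1, ← m2, ← m3]
  linear_combination hr1

section Ladder

variable {E A : Type*} [NormedAddCommGroup E] [AddCommGroup A] {W : Set E} {ε δ : ℝ}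
  {κ : E → E → A}

theorem IsCocycle.ladder (hκ : IsCocycle W ε κ) (hδ : δ ≤ 1) (hδε : 3 * δ ≤ ε) (a b : ℕ → E)
    (n : ℕ) (ha : ∀ k ≤ n, a k ∈ W) (hb : ∀ k ≤ n, b k ∈ W)
    (haa : ∀ k < n, RelNear δ (a k) (a (k + 1))) (hbb : ∀ k < n, RelNear δ (b k) (b (k + 1)))
    (hab : ∀ k ≤ n, RelNear δ (a k) (b k)) :
    ∑ k ∈ Finset.range n, κ (a k) (a (k + 1)) + κ (a n) (b n) =
      κ (a 0) (b 0) + ∑ k ∈ Finset.range n, κ (b k) (b (k + 1)) := by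
  induction n with
  | zero => simp
  | succ n ih =>
    have ih' := ih (fun k hk => ha k (by omega)) (fun k hk => hb k (by omega))
      (fun k hk => haa k (by omega)) (fun k hk => hbb k (by omega)) (fun k hk => hab k (by omega))
    have h1 := haa n (by omega)
    have hpos := h1.pos
    have h2 := hbb n (by omega)
    have h3 := hab n (by omega)
    have h4 := hab (n + 1) le_rfl
    have h5 := (h3.trans h2 hδ).mono hδε
    have e1 := hκ _ (ha n (by omega)) _ (ha (n + 1) le_rfl) _ (hb (n + 1) le_rfl)
      (h1.mono (by linarith)) (h4.mono (by linarith)) h5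
    have e2 := hκ _ (ha n (by omega)) _ (hb n (by omega)) _ (hb (n + 1) le_rfl)
      (h3.mono (by linarith)) (h2.mono (by linarith)) h5
    rw [Finset.sum_range_succ, Finset.sum_range_succ, add_assoc, e1, ← e2, ← add_assoc, ih',
      add_assoc]

end Ladder

section LinePotential

variable {F A : Type*} [NormedAddCommGroup F] [NormedSpace ℝ F] [AddCommGroup A]

/-- A cochain extended to twice the scale through midpoints. -/
noncomputable def midpointExtend (c : F → F → A) (u v : F) : A :=
  c u (midpoint ℝ u v) + c (midpoint ℝ u v) v

def IsAbsCocycle (δ : ℝ) (c : F → F → A) : Prop :=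
  ∀ u v w, dist u v < δ → dist v w < δ → dist u w < δ → c u v + c v w = c u w

theorem dist_midpoint_midpoint_left (u v w : F) :
    dist (midpoint ℝ u v) (midpoint ℝ u w) = dist v w / 2 := by
  rw [dist_eq_norm, dist_eq_norm, midpoint_eq_smul_add, midpoint_eq_smul_add, ← smul_sub,
    norm_smul, add_sub_add_left_eq_sub]
  simp
  ring

theorem IsAbsCocycle.midpointExtend {δ : ℝ} {c : F → F → A} (h : IsAbsCocycle δ c) :
    IsAbsCocycle (2 * δ) (midpointExtend c) := by
  intro u v w huv hvw huw
  unfold _root_.midpointExtend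
  have hl : ∀ a b : F, dist a (midpoint ℝ a b) = dist a b / 2 := by
    intro a b; rw [dist_left_midpoint]; simp; ring
  have hr : ∀ a b : F, dist (midpoint ℝ a b) b = dist a b / 2 := by
    intro a b; rw [dist_midpoint_right]; simp; ring
  have m1 : dist (midpoint ℝ u v) (midpoint ℝ u w) < δ := by
    rw [dist_midpoint_midpoint_left]; linarith
  have m2 : dist (midpoint ℝ u v) (midpoint ℝ v w) < δ := by
    rw [midpoint_comm u v, dist_midpoint_midpoint_left]; linarith
  have m3 : dist (midpoint ℝ v w) (midpoint ℝ u w) < δ := by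
    rw [midpoint_comm v w, midpoint_comm u w, dist_midpoint_midpoint_left, dist_comm]; linarith
  have l1 : dist u (midpoint ℝ u v) < δ := by rw [hl]; linarith
  have l2 : dist (midpoint ℝ u v) v < δ := by rw [hr]; linarith
  have l3 : dist v (midpoint ℝ v w) < δ := by rw [hl]; linarith
  have l4 : dist (midpoint ℝ v w) w < δ := by rw [hr]; linarith
  have l5 : dist u (midpoint ℝ u w) < δ := by rw [hl]; linarith
  have l6 : dist (midpoint ℝ u w) w < δ := by rw [hr]; linarith
  have e1 := h _ _ _ l1 m1 l5
  have e2 := h _ _ _ l2 l3 m2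
  have e3 := h _ _ _ m3 l6 l4
  have e4 := h _ _ _ m2 m3 m1
  rw [← e1, ← e4, ← e3, ← e2]
  abel

theorem midpointExtend_eq {δ : ℝ} {c : F → F → A} (h : IsAbsCocycle δ c) {u v : F}
    (huv : dist u v < δ) : midpointExtend c u v = c u v := by
  apply h _ _ _ _ _ huv
  · rw [dist_left_midpoint]; simp; linarith [dist_nonneg (x := u) (y := v)]
  · rw [dist_midpoint_right]; simp; linarith [dist_nonneg (x := u) (y := v)]

theorem IsAbsCocycle.exists_potential {δ : ℝ} (hδ : 0 < δ) {c : F → F → A}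
    (h : IsAbsCocycle δ c) : ∃ H : F → A, ∀ u v, dist u v < δ → c u v = H v - H u := by
  let C : ℕ → F → F → A := fun k => _root_.midpointExtend^[k] c
  have hC : ∀ k, IsAbsCocycle (2 ^ k * δ) (C k) := by
    intro k
    induction k with
    | zero => simpa [C] using h
    | succ k ih =>
      have := ih.midpointExtend
      simp only [C, Function.iterate_succ_apply'] at this ⊢
      convert this using 1; ring
  have hstep : ∀ k u v, dist u v < 2 ^ k * δ → C (k + 1) u v = C k u v := by
    intro k u v huv
    simp only [C, Function.iterate_succ_apply']
    exact midpointExtend_eq (hC k) huv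
  have hmono : ∀ k j u v, dist u v < 2 ^ k * δ → C (k + j) u v = C k u v := by
    intro k j u v huv
    induction j with
    | zero => rfl
    | succ j ih =>
      rw [← add_assoc, hstep, ih]
      refine huv.trans_le ?_
      gcongr
      · norm_num
      · omega
  have hex : ∀ v : F, ∃ k : ℕ, dist 0 v < 2 ^ k * δ := by
    intro v
    obtain ⟨k, hk⟩ := pow_unbounded_of_one_lt (dist 0 v / δ) (by norm_num : (1 : ℝ) < 2)
    exact ⟨k, by rwa [div_lt_iff₀ hδ] at hk⟩
  choose K hK using hex
  refine ⟨fun v => C (K v) 0 v, fun u v huv => ?_⟩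
  have hle : ∀ k j : ℕ, k ≤ j → (2 : ℝ) ^ k * δ ≤ 2 ^ j * δ := by
    intro k j hkj; gcongr; norm_num
  set M := max (K u) (K v)
  have hu : C M 0 u = C (K u) 0 u := by
    obtain ⟨j, hj⟩ := Nat.exists_eq_add_of_le (le_max_left (K u) (K v))
    rw [show M = K u + j from hj]; exact hmono _ _ _ _ (hK u)
  have hv : C M 0 v = C (K v) 0 v := by
    obtain ⟨j, hj⟩ := Nat.exists_eq_add_of_le (le_max_right (K u) (K v))
    rw [show M = K v + j from hj]; exact hmono _ _ _ _ (hK v)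
  have huv' : C M u v = c u v := by
    have := hmono 0 M u v (by simpa using huv)
    rwa [zero_add] at this
  have := hC M 0 u v ((hK u).trans_le (hle _ _ (le_max_left _ _)))
    (huv.trans_le (by simpa using hle 0 M (by omega)))
    ((hK v).trans_le (hle _ _ (le_max_right _ _)))
  simp only
  rw [← hu, ← hv, ← huv', ← this]
  abel

end LinePotential

theorem eventually_relNear {E : Type*} [NormedAddCommGroup E] {ε : ℝ} {q : E} (hq : q ≠ 0)
    (hε : 0 < ε) : ∀ᶠ p in 𝓝 q, RelNear ε q p := by
  have hpos : 0 < ‖q‖ := norm_pos_iff.2 hq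
  have h1 : Tendsto (fun p => ‖q - p‖) (𝓝 q) (𝓝 0) := by
    have : Continuous fun p : E => ‖q - p‖ := by fun_prop
    simpa using this.tendsto q
  have h2 : Tendsto (fun p => ε * ‖p‖ - ‖q - p‖) (𝓝 q) (𝓝 (ε * ‖q‖)) := by
    have : Continuous fun p : E => ε * ‖p‖ - ‖q - p‖ := by fun_prop
    simpa using this.tendsto q
  filter_upwards [(tendsto_order.1 h1).2 (ε * ‖q‖) (by positivity),
    (tendsto_order.1 h2).1 0 (by positivity)] with p h3 h4
  exact ⟨h3, by linarith⟩

section Holonomy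

variable {E A : Type*} [NormedAddCommGroup E] [NormedSpace ℂ E] [AddCommGroup A] {W : Set E}
  {ε δ : ℝ} {κ : E → E → A}

/-- The point `k` of the `n`-gon in the unit circle. -/
noncomputable def gonPoint (n k : ℕ) : ℂ := Complex.exp (k * (2 * Real.pi * Complex.I / n))

theorem gonPoint_ne_zero (n k : ℕ) : gonPoint n k ≠ 0 := Complex.exp_ne_zero _

theorem gonPoint_zero (n : ℕ) : gonPoint n 0 = 1 := by simp [gonPoint]

theorem gonPoint_self {n : ℕ} (hn : n ≠ 0) : gonPoint n n = 1 := by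
  have : (n : ℂ) ≠ 0 := by exact_mod_cast hn
  rw [gonPoint, mul_div_cancel₀ _ this, Complex.exp_two_pi_mul_I]

theorem norm_gonPoint (n k : ℕ) : ‖gonPoint n k‖ = 1 := by
  rw [gonPoint, show (k : ℂ) * (2 * Real.pi * Complex.I / n) =
    ((k * (2 * Real.pi / n) : ℝ) : ℂ) * Complex.I by push_cast; ring]
  exact Complex.norm_exp_ofReal_mul_I _

theorem gonPoint_succ (n k : ℕ) : gonPoint n (k + 1) = gonPoint n k * gonPoint n 1 := by
  rw [gonPoint, gonPoint, gonPoint, ← Complex.exp_add]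
  congr 1; push_cast; ring

/-- The sum of a cochain over the regular `n`-gon in the complex line through a point. -/
noncomputable def holonomy (n : ℕ) (κ : E → E → A) (q : E) : A :=
  ∑ k ∈ Finset.range n, κ (gonPoint n k • q) (gonPoint n (k + 1) • q)

theorem exists_near_exp (hε : 0 < ε) : ∃ δ > 0, ∀ w w' : ℂ, dist w w' < δ → ∀ q : E, q ≠ 0 →
    RelNear ε (Complex.exp w • q) (Complex.exp w' • q) := by
  refine ⟨min 1 (ε / 2), by positivity, ?_⟩
  have key : ∀ w w' : ℂ, dist w w' < min 1 (ε / 2) → ∀ q : E, q ≠ 0 →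
      ‖Complex.exp w • q - Complex.exp w' • q‖ < ε * ‖Complex.exp w • q‖ := by
    intro w w' h q hq
    have h1 : Complex.exp w' = Complex.exp w * Complex.exp (w' - w) := by
      rw [← Complex.exp_add]; congr 1; ring
    rw [dist_comm, dist_eq_norm] at h
    have h2 := Complex.norm_exp_sub_one_le (x := w' - w) (h.le.trans (min_le_left _ _))
    have h3 := h.trans_le (min_le_right _ _)
    rw [h1, ← sub_smul, norm_smul, norm_smul, show Complex.exp w - Complex.exp w *
      Complex.exp (w' - w) = - (Complex.exp w * (Complex.exp (w' - w) - 1)) by ring, norm_neg,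
      norm_mul]
    have : 0 < ‖Complex.exp w‖ := norm_pos_iff.2 (Complex.exp_ne_zero _)
    have : 0 < ‖q‖ := norm_pos_iff.2 hq
    have : ‖Complex.exp (w' - w) - 1‖ < ε := by linarith
    calc _ < ‖Complex.exp w‖ * ε * ‖q‖ := by gcongr
      _ = _ := by ring
  intro w w' h q hq
  refine ⟨key w w' h q hq, ?_⟩
  rw [norm_sub_rev]
  exact key w' w (by rwa [dist_comm]) q hq

theorem tendsto_gon_mesh :
    Tendsto (fun n : ℕ => ‖(2 * Real.pi * Complex.I / n : ℂ)‖) atTop (𝓝 0) := by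
  have : Tendsto (fun n : ℕ => 2 * Real.pi / (n : ℝ)) atTop (𝓝 0) :=
    tendsto_const_div_atTop_nhds_zero_nat _
  refine this.congr fun n => ?_
  simp [abs_of_pos Real.pi_pos]

theorem eventually_gon_near (hε : 0 < ε) : ∀ᶠ n : ℕ in atTop, n ≠ 0 ∧ ∀ q : E, q ≠ 0 → ∀ k,
    RelNear ε (gonPoint n k • q) (gonPoint n (k + 1) • q) := by
  obtain ⟨δ, hδ, h⟩ := exists_near_exp (E := E) hε
  filter_upwards [(tendsto_order.1 tendsto_gon_mesh).2 δ hδ, eventually_ne_atTop 0] with n hn hn0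
  refine ⟨hn0, fun q hq k => h _ _ ?_ q hq⟩
  rw [dist_eq_norm, ← norm_neg, show ∀ z : ℂ, -((k : ℂ) * z - ((k + 1 : ℕ) : ℂ) * z) = z by
    intro z; push_cast; ring]
  exact hn

theorem holonomy_eq_of_near (hW : ∀ q ∈ W, ∀ r : ℂ, r ≠ 0 → r • q ∈ W) (h0 : (0 : E) ∉ W)
    (hκ : IsCocycle W ε κ) (hε : 0 < ε) : ∃ δ > 0, ∀ᶠ n : ℕ in atTop, ∀ p ∈ W, ∀ q ∈ W,
    RelNear δ p q → holonomy n κ p = holonomy n κ q := by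
  refine ⟨min 1 (ε / 3), by positivity, ?_⟩
  filter_upwards [eventually_gon_near (E := E) (ε := min 1 (ε / 3)) (by positivity)]
    with n ⟨hn0, hn⟩ p hp q hq hpq
  have hne : ∀ q ∈ W, q ≠ 0 := fun q hq h => h0 (h ▸ hq)
  have := hκ.ladder (min_le_left 1 (ε / 3)) (by linarith [min_le_right 1 (ε / 3)])
    (fun k => gonPoint n k • p) (fun k => gonPoint n k • q) n
    (fun k _ => hW _ hp _ (gonPoint_ne_zero _ _)) (fun k _ => hW _ hq _ (gonPoint_ne_zero _ _))
    (fun k _ => hn p (hne p hp) k) (fun k _ => hn q (hne q hq) k)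
    (fun k _ => hpq.smul (gonPoint_ne_zero _ _))
  simp only [gonPoint_self hn0, gonPoint_zero] at this
  rw [add_comm] at this
  exact add_left_cancel this

theorem holonomy_const (hW : ∀ q ∈ W, ∀ r : ℂ, r ≠ 0 → r • q ∈ W) (h0 : (0 : E) ∉ W)
    (hpre : IsPreconnected W) (hκ : IsCocycle W ε κ) (hε : 0 < ε) :
    ∀ᶠ n : ℕ in atTop, ∀ p ∈ W, ∀ q ∈ W, holonomy n κ p = holonomy n κ q := by
  obtain ⟨δ, hδ, hev⟩ := holonomy_eq_of_near hW h0 hκ hε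
  filter_upwards [hev] with n hn p hp q hq
  refine hpre.induction₂ (fun p q => holonomy n κ p = holonomy n κ q) ?_ ?_ ?_ hp hq
  · intro x hx
    have hx0 : x ≠ 0 := fun h => h0 (h ▸ hx)
    filter_upwards [self_mem_nhdsWithin, mem_nhdsWithin_of_mem_nhds (eventually_relNear hx0 hδ)]
      with y hy hxy using hn x hx y hy hxy
  · intro x y z _ _ _ h h'; exact h.trans h'
  · intro x y _ _ h; exact h.symm

theorem exists_log_potential (hW : ∀ q ∈ W, ∀ r : ℂ, r ≠ 0 → r • q ∈ W) (h0 : (0 : E) ∉ W)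
    (hκ : IsCocycle W ε κ) (hε : 0 < ε) : ∃ δ > 0, ∀ q ∈ W, ∃ H : ℂ → A, ∀ w w', dist w w' < δ →
      κ (Complex.exp w • q) (Complex.exp w' • q) = H w' - H w := by
  obtain ⟨δ, hδ, h⟩ := exists_near_exp (E := E) hε
  refine ⟨δ, hδ, fun q hq => ?_⟩
  have hq0 : q ≠ 0 := fun h => h0 (h ▸ hq)
  refine IsAbsCocycle.exists_potential hδ
    (c := fun w w' => κ (Complex.exp w • q) (Complex.exp w' • q)) ?_
  intro u v w huv hvw huw
  exact hκ _ (hW q hq _ (Complex.exp_ne_zero _)) _ (hW q hq _ (Complex.exp_ne_zero _)) _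
    (hW q hq _ (Complex.exp_ne_zero _)) (h _ _ huv q hq0) (h _ _ hvw q hq0) (h _ _ huw q hq0)

theorem sum_gon_potential {c : ℂ → ℂ → A} {H : ℂ → A} (hδ : 0 < δ)
    (hH : ∀ w w', dist w w' < δ → c w w' = H w' - H w) :
    ∀ᶠ n : ℕ in atTop, n ≠ 0 ∧ ∀ w, ∑ k ∈ Finset.range n,
      c (w + (k : ℕ) * (2 * Real.pi * Complex.I / n))
        (w + ((k + 1 : ℕ) : ℂ) * (2 * Real.pi * Complex.I / n)) =
      H (w + 2 * Real.pi * Complex.I) - H w := by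
  filter_upwards [(tendsto_order.1 tendsto_gon_mesh).2 δ hδ, eventually_ne_atTop 0] with n hn hn0
  refine ⟨hn0, fun w => ?_⟩
  have hn0' : (n : ℂ) ≠ 0 := by exact_mod_cast hn0
  rw [Finset.sum_congr rfl (g := fun k : ℕ =>
      H (w + ((k + 1 : ℕ) : ℂ) * (2 * Real.pi * Complex.I / n)) -
    H (w + (k : ℕ) * (2 * Real.pi * Complex.I / n)))]
  · rw [Finset.sum_range_sub (fun k : ℕ => H (w + (k : ℂ) * (2 * Real.pi * Complex.I / n)))]
    rw [mul_div_cancel₀ _ hn0']; simp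
  · intro k _
    apply hH
    rw [dist_eq_norm, ← norm_neg, show ∀ z : ℂ,
      -(w + (k : ℂ) * z - (w + ((k + 1 : ℕ) : ℂ) * z)) = z by intro z; push_cast; ring]
    exact hn

/-- If the holonomy around the complex lines vanishes, a cocycle has a potential along each
complex line. -/
theorem exists_line_potential (hW : ∀ q ∈ W, ∀ r : ℂ, r ≠ 0 → r • q ∈ W) (h0 : (0 : E) ∉ W)
    (hκ : IsCocycle W ε κ) (hε : 0 < ε)
    (hhol : ∃ᶠ n : ℕ in atTop, ∀ q ∈ W, holonomy n κ q = 0) :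
    ∃ δ > 0, ∀ q ∈ W, ∃ h : ℂ → A, ∀ r s : ℂ, RelNear δ r s → κ (r • q) (s • q) = h s - h r := by
  obtain ⟨δ, hδ, hpot⟩ := exists_log_potential hW h0 hκ hε
  have hlog : ∀ᶠ z : ℂ in 𝓝 1, ‖Complex.log z‖ < δ := by
    have : ContinuousAt (fun z => ‖Complex.log z‖) 1 :=
      (continuousAt_clog (by simp [Complex.slitPlane])).norm
    have h := this.tendsto
    simp only [Complex.log_one, norm_zero] at h
    exact (tendsto_order.1 h).2 δ hδ
  obtain ⟨δ', hδ', hlog⟩ := Metric.eventually_nhds_iff.1 hlog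
  refine ⟨δ', hδ', fun q hq => ?_⟩
  obtain ⟨H, hH⟩ := hpot q hq
  have hper : ∀ w, H (w + 2 * Real.pi * Complex.I) = H w := by
    obtain ⟨n, hn, hn0, hsum⟩ := (hhol.and_eventually (sum_gon_potential hδ hH)).exists
    intro w
    have h1 := hsum w
    have h2 := hn (Complex.exp w • q) (hW q hq _ (Complex.exp_ne_zero _))
    rw [← sub_eq_zero, ← h1, ← h2, holonomy]
    refine Finset.sum_congr rfl fun k _ => ?_
    simp only [smul_smul, gonPoint, ← Complex.exp_add, add_comm]
  have hperi : ∀ (m : ℕ) w, H (w + m * (2 * Real.pi * Complex.I)) = H w := by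
    intro m w
    induction m with
    | zero => simp
    | succ m ih => rw [← ih, ← hper (w + m * _)]; congr 1; push_cast; ring
  have hperz : ∀ (m : ℤ) w, H (w + m * (2 * Real.pi * Complex.I)) = H w := by
    intro m w
    obtain ⟨k, rfl | rfl⟩ := m.eq_nat_or_neg
    · exact_mod_cast hperi k w
    · rw [← hperi k (w + _)]; congr 1; push_cast; ring
  refine ⟨fun r => H (Complex.log r), fun r s hrs => ?_⟩
  have hr := hrs.ne_zero
  have hs := hrs.symm.ne_zero
  have h1 : ‖Complex.log (s / r)‖ < δ := by
    apply hlog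
    have : s / r - 1 = (s - r) / r := by field_simp
    rw [dist_eq_norm, this, norm_div, div_lt_iff₀ (norm_pos_iff.2 hr), norm_sub_rev]
    exact hrs.1
  have h2 : Complex.exp (Complex.log r + Complex.log (s / r)) = s := by
    rw [Complex.exp_add, Complex.exp_log hr, Complex.exp_log (div_ne_zero hs hr)]
    field_simp
  have h3 := hH (Complex.log r) (Complex.log r + Complex.log (s / r)) (by simpa using h1)
  rw [h2, Complex.exp_log hr] at h3
  rw [h3]
  congr 1
  have h4 : Complex.exp (Complex.log s) = Complex.exp (Complex.log r + Complex.log (s / r)) := by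
    rw [h2, Complex.exp_log hs]
  obtain ⟨m, hm⟩ := Complex.exp_eq_exp_iff_exists_int.1 h4
  simp only [hm, hperz]

end Holonomy

/-- A cone in `ℂ² × ℂ` which is a `d`-sheeted family over a dense conical set of base points,
with controlled behaviour at the remaining base points. -/
structure ConeCover (W : Set ((ℂ × ℂ) × ℂ)) (U : Set (ℂ × ℂ)) (d : ℕ) : Prop where
  smul_mem : ∀ q ∈ W, ∀ r : ℂ, r ≠ 0 → r • q ∈ W
  smul_mem_base : ∀ u ∈ U, ∀ r : ℂ, r ≠ 0 → r • u ∈ U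
  fst_mem : ∀ q ∈ W, q.1 ∈ U
  fst_ne : ∀ u ∈ U, u.1 ≠ 0
  finite : {t : ℂ | ((1 : ℂ), t) ∉ U}.Finite
  bound : ∃ K, ∀ q ∈ W, ‖q.2‖ ≤ K * ‖q.1‖
  preconnected : IsPreconnected W
  pos : 0 < d
  fiber : ∀ u ∈ U, Nat.card {z // (u, z) ∈ W} = d
  cluster : ∀ u₀ : ℂ × ℂ, u₀ ≠ 0 → ∀ η > 0, ∃ σ > 0, σ < η ∧ ∃ r > 0, ∀ q ∈ W, ∀ q' ∈ W,
    dist q.1 u₀ < r → dist q'.1 u₀ < r → dist q.2 q'.2 < σ ∨ 3 * σ < dist q.2 q'.2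
  matching : ∀ ε > 0, ∃ δ > 0, ∀ u ∈ U, ∀ v ∈ U, RelNear δ u v →
    ∃ e : {z // (u, z) ∈ W} ≃ {z // (v, z) ∈ W}, ∀ z, RelNear ε (u, z.1) (v, (e z).1)

theorem RelNear.chain {E : Type*} [NormedAddCommGroup E] {η : ℝ} (f : ℕ → E) (h0 : f 0 ≠ 0)
    (hη : 0 < η) (hf : ∀ k, RelNear η (f k) (f (k + 1))) (k : ℕ) (hk : 3 ^ k * η ≤ 1) :
    RelNear (3 ^ k * η) (f 0) (f k) := by
  induction k with
  | zero => simpa using RelNear.refl hη h0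
  | succ k ih =>
    have h1 : 3 ^ k * η ≤ 1 := by
      refine le_trans ?_ hk
      gcongr
      · norm_num
      · omega
    have h2 : η ≤ 3 ^ k * η := le_mul_of_one_le_left hη.le (one_le_pow₀ (by norm_num))
    have := (ih h1).trans ((hf k).mono h2) h1
    rwa [pow_succ, mul_comm ((3 : ℝ) ^ k), mul_assoc]

theorem sum_perm_eq_zero {α A : Type*} [Fintype α] [AddCommGroup A] (π : Equiv.Perm α)
    (g : α → α → A) (hg : ∀ a b c, π.SameCycle a b → π.SameCycle b c → g a b + g b c = g a c) :
    ∑ x, g x (π x) = 0 := by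
  let o : α → α := fun x => (Quotient.mk (Equiv.Perm.SameCycle.setoid π) x).out
  have ho : ∀ x, π.SameCycle (o x) x := fun x =>
    Quotient.exact (s := Equiv.Perm.SameCycle.setoid π) (Quotient.out_eq _)
  have hoπ : ∀ x, o (π x) = o x := by
    intro x
    have : (Quotient.mk (Equiv.Perm.SameCycle.setoid π) (π x)) =
        Quotient.mk (Equiv.Perm.SameCycle.setoid π) x :=
      Quotient.sound (s := Equiv.Perm.SameCycle.setoid π)
        (Equiv.Perm.sameCycle_apply_left.2 (Equiv.Perm.SameCycle.refl π x))
    simp only [o, this]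
  have h1 : ∀ x, g x (π x) = g (o (π x)) (π x) - g (o x) x := by
    intro x
    rw [hoπ, ← hg (o x) x (π x) (ho x)
      (Equiv.Perm.sameCycle_apply_right.2 (Equiv.Perm.SameCycle.refl π x))]
    abel
  rw [Finset.sum_congr rfl fun x _ => h1 x, Finset.sum_sub_distrib,
    Equiv.sum_comp π (fun x => g (o x) x), sub_self]

theorem IsCocycle.sum_matching_eq {E A α β : Type*} [NormedAddCommGroup E] [AddCommGroup A]
    [Fintype α] {W : Set E} {ε η : ℝ} {κ : E → E → A} (hκ : IsCocycle W ε κ) (p : α → E)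
    (q : β → E) (hp : ∀ x, p x ∈ W) (hq : ∀ y, q y ∈ W) (e e' : α ≃ β)
    (he : ∀ x, RelNear η (p x) (q (e x))) (he' : ∀ x, RelNear η (p x) (q (e' x)))
    (h1 : 3 ^ (Nat.factorial (Fintype.card α) + 2) * η ≤ 1)
    (hε : 3 ^ (Nat.factorial (Fintype.card α) + 2) * η ≤ ε) :
    ∑ x, κ (p x) (q (e x)) = ∑ x, κ (p x) (q (e' x)) := by
  classical
  rcases isEmpty_or_nonempty α with hα | ⟨⟨x₀⟩⟩
  · simp
  have hη : 0 < η := (he x₀).pos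
  set M := Nat.factorial (Fintype.card α)
  have hpow : ∀ k ≤ M + 2, 3 ^ k * η ≤ 3 ^ (M + 2) * η := by
    intro k hk; gcongr; norm_num
  have hη1 := hpow 0 (by omega)
  have hη2 := hpow 1 (by omega)
  simp only [pow_zero, pow_one, one_mul] at hη1 hη2
  let π : Equiv.Perm α := e.trans e'.symm
  have hπ : ∀ x, e' (π x) = e x := fun x => by simp [π]
  have hn : ∀ x, RelNear (3 * η) (p x) (p (π x)) := by
    intro x
    refine (he x).trans ?_ (by linarith)
    rw [← hπ]; exact (he' _).symm
  have hcyc : ∀ a b, π.SameCycle a b → RelNear ε (p a) (p b) := by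
    intro a b hab
    obtain ⟨i, hi, rfl⟩ := hab.exists_pow_eq'
    have hi' : i ≤ M := by
      have h := orderOf_le_card_univ (x := π)
      rw [Fintype.card_perm] at h
      exact hi.le.trans h
    have hle : 3 ^ i * (3 * η) ≤ 3 ^ (M + 2) * η := by
      have := hpow (i + 1) (by omega)
      rwa [pow_succ, mul_assoc] at this
    have := RelNear.chain (fun k => p ((π ^ k) a)) (by simpa using (hn a).ne_zero)
      (by positivity : 0 < 3 * η)
      (fun k => by simpa [pow_succ'] using hn ((π ^ k) a)) i (hle.trans h1)
    simpa using this.mono (hle.trans hε)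
  have hsum := sum_perm_eq_zero π (fun a b => κ (p a) (p b)) (by
    intro a b c hab hbc
    exact hκ _ (hp a) _ (hp b) _ (hp c) (hcyc _ _ hab) (hcyc _ _ hbc) (hcyc _ _ (hab.trans hbc)))
  have hx : ∀ x, κ (p x) (q (e x)) = κ (p x) (p (π x)) + κ (p (π x)) (q (e' (π x))) := by
    intro x
    rw [hπ, hκ _ (hp x) _ (hp _) _ (hq _) ((hn x).mono (by linarith)) ?_
      ((he x).mono (by linarith))]
    rw [← hπ]; exact (he' _).mono (by linarith)
  rw [Finset.sum_congr rfl fun x _ => hx x, Finset.sum_add_distrib, hsum, zero_add,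
    Equiv.sum_comp π (fun x => κ (p x) (q (e' x)))]

namespace ConeCover

variable {W : Set ((ℂ × ℂ) × ℂ)} {U : Set (ℂ × ℂ)} {d : ℕ}

theorem base_ne_zero (h : ConeCover W U d) {u : ℂ × ℂ} (hu : u ∈ U) : u ≠ 0 := by
  rintro rfl; exact h.fst_ne _ hu rfl

theorem zero_notMem (h : ConeCover W U d) : (0 : (ℂ × ℂ) × ℂ) ∉ W := fun h0 =>
  h.base_ne_zero (h.fst_mem _ h0) rfl

theorem finite_fiber (h : ConeCover W U d) {u : ℂ × ℂ} (hu : u ∈ U) :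
    Finite {z // (u, z) ∈ W} := by
  apply Nat.finite_of_card_ne_zero
  rw [h.fiber u hu]; exact h.pos.ne'

theorem mem_base_iff (h : ConeCover W U d) {x y : ℂ} (hx : x ≠ 0) :
    (x, y) ∈ U ↔ ((1 : ℂ), y / x) ∈ U := by
  constructor
  · intro hu
    have := h.smul_mem_base _ hu x⁻¹ (inv_ne_zero hx)
    simpa [hx, div_eq_inv_mul] using this
  · intro hu
    have := h.smul_mem_base _ hu x hx
    simpa [hx, mul_div_cancel₀] using this

theorem exists_near_base (h : ConeCover W U d) {u : ℂ × ℂ} (hu : u ≠ 0) {η : ℝ} (hη : 0 < η) :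
    ∃ v ∈ U, RelNear η u v := by
  have key : ∀ (γ : ℂ → ℂ × ℂ), Continuous γ → γ 0 = u → {s : ℂ | s ≠ 0 ∧ γ s ∉ U}.Finite →
      ∃ v ∈ U, RelNear η u v := by
    intro γ hγ h0 hfin
    have h1 : ∀ᶠ s in 𝓝[≠] (0 : ℂ), RelNear η u (γ s) := by
      apply Filter.Eventually.filter_mono nhdsWithin_le_nhds
      have : Tendsto γ (𝓝 0) (𝓝 u) := h0 ▸ hγ.tendsto 0
      exact this.eventually (eventually_relNear hu hη)
    have h2 : ∀ᶠ s in 𝓝[≠] (0 : ℂ), γ s ∈ U := by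
      have h3 : {s : ℂ | s ≠ 0 ∧ γ s ∉ U}ᶜ ∈ 𝓝 (0 : ℂ) :=
        hfin.isClosed.isOpen_compl.mem_nhds (by simp)
      filter_upwards [mem_nhdsWithin_of_mem_nhds h3, self_mem_nhdsWithin] with s hs hs0
      by_contra hn
      exact hs ⟨hs0, hn⟩
    obtain ⟨s, hs1, hs2⟩ := (h1.and h2).exists
    exact ⟨γ s, hs2, hs1⟩
  obtain ⟨x, y⟩ := u
  by_cases hx : x = 0
  · subst hx
    have hy : y ≠ 0 := by rintro rfl; exact hu rfl
    refine key (fun s => (s, y)) (by fun_prop) rfl ?_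
    refine (h.finite.image fun t => y / t).subset ?_
    rintro s ⟨hs, hsU⟩
    rw [h.mem_base_iff hs] at hsU
    exact ⟨y / s, hsU, by simp [hy]⟩
  · refine key (fun s => (x, y + s * x)) (by fun_prop) (by simp) ?_
    refine (h.finite.image fun t => t - y / x).subset ?_
    rintro s ⟨hs, hsU⟩
    rw [h.mem_base_iff hx] at hsU
    exact ⟨_, hsU, by field_simp; ring⟩

end ConeCover

/-- A small cocycle on the punctured plane has zero sum over a large polygon in a complex line. -/
theorem IsCocycle.frequently_holonomy_eq_zero {A : Type*} [AddCommGroup A] {δ : ℝ} (hδ : 0 < δ)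
    {S : ℂ × ℂ → ℂ × ℂ → A} (hS : IsCocycle {u | u ≠ 0} δ S) (t : ℂ) :
    ∃ R : ℂ, R ≠ 0 ∧ ∀ᶠ n : ℕ in atTop, holonomy n S (R • ((1 : ℂ), t)) = 0 := by
  have hmin : ∃ m > 0, ∀ l : ℂ, m ≤ ‖((l, t * l + 1) : ℂ × ℂ)‖ := by
    refine ⟨1 / (2 * (‖t‖ + 1)), by positivity, fun l => ?_⟩
    by_contra hl
    push Not at hl
    rw [Prod.norm_mk, max_lt_iff] at hl
    have h1 : ‖(1 : ℂ)‖ ≤ ‖t * l + 1‖ + ‖t * l‖ := by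
      have := norm_sub_le (t * l + 1) (t * l)
      rwa [add_sub_cancel_left] at this
    rw [norm_mul, norm_one] at h1
    have h2 : 1 / (2 * (‖t‖ + 1)) * (2 * (‖t‖ + 1)) = 1 := by
      have : (0 : ℝ) < 2 * (‖t‖ + 1) := by positivity
      field_simp
    nlinarith [norm_nonneg t, norm_nonneg l, hl.1, hl.2]
  obtain ⟨m, hm, hmin⟩ := hmin
  let P : ℂ → ℂ × ℂ := fun l => (l, t * l + 1)
  have hP0 : ∀ l, P l ≠ 0 := fun l => norm_pos_iff.1 (hm.trans_le (hmin l))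
  have hPd : ∀ l l', ‖P l - P l'‖ ≤ (1 + ‖t‖) * dist l l' := by
    intro l l'
    have : P l - P l' = (l - l', t * (l - l')) := by simp [P]; ring
    rw [this, Prod.norm_mk, norm_mul, dist_eq_norm]
    apply max_le <;> nlinarith [norm_nonneg t, norm_nonneg (l - l')]
  set δ₁ := min 1 (δ / 3) with hδ₁
  have hδ₁0 : 0 < δ₁ := by positivity
  have hPn : ∀ l l', dist l l' < δ₁ * m / (1 + ‖t‖) → RelNear δ₁ (P l) (P l') := by
    intro l l' hl
    rw [lt_div_iff₀ (by positivity)] at hl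
    have h1 := hPd l l'
    constructor
    · nlinarith [hmin l]
    · nlinarith [hmin l']
  have hle1 : δ₁ ≤ 1 := min_le_left _ _
  have hle2 : 3 * δ₁ ≤ δ := by linarith [min_le_right 1 (δ / 3)]
  have hρ : 0 < δ₁ * m / (1 + ‖t‖) := by positivity
  obtain ⟨H, hH⟩ := IsAbsCocycle.exists_potential hρ (c := fun l l' => S (P l) (P l')) (by
    intro a b c hab hbc hac
    exact hS _ (hP0 a) _ (hP0 b) _ (hP0 c) ((hPn _ _ hab).mono (by linarith))
      ((hPn _ _ hbc).mono (by linarith)) ((hPn _ _ hac).mono (by linarith)))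
  set R : ℝ := 1 + 2 / δ₁ with hR
  have hR0 : 0 < R := by positivity
  have hRd : 1 < δ₁ * (R - 1) := by rw [hR]; field_simp; norm_num
  have hu : ((1 : ℂ), t) ≠ 0 := by simp
  have hRu : (R : ℂ) • ((1 : ℂ), t) ≠ 0 := smul_ne_zero (by exact_mod_cast hR0.ne') hu
  refine ⟨R, by exact_mod_cast hR0.ne', ?_⟩
  filter_upwards [eventually_gon_near (E := ℂ × ℂ) hδ₁0, eventually_gon_near (E := ℂ)
    (ε := δ₁ * m / (1 + ‖t‖) / R) (by positivity)] with n ⟨hn0, hn⟩ ⟨_, hn'⟩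
  have hd : ∀ k, dist (gonPoint n k * R) (gonPoint n (k + 1) * R) < δ₁ * m / (1 + ‖t‖) := by
    intro k
    have h1 := (hn' (R : ℂ) (by exact_mod_cast hR0.ne') k).1
    simp only [smul_eq_mul, norm_mul, norm_gonPoint, one_mul, Complex.norm_real, Real.norm_eq_abs,
      abs_of_pos hR0] at h1
    rw [div_mul_cancel₀ _ hR0.ne'] at h1
    rwa [dist_eq_norm]
  have hdiff : ∀ k, ‖gonPoint n k • (R : ℂ) • ((1 : ℂ), t) - P (gonPoint n k * R)‖ = 1 := by
    intro k
    have : gonPoint n k • (R : ℂ) • ((1 : ℂ), t) - P (gonPoint n k * R) = (0, -1) := by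
      simp [P]; ring
    rw [this]; simp
  have := hS.ladder hle1 hle2 (fun k => gonPoint n k • (R : ℂ) • ((1 : ℂ), t))
    (fun k => P (gonPoint n k * R)) n
    (fun k _ => smul_ne_zero (gonPoint_ne_zero _ _) hRu) (fun k _ => hP0 _)
    (fun k _ => hn _ hRu k) (fun k _ => hPn _ _ (hd k)) (by
      intro k _
      have hnorm : R ≤ ‖gonPoint n k • (R : ℂ) • ((1 : ℂ), t)‖ := by
        rw [norm_smul, norm_smul, norm_gonPoint, one_mul, Complex.norm_real, Real.norm_eq_abs,
          abs_of_pos hR0, Prod.norm_mk]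
        have : (1 : ℝ) ≤ max ‖(1 : ℂ)‖ ‖t‖ := by simp
        nlinarith
      have hnorm' : R ≤ ‖P (gonPoint n k * R)‖ := by
        refine le_trans ?_ (norm_fst_le _)
        simp [P, norm_gonPoint, abs_of_pos hR0]
      constructor
      · simp only [hdiff]; nlinarith
      · simp only [hdiff]; nlinarith)
  simp only [gonPoint_self hn0, gonPoint_zero] at this
  rw [add_comm] at this
  have h2 := add_left_cancel this
  rw [holonomy, h2, Finset.sum_congr rfl fun k _ => hH _ _ (hd k),
    Finset.sum_range_sub (fun k => H (gonPoint n k * R)), gonPoint_self hn0, gonPoint_zero,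
        sub_self]

namespace ConeCover

variable {W : Set ((ℂ × ℂ) × ℂ)} {U : Set (ℂ × ℂ)} {d : ℕ}

/-- Scaling identifies the fibers over `u` and `r • u`. -/
noncomputable def fiberScale (h : ConeCover W U d) (u : ℂ × ℂ) {r s : ℂ} (hr : r ≠ 0)
    (hs : s ≠ 0) : {z // (r • u, z) ∈ W} ≃ {z // (s • u, z) ∈ W} where
  toFun z := ⟨s / r * z.1, by
    have := h.smul_mem _ z.2 (s / r) (div_ne_zero hs hr)
    rwa [Prod.smul_mk, smul_smul, div_mul_cancel₀ _ hr] at this⟩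
  invFun z := ⟨r / s * z.1, by
    have := h.smul_mem _ z.2 (r / s) (div_ne_zero hr hs)
    rwa [Prod.smul_mk, smul_smul, div_mul_cancel₀ _ hs] at this⟩
  left_inv z := by ext; simp only; field_simp
  right_inv z := by ext; simp only; field_simp

theorem exists_transfer (h : ConeCover W U d) {A : Type*} [AddCommGroup A] {ε : ℝ} (hε : 0 < ε)
    {κ : (ℂ × ℂ) × ℂ → (ℂ × ℂ) × ℂ → A} (hκ : IsCocycle W ε κ) :
    ∃ δ > 0, ∃ η > 0, ∃ S : ℂ × ℂ → ℂ × ℂ → A, IsCocycle U δ S ∧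
      ∀ u ∈ U, ∀ v ∈ U, RelNear δ u v → ∀ [Fintype {z // (u, z) ∈ W}],
        ∀ e : {z // (u, z) ∈ W} ≃ {z // (v, z) ∈ W}, (∀ z, RelNear η (u, z.1) (v, (e z).1)) →
        S u v = ∑ z, κ (u, z.1) (v, (e z).1) := by
  classical
  set M := Nat.factorial d + 2
  have hP : (0 : ℝ) < 3 ^ M := by positivity
  obtain ⟨η, hη, hη1, hηε⟩ : ∃ η : ℝ, 0 < η ∧ 3 ^ M * (3 * η) ≤ 1 ∧ 3 ^ M * (3 * η) ≤ ε := by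
    refine ⟨min 1 ε / (3 ^ M * 3), by positivity, ?_, ?_⟩
    · rw [← mul_assoc, mul_div_cancel₀ _ (by positivity)]; exact min_le_left _ _
    · rw [← mul_assoc, mul_div_cancel₀ _ (by positivity)]; exact min_le_right _ _
  have h3M : (1 : ℝ) ≤ 3 ^ M := one_le_pow₀ (by norm_num)
  have h3η1 : 3 * η ≤ 1 := by nlinarith
  have h3ηε : 3 * η ≤ ε := by nlinarith
  obtain ⟨δ, hδ, hmatch⟩ := h.matching η hη
  have hex : ∀ u v, ∃ s : A, u ∈ U → v ∈ U → RelNear δ u v → ∀ [Fintype {z // (u, z) ∈ W}],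
      ∀ e : {z // (u, z) ∈ W} ≃ {z // (v, z) ∈ W}, (∀ z, RelNear (3 * η) (u, z.1) (v, (e z).1)) →
        s = ∑ z, κ (u, z.1) (v, (e z).1) := by
    intro u v
    by_cases huv : u ∈ U ∧ v ∈ U ∧ RelNear δ u v
    · obtain ⟨hu, hv, hn⟩ := huv
      have := h.finite_fiber hu
      have := Fintype.ofFinite {z // (u, z) ∈ W}
      obtain ⟨e, he⟩ := hmatch u hu v hv hn
      refine ⟨∑ z, κ (u, z.1) (v, (e z).1), fun _ _ _ inst e' he' => ?_⟩
      obtain rfl : inst = this := Subsingleton.elim _ _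
      have hc : Fintype.card {z // (u, z) ∈ W} = d := by
        rw [← Nat.card_eq_fintype_card]; exact h.fiber u hu
      exact hκ.sum_matching_eq (η := 3 * η) (fun z : {z // (u, z) ∈ W} => (u, z.1))
        (fun z : {z // (v, z) ∈ W} => (v, z.1)) (fun z => z.2) (fun z => z.2) e e'
        (fun z => (he z).mono (by linarith)) he' (by rw [hc]; exact hη1) (by rw [hc]; exact hηε)
    · exact ⟨0, fun hu hv hn => absurd ⟨hu, hv, hn⟩ huv⟩
  choose S hS using hex
  refine ⟨δ, hδ, η, hη, S, ?_, fun u hu v hv hn _ e he =>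
    hS u v hu hv hn e fun z => (he z).mono (by linarith)⟩
  intro a ha b hb c hc hab hbc hac
  have := h.finite_fiber ha
  have := Fintype.ofFinite {z // (a, z) ∈ W}
  have := h.finite_fiber hb
  have := Fintype.ofFinite {z // (b, z) ∈ W}
  obtain ⟨e, he⟩ := hmatch a ha b hb hab
  obtain ⟨e', he'⟩ := hmatch b hb c hc hbc
  have hn : ∀ z, RelNear (3 * η) (a, z.1) (c, ((e.trans e') z).1) := fun z =>
    (he z).trans (he' (e z)) (by linarith)
  rw [hS a b ha hb hab e fun z => (he z).mono (by linarith),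
    hS b c hb hc hbc e' fun z => (he' z).mono (by linarith),
    hS a c ha hc hac (e.trans e') hn, ← Equiv.sum_comp e, ← Finset.sum_add_distrib]
  refine Finset.sum_congr rfl fun z _ => ?_
  exact hκ _ z.2 _ (e z).2 _ (e' (e z)).2 ((he z).mono (by linarith))
    ((he' (e z)).mono (by linarith)) ((hn z).mono h3ηε)

theorem nsmul_holonomy (h : ConeCover W U d) {A : Type*} [AddCommGroup A] {ε : ℝ} (hε : 0 < ε)
    {κ : (ℂ × ℂ) × ℂ → (ℂ × ℂ) × ℂ → A} (hκ : IsCocycle W ε κ) :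
    ∀ᶠ n : ℕ in atTop, ∀ q ∈ W, d • holonomy n κ q = 0 := by
  classical
  obtain ⟨δ, hδ, η, hη, S, hS, hSe⟩ := h.exists_transfer hε hκ
  set δ₁ := min 1 (δ / 9)
  have hδ₁ : 0 < δ₁ := by positivity
  have hδ₁1 : δ₁ ≤ 1 := min_le_left _ _
  have hδ₁δ : δ₁ ≤ δ / 9 := min_le_right _ _
  have hround : ∀ u : ℂ × ℂ, ∃ v, u ≠ 0 → v ∈ U ∧ RelNear (δ₁ / 3) u v ∧ (u ∈ U → v = u) := by
    intro u
    by_cases hu : u ∈ U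
    · exact ⟨u, fun h0 => ⟨hu, RelNear.refl (by positivity) h0, fun _ => rfl⟩⟩
    · by_cases h0 : u = 0
      · exact ⟨0, fun hn => absurd h0 hn⟩
      · obtain ⟨v, hv, hn⟩ := h.exists_near_base h0 (by positivity : 0 < δ₁ / 3)
        exact ⟨v, fun _ => ⟨hv, hn, fun hu' => absurd hu' hu⟩⟩
  choose ρ hρ using hround
  have hρn : ∀ a b : ℂ × ℂ, RelNear (δ₁ / 3) a b → RelNear δ (ρ a) (ρ b) := by
    intro a b hab
    have h1 := (hρ a hab.ne_zero).2.1
    have h2 := (hρ b hab.symm.ne_zero).2.1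
    have h3 := h1.symm.trans hab (by linarith)
    exact (h3.trans (h2.mono (by linarith)) (by linarith)).mono (by linarith)
  have hS' : IsCocycle {u : ℂ × ℂ | u ≠ 0} (δ₁ / 3) (fun a b => S (ρ a) (ρ b)) := by
    intro a ha b hb c hc hab hbc hac
    exact hS _ (hρ a ha).1 _ (hρ b hb).1 _ (hρ c hc).1 (hρn _ _ hab) (hρn _ _ hbc) (hρn _ _ hac)
  obtain ⟨t, ht⟩ : ∃ t : ℂ, ((1 : ℂ), t) ∈ U := by
    by_contra hn
    push Not at hn
    exact Set.infinite_univ (h.finite.subset (fun t _ => hn t))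
  obtain ⟨R, hR, hev⟩ := hS'.frequently_holonomy_eq_zero (by positivity) t
  have huU : R • ((1 : ℂ), t) ∈ U := h.smul_mem_base _ ht R hR
  set u := R • ((1 : ℂ), t)
  have hfin := h.finite_fiber huU
  have hinst := Fintype.ofFinite {z // (u, z) ∈ W}
  have hu0 := h.base_ne_zero huU
  have hcard : Fintype.card {z // (u, z) ∈ W} = d := by
    rw [← Nat.card_eq_fintype_card]; exact h.fiber u huU
  filter_upwards [hev, holonomy_const h.smul_mem h.zero_notMem h.preconnected hκ hε,
    eventually_gon_near (E := ℂ × ℂ) hδ, eventually_gon_near (E := (ℂ × ℂ) × ℂ) hη]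
    with n hn hconst hgon hgon' q hq
  have hgU : ∀ k, gonPoint n k • u ∈ U := fun k => h.smul_mem_base _ huU _ (gonPoint_ne_zero _ _)
  have hterm : ∀ k, S (ρ (gonPoint n k • u)) (ρ (gonPoint n (k + 1) • u)) =
      ∑ z : {z // (u, z) ∈ W}, κ (gonPoint n k • (u, z.1)) (gonPoint n (k + 1) • (u, z.1)) := by
    intro k
    have e1 := (hρ _ (h.base_ne_zero (hgU k))).2.2 (hgU k)
    have e2 := (hρ _ (h.base_ne_zero (hgU (k + 1)))).2.2 (hgU (k + 1))
    rw [e1, e2]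
    have hk0 := gonPoint_ne_zero n k
    have := h.finite_fiber (hgU k)
    have := Fintype.ofFinite {z // (gonPoint n k • u, z) ∈ W}
    have hnear : ∀ z : {z // (gonPoint n k • u, z) ∈ W}, RelNear η (gonPoint n k • u, z.1)
        (gonPoint n (k + 1) • u, (h.fiberScale u hk0 (gonPoint_ne_zero n (k + 1)) z).1) := by
      intro z
      have := hgon'.2 (u, (gonPoint n k)⁻¹ * z.1) (by
        intro h0; exact hu0 (congrArg Prod.fst h0)) k
      simp only [Prod.smul_mk, smul_eq_mul, mul_inv_cancel_left₀ hk0] at this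
      convert this using 2
      simp only [fiberScale, Equiv.coe_fn_mk]
      field_simp
    rw [hSe _ (hgU k) _ (hgU (k + 1)) (hgon.2 u hu0 k)
      (h.fiberScale u hk0 (gonPoint_ne_zero n (k + 1))) hnear]
    have h1u : (1 : ℂ) • u = u := one_smul _ _
    let g : {z // (u, z) ∈ W} ≃ {z // (gonPoint n k • u, z) ∈ W} :=
      (Equiv.subtypeEquivRight (by intro z; rw [h1u])).trans (h.fiberScale u one_ne_zero hk0)
    have hg : ∀ z, (g z).1 = gonPoint n k * z.1 := by
      intro z; simp [g, fiberScale]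
    rw [← Equiv.sum_comp g]
    refine Finset.sum_congr rfl fun z _ => ?_
    simp only [fiberScale, Equiv.coe_fn_mk, hg, Prod.smul_mk, smul_eq_mul]
    congr 2
    field_simp
  rw [holonomy, Finset.sum_congr rfl fun k _ => hterm k, Finset.sum_comm] at hn
  have : ∀ z : {z // (u, z) ∈ W}, ∑ k ∈ Finset.range n, κ (gonPoint n k • (u, z.1))
      (gonPoint n (k + 1) • (u, z.1)) = holonomy n κ q := fun z => hconst _ z.2 _ hq
  rw [Finset.sum_congr rfl fun z _ => this z, Finset.sum_const, Finset.card_univ, hcard] at hn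
  exact hn

end ConeCover

section Winding

/-- The integer defect of additivity of the principal argument. -/
noncomputable def argDefect (z w : ℂ) : ℤ :=
  round ((Complex.arg (z * w) - Complex.arg z - Complex.arg w) / (2 * Real.pi))

theorem arg_mul_eq {z w : ℂ} (hz : z ≠ 0) (hw : w ≠ 0) :
    Complex.arg (z * w) = Complex.arg z + Complex.arg w + 2 * Real.pi * argDefect z w := by
  have h := Complex.arg_mul_coe_angle hz hw
  rw [← Real.Angle.coe_add, Real.Angle.angle_eq_iff_two_pi_dvd_sub] at h
  obtain ⟨k, hk⟩ := h
  have h2 : argDefect z w = k := by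
    rw [argDefect, sub_sub, hk, mul_div_cancel_left₀ _ (by positivity)]
    exact round_intCast k
  rw [h2]; linarith

theorem int_eq_zero_of_two_pi_mul_lt {k : ℤ} (h : |2 * Real.pi * k| < 2 * Real.pi) : k = 0 := by
  rw [abs_mul, abs_of_pos (by positivity : (0 : ℝ) < 2 * Real.pi)] at h
  have h1 : |(k : ℝ)| < 1 := by
    by_contra hn
    push Not at hn
    nlinarith [Real.pi_pos]
  have h2 : |k| < 1 := by exact_mod_cast h1
  exact Int.abs_lt_one_iff.1 h2

/-- The integer by which the principal argument of `F` jumps between two points. -/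
noncomputable def argJump {E : Type*} (F : E → ℂ) (a b : E) : ℤ := argDefect (F a) (F b / F a)

theorem argJump_eq {E : Type*} {F : E → ℂ} {a b : E} (ha : F a ≠ 0) (hb : F b ≠ 0) :
    2 * Real.pi * argJump F a b =
      Complex.arg (F b) - Complex.arg (F a) - Complex.arg (F b / F a) := by
  have := arg_mul_eq ha (div_ne_zero hb ha)
  rw [mul_div_cancel₀ _ ha] at this
  rw [this, argJump]; ring

/-- The coboundary of a 1-cochain. -/
def coboundary {E A : Type*} [AddCommGroup A] (n : E → E → A) (a b c : E) : A :=
  n a b + n b c - n a c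

theorem coboundary_argJump {E : Type*} {F : E → ℂ} {a b c : E} (ha : F a ≠ 0) (hb : F b ≠ 0)
    (hc : F c ≠ 0) : 2 * Real.pi * coboundary (argJump F) a b c =
      Complex.arg (F c / F a) - Complex.arg (F b / F a) - Complex.arg (F c / F b) := by
  have h1 := argJump_eq ha hb
  have h2 := argJump_eq hb hc
  have h3 := argJump_eq ha hc
  unfold coboundary
  push_cast
  linear_combination h1 + h2 - h3

theorem coboundary_argJump_eq_zero {E : Type*} {F : E → ℂ} {a b c : E} (ha : F a ≠ 0)
    (hb : F b ≠ 0) (hc : F c ≠ 0) (h1 : |Complex.arg (F b / F a)| < Real.pi / 6)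
    (h2 : |Complex.arg (F c / F b)| < Real.pi / 6)
    (h3 : |Complex.arg (F c / F a)| < Real.pi / 6) : coboundary (argJump F) a b c = 0 := by
  apply int_eq_zero_of_two_pi_mul_lt
  rw [coboundary_argJump ha hb hc, abs_lt]
  rw [abs_lt] at h1 h2 h3
  constructor <;> linarith [Real.pi_pos]

theorem exists_small_arg : ∃ ρ > 0, ρ < 1 ∧ ∀ z : ℂ, ‖z - 1‖ < ρ →
    z ≠ 0 ∧ |Complex.arg z| < Real.pi / 6 := by
  have h : ContinuousAt (fun z => |Complex.arg z|) 1 :=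
    (Complex.continuousAt_arg (by simp [Complex.slitPlane])).abs
  have h := h.tendsto
  simp only [Complex.arg_one, abs_zero] at h
  obtain ⟨ρ, hρ, hz⟩ := Metric.eventually_nhds_iff.1
    ((tendsto_order.1 h).2 (Real.pi / 6) (by positivity))
  refine ⟨min ρ (1 / 2), by positivity, lt_of_le_of_lt (min_le_right _ _) (by norm_num),
    fun z hzz => ⟨?_, hz ?_⟩⟩
  · rintro rfl
    have := hzz.trans_le (min_le_right _ _)
    norm_num at this
  · rw [dist_eq_norm]; exact hzz.trans_le (min_le_left _ _)

theorem holonomy_argJump {E : Type*} [NormedAddCommGroup E] [NormedSpace ℂ E] {F : E → ℂ} {q : E}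
    (hF : ∀ r : ℂ, r ≠ 0 → F (r • q) = r * F q) (hq : F q ≠ 0) :
    ∀ᶠ n : ℕ in atTop, holonomy n (argJump F) q = -1 := by
  filter_upwards [eventually_gt_atTop 2] with n hn
  have hn0 : n ≠ 0 := by omega
  have hne : ∀ k, F (gonPoint n k • q) ≠ 0 := fun k => by
    rw [hF _ (gonPoint_ne_zero _ _)]; exact mul_ne_zero (gonPoint_ne_zero _ _) hq
  have hratio : ∀ k, F (gonPoint n (k + 1) • q) / F (gonPoint n k • q) = gonPoint n 1 := by
    intro k
    rw [hF _ (gonPoint_ne_zero _ _), hF _ (gonPoint_ne_zero _ _), gonPoint_succ]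
    have := gonPoint_ne_zero n k
    field_simp
  have harg : Complex.arg (gonPoint n 1) = 2 * Real.pi / n := by
    have : gonPoint n 1 = Complex.exp (((2 * Real.pi / n : ℝ) : ℂ) * Complex.I) := by
      rw [gonPoint]; congr 1; push_cast; ring
    rw [this]
    have hn' : (2 : ℝ) < n := by exact_mod_cast hn
    have h2 : 2 * Real.pi / n ≤ Real.pi := by
      rw [div_le_iff₀ (by linarith)]; nlinarith [Real.pi_pos]
    have h3 : 0 < 2 * Real.pi / n := by positivity
    exact Complex.arg_exp_mul_I _ ▸ (toIocMod_eq_self _).2 ⟨by linarith [Real.pi_pos], by linarith⟩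
  have hsum : 2 * Real.pi * ((holonomy n (argJump F) q : ℤ) : ℝ) = - (2 * Real.pi) := by
    rw [holonomy]
    push_cast
    rw [Finset.mul_sum, Finset.sum_congr rfl fun k _ => argJump_eq (hne k) (hne (k + 1)),
      Finset.sum_sub_distrib, Finset.sum_range_sub (fun k => Complex.arg (F (gonPoint n k • q))),
      gonPoint_self hn0, gonPoint_zero, sub_self, Finset.sum_congr rfl fun k _ => by rw [hratio k],
      Finset.sum_const, harg]
    have : (n : ℝ) ≠ 0 := by exact_mod_cast hn0
    simp
    field_simp
  have : ((holonomy n (argJump F) q : ℤ) : ℝ) = -1 := by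
    have := Real.pi_pos
    nlinarith
  exact_mod_cast this

end Winding

/-- The slope coordinate on the projectivised base. -/
noncomputable def slope3 (q : (ℂ × ℂ) × ℂ) : ℂ := q.1.2 / q.1.1

theorem slope3_smul {r : ℂ} (hr : r ≠ 0) (q : (ℂ × ℂ) × ℂ) : slope3 (r • q) = slope3 q := by
  simp only [slope3, Prod.smul_fst, Prod.smul_snd, smul_eq_mul]
  exact mul_div_mul_left _ _ hr

/-- The difference `slope - t₀`, with the value zero replaced by one. -/
noncomputable def slopeDiff (t₀ : ℂ) (q : (ℂ × ℂ) × ℂ) : ℂ :=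
  if slope3 q = t₀ then 1 else slope3 q - t₀

theorem slopeDiff_ne_zero (t₀ : ℂ) (q : (ℂ × ℂ) × ℂ) : slopeDiff t₀ q ≠ 0 := by
  unfold slopeDiff
  split_ifs with h
  · exact one_ne_zero
  · exact sub_ne_zero.2 h

theorem slopeDiff_of_ne {t₀ : ℂ} {q : (ℂ × ℂ) × ℂ} (h : slope3 q ≠ t₀) :
    slopeDiff t₀ q = slope3 q - t₀ := if_neg h

theorem slopeDiff_smul (t₀ : ℂ) {r : ℂ} (hr : r ≠ 0) (q : (ℂ × ℂ) × ℂ) :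
    slopeDiff t₀ (r • q) = slopeDiff t₀ q := by
  simp only [slopeDiff, slope3_smul hr]

theorem argJump_smul_right {t₀ r : ℂ} (hr : r ≠ 0) (q : (ℂ × ℂ) × ℂ) :
    argJump (slopeDiff t₀) q (r • q) = 0 := by
  apply int_eq_zero_of_two_pi_mul_lt
  rw [argJump_eq (slopeDiff_ne_zero _ _) (slopeDiff_ne_zero _ _), slopeDiff_smul _ hr,
    div_self (slopeDiff_ne_zero _ _)]
  simp
  positivity

/-- Integral 2-cochains which are small-scale coboundaries of cochains vanishing along lines. -/
def lineCoboundaries (W : Set ((ℂ × ℂ) × ℂ)) :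
    AddSubgroup ((ℂ × ℂ) × ℂ → (ℂ × ℂ) × ℂ → (ℂ × ℂ) × ℂ → ℤ) where
  carrier := {z | ∃ ε > 0, ∃ n : (ℂ × ℂ) × ℂ → (ℂ × ℂ) × ℂ → ℤ,
    (∀ a ∈ W, ∀ r : ℂ, r ≠ 0 → n a (r • a) = 0) ∧
    ∀ a ∈ W, ∀ b ∈ W, ∀ c ∈ W, RelNear ε a b → RelNear ε b c → RelNear ε a c →
      z a b c = coboundary n a b c}
  zero_mem' := ⟨1, one_pos, 0, by simp, by intros; simp [coboundary]⟩
  add_mem' := by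
    rintro z z' ⟨ε, hε, n, hn, h⟩ ⟨ε', hε', n', hn', h'⟩
    refine ⟨min ε ε', by positivity, n + n', ?_, ?_⟩
    · intro a ha r hr; simp [hn a ha r hr, hn' a ha r hr]
    · intro a ha b hb c hc h1 h2 h3
      have e1 := h a ha b hb c hc (h1.mono (min_le_left _ _)) (h2.mono (min_le_left _ _))
        (h3.mono (min_le_left _ _))
      have e2 := h' a ha b hb c hc (h1.mono (min_le_right _ _)) (h2.mono (min_le_right _ _))
        (h3.mono (min_le_right _ _))
      simp only [Pi.add_apply, e1, e2, coboundary]; ring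
  neg_mem' := by
    rintro z ⟨ε, hε, n, hn, h⟩
    refine ⟨ε, hε, -n, ?_, ?_⟩
    · intro a ha r hr; simp [hn a ha r hr]
    · intro a ha b hb c hc h1 h2 h3
      simp only [Pi.neg_apply, h a ha b hb c hc h1 h2 h3, coboundary]; ring

theorem mem_lineCoboundaries_of_eq {W : Set ((ℂ × ℂ) × ℂ)}
    {z z' : (ℂ × ℂ) × ℂ → (ℂ × ℂ) × ℂ → (ℂ × ℂ) × ℂ → ℤ} {ε : ℝ} (hε : 0 < ε)
    (h : z' ∈ lineCoboundaries W)
    (heq : ∀ a ∈ W, ∀ b ∈ W, ∀ c ∈ W, RelNear ε a b → RelNear ε b c → RelNear ε a c →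
      z a b c = z' a b c) : z ∈ lineCoboundaries W := by
  obtain ⟨ε', hε', n, hn, h⟩ := h
  refine ⟨min ε ε', by positivity, n, hn, ?_⟩
  intro a ha b hb c hc h1 h2 h3
  rw [heq a ha b hb c hc (h1.mono (min_le_left _ _)) (h2.mono (min_le_left _ _))
    (h3.mono (min_le_left _ _)), h a ha b hb c hc (h1.mono (min_le_right _ _))
    (h2.mono (min_le_right _ _)) (h3.mono (min_le_right _ _))]

open Classical in
/-- The restriction of a 2-cochain to triples contained in a set. -/
noncomputable def restrictTo {E : Type*} (N : Set E) (z : E → E → E → ℤ) (a b c : E) : ℤ :=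
  if a ∈ N ∧ b ∈ N ∧ c ∈ N then z a b c else 0

/-- A sheet of a cone over a disc of slopes. -/
structure IsSheet (W : Set ((ℂ × ℂ) × ℂ)) (t₀ : ℂ) (r : ℝ) (N : Set ((ℂ × ℂ) × ℂ)) : Prop where
  subset : N ⊆ W
  smul_mem : ∀ q ∈ N, ∀ s : ℂ, s ≠ 0 → s • q ∈ N
  slope_lt : ∀ q ∈ N, ‖slope3 q - t₀‖ < r
  unique : ∀ q ∈ N, ∀ q' ∈ N, q.1 = q'.1 → q = q'
  separated : ∃ η > 0, ∀ q ∈ N, ∀ q' ∈ W, RelNear η q q' → ‖slope3 q' - t₀‖ < r → q' ∈ N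

namespace ConeCover

variable {W : Set ((ℂ × ℂ) × ℂ)} {U : Set (ℂ × ℂ)} {d : ℕ}

theorem exists_near_slope (h : ConeCover W U d) (M : ℝ) {θ : ℝ} (hθ : 0 < θ) :
    ∃ ε > 0, ∀ a ∈ W, ∀ b ∈ W, RelNear ε a b → ‖slope3 a‖ ≤ M →
      ‖slope3 b - slope3 a‖ < θ ∧ ‖b.1.1 / a.1.1 - 1‖ < θ := by
  obtain ⟨K, hK⟩ := h.bound
  set C := (1 + |K|) * (1 + |M|) with hC
  have hCpos : 0 < C := by positivity
  obtain ⟨ε, hε, hε1, hε2, hε3⟩ : ∃ ε : ℝ, 0 < ε ∧ ε * C ≤ 1 / 2 ∧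
      2 * (ε * C * (1 + |M|)) < θ ∧ ε * C < θ := by
    refine ⟨min (1 / 2) (θ / 4) / (C * (1 + |M|)), by positivity, ?_, ?_, ?_⟩
    · have : min (1 / 2) (θ / 4) / (C * (1 + |M|)) * C = min (1 / 2) (θ / 4) / (1 + |M|) := by
        field_simp
      rw [this, div_le_iff₀ (by positivity)]
      nlinarith [min_le_left (1 / 2) (θ / 4), abs_nonneg M]
    · have : min (1 / 2) (θ / 4) / (C * (1 + |M|)) * C * (1 + |M|) = min (1 / 2) (θ / 4) := by
        field_simp
      rw [this]; linarith [min_le_right (1 / 2) (θ / 4)]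
    · have : min (1 / 2) (θ / 4) / (C * (1 + |M|)) * C = min (1 / 2) (θ / 4) / (1 + |M|) := by
        field_simp
      rw [this, div_lt_iff₀ (by positivity)]
      nlinarith [min_le_right (1 / 2) (θ / 4), abs_nonneg M]
  refine ⟨ε, hε, fun a ha b hb hab hM => ?_⟩
  have hxa : a.1.1 ≠ 0 := h.fst_ne _ (h.fst_mem a ha)
  have hxb : b.1.1 ≠ 0 := h.fst_ne _ (h.fst_mem b hb)
  have hxa' : 0 < ‖a.1.1‖ := norm_pos_iff.2 hxa
  have hxb' : 0 < ‖b.1.1‖ := norm_pos_iff.2 hxb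
  have hy : a.1.2 = slope3 a * a.1.1 := by rw [slope3, div_mul_cancel₀ _ hxa]
  have hyb : b.1.2 = slope3 b * b.1.1 := by rw [slope3, div_mul_cancel₀ _ hxb]
  have hM' : ‖slope3 a‖ ≤ |M| := hM.trans (le_abs_self M)
  have hu : ‖a.1‖ ≤ (1 + |M|) * ‖a.1.1‖ := by
    rw [Prod.norm_def, hy, norm_mul]
    apply max_le <;> nlinarith [abs_nonneg M]
  have hz : ‖a.2‖ ≤ |K| * ‖a.1‖ := (hK a ha).trans (by gcongr; exact le_abs_self K)
  have hq : ‖a‖ ≤ C * ‖a.1.1‖ := by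
    have h1 : ‖a‖ ≤ (1 + |K|) * ‖a.1‖ := by
      rw [Prod.norm_def a]
      apply max_le <;> nlinarith [abs_nonneg K, norm_nonneg a.1]
    calc ‖a‖ ≤ (1 + |K|) * ‖a.1‖ := h1
      _ ≤ (1 + |K|) * ((1 + |M|) * ‖a.1.1‖) := by gcongr
      _ = _ := by rw [hC]; ring
  have hab' : ‖a - b‖ < ε * C * ‖a.1.1‖ := by
    refine hab.1.trans_le ?_
    rw [mul_assoc]; gcongr
  have hx : ‖a.1.1 - b.1.1‖ < ε * C * ‖a.1.1‖ :=
    ((norm_fst_le (a - b).1).trans (norm_fst_le (a - b))).trans_lt hab'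
  have hy' : ‖a.1.2 - b.1.2‖ < ε * C * ‖a.1.1‖ :=
    ((norm_snd_le (a - b).1).trans (norm_fst_le (a - b))).trans_lt hab'
  constructor
  · have hxb2 : ‖a.1.1‖ ≤ 2 * ‖b.1.1‖ := by
      have := norm_sub_norm_le a.1.1 b.1.1
      nlinarith
    have e1 : (slope3 b - slope3 a) * b.1.1 =
        -(a.1.2 - b.1.2) + slope3 a * (a.1.1 - b.1.1) := by rw [hy, hyb]; ring
    have e2 : ‖slope3 b - slope3 a‖ * ‖b.1.1‖ ≤ ‖a.1.2 - b.1.2‖ + |M| * ‖a.1.1 - b.1.1‖ := by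
      rw [← norm_mul, e1]
      refine (norm_add_le _ _).trans ?_
      rw [norm_neg, norm_mul]; gcongr
    have e3 : ‖slope3 b - slope3 a‖ * ‖b.1.1‖ < 2 * (ε * C * (1 + |M|)) * ‖b.1.1‖ := by
      calc _ ≤ ‖a.1.2 - b.1.2‖ + |M| * ‖a.1.1 - b.1.1‖ := e2
        _ < ε * C * ‖a.1.1‖ + |M| * (ε * C * ‖a.1.1‖) := by
            have := mul_le_mul_of_nonneg_left hx.le (abs_nonneg M)
            linarith
        _ = ε * C * (1 + |M|) * ‖a.1.1‖ := by ring
        _ ≤ ε * C * (1 + |M|) * (2 * ‖b.1.1‖) := by gcongr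
        _ = _ := by ring
    exact (lt_of_mul_lt_mul_right e3 hxb'.le).trans hε2
  · have : b.1.1 / a.1.1 - 1 = (b.1.1 - a.1.1) / a.1.1 := by field_simp
    rw [this, norm_div, div_lt_iff₀ hxa', norm_sub_rev]
    nlinarith

theorem exists_near_slopeDiff (h : ConeCover W U d) (M : ℝ) (t₀ : ℂ) {ρ : ℝ} (hρ : 0 < ρ) :
    ∃ ε > 0, ∀ a ∈ W, ∀ b ∈ W, RelNear ε a b → ‖slope3 a‖ ≤ M → ρ ≤ ‖slope3 a - t₀‖ →
      |Complex.arg (slopeDiff t₀ b / slopeDiff t₀ a)| < Real.pi / 6 := by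
  obtain ⟨θ, hθ, hθ1, harg⟩ := exists_small_arg
  obtain ⟨ε, hε, hs⟩ := h.exists_near_slope M (mul_pos hθ hρ)
  refine ⟨ε, hε, fun a ha b hb hab hM hfar => ?_⟩
  have h1 := (hs a ha b hb hab hM).1
  have ha0 : slope3 a ≠ t₀ := by
    intro h0; rw [h0, sub_self, norm_zero] at hfar; linarith
  have hb0 : slope3 b ≠ t₀ := by
    intro h0; rw [h0, norm_sub_rev] at h1; nlinarith
  have ha1 := sub_ne_zero.2 ha0
  apply (harg _ _).2
  rw [slopeDiff_of_ne ha0, slopeDiff_of_ne hb0]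
  have : (slope3 b - t₀) / (slope3 a - t₀) - 1 = (slope3 b - slope3 a) / (slope3 a - t₀) := by
    field_simp; ring
  rw [this, norm_div, div_lt_iff₀ (norm_pos_iff.2 ha1)]
  nlinarith

end ConeCover

theorem restrictTo_coboundary_mem {W : Set ((ℂ × ℂ) × ℂ)} {t₀ : ℂ} {r ρ ε : ℝ}
    {N : Set ((ℂ × ℂ) × ℂ)} (hN : IsSheet W t₀ r N)
    (hslope : ∃ ε > 0, ∀ a ∈ N, ∀ b ∈ W, RelNear ε a b → ‖slope3 b - slope3 a‖ < r - ρ)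
    {m : (ℂ × ℂ) × ℂ → (ℂ × ℂ) × ℂ → ℤ} (hm0 : ∀ a ∈ W, ∀ s : ℂ, s ≠ 0 → m a (s • a) = 0)
    (hε : 0 < ε) (hm : ∀ a ∈ N, ∀ b ∈ N, RelNear ε a b → ρ ≤ ‖slope3 a - t₀‖ → m a b = 0) :
    restrictTo N (coboundary m) ∈ lineCoboundaries W := by
  classical
  obtain ⟨η, hη, hsep⟩ := hN.separated
  obtain ⟨ε₁, hε₁, hs⟩ := hslope
  refine ⟨min ε (min η ε₁), by positivity, fun a b => if a ∈ N ∧ b ∈ N then m a b else 0, ?_, ?_⟩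
  · intro a ha s hs; simp [hm0 a ha s hs]
  · intro a ha b hb c hc hab hbc hac
    have key : ∀ a ∈ N, ∀ c ∈ W, RelNear (min ε (min η ε₁)) a c → c ∉ N →
        ρ ≤ ‖slope3 a - t₀‖ := by
      intro a ha c hc hac hcN
      by_contra hlt
      push Not at hlt
      apply hcN
      refine hsep a ha c hc (hac.mono ((min_le_right _ _).trans (min_le_left _ _))) ?_
      have h1 := hs a ha c hc (hac.mono ((min_le_right _ _).trans (min_le_right _ _)))
      calc ‖slope3 c - t₀‖ = ‖(slope3 c - slope3 a) + (slope3 a - t₀)‖ := by congr 1; ring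
        _ ≤ _ := norm_add_le _ _
        _ < r := by linarith
    have key2 : ∀ a ∈ N, ∀ b ∈ N, ∀ c ∈ W, RelNear (min ε (min η ε₁)) a b →
        RelNear (min ε (min η ε₁)) a c → c ∉ N → m a b = 0 := fun a ha b hb c hc hab hac hcN =>
      hm a ha b hb (hab.mono (min_le_left _ _)) (key a ha c hc hac hcN)
    unfold restrictTo coboundary
    by_cases haN : a ∈ N <;> by_cases hbN : b ∈ N <;> by_cases hcN : c ∈ N <;> simp [haN, hbN, hcN]
    · exact (key2 a haN b hbN c hc hab hac hcN).symm
    · exact key2 a haN c hcN b hb hac hab hbN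
    · exact (key2 b hbN c hcN a ha hbc hab.symm haN).symm

/-- The affine coordinate of a point of a cone over its slope. -/
noncomputable def height3 (q : (ℂ × ℂ) × ℂ) : ℂ := q.2 / q.1.1

theorem height3_smul {r : ℂ} (hr : r ≠ 0) (q : (ℂ × ℂ) × ℂ) : height3 (r • q) = height3 q := by
  simp only [height3, Prod.smul_fst, Prod.smul_snd, smul_eq_mul]
  exact mul_div_mul_left _ _ hr

/-- The point with first coordinate one on the line of a given point. -/
noncomputable def normalize3 (q : (ℂ × ℂ) × ℂ) : (ℂ × ℂ) × ℂ := ((1, slope3 q), height3 q)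

theorem smul_normalize3 {q : (ℂ × ℂ) × ℂ} (hq : q.1.1 ≠ 0) : q.1.1 • normalize3 q = q := by
  ext <;> simp [normalize3, slope3, height3, mul_div_cancel₀ _ hq]

theorem normalize3_eq_smul {q : (ℂ × ℂ) × ℂ} (hq : q.1.1 ≠ 0) : normalize3 q = q.1.1⁻¹ • q := by
  rw [eq_inv_smul_iff₀ hq, smul_normalize3 hq]

namespace ConeCover

variable {W : Set ((ℂ × ℂ) × ℂ)} {U : Set (ℂ × ℂ)} {d : ℕ}

theorem fst_fst_ne (h : ConeCover W U d) {q : (ℂ × ℂ) × ℂ} (hq : q ∈ W) : q.1.1 ≠ 0 :=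
  h.fst_ne _ (h.fst_mem q hq)

theorem normalize3_mem (h : ConeCover W U d) {q : (ℂ × ℂ) × ℂ} (hq : q ∈ W) :
    normalize3 q ∈ W := by
  rw [normalize3_eq_smul (h.fst_fst_ne hq)]
  exact h.smul_mem q hq _ (inv_ne_zero (h.fst_fst_ne hq))

theorem height_bound (h : ConeCover W U d) : ∃ K, 0 ≤ K ∧ ∀ q ∈ W,
    ‖height3 q‖ ≤ K * max 1 ‖slope3 q‖ := by
  obtain ⟨K, hK⟩ := h.bound
  refine ⟨|K|, abs_nonneg _, fun q hq => ?_⟩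
  have := hK _ (h.normalize3_mem hq)
  simp only [normalize3, Prod.norm_def, norm_one] at this
  exact this.trans (by gcongr; exact le_abs_self K)

theorem exists_near_height (h : ConeCover W U d) (M : ℝ) {θ : ℝ} (hθ : 0 < θ) :
    ∃ ε > 0, ∀ a ∈ W, ∀ b ∈ W, RelNear ε a b → ‖slope3 a‖ ≤ M →
      ‖height3 b - height3 a‖ < θ := by
  obtain ⟨K, hK0, hK⟩ := h.height_bound
  set C := 1 + K * max 1 |M| + |M| with hC
  have hCpos : 0 < C := by positivity
  obtain ⟨ε₁, hε₁, hs⟩ := h.exists_near_slope M (θ := min (1 / 2) (θ / (8 * C))) (by positivity)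
  refine ⟨min ε₁ (θ / (8 * C)), by positivity, fun a ha b hb hab hM => ?_⟩
  have hxa := h.fst_fst_ne ha
  have hxb := h.fst_fst_ne hb
  have hxa' : 0 < ‖a.1.1‖ := norm_pos_iff.2 hxa
  have h1 := (hs a ha b hb (hab.mono (min_le_left _ _)) hM).2
  have hab' := (hab.mono (min_le_right _ _)).smul (inv_ne_zero hxa)
  rw [← normalize3_eq_smul hxa] at hab'
  set x := b.1.1 / a.1.1 with hx
  have hb2 : (a.1.1⁻¹ • b).2 = x * height3 b := by
    simp only [Prod.smul_snd, smul_eq_mul, hx, height3]; field_simp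
  have hnorm : ‖normalize3 a‖ ≤ C := by
    have h2 := hK a ha
    have h3 : ‖height3 a‖ ≤ K * max 1 |M| := h2.trans (by
      gcongr; exact hM.trans (le_abs_self M))
    have h4 : ‖slope3 a‖ ≤ |M| := hM.trans (le_abs_self M)
    have h5 : 0 ≤ K * max 1 |M| := by positivity
    simp only [normalize3, Prod.norm_def, norm_one]
    refine max_le (max_le ?_ ?_) ?_ <;> linarith [abs_nonneg M]
  have h2 : ‖height3 a - x * height3 b‖ < θ / 8 := by
    have e1 := (norm_snd_le _).trans_lt hab'.1
    rw [Prod.snd_sub, hb2] at e1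
    refine e1.trans_le ?_
    calc θ / (8 * C) * ‖normalize3 a‖ ≤ θ / (8 * C) * C := by gcongr
      _ = θ / 8 := by field_simp
  have h3 : ‖height3 a‖ ≤ C := (norm_snd_le (normalize3 a)).trans hnorm
  have hx1 := h1.trans_le (min_le_left _ _)
  have hx2 := h1.trans_le (min_le_right _ _)
  have hxn : 1 / 2 ≤ ‖x‖ := by
    have e1 : ‖(1:ℂ)‖ ≤ ‖x‖ + ‖x - 1‖ := by
      have := norm_sub_le x (x - 1); rwa [sub_sub_cancel] at this
    rw [norm_one] at e1; linarith
  have h4 : ‖x * (height3 b - height3 a)‖ < θ / 4 := by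
    have e1 : x * (height3 b - height3 a) = -(height3 a - x * height3 b) - (x - 1) * height3 a := by
      ring
    rw [e1]
    have e2 := norm_sub_le (-(height3 a - x * height3 b)) ((x - 1) * height3 a)
    rw [norm_neg, norm_mul] at e2
    have e3 : ‖x - 1‖ * ‖height3 a‖ ≤ θ / (8 * C) * C := by gcongr
    have e4 : θ / (8 * C) * C = θ / 8 := by field_simp
    linarith
  rw [norm_mul] at h4
  nlinarith [norm_nonneg (height3 b - height3 a)]

theorem exists_base_near (t₀ : ℂ) {δ : ℝ} (hδ : 0 < δ) :
    ∃ r > 0, ∀ t, ‖t - t₀‖ < r → RelNear δ ((1 : ℂ), t₀) ((1 : ℂ), t) := by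
  refine ⟨δ, hδ, fun t ht => ?_⟩
  have h1 : ‖((1 : ℂ), t₀) - ((1 : ℂ), t)‖ < δ := by
    simp only [Prod.mk_sub_mk, sub_self, Prod.norm_def, norm_zero]
    rw [norm_sub_rev]; exact max_lt hδ ht
  have h2 : ∀ t : ℂ, 1 ≤ ‖((1 : ℂ), t)‖ := fun t => by
    simp [Prod.norm_def]
  constructor
  · nlinarith [h2 t₀]
  · nlinarith [h2 t]

theorem exists_fiber_near (h : ConeCover W U d) {t₀ : ℂ} (ht₀ : ((1 : ℂ), t₀) ∈ U) {s : ℝ}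
    (hs : 0 < s) : ∃ r > 0, ∀ t, ‖t - t₀‖ < r → ((1 : ℂ), t) ∈ U →
      ∃ e : {z // (((1 : ℂ), t₀), z) ∈ W} ≃ {z // (((1 : ℂ), t), z) ∈ W},
        ∀ z, ‖z.1 - (e z).1‖ < s := by
  obtain ⟨K, hK⟩ := h.bound
  set C := (1 + |K|) * ‖((1 : ℂ), t₀)‖ with hC
  have h1 : 1 ≤ ‖((1 : ℂ), t₀)‖ := by simp [Prod.norm_def]
  have hCpos : 0 < C := by positivity
  obtain ⟨δ, hδ, hm⟩ := h.matching (s / C) (by positivity)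
  obtain ⟨r, hr, hn⟩ := exists_base_near t₀ hδ
  refine ⟨r, hr, fun t ht htU => ?_⟩
  obtain ⟨e, he⟩ := hm _ ht₀ _ htU (hn t ht)
  refine ⟨e, fun z => ?_⟩
  have h2 := (norm_snd_le _).trans_lt (he z).1
  refine h2.trans_le ?_
  have h3 : ‖(((1 : ℂ), t₀), z.1)‖ ≤ C := by
    have := hK _ z.2
    simp only at this
    rw [Prod.norm_def]
    refine max_le ?_ ?_
    · simp only; rw [hC]; nlinarith [abs_nonneg K]
    · simp only
      refine this.trans ?_
      rw [hC]
      nlinarith [le_abs_self K]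
  calc s / C * _ ≤ s / C * C := by gcongr
    _ = s := by field_simp

theorem exists_sheets (h : ConeCover W U d) {t₀ : ℂ} (ht₀ : ((1 : ℂ), t₀) ∈ U) :
    ∃ R > 0, ∀ r > 0, r ≤ R → ∃ N : {z // (((1 : ℂ), t₀), z) ∈ W} → Set ((ℂ × ℂ) × ℂ),
      (∀ ζ, IsSheet W t₀ r (N ζ)) ∧ (∀ ζ, (((1 : ℂ), t₀), ζ.1) ∈ N ζ) ∧
      (∀ q ∈ W, ‖slope3 q - t₀‖ < r → ∃ ζ, q ∈ N ζ) ∧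
      (∀ ζ ζ', ∀ q ∈ N ζ, q ∈ N ζ' → ζ = ζ') := by
  have : Finite {z // (((1 : ℂ), t₀), z) ∈ W} := h.finite_fiber ht₀
  obtain ⟨s, hs, hsep⟩ : ∃ s > 0, ∀ ζ ζ' : {z // (((1 : ℂ), t₀), z) ∈ W},
      ‖ζ.1 - ζ'.1‖ < 3 * s → ζ = ζ' := by
    have hfin := Set.finite_range
      (fun p : {p : {z // (((1 : ℂ), t₀), z) ∈ W} × {z // (((1 : ℂ), t₀), z) ∈ W} // p.1 ≠ p.2} =>
        ‖p.1.1.1 - p.1.2.1‖)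
    have h0 : (0 : ℝ) ∉ Set.range
      (fun p : {p : {z // (((1 : ℂ), t₀), z) ∈ W} × {z // (((1 : ℂ), t₀), z) ∈ W} // p.1 ≠ p.2} =>
        ‖p.1.1.1 - p.1.2.1‖) := by
      rintro ⟨⟨⟨a, b⟩, hab⟩, h0⟩
      exact hab (Subtype.ext (sub_eq_zero.1 (norm_eq_zero.1 h0)))
    obtain ⟨ε, hε, hb⟩ := Metric.isOpen_iff.1 hfin.isClosed.isOpen_compl 0 h0
    refine ⟨ε / 3, by positivity, fun ζ ζ' hlt => ?_⟩
    by_contra hne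
    have : ‖ζ.1 - ζ'.1‖ ∈ Metric.ball (0 : ℝ) ε := by
      rw [Metric.mem_ball, dist_zero_right, norm_norm]; linarith
    exact hb this ⟨⟨(ζ, ζ'), hne⟩, rfl⟩
  obtain ⟨R, hR, hfib⟩ := h.exists_fiber_near ht₀ hs
  refine ⟨R, hR, fun r hr hrR => ?_⟩
  have hex : ∀ q ∈ W, ‖slope3 q - t₀‖ < r →
      ∃ e : {z // (((1 : ℂ), t₀), z) ∈ W} ≃ {z // (((1 : ℂ), slope3 q), z) ∈ W},
        ∀ z, ‖z.1 - (e z).1‖ < s := fun q hq hlt =>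
    hfib _ (hlt.trans_le hrR) (h.fst_mem _ (h.normalize3_mem hq))
  have hex2 : ∀ q ∈ W, ‖slope3 q - t₀‖ < r → ∃ ζ : {z // (((1 : ℂ), t₀), z) ∈ W},
      ‖height3 q - ζ.1‖ < s := by
    intro q hq hlt
    obtain ⟨e, he⟩ := hex q hq hlt
    refine ⟨e.symm ⟨height3 q, h.normalize3_mem hq⟩, ?_⟩
    have := he (e.symm ⟨height3 q, h.normalize3_mem hq⟩)
    rwa [Equiv.apply_symm_apply, norm_sub_rev] at this
  have htri : ∀ x y z : ℂ, ∀ α β : ℝ, ‖x - y‖ < α → ‖x - z‖ < β → ‖y - z‖ < α + β := by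
    intro x y z α β h1 h2
    have := norm_sub_le_norm_sub_add_norm_sub y x z
    rw [norm_sub_rev y x] at this; linarith
  refine ⟨fun ζ => {q | q ∈ W ∧ ‖slope3 q - t₀‖ < r ∧ ‖height3 q - ζ.1‖ < s},
    fun ζ => ⟨fun q hq => hq.1, ?_, fun q hq => hq.2.1, ?_, ?_⟩, ?_, ?_, ?_⟩
  · rintro q ⟨hq, h1, h2⟩ r hr
    exact ⟨h.smul_mem q hq r hr, by rwa [slope3_smul hr], by rwa [height3_smul hr]⟩
  · rintro q ⟨hq, h1, h2⟩ q' ⟨hq', h1', h2'⟩ heq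
    obtain ⟨e, he⟩ := hex q hq h1
    have hsl : slope3 q' = slope3 q := by simp [slope3, heq]
    have key : ∀ z : {z // (((1 : ℂ), slope3 q), z) ∈ W}, ‖z.1 - ζ.1‖ < s → e ζ = z := by
      intro z hz
      rw [← Equiv.apply_symm_apply e z]
      congr 1
      apply hsep
      have := he (e.symm z)
      rw [Equiv.apply_symm_apply, norm_sub_rev] at this
      linarith [htri _ _ _ _ _ hz this]
    have k1 := key ⟨height3 q, h.normalize3_mem hq⟩ h2
    have k2 := key ⟨height3 q', by have := h.normalize3_mem hq'; rwa [normalize3, hsl] at this⟩ h2'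
    have k3 : height3 q = height3 q' := congrArg Subtype.val (k1.symm.trans k2)
    rw [← smul_normalize3 (h.fst_fst_ne hq), ← smul_normalize3 (h.fst_fst_ne hq'), heq]
    simp only [normalize3, k3, hsl]
  · obtain ⟨η, hη, hn⟩ := h.exists_near_height (‖t₀‖ + r) hs
    refine ⟨η, hη, ?_⟩
    rintro q ⟨hq, h1, h2⟩ q' hq' hqq' h1'
    refine ⟨hq', h1', ?_⟩
    obtain ⟨ζ', hζ'⟩ := hex2 q' hq' h1'
    have h3 := hn q hq q' hq' hqq' (by
      have := norm_add_le (slope3 q - t₀) t₀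
      rw [sub_add_cancel] at this; linarith)
    have h4 := htri _ _ _ _ _ h3 hζ'
    have h5 := htri _ _ _ _ _ h2 h4
    rw [hsep ζ ζ' (by linarith)]
    exact hζ'
  · intro ζ
    exact ⟨ζ.2, by simp [slope3, hr], by simp [height3, hs]⟩
  · intro q hq hlt
    obtain ⟨ζ, hζ⟩ := hex2 q hq hlt
    exact ⟨ζ, hq, hlt, hζ⟩
  · rintro ζ ζ' q ⟨_, _, h1⟩ ⟨_, _, h2⟩
    apply hsep
    linarith [htri _ _ _ _ _ h1 h2]

theorem exists_sheet (h : ConeCover W U d) {p : (ℂ × ℂ) × ℂ} (hp : p ∈ W) :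
    ∃ r > 0, ∃ N, IsSheet W (slope3 p) r N ∧ p ∈ N := by
  obtain ⟨R, hR, hN⟩ := h.exists_sheets (h.fst_mem _ (h.normalize3_mem hp))
  obtain ⟨N, hN, -, hcov, -⟩ := hN R hR le_rfl
  obtain ⟨ζ, hζ⟩ := hcov p hp (by simpa using hR)
  exact ⟨R, hR, N ζ, hN ζ, hζ⟩

end ConeCover

/-- The coboundary of the argument of `slope - t₀`, restricted to a set: a representative of the
fundamental class. -/
noncomputable def pointClass (t₀ : ℂ) (N : Set ((ℂ × ℂ) × ℂ)) :
    (ℂ × ℂ) × ℂ → (ℂ × ℂ) × ℂ → (ℂ × ℂ) × ℂ → ℤ :=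
  restrictTo N (coboundary (argJump (slopeDiff t₀)))

/-- The failure of `argJump` to be additive on products, corrected by a coboundary. -/
noncomputable def argJumpDefect {E : Type*} (G H : E → ℂ) (a b : E) : ℤ :=
  argJump (fun q => G q * H q) a b - argJump G a b - argJump H a b -
    (argDefect (G b) (H b) - argDefect (G a) (H a))

theorem argJumpDefect_eq {E : Type*} {G H : E → ℂ} {a b : E} (h1 : G a ≠ 0) (h2 : G b ≠ 0)
    (h3 : H a ≠ 0) (h4 : H b ≠ 0) : 2 * Real.pi * argJumpDefect G H a b =
      Complex.arg (G b / G a) + Complex.arg (H b / H a) -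
        Complex.arg ((G b * H b) / (G a * H a)) := by
  have e1 := argJump_eq (F := fun q => G q * H q) (mul_ne_zero h1 h3) (mul_ne_zero h2 h4)
  have e2 := argJump_eq h1 h2
  have e3 := argJump_eq h3 h4
  have e4 := arg_mul_eq h1 h3
  have e5 := arg_mul_eq h2 h4
  unfold argJumpDefect
  push_cast
  linear_combination e1 - e2 - e3 + e5 - e4

theorem coboundary_argJumpDefect {E : Type*} (G H : E → ℂ) (a b c : E) :
    coboundary (argJumpDefect G H) a b c = coboundary (argJump (fun q => G q * H q)) a b c -
      coboundary (argJump G) a b c - coboundary (argJump H) a b c := by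
  unfold coboundary argJumpDefect; ring

theorem argJump_eq_zero_of_small {E : Type*} {F : E → ℂ} {a b : E} (ha : F a ≠ 0) (hb : F b ≠ 0)
    (h1 : |Complex.arg (F a)| < Real.pi / 6) (h2 : |Complex.arg (F b)| < Real.pi / 6) :
    argJump F a b = 0 := by
  apply int_eq_zero_of_two_pi_mul_lt
  rw [argJump_eq ha hb, abs_lt]
  rw [abs_lt] at h1 h2
  have := Complex.neg_pi_lt_arg (F b / F a)
  have := Complex.arg_le_pi (F b / F a)
  constructor <;> linarith [Real.pi_pos]

theorem restrictTo_add {E : Type*} (N : Set E) (z z' : E → E → E → ℤ) :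
    restrictTo N (z + z') = restrictTo N z + restrictTo N z' := by
  ext a b c; unfold restrictTo; simp only [Pi.add_apply]; split_ifs <;> simp

namespace ConeCover

variable {W : Set ((ℂ × ℂ) × ℂ)} {U : Set (ℂ × ℂ)} {d : ℕ}

theorem norm_slope_le {t₀ : ℂ} {r : ℝ} {N : Set ((ℂ × ℂ) × ℂ)} (hN : IsSheet W t₀ r N)
    {q : (ℂ × ℂ) × ℂ} (hq : q ∈ N) : ‖slope3 q‖ ≤ ‖t₀‖ + r := by
  have := norm_add_le (slope3 q - t₀) t₀
  rw [sub_add_cancel] at this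
  linarith [hN.slope_lt q hq]

theorem restrictTo_mem (h : ConeCover W U d) {t₀ : ℂ} {r ρ : ℝ} {N : Set ((ℂ × ℂ) × ℂ)}
    (hN : IsSheet W t₀ r N) (hρ : ρ < r) {m : (ℂ × ℂ) × ℂ → (ℂ × ℂ) × ℂ → ℤ}
    (hm0 : ∀ a ∈ W, ∀ s : ℂ, s ≠ 0 → m a (s • a) = 0)
    (hm : ∃ ε > 0, ∀ a ∈ N, ∀ b ∈ N, RelNear ε a b → ρ ≤ ‖slope3 a - t₀‖ → m a b = 0) :
    restrictTo N (coboundary m) ∈ lineCoboundaries W := by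
  obtain ⟨ε, hε, hm⟩ := hm
  refine restrictTo_coboundary_mem hN ?_ hm0 hε hm
  obtain ⟨ε, hε, hs⟩ := h.exists_near_slope (‖t₀‖ + r) (sub_pos.2 hρ)
  exact ⟨ε, hε, fun a ha b hb hab => (hs a (hN.subset ha) b hb hab (norm_slope_le hN ha)).1⟩

theorem pointClass_move (h : ConeCover W U d) : ∃ κ > 0, ∀ (t₀ : ℂ) (r : ℝ)
    (N : Set ((ℂ × ℂ) × ℂ)), IsSheet W t₀ r N → ∀ t₁, ‖t₁ - t₀‖ < κ * r →
      pointClass t₀ N - pointClass t₁ N ∈ lineCoboundaries W := by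
  obtain ⟨θ, hθ, hθ1, harg⟩ := exists_small_arg
  refine ⟨θ / 8, by positivity, fun t₀ r N hN t₁ ht => ?_⟩
  have hr : 0 < r := by
    by_contra hn
    nlinarith [norm_nonneg (t₁ - t₀)]
  set R : (ℂ × ℂ) × ℂ → ℂ := fun q => slopeDiff t₀ q / slopeDiff t₁ q with hR
  have hR0 : ∀ q, R q ≠ 0 := fun q => div_ne_zero (slopeDiff_ne_zero _ _) (slopeDiff_ne_zero _ _)
  have hprod : (fun q => slopeDiff t₁ q * R q) = slopeDiff t₀ := by
    ext q; exact mul_div_cancel₀ _ (slopeDiff_ne_zero _ _)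
  have hRs : ∀ q : (ℂ × ℂ) × ℂ, ∀ s : ℂ, s ≠ 0 → R (s • q) = R q := fun q s hs => by
    simp only [hR, slopeDiff_smul _ hs]
  set m : (ℂ × ℂ) × ℂ → (ℂ × ℂ) × ℂ → ℤ := fun a b =>
    argJumpDefect (slopeDiff t₁) R a b + argJump R a b with hm
  have heq : pointClass t₀ N - pointClass t₁ N = restrictTo N (coboundary m) := by
    have e1 : coboundary (argJump (slopeDiff t₀)) =
        coboundary m + coboundary (argJump (slopeDiff t₁)) := by
      ext a b c
      have := coboundary_argJumpDefect (slopeDiff t₁) R a b c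
      rw [hprod] at this
      simp only [Pi.add_apply]
      have e2 : coboundary m a b c = coboundary (argJumpDefect (slopeDiff t₁) R) a b c +
        coboundary (argJump R) a b c := by simp only [hm, coboundary]; ring
      rw [e2, this]; ring
    rw [pointClass, e1, restrictTo_add, pointClass, add_sub_cancel_right]
  rw [heq]
  have hsmall : ∀ q : (ℂ × ℂ) × ℂ, r / 4 ≤ ‖slope3 q - t₀‖ →
      r / 8 ≤ ‖slope3 q - t₁‖ ∧ |Complex.arg (R q)| < Real.pi / 6 := by
    intro q hq
    have h1 : ‖slope3 q - t₀‖ ≤ ‖slope3 q - t₁‖ + ‖t₁ - t₀‖ := by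
      have := norm_add_le (slope3 q - t₁) (t₁ - t₀); rwa [sub_add_sub_cancel] at this
    have h2 : r / 8 ≤ ‖slope3 q - t₁‖ := by nlinarith
    refine ⟨h2, (harg _ ?_).2⟩
    have n0 : slope3 q ≠ t₀ := by
      intro h0; rw [h0, sub_self, norm_zero] at hq; linarith
    have n1 : slope3 q ≠ t₁ := by
      intro h0; rw [h0, sub_self, norm_zero] at h2; linarith
    have n1' := sub_ne_zero.2 n1
    simp only [hR]
    rw [slopeDiff_of_ne n0, slopeDiff_of_ne n1]
    have : (slope3 q - t₀) / (slope3 q - t₁) - 1 = (t₁ - t₀) / (slope3 q - t₁) := by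
      field_simp; ring
    rw [this, norm_div, div_lt_iff₀ (norm_pos_iff.2 n1')]
    nlinarith
  obtain ⟨ε₀, hε₀, hs₀⟩ := h.exists_near_slopeDiff (‖t₀‖ + r) t₀ (ρ := r / 4) (by positivity)
  obtain ⟨ε₁, hε₁, hs₁⟩ := h.exists_near_slopeDiff (‖t₀‖ + r) t₁ (ρ := r / 8) (by positivity)
  obtain ⟨ε₂, hε₂, hs₂⟩ := h.exists_near_slope (‖t₀‖ + r) (θ := r / 4) (by positivity)
  refine h.restrictTo_mem hN (ρ := r / 2) (by linarith) ?_ ⟨min ε₀ (min ε₁ ε₂), by positivity, ?_⟩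
  · intro a ha s hs
    have e1 : argJumpDefect (slopeDiff t₁) R a (s • a) = 0 := by
      apply int_eq_zero_of_two_pi_mul_lt
      rw [argJumpDefect_eq (slopeDiff_ne_zero _ _) (slopeDiff_ne_zero _ _) (hR0 _) (hR0 _),
        hRs _ _ hs, slopeDiff_smul _ hs, div_self (slopeDiff_ne_zero _ _), div_self (hR0 _),
        div_self (mul_ne_zero (slopeDiff_ne_zero _ _) (hR0 _))]
      simp; positivity
    have e2 : argJump R a (s • a) = 0 := by
      apply int_eq_zero_of_two_pi_mul_lt
      rw [argJump_eq (hR0 _) (hR0 _), hRs _ _ hs, div_self (hR0 _)]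
      simp; positivity
    simp only [hm, e1, e2, add_zero]
  · intro a ha b hb hab hfar
    have haW := hN.subset ha
    have hbW := hN.subset hb
    have hM := norm_slope_le hN ha
    have hsl := (hs₂ a haW b hbW (hab.mono ((min_le_right _ _).trans (min_le_right _ _))) hM).1
    have hb4 : r / 4 ≤ ‖slope3 b - t₀‖ := by
      have := norm_sub_le (slope3 b - t₀) (slope3 b - slope3 a)
      rw [sub_sub_sub_cancel_left] at this
      linarith
    have k1 := hs₀ a haW b hbW (hab.mono (min_le_left _ _)) hM (by linarith)
    have k2 := hs₁ a haW b hbW (hab.mono ((min_le_right _ _).trans (min_le_left _ _))) hM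
      (hsmall a (by linarith)).1
    have ka := (hsmall a (by linarith)).2
    have kb := (hsmall b hb4).2
    have e1 : argJumpDefect (slopeDiff t₁) R a b = 0 := by
      apply int_eq_zero_of_two_pi_mul_lt
      rw [argJumpDefect_eq (slopeDiff_ne_zero _ _) (slopeDiff_ne_zero _ _) (hR0 _) (hR0 _)]
      have p1 := congrFun hprod a
      have p2 := congrFun hprod b
      rw [show slopeDiff t₁ a * R a = _ from p1, show slopeDiff t₁ b * R b = _ from p2]
      rw [abs_lt] at k1 k2 ⊢
      have := Complex.neg_pi_lt_arg (R b / R a)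
      have := Complex.arg_le_pi (R b / R a)
      constructor <;> linarith [Real.pi_pos]
    simp only [hm, e1, argJump_eq_zero_of_small (hR0 a) (hR0 b) ka kb, add_zero]

theorem relNear_normalized {ε : ℝ} (hε : 0 < ε) {t t' z z' : ℂ} (ht : ‖t - t'‖ < ε)
    (hz : ‖z - z'‖ < ε) : RelNear ε (((1 : ℂ), t), z) (((1 : ℂ), t'), z') := by
  have h1 : ‖(((1 : ℂ), t), z) - (((1 : ℂ), t'), z')‖ < ε := by
    simp only [Prod.mk_sub_mk, sub_self, Prod.norm_def, norm_zero]
    exact max_lt (max_lt hε ht) hz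
  have h2 : ∀ t z : ℂ, 1 ≤ ‖(((1 : ℂ), t), z)‖ := fun t z => by simp [Prod.norm_def]
  constructor
  · nlinarith [h2 t z]
  · nlinarith [h2 t' z']

theorem slope3_normalize3 (q : (ℂ × ℂ) × ℂ) : slope3 (normalize3 q) = slope3 q := by
  simp [normalize3, slope3]

theorem normalize3_mem_sheet (h : ConeCover W U d) {t₀ : ℂ} {r : ℝ} {N : Set ((ℂ × ℂ) × ℂ)}
    (hN : IsSheet W t₀ r N) {q : (ℂ × ℂ) × ℂ} (hq : q ∈ W) : normalize3 q ∈ N ↔ q ∈ N := by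
  have hx := h.fst_fst_ne hq
  constructor
  · intro hn
    rw [← smul_normalize3 hx]; exact hN.smul_mem _ hn _ hx
  · intro hn
    rw [normalize3_eq_smul hx]; exact hN.smul_mem _ hn _ (inv_ne_zero hx)

theorem sheet_continuous (h : ConeCover W U d) {t₀ : ℂ} {r : ℝ} {N : Set ((ℂ × ℂ) × ℂ)}
    (hN : IsSheet W t₀ r N) {p : (ℂ × ℂ) × ℂ} (hp : p ∈ N) {ε : ℝ} (hε : 0 < ε) :
    ∃ ρ > 0, ∀ q ∈ N, ‖slope3 q - slope3 p‖ < ρ → RelNear ε (normalize3 p) (normalize3 q) := by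
  obtain ⟨η, hη, hsep⟩ := hN.separated
  have hpW := hN.subset hp
  have hpn := h.normalize3_mem hpW
  obtain ⟨ρ, hρ, hf⟩ := h.exists_fiber_near (h.fst_mem _ hpn) (s := min ε η) (by positivity)
  refine ⟨min ρ (min ε η), by positivity, fun q hq hlt => ?_⟩
  have hqW := hN.subset hq
  obtain ⟨e, he⟩ := hf (slope3 q) (hlt.trans_le (min_le_left _ _))
    (h.fst_mem _ (h.normalize3_mem hqW))
  have h1 := he ⟨height3 p, hpn⟩
  set z := e ⟨height3 p, hpn⟩ with hz
  have h2 : RelNear (min ε η) (normalize3 p) (((1 : ℂ), slope3 q), z.1) :=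
    relNear_normalized (by positivity) (by
      rw [norm_sub_rev]; exact hlt.trans_le (min_le_right _ _)) h1
  have h3 : (((1 : ℂ), slope3 q), z.1) ∈ N :=
    hsep _ ((h.normalize3_mem_sheet hN hpW).2 hp) _ z.2 (h2.mono (min_le_right _ _)) (by
      have := hN.slope_lt q hq
      simpa [slope3] using this)
  have h4 := hN.unique _ h3 _ ((h.normalize3_mem_sheet hN hqW).2 hq) rfl
  rw [← h4]
  exact h2.mono (min_le_left _ _)

theorem sheet_subset_sheet (h : ConeCover W U d) {t₀ t₁ : ℂ} {r r' : ℝ}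
    {N N' : Set ((ℂ × ℂ) × ℂ)} (hN : IsSheet W t₀ r N) (hN' : IsSheet W t₁ r' N')
    {p : (ℂ × ℂ) × ℂ} (hp : p ∈ N) (hp' : p ∈ N') :
    ∃ ρ > 0, ∀ q ∈ N, ‖slope3 q - slope3 p‖ < ρ → q ∈ N' := by
  obtain ⟨η, hη, hsep⟩ := hN'.separated
  obtain ⟨ρ, hρ, hc⟩ := h.sheet_continuous hN hp hη
  have hpos : 0 < r' - ‖slope3 p - t₁‖ := sub_pos.2 (hN'.slope_lt p hp')
  refine ⟨min ρ (r' - ‖slope3 p - t₁‖), by positivity, fun q hq hlt => ?_⟩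
  have hqW := hN.subset hq
  refine (h.normalize3_mem_sheet hN' hqW).1 (hsep _
    ((h.normalize3_mem_sheet hN' (hN.subset hp)).2 hp') _ (h.normalize3_mem hqW)
    (hc q hq (hlt.trans_le (min_le_left _ _))) ?_)
  rw [slope3_normalize3]
  have h1 := hlt.trans_le (min_le_right _ _)
  have h2 := norm_add_le (slope3 q - slope3 p) (slope3 p - t₁)
  rw [sub_add_sub_cancel] at h2
  linarith

theorem restrictTo_sub_mem_of_agree (h : ConeCover W U d) {t₀ t₁ t₂ : ℂ} {r r' ρ : ℝ}
    {N N' : Set ((ℂ × ℂ) × ℂ)} (hN : IsSheet W t₀ r N) (hN' : IsSheet W t₁ r' N') (hρ : 0 < ρ)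
    (hagree : ∀ q ∈ W, ‖slope3 q - t₂‖ < ρ → (q ∈ N ↔ q ∈ N')) :
    pointClass t₂ N - pointClass t₂ N' ∈ lineCoboundaries W := by
  set M := max (‖t₀‖ + r) (‖t₁‖ + r') with hM
  obtain ⟨ε₀, hε₀, hs₀⟩ := h.exists_near_slopeDiff M t₂ (ρ := ρ / 3) (by positivity)
  obtain ⟨ε₁, hε₁, hs₁⟩ := h.exists_near_slope M (θ := ρ / 3) (by positivity)
  refine mem_lineCoboundaries_of_eq (ε := min ε₀ ε₁) (by positivity) (zero_mem _) ?_
  intro a ha b hb c hc hab hbc hac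
  have hcob : ‖slope3 a‖ ≤ M → ‖slope3 b‖ ≤ M → ρ / 3 ≤ ‖slope3 a - t₂‖ →
      ρ / 3 ≤ ‖slope3 b - t₂‖ → coboundary (argJump (slopeDiff t₂)) a b c = 0 := by
    intro h1 h2 h3 h4
    exact coboundary_argJump_eq_zero (slopeDiff_ne_zero _ _) (slopeDiff_ne_zero _ _)
      (slopeDiff_ne_zero _ _) (hs₀ a ha b hb (hab.mono (min_le_left _ _)) h1 h3)
      (hs₀ b hb c hc (hbc.mono (min_le_left _ _)) h2 h4)
      (hs₀ a ha c hc (hac.mono (min_le_left _ _)) h1 h3)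
  have hnear : ∀ q ∈ W, ∀ q' ∈ W, RelNear (min ε₀ ε₁) q q' → ‖slope3 q‖ ≤ M → ∀ s,
      ‖slope3 q - t₂‖ < s → ‖slope3 q' - t₂‖ < s + ρ / 3 := by
    intro q hq q' hq' hqq hqM s hlt
    have h1 := (hs₁ q hq q' hq' (hqq.mono (min_le_right _ _)) hqM).1
    have h2 := norm_add_le (slope3 q' - slope3 q) (slope3 q - t₂)
    rw [sub_add_sub_cancel] at h2
    linarith
  simp only [Pi.sub_apply, pointClass, restrictTo, Pi.zero_apply]
  by_cases hMa : ‖slope3 a‖ ≤ M ∧ ‖slope3 b‖ ≤ M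
  · by_cases hfar : ρ / 3 ≤ ‖slope3 a - t₂‖ ∧ ρ / 3 ≤ ‖slope3 b - t₂‖
    · rw [hcob hMa.1 hMa.2 hfar.1 hfar.2]; simp
    · have hall : ‖slope3 a - t₂‖ < ρ ∧ ‖slope3 b - t₂‖ < ρ ∧ ‖slope3 c - t₂‖ < ρ := by
        by_cases hA : ‖slope3 a - t₂‖ < ρ / 3
        · have e1 := hnear a ha b hb hab hMa.1 _ hA
          have e2 := hnear a ha c hc hac hMa.1 _ hA
          refine ⟨?_, ?_, ?_⟩ <;> linarith
        · have hB : ‖slope3 b - t₂‖ < ρ / 3 := by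
            by_contra hB; push Not at hA hB; exact hfar ⟨hA, hB⟩
          have e1 := hnear b hb a ha hab.symm hMa.2 _ hB
          have e2 := hnear b hb c hc hbc hMa.2 _ hB
          refine ⟨?_, ?_, ?_⟩ <;> linarith
      rw [hagree a ha hall.1, hagree b hb hall.2.1, hagree c hc hall.2.2, sub_self]
  · have n1 : ¬ (a ∈ N ∧ b ∈ N ∧ c ∈ N) := fun hh => hMa
      ⟨(norm_slope_le hN hh.1).trans (le_max_left _ _),
        (norm_slope_le hN hh.2.1).trans (le_max_left _ _)⟩
    have n2 : ¬ (a ∈ N' ∧ b ∈ N' ∧ c ∈ N') := fun hh => hMa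
      ⟨(norm_slope_le hN' hh.1).trans (le_max_right _ _),
        (norm_slope_le hN' hh.2.1).trans (le_max_right _ _)⟩
    rw [if_neg n1, if_neg n2, sub_self]

theorem pointClass_sub_mem_of_mem (h : ConeCover W U d) {t₀ t₁ : ℂ} {r r' : ℝ}
    {N N' : Set ((ℂ × ℂ) × ℂ)} (hN : IsSheet W t₀ r N) (hN' : IsSheet W t₁ r' N')
    {p : (ℂ × ℂ) × ℂ} (hp : p ∈ N) (hp' : p ∈ N') :
    pointClass (slope3 p) N - pointClass (slope3 p) N' ∈ lineCoboundaries W := by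
  obtain ⟨ρ, hρ, h1⟩ := h.sheet_subset_sheet hN hN' hp hp'
  obtain ⟨ρ', hρ', h2⟩ := h.sheet_subset_sheet hN' hN hp' hp
  exact h.restrictTo_sub_mem_of_agree hN hN' (ρ := min ρ ρ') (by positivity) fun q hq hlt =>
    ⟨fun hh => h1 q hh (hlt.trans_le (min_le_left _ _)),
      fun hh => h2 q hh (hlt.trans_le (min_le_right _ _))⟩

theorem continuousAt_slope3 {p : (ℂ × ℂ) × ℂ} (hp : p.1.1 ≠ 0) : ContinuousAt slope3 p := by
  unfold slope3
  exact ContinuousAt.div (by fun_prop) (by fun_prop) hp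

/-- All the point classes of sheets agree modulo coboundaries. -/
theorem pointClass_sub_mem (h : ConeCover W U d) {p p' : (ℂ × ℂ) × ℂ} (hp : p ∈ W)
    (hp' : p' ∈ W) : ∀ t₀ r N t₁ r' N', IsSheet W t₀ r N → IsSheet W t₁ r' N' → p ∈ N → p' ∈ N' →
      pointClass (slope3 p) N - pointClass (slope3 p') N' ∈ lineCoboundaries W := by
  obtain ⟨κ, hκ, hmove⟩ := h.pointClass_move
  refine h.preconnected.induction₂ (fun p p' => ∀ t₀ r N t₁ r' N', IsSheet W t₀ r N →
    IsSheet W t₁ r' N' → p ∈ N → p' ∈ N' →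
      pointClass (slope3 p) N - pointClass (slope3 p') N' ∈ lineCoboundaries W) ?_ ?_ ?_ hp hp'
  · intro p hp
    obtain ⟨R, hR, N₀, hN₀, hpN₀⟩ := h.exists_sheet hp
    obtain ⟨η, hη, hsep⟩ := hN₀.separated
    have e1 : ∀ᶠ q in 𝓝[W] p, RelNear η p q :=
      (eventually_relNear (fun h0 => h.zero_notMem (h0 ▸ hp)) hη).filter_mono nhdsWithin_le_nhds
    have e2 : ∀ᶠ q in 𝓝[W] p, ‖slope3 q - slope3 p‖ < min R (κ * R) := by
      have := (continuousAt_slope3 (h.fst_fst_ne hp)).tendsto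
      have := Metric.tendsto_nhds.1 this (min R (κ * R)) (by positivity)
      simp only [dist_eq_norm] at this
      exact this.filter_mono nhdsWithin_le_nhds
    filter_upwards [e1, e2, self_mem_nhdsWithin] with q hq1 hq2 hqW
    intro t₀ r N t₁ r' N' hN hN' hpN hqN'
    have hqN₀ : q ∈ N₀ := hsep p hpN₀ q hqW hq1 (hq2.trans_le (min_le_left _ _))
    have k1 := h.pointClass_sub_mem_of_mem hN hN₀ hpN hpN₀
    have k2 := hmove _ _ _ hN₀ (slope3 q) (hq2.trans_le (min_le_right _ _))
    have k3 := h.pointClass_sub_mem_of_mem hN₀ hN' hqN₀ hqN'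
    have := add_mem (add_mem k1 k2) k3
    rwa [sub_add_sub_cancel, sub_add_sub_cancel] at this
  · intro x y z hx hy hz hxy hyz t₀ r N t₁ r' N' hN hN' hxN hzN'
    obtain ⟨R, hR, N₀, hN₀, hyN₀⟩ := h.exists_sheet hy
    have := add_mem (hxy _ _ _ _ _ _ hN hN₀ hxN hyN₀) (hyz _ _ _ _ _ _ hN₀ hN' hyN₀ hzN')
    rwa [sub_add_sub_cancel] at this
  · intro x y hx hy hxy t₀ r N t₁ r' N' hN hN' hyN hxN'
    have := neg_mem (hxy _ _ _ _ _ _ hN' hN hxN' hyN)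
    rwa [neg_sub] at this

end ConeCover

/-- The linear form `y - t₀ x`, with zero values replaced by `x`. -/
noncomputable def linForm (t₀ : ℂ) (q : (ℂ × ℂ) × ℂ) : ℂ := q.1.1 * slopeDiff t₀ q

theorem linForm_smul (t₀ : ℂ) {r : ℂ} (hr : r ≠ 0) (q : (ℂ × ℂ) × ℂ) :
    linForm t₀ (r • q) = r * linForm t₀ q := by
  simp only [linForm, slopeDiff_smul t₀ hr, Prod.smul_fst, smul_eq_mul]; ring

namespace ConeCover

variable {W : Set ((ℂ × ℂ) × ℂ)} {U : Set (ℂ × ℂ)} {d : ℕ}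

theorem linForm_ne_zero (h : ConeCover W U d) (t₀ : ℂ) {q : (ℂ × ℂ) × ℂ} (hq : q ∈ W) :
    linForm t₀ q ≠ 0 := mul_ne_zero (h.fst_fst_ne hq) (slopeDiff_ne_zero _ _)

theorem exists_near_linForm (h : ConeCover W U d) (t₀ : ℂ) {ρ : ℝ} (hρ : 0 < ρ) :
    ∃ ε > 0, ∀ a ∈ W, ∀ b ∈ W, RelNear ε a b → ρ ≤ ‖slope3 a - t₀‖ → ρ ≤ ‖slope3 b - t₀‖ →
      |Complex.arg (linForm t₀ b / linForm t₀ a)| < Real.pi / 6 := by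
  obtain ⟨θ, hθ, hθ1, harg⟩ := exists_small_arg
  obtain ⟨K, hK0, hK⟩ := h.height_bound
  set C := (1 + K) * (1 + (1 + ‖t₀‖) / ρ) with hC
  have hCpos : 0 < C := by positivity
  refine ⟨θ / (2 * C * (1 + ‖t₀‖)), by positivity, fun a ha b hb hab hfa hfb => (harg _ ?_).2⟩
  have hlin : ∀ q ∈ W, ρ ≤ ‖slope3 q - t₀‖ → linForm t₀ q = q.1.2 - t₀ * q.1.1 := by
    intro q hq hf
    have : slope3 q ≠ t₀ := by
      intro h0; rw [h0, sub_self, norm_zero] at hf; linarith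
    have hx := h.fst_fst_ne hq
    rw [linForm, slopeDiff_of_ne this, slope3]
    field_simp
  have hL0 := h.linForm_ne_zero t₀ ha
  have hxa := h.fst_fst_ne ha
  have hlow : ‖a‖ ≤ C * ‖linForm t₀ a‖ := by
    set D := ‖slope3 a - t₀‖ with hD
    have hDρ : 1 ≤ D / ρ := (one_le_div hρ).2 hfa
    have h1 : ‖slope3 a‖ ≤ D + ‖t₀‖ := by
      have := norm_add_le (slope3 a - t₀) t₀; rwa [sub_add_cancel] at this
    have h2 : max 1 ‖slope3 a‖ ≤ (1 + (1 + ‖t₀‖) / ρ) * D := by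
      have e : (1 + (1 + ‖t₀‖) / ρ) * D = D + (1 + ‖t₀‖) * (D / ρ) := by field_simp
      rw [e]
      have := mul_le_mul_of_nonneg_left hDρ (norm_nonneg t₀)
      have hD0 : 0 ≤ D := norm_nonneg _
      apply max_le <;> nlinarith [norm_nonneg t₀]
    have h3 : ‖normalize3 a‖ ≤ C * D := by
      have h4 := hK a ha
      have h5 : (1 : ℝ) ≤ max 1 ‖slope3 a‖ := le_max_left _ _
      have h6 : ‖normalize3 a‖ ≤ (1 + K) * max 1 ‖slope3 a‖ := by
        simp only [normalize3, Prod.norm_def, norm_one]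
        apply max_le <;> nlinarith
      calc _ ≤ (1 + K) * max 1 ‖slope3 a‖ := h6
        _ ≤ (1 + K) * ((1 + (1 + ‖t₀‖) / ρ) * D) := by gcongr
        _ = C * D := by rw [hC]; ring
    have h7 : ‖linForm t₀ a‖ = ‖a.1.1‖ * D := by
      have : slope3 a ≠ t₀ := by
        intro h0; rw [hD, h0, sub_self, norm_zero] at hfa; linarith
      rw [linForm, slopeDiff_of_ne this, norm_mul]
    rw [h7]
    calc ‖a‖ = ‖a.1.1‖ * ‖normalize3 a‖ := by
          rw [← norm_smul, smul_normalize3 hxa]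
      _ ≤ ‖a.1.1‖ * (C * D) := by gcongr
      _ = _ := by ring
  have e1 : linForm t₀ b / linForm t₀ a - 1 = (linForm t₀ b - linForm t₀ a) / linForm t₀ a := by
    field_simp
  have hLpos := norm_pos_iff.2 hL0
  rw [e1, norm_div, div_lt_iff₀ hLpos]
  have e2 : linForm t₀ b - linForm t₀ a = -((a - b).1.2) + t₀ * (a - b).1.1 := by
    rw [hlin a ha hfa, hlin b hb hfb]; simp; ring
  have e3 : ‖linForm t₀ b - linForm t₀ a‖ ≤ (1 + ‖t₀‖) * ‖a - b‖ := by
    rw [e2]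
    refine (norm_add_le _ _).trans ?_
    rw [norm_neg, norm_mul]
    have := (norm_snd_le (a - b).1).trans (norm_fst_le (a - b))
    have := (norm_fst_le (a - b).1).trans (norm_fst_le (a - b))
    nlinarith [norm_nonneg t₀]
  calc _ ≤ (1 + ‖t₀‖) * ‖a - b‖ := e3
    _ ≤ (1 + ‖t₀‖) * (θ / (2 * C * (1 + ‖t₀‖)) * (C * ‖linForm t₀ a‖)) := by
        have := hab.1.le.trans (mul_le_mul_of_nonneg_left hlow
          (by positivity : 0 ≤ θ / (2 * C * (1 + ‖t₀‖))))
        gcongr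
    _ = θ / 2 * ‖linForm t₀ a‖ := by field_simp
    _ < θ * ‖linForm t₀ a‖ := by nlinarith

theorem exists_base (h : ConeCover W U d) : ∃ t : ℂ, ((1 : ℂ), t) ∈ U := by
  by_contra hn
  push Not at hn
  exact (Set.infinite_univ (α := ℂ)) (h.finite.subset fun t _ => hn t)

theorem exists_far_fst (h : ConeCover W U d) (M : ℝ) :
    ∃ ε > 0, ∀ a ∈ W, ∀ b ∈ W, RelNear ε a b → ‖slope3 a‖ ≤ M →
      |Complex.arg (b.1.1 / a.1.1)| < Real.pi / 6 := by
  obtain ⟨θ, hθ, hθ1, harg⟩ := exists_small_arg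
  obtain ⟨ε, hε, hs⟩ := h.exists_near_slope M hθ
  exact ⟨ε, hε, fun a ha b hb hab hM => (harg _ (hs a ha b hb hab hM).2).2⟩

theorem linForm_restrict_mem (h : ConeCover W U d) {t₀ : ℂ} {r : ℝ} (hr : 0 < r)
    {N : Set ((ℂ × ℂ) × ℂ)} (hN : IsSheet W t₀ r N) :
    restrictTo N (coboundary (argJump (linForm t₀))) - pointClass t₀ N ∈ lineCoboundaries W := by
  set m := argJumpDefect (fun q : (ℂ × ℂ) × ℂ => q.1.1) (slopeDiff t₀) with hm
  set M := ‖t₀‖ + r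
  obtain ⟨ε₀, hε₀, hx⟩ := h.exists_far_fst M
  have hmem : restrictTo N (coboundary m) ∈ lineCoboundaries W := by
    obtain ⟨ε₁, hε₁, hT⟩ := h.exists_near_slopeDiff M t₀ (ρ := r / 2) (by positivity)
    obtain ⟨ε₂, hε₂, hL⟩ := h.exists_near_linForm t₀ (ρ := r / 4) (by positivity)
    obtain ⟨ε₃, hε₃, hs⟩ := h.exists_near_slope M (θ := r / 4) (by positivity)
    refine h.restrictTo_mem hN (ρ := r / 2) (by linarith) ?_
      ⟨min (min ε₀ ε₁) (min ε₂ ε₃), by positivity, ?_⟩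
    · intro a ha s hs
      apply int_eq_zero_of_two_pi_mul_lt
      have hxa := h.fst_fst_ne ha
      have hxs : (s • a).1.1 ≠ 0 := mul_ne_zero hs hxa
      rw [hm, argJumpDefect_eq (G := fun q : (ℂ × ℂ) × ℂ => q.1.1) hxa hxs (slopeDiff_ne_zero _ _)
        (slopeDiff_ne_zero _ _), slopeDiff_smul _ hs, div_self (slopeDiff_ne_zero _ _),
        mul_div_mul_right _ _ (slopeDiff_ne_zero _ _)]
      simp; positivity
    · intro a ha b hb hab hfar
      have haW := hN.subset ha
      have hbW := hN.subset hb
      have hM := norm_slope_le hN ha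
      have k0 := hx a haW b hbW (hab.mono ((min_le_left _ _).trans (min_le_left _ _))) hM
      have k1 := hT a haW b hbW (hab.mono ((min_le_left _ _).trans (min_le_right _ _))) hM hfar
      have k3 := (hs a haW b hbW (hab.mono ((min_le_right _ _).trans (min_le_right _ _))) hM).1
      have hb4 : r / 4 ≤ ‖slope3 b - t₀‖ := by
        have := norm_sub_le (slope3 b - t₀) (slope3 b - slope3 a)
        rw [sub_sub_sub_cancel_left] at this
        linarith
      have k2 := hL a haW b hbW (hab.mono ((min_le_right _ _).trans (min_le_left _ _)))
        (by linarith) hb4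
      apply int_eq_zero_of_two_pi_mul_lt
      rw [hm, argJumpDefect_eq (G := fun q : (ℂ × ℂ) × ℂ => q.1.1) (h.fst_fst_ne haW)
        (h.fst_fst_ne hbW) (slopeDiff_ne_zero _ _)
        (slopeDiff_ne_zero _ _)]
      change |_ + _ - Complex.arg (linForm t₀ b / linForm t₀ a)| < _
      rw [abs_lt] at k0 k1 k2 ⊢
      constructor <;> linarith [Real.pi_pos]
  refine mem_lineCoboundaries_of_eq hε₀ hmem ?_
  intro a ha b hb c hc hab hbc hac
  simp only [Pi.sub_apply, pointClass, restrictTo]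
  split_ifs with hin
  · have e1 := coboundary_argJumpDefect (fun q : (ℂ × ℂ) × ℂ => q.1.1) (slopeDiff t₀) a b c
    have e2 : coboundary (argJump fun q : (ℂ × ℂ) × ℂ => q.1.1) a b c = 0 :=
      coboundary_argJump_eq_zero (h.fst_fst_ne ha) (h.fst_fst_ne hb) (h.fst_fst_ne hc)
        (hx a ha b hb hab (norm_slope_le hN hin.1))
        (hx b hb c hc hbc (norm_slope_le hN hin.2.1))
        (hx a ha c hc hac (norm_slope_le hN hin.1))
    rw [e2, sub_zero] at e1
    rw [hm, e1]; rfl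
  · simp

theorem linForm_coboundary_mem (h : ConeCover W U d) {t₀ : ℂ} {r : ℝ} (hr : 0 < r)
    {ι : Type*} [Fintype ι] {N : ι → Set ((ℂ × ℂ) × ℂ)} (hN : ∀ i, IsSheet W t₀ r (N i))
    (hcov : ∀ q ∈ W, ‖slope3 q - t₀‖ < r → ∃ i, q ∈ N i)
    (hdisj : ∀ i j, ∀ q ∈ N i, q ∈ N j → i = j) :
    coboundary (argJump (linForm t₀)) - ∑ i, pointClass t₀ (N i) ∈ lineCoboundaries W := by
  classical
  have hmem : ∑ i, (restrictTo (N i) (coboundary (argJump (linForm t₀))) - pointClass t₀ (N i)) ∈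
      lineCoboundaries W := sum_mem fun i _ => h.linForm_restrict_mem hr (hN i)
  choose η hη hsep using fun i => (hN i).separated
  obtain ⟨η₀, hη₀, hη₀'⟩ : ∃ η₀ > 0, ∀ i, η₀ ≤ η i := by
    rcases isEmpty_or_nonempty ι with hι | hι
    · exact ⟨1, one_pos, fun i => (hι.false i).elim⟩
    · obtain ⟨i, hi⟩ := Finite.exists_min η
      exact ⟨η i, hη i, hi⟩
  set M := ‖t₀‖ + r with hMdef
  obtain ⟨ε₀, hε₀, hL⟩ := h.exists_near_linForm t₀ (ρ := r / 4) (by positivity)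
  obtain ⟨ε₁, hε₁, hs⟩ := h.exists_near_slope M (θ := r / 4) (by positivity)
  refine mem_lineCoboundaries_of_eq (ε := min η₀ (min ε₀ ε₁)) (by positivity) hmem ?_
  intro a ha b hb c hc hab hbc hac
  simp only [Pi.sub_apply, Finset.sum_apply, Finset.sum_sub_distrib, sub_left_inj]
  have hle1 : min η₀ (min ε₀ ε₁) ≤ ε₀ := (min_le_right _ _).trans (min_le_left _ _)
  have hle2 : min η₀ (min ε₀ ε₁) ≤ ε₁ := (min_le_right _ _).trans (min_le_right _ _)
  by_cases hex : ∃ i, a ∈ N i ∧ b ∈ N i ∧ c ∈ N i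
  · obtain ⟨i, hi⟩ := hex
    rw [Finset.sum_eq_single i]
    · simp [restrictTo, hi]
    · intro j _ hj
      rw [restrictTo, if_neg]
      exact fun hh => hj (hdisj j i a hh.1 hi.1)
    · simp
  · rw [Finset.sum_eq_zero fun i _ => by rw [restrictTo, if_neg fun hh => hex ⟨i, hh⟩]]
    have hnear : ∀ q ∈ W, ∀ q' ∈ W, RelNear (min η₀ (min ε₀ ε₁)) q q' → ‖slope3 q - t₀‖ < r / 4 →
        ∀ i, q ∈ N i → q' ∈ N i := by
      intro q hq q' hq' hqq hlt i hi
      refine hsep i q hi q' hq' (hqq.mono ((min_le_left _ _).trans (hη₀' i))) ?_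
      have h1 := (hs q hq q' hq' (hqq.mono hle2) (norm_slope_le (hN i) hi)).1
      have h2 := norm_add_le (slope3 q' - slope3 q) (slope3 q - t₀)
      rw [sub_add_sub_cancel] at h2
      linarith
    have hfar : ∀ q ∈ W, RelNear (min η₀ (min ε₀ ε₁)) q a → RelNear (min η₀ (min ε₀ ε₁)) q b →
        RelNear (min η₀ (min ε₀ ε₁)) q c → r / 4 ≤ ‖slope3 q - t₀‖ := by
      intro q hq h1 h2 h3
      by_contra hlt
      push Not at hlt
      obtain ⟨i, hi⟩ := hcov q hq (by linarith)
      exact hex ⟨i, hnear q hq a ha h1 hlt i hi, hnear q hq b hb h2 hlt i hi,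
        hnear q hq c hc h3 hlt i hi⟩
    have hpos := hab.pos
    have hself : ∀ q ∈ W, RelNear (min η₀ (min ε₀ ε₁)) q q := fun q hq =>
      RelNear.refl hpos (fun h0 => h.zero_notMem (h0 ▸ hq))
    have fa := hfar a ha (hself a ha) hab hac
    have fb := hfar b hb hab.symm (hself b hb) hbc
    have fc := hfar c hc hac.symm hbc.symm (hself c hc)
    exact coboundary_argJump_eq_zero (h.linForm_ne_zero _ ha) (h.linForm_ne_zero _ hb)
      (h.linForm_ne_zero _ hc) (hL a ha b hb (hab.mono hle1) fa fb)
      (hL b hb c hc (hbc.mono hle1) fb fc) (hL a ha c hc (hac.mono hle1) fa fc)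

/-- The fundamental class, and the relation between it and the tautological class. -/
theorem exists_fundamentalClass (h : ConeCover W U d) :
    ∃ Ω : (ℂ × ℂ) × ℂ → (ℂ × ℂ) × ℂ → (ℂ × ℂ) × ℂ → ℤ,
      (∀ p ∈ W, ∀ t₀ r N, IsSheet W t₀ r N → p ∈ N →
        pointClass (slope3 p) N - Ω ∈ lineCoboundaries W) ∧
      ∃ ε > 0, ∃ w : (ℂ × ℂ) × ℂ → (ℂ × ℂ) × ℂ → ℤ,
        (∀ a ∈ W, ∀ b ∈ W, ∀ c ∈ W, RelNear ε a b → RelNear ε b c → RelNear ε a c →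
          coboundary w a b c = d * Ω a b c) ∧
        ∀ q ∈ W, ∀ᶠ n in atTop, holonomy n w q = -1 := by
  obtain ⟨t₀, ht₀⟩ := h.exists_base
  obtain ⟨R, hR, hN⟩ := h.exists_sheets ht₀
  obtain ⟨N, hN, hmem, hcov, hdisj⟩ := hN R hR le_rfl
  have hfin : Finite {z // (((1 : ℂ), t₀), z) ∈ W} := h.finite_fiber ht₀
  have := Fintype.ofFinite {z // (((1 : ℂ), t₀), z) ∈ W}
  have hcard : Fintype.card {z // (((1 : ℂ), t₀), z) ∈ W} = d := by
    rw [← Nat.card_eq_fintype_card]; exact h.fiber _ ht₀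
  have : Nonempty {z // (((1 : ℂ), t₀), z) ∈ W} :=
    Fintype.card_pos_iff.1 (hcard ▸ h.pos)
  obtain ⟨ζ₀⟩ := this
  have hsl : ∀ ζ : {z // (((1 : ℂ), t₀), z) ∈ W}, slope3 (((1 : ℂ), t₀), ζ.1) = t₀ := fun ζ => by
    simp [slope3]
  refine ⟨pointClass t₀ (N ζ₀), ?_, ?_⟩
  · intro p hp t₁ r N' hN' hpN'
    have := h.pointClass_sub_mem hp ζ₀.2 _ _ _ _ _ _ hN' (hN ζ₀) hpN' (hmem ζ₀)
    rwa [hsl] at this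
  · have h1 := h.linForm_coboundary_mem hR hN hcov hdisj
    have h2 : ∑ ζ, (pointClass t₀ (N ζ) - pointClass t₀ (N ζ₀)) ∈ lineCoboundaries W := by
      refine sum_mem fun ζ _ => ?_
      have := h.pointClass_sub_mem ζ.2 ζ₀.2 _ _ _ _ _ _ (hN ζ) (hN ζ₀) (hmem ζ) (hmem ζ₀)
      rwa [hsl, hsl] at this
    have h3 := add_mem h1 h2
    rw [Finset.sum_sub_distrib, sub_add_sub_cancel, Finset.sum_const, Finset.card_univ, hcard] at h3
    obtain ⟨ε, hε, n, hn, heq⟩ := h3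
    refine ⟨ε, hε, argJump (linForm t₀) - n, ?_, ?_⟩
    · intro a ha b hb c hc hab hbc hac
      have := heq a ha b hb c hc hab hbc hac
      simp only [Pi.sub_apply, Pi.smul_apply] at this
      rw [nsmul_eq_mul] at this
      have e : coboundary (argJump (linForm t₀) - n) a b c =
        coboundary (argJump (linForm t₀)) a b c - coboundary n a b c := by
        simp only [coboundary, Pi.sub_apply]; ring
      rw [e, ← this]; ring
    · intro q hq
      filter_upwards [holonomy_argJump (fun r hr => linForm_smul t₀ hr q)
        (h.linForm_ne_zero t₀ hq)] with k hk
      have hz : holonomy k n q = 0 := by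
        rw [holonomy]
        refine Finset.sum_eq_zero fun j _ => ?_
        have : gonPoint k (j + 1) • q =
            (gonPoint k (j + 1) / gonPoint k j) • (gonPoint k j • q) := by
          rw [smul_smul, div_mul_cancel₀ _ (gonPoint_ne_zero _ _)]
        rw [this]
        exact hn _ (h.smul_mem q hq _ (gonPoint_ne_zero _ _)) _
          (div_ne_zero (gonPoint_ne_zero _ _) (gonPoint_ne_zero _ _))
      have : holonomy k (argJump (linForm t₀) - n) q =
          holonomy k (argJump (linForm t₀)) q - holonomy k n q := by
        simp [holonomy, Finset.sum_sub_distrib]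
      rw [this, hk, hz, sub_zero]

theorem dvd_of_torsionExponent (h : ConeCover W U d) {e : ℕ} (he : TorsionExponent W e) :
    d ∣ e := by
  obtain ⟨Ω, -, ε, hε, w, hw, hhol⟩ := h.exists_fundamentalClass
  have hd : (d : ℝ) ≠ 0 := by exact_mod_cast h.pos.ne'
  obtain ⟨ε', hε', n, hn⟩ := he ε hε (fun a b => w a b / d) (by
    intro a ha b hb c hc hab hbc hac
    have h1 := hw a ha b hb c hc hab hbc hac
    rw [← AddCircle.coe_add, ← sub_eq_zero, ← AddCircle.coe_sub]
    have h2 : (w a b / d + w b c / d - w a c / d : ℝ) = ((Ω a b c : ℤ) : ℝ) := by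
      have h3 : (w a b + w b c - w a c : ℝ) = d * Ω a b c := by
        have := congrArg (Int.cast : ℤ → ℝ) h1
        simpa [coboundary] using this
      field_simp
      linarith
    rw [h2]
    exact (AddCircle.coe_eq_zero_iff (1 : ℝ)).2 ⟨Ω a b c, by simp⟩)
  have hcint : IsCocycle W ε' (fun a b => (e : ℤ) * w a b - d * n a b) := by
    intro a ha b hb c hc hab hbc hac
    have := hn a ha b hb c hc hab hbc hac
    simp only at this
    have h4 : ((e * w a b - d * n a b + (e * w b c - d * n b c) : ℤ) : ℝ) =
        ((e * w a c - d * n a c : ℤ) : ℝ) := by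
      push_cast
      field_simp at this
      linarith
    exact_mod_cast h4
  obtain ⟨t, ht⟩ := h.exists_base
  have := h.finite_fiber ht
  have hne : Nonempty {z // (((1 : ℂ), t), z) ∈ W} := by
    apply (Nat.card_pos_iff.1 _).1
    rw [h.fiber _ ht]; exact h.pos
  obtain ⟨z, hz⟩ := hne
  obtain ⟨k, hk1, hk2⟩ := ((h.nsmul_holonomy hε' hcint).and (hhol _ hz)).exists
  have hk3 := hk1 _ hz
  have h0 : holonomy k (fun a b => (e : ℤ) * w a b - d * n a b) (((1 : ℂ), t), z) = 0 := by
    rcases smul_eq_zero.1 hk3 with h0 | h0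
    · exact absurd h0 h.pos.ne'
    · exact h0
  have h5 : holonomy k (fun a b => (e : ℤ) * w a b - d * n a b) (((1 : ℂ), t), z) =
      e * holonomy k w (((1 : ℂ), t), z) - d * holonomy k n (((1 : ℂ), t), z) := by
    simp [holonomy, Finset.sum_sub_distrib, Finset.mul_sum]
  rw [h5, hk2] at h0
  have : (d : ℤ) ∣ e := ⟨- holonomy k n (((1 : ℂ), t), z), by linarith⟩
  exact_mod_cast this

end ConeCover

section Grid

/-- The corners of a square grid. -/
noncomputable def gridCorner (c₀ : ℂ) (h : ℝ) (m n : ℤ) : ℂ := c₀ + h * (m + n * Complex.I)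

theorem gridCorner_re (c₀ : ℂ) (h : ℝ) (m n : ℤ) : (gridCorner c₀ h m n).re = c₀.re + h * m := by
  simp [gridCorner]

theorem gridCorner_im (c₀ : ℂ) (h : ℝ) (m n : ℤ) : (gridCorner c₀ h m n).im = c₀.im + h * n := by
  simp [gridCorner]

/-- The column of a point in a square grid. -/
noncomputable def gridCol (c₀ : ℂ) (h : ℝ) (t : ℂ) : ℤ := ⌊(t - c₀).re / h⌋

/-- The row of a point in a square grid. -/
noncomputable def gridRow (c₀ : ℂ) (h : ℝ) (t : ℂ) : ℤ := ⌊(t - c₀).im / h⌋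

/-- The square of a bounded grid containing a point; `none` outside the grid. -/
noncomputable def gridLabel (c₀ : ℂ) (h : ℝ) (L : ℤ) (t : ℂ) : Option (ℤ × ℤ) :=
  if (-L ≤ gridCol c₀ h t ∧ gridCol c₀ h t < L) ∧ (-L ≤ gridRow c₀ h t ∧ gridRow c₀ h t < L) then
    some (gridCol c₀ h t, gridRow c₀ h t) else none

variable {c₀ : ℂ} {h : ℝ} {L : ℤ} {t : ℂ}

theorem norm_sub_gridCorner_le (hh : 0 < h) :
    ‖t - gridCorner c₀ h (gridCol c₀ h t) (gridRow c₀ h t)‖ < 2 * h := by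
  refine (Complex.norm_le_abs_re_add_abs_im _).trans_lt ?_
  rw [Complex.sub_re, Complex.sub_im, gridCorner_re, gridCorner_im]
  have h1 := Int.floor_le ((t - c₀).re / h)
  have h2 := Int.lt_floor_add_one ((t - c₀).re / h)
  have h3 := Int.floor_le ((t - c₀).im / h)
  have h4 := Int.lt_floor_add_one ((t - c₀).im / h)
  rw [le_div_iff₀ hh, Complex.sub_re] at h1
  rw [le_div_iff₀ hh, Complex.sub_im] at h3
  rw [div_lt_iff₀ hh, Complex.sub_re] at h2
  rw [div_lt_iff₀ hh, Complex.sub_im] at h4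
  unfold gridCol gridRow
  rw [Complex.sub_re, Complex.sub_im]
  rw [abs_of_nonneg (by linarith), abs_of_nonneg (by linarith)]
  linarith

theorem le_norm_of_gridLabel_eq_none (hh : 0 < h) (ht : gridLabel c₀ h L t = none) :
    h * L ≤ ‖t - c₀‖ := by
  have h1 : L ≤ |(t - c₀).re / h| ∨ L ≤ |(t - c₀).im / h| := by
    by_contra hn
    push Not at hn
    rw [abs_lt, abs_lt] at hn
    rw [gridLabel, if_pos] at ht
    · simp at ht
    · unfold gridCol gridRow
      refine ⟨⟨?_, ?_⟩, ⟨?_, ?_⟩⟩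
      · rw [Int.le_floor]; push_cast; linarith [hn.1.1]
      · rw [Int.floor_lt]; exact hn.1.2
      · rw [Int.le_floor]; push_cast; linarith [hn.2.1]
      · rw [Int.floor_lt]; exact hn.2.2
  rcases h1 with h1 | h1 <;> rw [abs_div, abs_of_pos hh, le_div_iff₀ hh] at h1
  · rw [mul_comm]; exact h1.trans (Complex.abs_re_le_norm _)
  · rw [mul_comm]; exact h1.trans (Complex.abs_im_le_norm _)

theorem floor_near_corner {x : ℝ} {m : ℤ} (hx : |x - m| < 1) :
    ⌊x⌋ = if 0 ≤ x - m then m else m - 1 := by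
  rw [abs_lt] at hx
  split_ifs with h0
  · rw [Int.floor_eq_iff]; constructor <;> linarith
  · rw [Int.floor_eq_iff]; push_cast; constructor <;> linarith

/-- The quadrant of a complex number. -/
noncomputable def quadrant (s : ℂ) : Bool × Bool := (decide (0 ≤ s.re), decide (0 ≤ s.im))

theorem gridLabel_eq_of_quadrant_eq (hh : 0 < h) {m n : ℤ} {t' : ℂ}
    (ht : ‖t - gridCorner c₀ h m n‖ < h) (ht' : ‖t' - gridCorner c₀ h m n‖ < h)
    (hq : quadrant (t - gridCorner c₀ h m n) = quadrant (t' - gridCorner c₀ h m n)) :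
    gridLabel c₀ h L t = gridLabel c₀ h L t' := by
  have key : ∀ t : ℂ, ‖t - gridCorner c₀ h m n‖ < h →
      gridCol c₀ h t = (if 0 ≤ (t - gridCorner c₀ h m n).re then m else m - 1) ∧
      gridRow c₀ h t = (if 0 ≤ (t - gridCorner c₀ h m n).im then n else n - 1) := by
    intro t ht
    have e1 := (Complex.abs_re_le_norm _).trans_lt ht
    have e2 := (Complex.abs_im_le_norm _).trans_lt ht
    have k1 : (t - c₀).re / h - m = (t - gridCorner c₀ h m n).re / h := by
      rw [Complex.sub_re, Complex.sub_re, gridCorner_re]; field_simp; ring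
    have k2 : (t - c₀).im / h - n = (t - gridCorner c₀ h m n).im / h := by
      rw [Complex.sub_im, Complex.sub_im, gridCorner_im]; field_simp; ring
    constructor
    · rw [gridCol, floor_near_corner (m := m), k1]
      · simp only [le_div_iff₀ hh, zero_mul]
      · rw [k1, abs_div, abs_of_pos hh, div_lt_one hh]; exact e1
    · rw [gridRow, floor_near_corner (m := n), k2]
      · simp only [le_div_iff₀ hh, zero_mul]
      · rw [k2, abs_div, abs_of_pos hh, div_lt_one hh]; exact e2
  have e1 := key t ht
  have e2 := key t' ht'
  simp only [quadrant, Prod.mk.injEq, decide_eq_decide] at hq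
  have e3 : gridCol c₀ h t = gridCol c₀ h t' := by rw [e1.1, e2.1]; simp only [hq.1]
  have e4 : gridRow c₀ h t = gridRow c₀ h t' := by rw [e1.2, e2.2]; simp only [hq.2]
  rw [gridLabel, gridLabel, e3, e4]

theorem floor_three {x y z δ : ℝ} (hδ : δ ≤ 1) (hxy : |x - y| < δ) (hyz : |y - z| < δ)
    (hxz : |x - z| < δ) : (⌊x⌋ = ⌊y⌋ ∧ ⌊y⌋ = ⌊z⌋) ∨ ∃ m : ℤ, (|x - m| < δ ∧ |y - m| < δ ∧
        |z - m| < δ) ∧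
      (m - 1 ≤ ⌊x⌋ ∧ ⌊x⌋ ≤ m) ∧ (m - 1 ≤ ⌊y⌋ ∧ ⌊y⌋ ≤ m) ∧ (m - 1 ≤ ⌊z⌋ ∧ ⌊z⌋ ≤ m) := by
  rw [abs_lt] at hxy hyz hxz
  have key : ∀ u v w : ℝ, u ≤ v → v - u < δ → (w - v < δ ∧ v - w < δ) → (w - u < δ ∧ u - w < δ) →
      ⌊u⌋ ≠ ⌊v⌋ → ∃ m : ℤ, (|u - m| < δ ∧ |v - m| < δ ∧ |w - m| < δ) ∧
      (m - 1 ≤ ⌊u⌋ ∧ ⌊u⌋ ≤ m) ∧ (m - 1 ≤ ⌊v⌋ ∧ ⌊v⌋ ≤ m) ∧ (m - 1 ≤ ⌊w⌋ ∧ ⌊w⌋ ≤ m) := by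
    intro u v w huv h1 h2 h3 hne
    have h4 : ⌊u⌋ < ⌊v⌋ := lt_of_le_of_ne (Int.floor_mono huv) hne
    have h5 : u < ⌊v⌋ := Int.floor_lt.1 h4
    have h6 := Int.floor_le v
    refine ⟨⌊v⌋, ⟨?_, ?_, ?_⟩, ⟨?_, ?_⟩, ⟨?_, ?_⟩, ⟨?_, ?_⟩⟩
    · rw [abs_lt]; constructor <;> linarith
    · rw [abs_lt]; constructor <;> linarith
    · rw [abs_lt]; constructor <;> linarith
    · rw [Int.le_floor]; push_cast; linarith
    · exact h4.le
    · omega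
    · exact le_rfl
    · rw [Int.le_floor]; push_cast; linarith
    · rw [← Int.lt_add_one_iff, Int.floor_lt]; push_cast; linarith
  by_cases h1 : ⌊x⌋ = ⌊y⌋
  · by_cases h2 : ⌊y⌋ = ⌊z⌋
    · exact Or.inl ⟨h1, h2⟩
    · right
      rcases le_total y z with hle | hle
      · obtain ⟨m, ⟨a, b, c⟩, e, f, g⟩ := key y z x hle (by linarith) ⟨by linarith, by linarith⟩
          ⟨by linarith, by linarith⟩ h2
        exact ⟨m, ⟨c, a, b⟩, g, e, f⟩
      · obtain ⟨m, ⟨a, b, c⟩, e, f, g⟩ := key z y x hle (by linarith) ⟨by linarith, by linarith⟩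
          ⟨by linarith, by linarith⟩ (Ne.symm h2)
        exact ⟨m, ⟨c, b, a⟩, g, f, e⟩
  · right
    rcases le_total x y with hle | hle
    · obtain ⟨m, ⟨a, b, c⟩, e, f, g⟩ := key x y z hle (by linarith) ⟨by linarith, by linarith⟩
        ⟨by linarith, by linarith⟩ h1
      exact ⟨m, ⟨a, b, c⟩, e, f, g⟩
    · obtain ⟨m, ⟨a, b, c⟩, e, f, g⟩ := key y x z hle (by linarith) ⟨by linarith, by linarith⟩
        ⟨by linarith, by linarith⟩ (Ne.symm h1)
      exact ⟨m, ⟨b, a, c⟩, f, e, g⟩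

theorem grid_three (hh : 0 < h) {ρ : ℝ} (hρh : ρ ≤ h) {t₁ t₂ t₃ : ℂ} (h12 : ‖t₁ - t₂‖ < ρ)
    (h23 : ‖t₂ - t₃‖ < ρ) (h13 : ‖t₁ - t₃‖ < ρ) :
    (∃ m n : ℤ, (-L ≤ m ∧ m ≤ L) ∧ (-L ≤ n ∧ n ≤ L) ∧ ‖t₁ - gridCorner c₀ h m n‖ < 2 * ρ ∧
      ‖t₂ - gridCorner c₀ h m n‖ < 2 * ρ ∧ ‖t₃ - gridCorner c₀ h m n‖ < 2 * ρ) ∨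
    gridLabel c₀ h L t₁ = gridLabel c₀ h L t₂ ∨ gridLabel c₀ h L t₂ = gridLabel c₀ h L t₃ ∨
      gridLabel c₀ h L t₁ = gridLabel c₀ h L t₃ := by
  have hre : ∀ s t : ℂ, ‖s - t‖ < ρ → |(s - c₀).re / h - (t - c₀).re / h| < ρ / h := by
    intro s t hst
    rw [← sub_div, abs_div, abs_of_pos hh, ← Complex.sub_re, sub_sub_sub_cancel_right]
    gcongr; exact (Complex.abs_re_le_norm _).trans_lt hst
  have him : ∀ s t : ℂ, ‖s - t‖ < ρ → |(s - c₀).im / h - (t - c₀).im / h| < ρ / h := by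
    intro s t hst
    rw [← sub_div, abs_div, abs_of_pos hh, ← Complex.sub_im, sub_sub_sub_cancel_right]
    gcongr; exact (Complex.abs_im_le_norm _).trans_lt hst
  have hle : ρ / h ≤ 1 := (div_le_one hh).2 hρh
  have hnorm : ∀ (t : ℂ) (m n : ℤ), |(t - c₀).re / h - m| < ρ / h → |(t - c₀).im / h - n| < ρ / h →
      ‖t - gridCorner c₀ h m n‖ < 2 * ρ := by
    intro t m n h1 h2
    have k1 : (t - c₀).re / h - m = (t - gridCorner c₀ h m n).re / h := by
      rw [Complex.sub_re, Complex.sub_re, gridCorner_re]; field_simp; ring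
    have k2 : (t - c₀).im / h - n = (t - gridCorner c₀ h m n).im / h := by
      rw [Complex.sub_im, Complex.sub_im, gridCorner_im]; field_simp; ring
    rw [k1, abs_div, abs_of_pos hh, div_lt_div_iff_of_pos_right hh] at h1
    rw [k2, abs_div, abs_of_pos hh, div_lt_div_iff_of_pos_right hh] at h2
    refine (Complex.norm_le_abs_re_add_abs_im _).trans_lt ?_
    linarith
  have hlab : ∀ s t : ℂ, gridCol c₀ h s = gridCol c₀ h t → gridRow c₀ h s = gridRow c₀ h t →
      gridLabel c₀ h L s = gridLabel c₀ h L t := by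
    intro s t h1 h2; rw [gridLabel, gridLabel, h1, h2]
  have hnone : ∀ t : ℂ, ¬ ((-L ≤ gridCol c₀ h t ∧ gridCol c₀ h t < L) ∧
      (-L ≤ gridRow c₀ h t ∧ gridRow c₀ h t < L)) → gridLabel c₀ h L t = none :=
          fun t ht => if_neg ht
  rcases floor_three hle (hre _ _ h12) (hre _ _ h23) (hre _ _ h13) with hc | ⟨m, ⟨a1, a2, a3⟩,
      b1, b2, b3⟩ <;>
  rcases floor_three hle (him _ _ h12) (him _ _ h23) (him _ _ h13) with hr | ⟨n, ⟨d1, d2, d3⟩,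
      e1, e2, e3⟩
  · exact Or.inr (Or.inl (hlab _ _ hc.1 hr.1))
  · right
    have : ⌊(t₁ - c₀).im / h⌋ = ⌊(t₂ - c₀).im / h⌋ ∨ ⌊(t₂ - c₀).im / h⌋ = ⌊(t₃ - c₀).im / h⌋ ∨
      ⌊(t₁ - c₀).im / h⌋ = ⌊(t₃ - c₀).im / h⌋ := by omega
    rcases this with h1 | h1 | h1
    · exact Or.inl (hlab _ _ hc.1 h1)
    · exact Or.inr (Or.inl (hlab _ _ hc.2 h1))
    · exact Or.inr (Or.inr (hlab _ _ (hc.1.trans hc.2) h1))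
  · right
    have : ⌊(t₁ - c₀).re / h⌋ = ⌊(t₂ - c₀).re / h⌋ ∨ ⌊(t₂ - c₀).re / h⌋ = ⌊(t₃ - c₀).re / h⌋ ∨
      ⌊(t₁ - c₀).re / h⌋ = ⌊(t₃ - c₀).re / h⌋ := by omega
    rcases this with h1 | h1 | h1
    · exact Or.inl (hlab _ _ h1 hr.1)
    · exact Or.inr (Or.inl (hlab _ _ h1 hr.2))
    · exact Or.inr (Or.inr (hlab _ _ h1 (hr.1.trans hr.2)))
  · by_cases hin : (-L ≤ m ∧ m ≤ L) ∧ (-L ≤ n ∧ n ≤ L)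
    · exact Or.inl ⟨m, n, hin.1, hin.2, hnorm _ _ _ a1 d1, hnorm _ _ _ a2 d2, hnorm _ _ _ a3 d3⟩
    · right; left
      rw [hnone t₁, hnone t₂]
      · simp only [gridCol, gridRow]; omega
      · simp only [gridCol, gridRow]; omega

end Grid

theorem RelNear.norm_inv_smul_sub_le {E : Type*} [NormedAddCommGroup E] [NormedSpace ℂ E]
    {a b : E} {ε C : ℝ} (hab : RelNear ε a b) {l : E →ₗ[ℂ] ℂ} (hl : ∀ q, ‖l q‖ ≤ ‖q‖)
    (ha : ‖a‖ ≤ C * ‖l a‖) (hb : ‖b‖ ≤ C * ‖l b‖) (ha0 : l a ≠ 0) (hb0 : l b ≠ 0) :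
    ‖(l a)⁻¹ • a - (l b)⁻¹ • b‖ ≤ ε * C * (1 + C) := by
  have hA : 0 < ‖l a‖ := norm_pos_iff.2 ha0
  have hB : 0 < ‖l b‖ := norm_pos_iff.2 hb0
  have hε := hab.pos
  have hC : 0 ≤ C := by
    by_contra hn
    nlinarith [norm_nonneg a]
  have e : (l a)⁻¹ • a - (l b)⁻¹ • b = (l a)⁻¹ • (a - b) + ((l b - l a) / (l a * l b)) • b := by
    rw [smul_sub, sub_add_eq_add_sub, eq_comm, sub_eq_iff_eq_add, ← sub_eq_iff_eq_add']
    rw [← sub_eq_zero]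
    have : (l b - l a) / (l a * l b) = (l a)⁻¹ - (l b)⁻¹ := by field_simp
    rw [this, sub_smul]; abel
  have h1 : ‖a - b‖ ≤ ε * C * ‖l a‖ := by nlinarith [hab.1.le, mul_le_mul_of_nonneg_left ha hε.le]
  have h2 : ‖l b - l a‖ ≤ ε * C * ‖l a‖ := by
    rw [← map_sub]; refine (hl _).trans ?_; rwa [norm_sub_rev]
  rw [e]
  refine (norm_add_le _ _).trans ?_
  rw [norm_smul, norm_smul, norm_inv, norm_div, norm_mul]
  have h3 : ‖l a‖⁻¹ * ‖a - b‖ ≤ ε * C := by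
    rw [inv_mul_le_iff₀ hA]; linarith
  have h4 : ‖l b - l a‖ / (‖l a‖ * ‖l b‖) * ‖b‖ ≤ ε * C * C := by
    rw [div_mul_eq_mul_div, div_le_iff₀ (by positivity)]
    calc ‖l b - l a‖ * ‖b‖ ≤ (ε * C * ‖l a‖) * (C * ‖l b‖) := by gcongr
      _ = _ := by ring
  linarith

namespace ConeCover

variable {W : Set ((ℂ × ℂ) × ℂ)} {U : Set (ℂ × ℂ)} {d : ℕ}

/-- Choosing one point in each cluster of points with the same label. -/
theorem exists_tiles_of_labels (h : ConeCover W U d) {ι : Type*} (lab : (ℂ × ℂ) × ℂ → ι)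
    (l : ι → ((ℂ × ℂ) × ℂ →ₗ[ℂ] ℂ)) (σ : ι → ℝ) {σ₀ ε C : ℝ} (hσ₀ : 0 < σ₀)
    (hσ : ∀ q ∈ W, σ₀ ≤ σ (lab q) ∧ σ (lab q) ≤ ε)
    (hlab : ∀ q ∈ W, ∀ s : ℂ, s ≠ 0 → lab (s • q) = lab q)
    (hl : ∀ i q, ‖l i q‖ ≤ ‖q‖) (hC : ∀ q ∈ W, ‖q‖ ≤ C * ‖l (lab q) q‖)
    (hbase : ∀ q ∈ W, ∀ q' ∈ W, lab q = lab q' →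
      ‖(l (lab q) q)⁻¹ • q.1 - (l (lab q) q')⁻¹ • q'.1‖ < ε)
    (hcl : ∀ q ∈ W, ∀ q' ∈ W, lab q = lab q' →
      ‖(l (lab q) q)⁻¹ • q.2 - (l (lab q) q')⁻¹ • q'.2‖ < σ (lab q) ∨
      3 * σ (lab q) < ‖(l (lab q) q)⁻¹ • q.2 - (l (lab q) q')⁻¹ • q'.2‖) :
    ∃ τ : (ℂ × ℂ) × ℂ → (ℂ × ℂ) × ℂ, (∀ q ∈ W, ∀ s : ℂ, s ≠ 0 → τ (s • q) = τ q) ∧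
      (∀ q ∈ W, τ q ∈ W ∧ ∃ s : ℂ, s ≠ 0 ∧ RelNear ε q (s • τ q)) ∧
      ∃ ε' > 0, ∀ q ∈ W, ∀ q' ∈ W, RelNear ε' q q' → lab q = lab q' → τ q = τ q' := by
  classical
  have hne : ∀ q ∈ W, ∀ q' ∈ W, lab q = lab q' → l (lab q) q' ≠ 0 := by
    intro q hq q' hq' hqq h0
    have := hC q' hq'
    rw [← hqq, h0, norm_zero, mul_zero] at this
    exact h.zero_notMem (norm_le_zero_iff.1 this ▸ hq')
  let R : (ℂ × ℂ) × ℂ → (ℂ × ℂ) × ℂ → Prop := fun p q => p ∈ W ∧ lab p = lab q ∧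
    ‖(l (lab q) p)⁻¹ • p.2 - (l (lab q) q)⁻¹ • q.2‖ < σ (lab q)
  have hrefl : ∀ q ∈ W, R q q := by
    intro q hq
    refine ⟨hq, rfl, ?_⟩
    rw [sub_self, norm_zero]; linarith [(hσ q hq).1]
  have htrans : ∀ p q, q ∈ W → ∀ r ∈ W, R p q → lab q = lab r →
      ‖(l (lab q) q)⁻¹ • q.2 - (l (lab q) r)⁻¹ • r.2‖ < 2 * σ (lab q) → R p r := by
    rintro p q hq r hr ⟨hp, h1, h2⟩ h3 h4
    refine ⟨hp, h1.trans h3, ?_⟩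
    rcases hcl p hp r hr (h1.trans h3) with h5 | h5
    · rw [h1, h3] at h5; exact h5
    · exfalso
      rw [h1] at h5
      have := norm_sub_le_norm_sub_add_norm_sub ((l (lab q) p)⁻¹ • p.2) ((l (lab q) q)⁻¹ • q.2)
        ((l (lab q) r)⁻¹ • r.2)
      linarith
  have heq : ∀ q ∈ W, ∀ r ∈ W, lab q = lab r →
      ‖(l (lab q) q)⁻¹ • q.2 - (l (lab q) r)⁻¹ • r.2‖ < 2 * σ (lab q) → ∀ p, R p q = R p r := by
    intro q hq r hr h1 h2 p
    refine propext ⟨fun h3 => htrans p q hq r hr h3 h1 h2, fun h3 => ?_⟩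
    refine htrans p r hr q hq h3 h1.symm ?_
    rw [norm_sub_rev, ← h1]; exact h2
  let τ : (ℂ × ℂ) × ℂ → (ℂ × ℂ) × ℂ := fun q => Classical.epsilon fun p => R p q
  have hτeq : ∀ q ∈ W, ∀ r ∈ W, lab q = lab r →
      ‖(l (lab q) q)⁻¹ • q.2 - (l (lab q) r)⁻¹ • r.2‖ < 2 * σ (lab q) → τ q = τ r := by
    intro q hq r hr h1 h2
    simp only [τ, heq q hq r hr h1 h2]
  have hτ : ∀ q ∈ W, R (τ q) q := fun q hq => Classical.epsilon_spec (p := fun p => R p q)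
    ⟨q, hrefl q hq⟩
  have hpos : ∀ q ∈ W, 0 < σ (lab q) := fun q hq => hσ₀.trans_le (hσ q hq).1
  refine ⟨τ, ?_, ?_, ?_⟩
  · intro q hq s hs
    refine hτeq _ (h.smul_mem q hq s hs) q hq (hlab q hq s hs) ?_
    have e : (l (lab (s • q)) (s • q))⁻¹ • (s • q).2 = (l (lab (s • q)) q)⁻¹ • q.2 := by
      rw [map_smul, Prod.smul_snd]
      simp only [smul_eq_mul]
      rw [mul_inv, ← mul_assoc, mul_right_comm s⁻¹, inv_mul_cancel₀ hs, one_mul]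
    rw [e, sub_self, norm_zero, hlab q hq s hs]
    linarith [hpos q hq]
  · intro q hq
    obtain ⟨h1, h2, h3⟩ := hτ q hq
    have hq0 := hne q hq q hq rfl
    have ht0 := hne q hq _ h1 h2.symm
    refine ⟨h1, l (lab q) q * (l (lab q) (τ q))⁻¹, mul_ne_zero hq0 (inv_ne_zero ht0), ?_⟩
    have key : RelNear ε ((l (lab q) q)⁻¹ • q) ((l (lab q) (τ q))⁻¹ • τ q) := by
      have hn : ∀ p, l (lab q) p ≠ 0 → 1 ≤ ‖(l (lab q) p)⁻¹ • p‖ := by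
        intro p hp
        rw [norm_smul, norm_inv, le_inv_mul_iff₀ (norm_pos_iff.2 hp), mul_one]
        exact hl _ _
      have hε : 0 < ε := (hpos q hq).trans_le (hσ q hq).2
      have hd : ‖(l (lab q) q)⁻¹ • q - (l (lab q) (τ q))⁻¹ • τ q‖ < ε := by
        rw [Prod.norm_def]
        refine max_lt (hbase q hq _ h1 h2.symm) ?_
        rw [norm_sub_rev] at h3
        exact lt_of_lt_of_le h3 (hσ q hq).2
      exact ⟨hd.trans_le (le_mul_of_one_le_right hε.le (hn _ hq0)),
        hd.trans_le (le_mul_of_one_le_right hε.le (hn _ ht0))⟩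
    have := key.smul hq0
    rwa [smul_inv_smul₀ hq0, smul_smul] at this
  · have hC0 : (0 : ℝ) < |C| + 1 := by positivity
    refine ⟨σ₀ / ((|C| + 1) * (1 + (|C| + 1))), by positivity, fun q hq q' hq' hqq hl' => ?_⟩
    refine hτeq q hq q' hq' hl' ?_
    have hC' : ∀ q ∈ W, ‖q‖ ≤ (|C| + 1) * ‖l (lab q) q‖ := fun q hq => (hC q hq).trans (by
      gcongr; linarith [le_abs_self C])
    have h1 := hqq.norm_inv_smul_sub_le (hl (lab q)) (hC' q hq) (by rw [hl']; exact hC' q' hq')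
      (hne q hq q hq rfl) (hne q hq q' hq' hl')
    rw [mul_assoc, div_mul_cancel₀ _ (by positivity)] at h1
    have h2 := (norm_snd_le _).trans h1
    have : (((l (lab q)) q)⁻¹ • q - ((l (lab q)) q')⁻¹ • q').2 =
      (l (lab q) q)⁻¹ • q.2 - (l (lab q) q')⁻¹ • q'.2 := rfl
    rw [this] at h2
    linarith [(hσ q hq).1]

theorem exists_tiling (h : ConeCover W U d) {ε : ℝ} (hε : 0 < ε) :
    ∃ τ : (ℂ × ℂ) × ℂ → (ℂ × ℂ) × ℂ, ∃ F : Finset ℂ, (∀ v ∈ F, ((1 : ℂ), v) ∈ U) ∧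
      (∀ q ∈ W, ∀ s : ℂ, s ≠ 0 → τ (s • q) = τ q) ∧
      (∀ q ∈ W, τ q ∈ W ∧ ∃ s : ℂ, s ≠ 0 ∧ RelNear ε q (s • τ q)) ∧
      (∀ v ∈ F, ∃ R > 0, ∃ ε' > 0, ∀ q ∈ W, ∀ q' ∈ W, ‖slope3 q - v‖ < R → ‖slope3 q' - v‖ < R →
        quadrant (slope3 q - v) = quadrant (slope3 q' - v) → RelNear ε' q q' → τ q = τ q') ∧
      (∀ ρ > 0, ∃ ε' > 0, ∀ a ∈ W, ∀ b ∈ W, ∀ c ∈ W, RelNear ε' a b → RelNear ε' b c →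
        RelNear ε' a c → (∃ v ∈ F, ‖slope3 a - v‖ < ρ ∧ ‖slope3 b - v‖ < ρ ∧ ‖slope3 c - v‖ < ρ) ∨
        τ a = τ b ∨ τ b = τ c ∨ τ a = τ c) := by
  classical
  obtain ⟨σi, hσi, hσiε, ri, hri, hcli⟩ := h.cluster (0, 1) (by simp) ε hε
  obtain ⟨M₀, hM1, hMr, hMε⟩ : ∃ M₀ : ℝ, 1 ≤ M₀ ∧ 1 / M₀ < ri ∧ 2 / M₀ < ε := by
    refine ⟨max 1 (max (1 / ri + 1) (2 / ε + 1)), le_max_left _ _, ?_, ?_⟩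
    · rw [div_lt_comm₀ (by positivity) hri]
      exact lt_of_lt_of_le (lt_add_one _) ((le_max_left _ _).trans (le_max_right _ _))
    · rw [div_lt_comm₀ (by positivity) hε]
      exact lt_of_lt_of_le (lt_add_one _) ((le_max_right _ _).trans (le_max_right _ _))
  choose σc hσc hσcε rc hrc hclc using fun t : ℂ => h.cluster (1, t) (by simp) ε hε
  obtain ⟨δ, hδ, hleb⟩ := lebesgue_number_lemma_of_metric
    (isCompact_closedBall (0 : ℂ) (2 * M₀ + 5)) (c := fun t : ℂ => Metric.ball t (rc t))
    (fun t => Metric.isOpen_ball) (fun t _ => Set.mem_iUnion.2 ⟨t, Metric.mem_ball_self (hrc t)⟩)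
  obtain ⟨g, hg, hg1, hgδ, hgε⟩ : ∃ g : ℝ, 0 < g ∧ g ≤ 1 ∧ 2 * g < δ ∧ 4 * g < ε := by
    refine ⟨min 1 (min (δ / 3) (ε / 5)), by positivity, min_le_left _ _, ?_, ?_⟩
    · have := (min_le_right 1 (min (δ / 3) (ε / 5))).trans (min_le_left _ _); linarith
    · have := (min_le_right 1 (min (δ / 3) (ε / 5))).trans (min_le_right _ _); linarith
  obtain ⟨c₀, hc₀, hcorner⟩ : ∃ c₀ : ℂ, ‖c₀‖ < 1 ∧ ∀ m n : ℤ,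
      ((1 : ℂ), gridCorner c₀ g m n) ∈ U := by
    have hcount : (⋃ p : ℤ × ℤ, (fun t : ℂ => t - g * (p.1 + p.2 * Complex.I)) ''
        {t : ℂ | ((1 : ℂ), t) ∉ U}).Countable :=
      Set.countable_iUnion fun p => (h.finite.image _).countable
    obtain ⟨c, hc, hcb⟩ := (hcount.dense_compl ℝ).exists_dist_lt (0 : ℂ) one_pos
    refine ⟨c, by rwa [dist_zero_left] at hcb, fun m n => ?_⟩
    by_contra hn
    refine hc (Set.mem_iUnion.2 ⟨(m, n), gridCorner c g m n, hn, ?_⟩)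
    simp [gridCorner]
  set L : ℤ := ⌈(M₀ + 1) / g⌉ with hL
  have hL1 : M₀ + 1 ≤ g * L := by
    have := Int.le_ceil ((M₀ + 1) / g); rwa [div_le_iff₀ hg, mul_comm] at this
  have hL2 : g * L ≤ M₀ + 2 := by
    have := (Int.ceil_lt_add_one ((M₀ + 1) / g)).le
    rw [← hL] at this
    have := mul_le_mul_of_nonneg_left this hg.le
    rw [mul_add, mul_div_cancel₀ _ hg.ne'] at this
    linarith
  have hcb : ∀ m n : ℤ, (-L ≤ m ∧ m ≤ L) → (-L ≤ n ∧ n ≤ L) →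
      ‖gridCorner c₀ g m n‖ ≤ 2 * M₀ + 5 := by
    intro m n hm hn
    have hm' : |(m : ℝ)| ≤ L := abs_le.2 ⟨by exact_mod_cast hm.1, by exact_mod_cast hm.2⟩
    have hn' : |(n : ℝ)| ≤ L := abs_le.2 ⟨by exact_mod_cast hn.1, by exact_mod_cast hn.2⟩
    have e1 : ‖(m + n * Complex.I : ℂ)‖ ≤ 2 * L := by
      refine (norm_add_le _ _).trans ?_
      simp only [norm_mul, Complex.norm_I, mul_one, Complex.norm_intCast]
      linarith
    rw [gridCorner]
    refine (norm_add_le _ _).trans ?_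
    rw [norm_mul, Complex.norm_real, Real.norm_of_nonneg hg.le]
    nlinarith
  let lab : (ℂ × ℂ) × ℂ → Option (ℤ × ℤ) := fun q => gridLabel c₀ g L (slope3 q)
  have hsome : ∀ q i, lab q = some i → (-L ≤ i.1 ∧ i.1 ≤ L) ∧ (-L ≤ i.2 ∧ i.2 ≤ L) ∧
      ‖slope3 q - gridCorner c₀ g i.1 i.2‖ < 2 * g := by
    intro q i hq
    simp only [lab, gridLabel] at hq
    split_ifs at hq with hc
    obtain rfl := Option.some.inj hq
    exact ⟨⟨hc.1.1, hc.1.2.le⟩, ⟨hc.2.1, hc.2.2.le⟩, norm_sub_gridCorner_le hg⟩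
  have hslope : ∀ q i, lab q = some i → ‖slope3 q‖ ≤ 2 * M₀ + 7 := by
    intro q i hq
    obtain ⟨h1, h2, h3⟩ := hsome q i hq
    have := hcb _ _ h1 h2
    have h4 := norm_sub_norm_le (slope3 q) (gridCorner c₀ g i.1 i.2)
    linarith
  have hnone : ∀ q, lab q = none → M₀ ≤ ‖slope3 q‖ := by
    intro q hq
    have h1 := le_norm_of_gridLabel_eq_none hg hq
    have h2 := norm_sub_le (slope3 q) c₀
    linarith
  have hctr : ∀ i : ℤ × ℤ, ∃ t : ℂ, (-L ≤ i.1 ∧ i.1 ≤ L) → (-L ≤ i.2 ∧ i.2 ≤ L) →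
      Metric.ball (gridCorner c₀ g i.1 i.2) δ ⊆ Metric.ball t (rc t) := by
    intro i
    by_cases hi : (-L ≤ i.1 ∧ i.1 ≤ L) ∧ (-L ≤ i.2 ∧ i.2 ≤ L)
    · obtain ⟨t, ht⟩ := hleb (gridCorner c₀ g i.1 i.2)
        (by rw [mem_closedBall_zero_iff]; exact hcb _ _ hi.1 hi.2)
      exact ⟨t, fun _ _ => ht⟩
    · exact ⟨0, fun h1 h2 => absurd ⟨h1, h2⟩ hi⟩
  choose ctr hctr using hctr
  let lx : (ℂ × ℂ) × ℂ →ₗ[ℂ] ℂ := LinearMap.fst ℂ ℂ ℂ ∘ₗ LinearMap.fst ℂ (ℂ × ℂ) ℂ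
  let ly : (ℂ × ℂ) × ℂ →ₗ[ℂ] ℂ := LinearMap.snd ℂ ℂ ℂ ∘ₗ LinearMap.fst ℂ (ℂ × ℂ) ℂ
  let l : Option (ℤ × ℤ) → ((ℂ × ℂ) × ℂ →ₗ[ℂ] ℂ) := fun i => i.elim ly fun _ => lx
  let σ : Option (ℤ × ℤ) → ℝ := fun i => i.elim σi fun i => σc (ctr i)
  have hσpos : ∀ i, 0 < σ i := by
    rintro (_ | i)
    · exact hσi
    · exact hσc _
  let S : Finset (Option (ℤ × ℤ)) :=
    insert none ((Finset.Icc (-L) L ×ˢ Finset.Icc (-L) L).image some)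
  have hS : ∀ q, lab q ∈ S := by
    intro q
    rcases hq : lab q with _ | i
    · exact Finset.mem_insert_self _ _
    · obtain ⟨h1, h2, -⟩ := hsome q i hq
      refine Finset.mem_insert_of_mem (Finset.mem_image_of_mem _ ?_)
      rw [Finset.mem_product, Finset.mem_Icc, Finset.mem_Icc]
      exact ⟨h1, h2⟩
  obtain ⟨i₀, hi₀, hmin⟩ := S.exists_min_image σ ⟨none, Finset.mem_insert_self _ _⟩
  obtain ⟨K, hK⟩ := h.bound
  have hx : ∀ q ∈ W, q.1.1⁻¹ • q.1 = (1, slope3 q) := by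
    intro q hq
    ext
    · simp [h.fst_fst_ne hq]
    · simp [slope3]; ring
  have hyne : ∀ q ∈ W, lab q = none → q.1.2 ≠ 0 := by
    intro q hq hl h0
    have := hnone q hl
    rw [slope3, h0, zero_div, norm_zero] at this
    linarith
  have hy : ∀ q ∈ W, lab q = none → q.1.2⁻¹ • q.1 = ((slope3 q)⁻¹, 1) := by
    intro q hq hl
    ext
    · simp [slope3]; ring
    · simp [hyne q hq hl]
  obtain ⟨τ, hτ1, hτ2, ε₀, hε₀, hτ3⟩ := h.exists_tiles_of_labels lab l σ
    (C := (|K| + 1) * (2 * M₀ + 7)) (ε := ε) (hσpos i₀)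
    (fun q hq => ⟨hmin _ (hS q), by
      rcases lab q with _ | i
      · exact hσiε.le
      · exact (hσcε _).le⟩)
    (fun q hq s hs => by simp only [lab, slope3_smul hs])
    (by
      rintro (_ | i) q
      · exact (norm_snd_le q.1).trans (norm_fst_le q)
      · exact (norm_fst_le q.1).trans (norm_fst_le q))
    (by
      intro q hq
      have e1 : ‖q.1‖ ≤ (2 * M₀ + 7) * ‖l (lab q) q‖ := by
        rcases hl : lab q with _ | i
        · change ‖q.1‖ ≤ (2 * M₀ + 7) * ‖q.1.2‖
          have h1 := hnone q hl
          have hx0 : 0 < ‖q.1.1‖ := norm_pos_iff.2 (h.fst_fst_ne hq)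
          rw [slope3, norm_div, le_div_iff₀ hx0] at h1
          rw [Prod.norm_def]
          refine max_le ?_ ?_ <;> nlinarith [norm_nonneg q.1.2]
        · change ‖q.1‖ ≤ (2 * M₀ + 7) * ‖q.1.1‖
          have h1 := hslope q i hl
          have hx0 : 0 < ‖q.1.1‖ := norm_pos_iff.2 (h.fst_fst_ne hq)
          rw [slope3, norm_div, div_le_iff₀ hx0] at h1
          rw [Prod.norm_def]
          refine max_le ?_ h1
          nlinarith
      have e2 : ‖q.2‖ ≤ |K| * ‖q.1‖ := (hK q hq).trans (by gcongr; exact le_abs_self K)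
      have e3 : ‖q‖ ≤ (|K| + 1) * ‖q.1‖ := by
        rw [Prod.norm_def]
        refine max_le ?_ ?_ <;> nlinarith [norm_nonneg q.1, abs_nonneg K]
      refine e3.trans ?_
      rw [mul_assoc]
      gcongr)
    (by
      intro q hq q' hq' hqq
      rcases hl : lab q with _ | i
      · change ‖q.1.2⁻¹ • q.1 - q'.1.2⁻¹ • q'.1‖ < ε
        rw [hy q hq hl, hy q' hq' (hqq ▸ hl), Prod.mk_sub_mk, sub_self, Prod.norm_def]
        simp only [norm_zero]
        have hM : (0 : ℝ) < M₀ := by linarith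
        have h1 : ‖(slope3 q)⁻¹‖ ≤ 1 / M₀ := by
          rw [norm_inv, one_div]; exact inv_anti₀ hM (hnone q hl)
        have h2 : ‖(slope3 q')⁻¹‖ ≤ 1 / M₀ := by
          rw [norm_inv, one_div]; exact inv_anti₀ hM (hnone q' (hqq ▸ hl))
        refine max_lt ((norm_sub_le _ _).trans_lt ?_) hε
        have : 2 / M₀ = 1 / M₀ + 1 / M₀ := by ring
        linarith
      · change ‖q.1.1⁻¹ • q.1 - q'.1.1⁻¹ • q'.1‖ < ε
        rw [hx q hq, hx q' hq', Prod.mk_sub_mk, sub_self, Prod.norm_def]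
        simp only [norm_zero]
        refine max_lt hε ?_
        have h1 := (hsome q i hl).2.2
        have h2 := (hsome q' i (hqq ▸ hl)).2.2
        rw [norm_sub_rev] at h2
        have := norm_sub_le_norm_sub_add_norm_sub (slope3 q) (gridCorner c₀ g i.1 i.2) (slope3 q')
        linarith)
    (by
      intro q hq q' hq' hqq
      rcases hl : lab q with _ | i
      · have hM : (0 : ℝ) < M₀ := by linarith
        have key : ∀ p ∈ W, lab p = none → p.1.2⁻¹ • p ∈ W ∧ dist (p.1.2⁻¹ • p).1 (0, 1) < ri := by
          intro p hp hlp
          refine ⟨h.smul_mem p hp _ (inv_ne_zero (hyne p hp hlp)), ?_⟩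
          rw [Prod.smul_fst, hy p hp hlp, Prod.dist_eq, dist_self]
          refine max_lt ?_ hri
          rw [dist_zero_right, norm_inv]
          refine lt_of_le_of_lt ?_ hMr
          rw [one_div]; exact inv_anti₀ hM (hnone p hlp)
        have k1 := key q hq hl
        have k2 := key q' hq' (hqq ▸ hl)
        have := hcli _ k1.1 _ k2.1 k1.2 k2.2
        rwa [dist_eq_norm] at this
      · have key : ∀ p ∈ W, lab p = some i →
            p.1.1⁻¹ • p ∈ W ∧ dist (p.1.1⁻¹ • p).1 (1, ctr i) < rc (ctr i) := by
          intro p hp hlp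
          refine ⟨h.smul_mem p hp _ (inv_ne_zero (h.fst_fst_ne hp)), ?_⟩
          rw [Prod.smul_fst, hx p hp, Prod.dist_eq, dist_self]
          refine max_lt (hrc _) ?_
          obtain ⟨h1, h2, h3⟩ := hsome p i hlp
          have := hctr i h1 h2 (show slope3 p ∈ Metric.ball _ δ from by
            rw [Metric.mem_ball, dist_eq_norm]; linarith)
          exact this
        have k1 := key q hq hl
        have k2 := key q' hq' (hqq ▸ hl)
        have := hclc _ _ k1.1 _ k2.1 k1.2 k2.2
        rwa [dist_eq_norm] at this)
  refine ⟨τ, (Finset.Icc (-L) L ×ˢ Finset.Icc (-L) L).image fun i => gridCorner c₀ g i.1 i.2,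
    ?_, hτ1, hτ2, ?_, ?_⟩
  · intro v hv
    obtain ⟨i, -, rfl⟩ := Finset.mem_image.1 hv
    exact hcorner _ _
  · intro v hv
    obtain ⟨i, -, rfl⟩ := Finset.mem_image.1 hv
    refine ⟨g, hg, ε₀, hε₀, fun q hq q' hq' h1 h2 h3 h4 => hτ3 q hq q' hq' h4 ?_⟩
    exact gridLabel_eq_of_quadrant_eq hg h1 h2 h3
  · intro ρ hρ
    obtain ⟨ε₁, hε₁, hs⟩ := h.exists_near_slope (2 * M₀ + 8 + 1) (θ := min (min (ρ / 2) g) 1)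
      (by positivity)
    refine ⟨min ε₀ ε₁, by positivity, fun a ha b hb c hc hab hbc hac => ?_⟩
    have hτab := hτ3 a ha b hb (hab.mono (min_le_left _ _))
    by_cases hM : ‖slope3 a‖ ≤ 2 * M₀ + 8
    · have h1 := (hs a ha b hb (hab.mono (min_le_right _ _)) (by linarith)).1
      have h2 := (hs a ha c hc (hac.mono (min_le_right _ _)) (by linarith)).1
      have hb' : ‖slope3 b‖ ≤ 2 * M₀ + 8 + 1 := by
        have := norm_sub_norm_le (slope3 b) (slope3 a)
        have := h1.trans_le (min_le_right _ _)
        linarith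
      have h3 := (hs b hb c hc (hbc.mono (min_le_right _ _)) hb').1
      rw [norm_sub_rev] at h1 h2 h3
      rcases grid_three (c₀ := c₀) (L := L) hg (min_le_right (ρ / 2) g)
        (h1.trans_le (min_le_left _ _)) (h3.trans_le (min_le_left _ _))
        (h2.trans_le (min_le_left _ _)) with ⟨m, n, hm, hn, k1, k2, k3⟩ | k | k | k
      · left
        have : 2 * min (ρ / 2) g ≤ ρ := by linarith [min_le_left (ρ / 2) g]
        refine ⟨gridCorner c₀ g m n, Finset.mem_image.2 ⟨(m, n), ?_, rfl⟩, by linarith, by linarith,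
          by linarith⟩
        rw [Finset.mem_product, Finset.mem_Icc, Finset.mem_Icc]
        exact ⟨hm, hn⟩
      · exact Or.inr (Or.inl (hτab k))
      · exact Or.inr (Or.inr (Or.inl (hτ3 b hb c hc (hbc.mono (min_le_left _ _)) k)))
      · exact Or.inr (Or.inr (Or.inr (hτ3 a ha c hc (hac.mono (min_le_left _ _)) k)))
    · have hla : lab a = none := by
        rcases hl : lab a with _ | i
        · rfl
        · linarith [hslope a i hl]
      have hlb : lab b = none := by
        rcases hl : lab b with _ | i
        · rfl
        · have h1 := (hs b hb a ha (hab.symm.mono (min_le_right _ _))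
            (by linarith [hslope b i hl])).1.trans_le (min_le_right _ _)
          have := norm_sub_norm_le (slope3 a) (slope3 b)
          linarith [hslope b i hl]
      exact Or.inr (Or.inl (hτab (hla.trans hlb.symm)))

end ConeCover

theorem quadrant_jump {s s' : ℂ} {J : ℤ}
    (hJ : 2 * Real.pi * J = Complex.arg s' - Complex.arg s - Complex.arg (s' / s))
    (h : |Complex.arg (s' / s)| < Real.pi / 6) :
    (quadrant s = quadrant s' ∧ J = 0) ∨
    (quadrant s = (true, true) ∧ quadrant s' ≠ (false, false) ∧ J = 0) ∨
    (quadrant s' = (true, true) ∧ quadrant s ≠ (false, false) ∧ J = 0) ∨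
    (quadrant s = (false, false) ∧ quadrant s' = (true, false) ∧ J = 0) ∨
    (quadrant s = (true, false) ∧ quadrant s' = (false, false) ∧ J = 0) ∨
    (quadrant s = (false, true) ∧ quadrant s' = (false, false) ∧ J = -1) ∨
    (quadrant s = (false, false) ∧ quadrant s' = (false, true) ∧ J = 1) := by
  have hpi := Real.pi_pos
  have key : ∀ s : ℂ,
      (quadrant s = (true, true) ∧ 0 ≤ s.arg ∧ s.arg ≤ Real.pi / 2) ∨
      (quadrant s = (false, true) ∧ Real.pi / 2 < s.arg ∧ s.arg ≤ Real.pi) ∨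
      (quadrant s = (false, false) ∧ -Real.pi < s.arg ∧ s.arg < -(Real.pi / 2)) ∨
      (quadrant s = (true, false) ∧ -(Real.pi / 2) ≤ s.arg ∧ s.arg < 0) := by
    intro s
    have h1 := Complex.neg_pi_lt_arg s
    have h2 := Complex.arg_le_pi s
    have h3 := Complex.arg_nonneg_iff (z := s)
    have h4 := Complex.abs_arg_le_pi_div_two_iff (z := s)
    unfold quadrant
    by_cases hr : 0 ≤ s.re <;> by_cases hi : 0 ≤ s.im
    · have := abs_le.1 (h4.2 hr)
      left; simp only [hr, hi, decide_true, true_and]; exact ⟨h3.2 hi, this.2⟩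
    · have := abs_le.1 (h4.2 hr)
      right; right; right
      simp only [hr, hi, decide_true, decide_false, true_and]
      exact ⟨this.1, not_le.1 fun hn => hi (h3.1 hn)⟩
    · have h5 : Real.pi / 2 < |s.arg| := not_le.1 fun hn => hr (h4.1 hn)
      rw [abs_of_nonneg (h3.2 hi)] at h5
      right; left
      simp only [hr, hi, decide_true, decide_false, true_and]
      exact ⟨h5, h2⟩
    · have h5 : Real.pi / 2 < |s.arg| := not_le.1 fun hn => hr (h4.1 hn)
      have h6 : s.arg < 0 := not_le.1 fun hn => hi (h3.1 hn)
      rw [abs_of_neg h6] at h5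
      right; right; left
      simp only [hr, hi, decide_false, true_and]
      exact ⟨h1, by linarith⟩
  have hJ0 : ∀ k : ℤ, |2 * Real.pi * J - 2 * Real.pi * k| < 2 * Real.pi → J = k := by
    intro k hk
    have : J - k = 0 := by
      apply int_eq_zero_of_two_pi_mul_lt
      push_cast
      rwa [mul_sub]
    omega
  rw [abs_lt] at h
  rcases key s with ⟨e, h1, h2⟩ | ⟨e, h1, h2⟩ | ⟨e, h1, h2⟩ | ⟨e, h1, h2⟩ <;>
    rcases key s' with ⟨e', h1', h2'⟩ | ⟨e', h1', h2'⟩ | ⟨e', h1', h2'⟩ | ⟨e', h1', h2'⟩ <;>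
    simp only [e, e', Prod.mk.injEq, Bool.true_eq_false, Bool.false_eq_true, and_true, and_false,
      and_self, false_and, true_and, ne_eq, not_false_eq_true, not_true_eq_false, false_or,
      or_false, or_self]
  · exact hJ0 0 (by push_cast; rw [abs_lt]; constructor <;> linarith)
  · exact hJ0 0 (by push_cast; rw [abs_lt]; constructor <;> linarith)
  · have : J = 0 := hJ0 0 (by push_cast; rw [abs_lt]; constructor <;> linarith)
    rw [this] at hJ; push_cast at hJ; linarith
  · exact hJ0 0 (by push_cast; rw [abs_lt]; constructor <;> linarith)
  · exact hJ0 0 (by push_cast; rw [abs_lt]; constructor <;> linarith)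
  · exact hJ0 0 (by push_cast; rw [abs_lt]; constructor <;> linarith)
  · exact hJ0 (-1) (by push_cast; rw [abs_lt]; constructor <;> linarith)
  · have : J = 0 := hJ0 0 (by push_cast; rw [abs_lt]; constructor <;> linarith)
    rw [this] at hJ; push_cast at hJ; linarith
  · have : J = 0 := hJ0 0 (by push_cast; rw [abs_lt]; constructor <;> linarith)
    rw [this] at hJ; push_cast at hJ; linarith
  · exact hJ0 1 (by push_cast; rw [abs_lt]; constructor <;> linarith)
  · exact hJ0 0 (by push_cast; rw [abs_lt]; constructor <;> linarith)
  · exact hJ0 0 (by push_cast; rw [abs_lt]; constructor <;> linarith)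
  · exact hJ0 0 (by push_cast; rw [abs_lt]; constructor <;> linarith)
  · have : J = 0 := hJ0 0 (by push_cast; rw [abs_lt]; constructor <;> linarith)
    rw [this] at hJ; push_cast at hJ; linarith
  · exact hJ0 0 (by push_cast; rw [abs_lt]; constructor <;> linarith)
  · exact hJ0 0 (by push_cast; rw [abs_lt]; constructor <;> linarith)

theorem quadrant_slopeDiff (v : ℂ) (q : (ℂ × ℂ) × ℂ) :
    quadrant (slopeDiff v q) = quadrant (slope3 q - v) := by
  unfold slopeDiff
  split_ifs with hq
  · simp [quadrant, hq]
  · rfl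

theorem IsSheet.restrict {W N : Set ((ℂ × ℂ) × ℂ)} {t₀ : ℂ} {r r' : ℝ} (hN : IsSheet W t₀ r N)
    (hr : r' ≤ r) : IsSheet W t₀ r' {q ∈ N | ‖slope3 q - t₀‖ < r'} where
  subset q hq := hN.subset hq.1
  smul_mem q hq s hs := ⟨hN.smul_mem q hq.1 s hs, by rw [slope3_smul hs]; exact hq.2⟩
  slope_lt q hq := hq.2
  unique q hq q' hq' := hN.unique q hq.1 q' hq'.1
  separated := by
    obtain ⟨η, hη, hs⟩ := hN.separated
    exact ⟨η, hη, fun q hq q' hq' h1 h2 => ⟨hs q hq.1 q' hq' h1 (h2.trans_le hr), h2⟩⟩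

namespace ConeCover

variable {W : Set ((ℂ × ℂ) × ℂ)} {U : Set (ℂ × ℂ)} {d : ℕ}

/-- The contribution of one corner of a tiling, on one sheet, is a multiple of the
fundamental class. -/
theorem exists_corner_multiple (h : ConeCover W U d)
    {Ω : (ℂ × ℂ) × ℂ → (ℂ × ℂ) × ℂ → (ℂ × ℂ) × ℂ → ℤ}
    (hΩ : ∀ p ∈ W, ∀ t₀ r N, IsSheet W t₀ r N → p ∈ N →
        pointClass (slope3 p) N - Ω ∈ lineCoboundaries W)
    {v : ℂ} {r : ℝ} (hr : 0 < r) {N : Set ((ℂ × ℂ) × ℂ)} (hN : IsSheet W v r N) {p : (ℂ × ℂ) × ℂ}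
    (hp : p ∈ N) (hpv : slope3 p = v) {τ : (ℂ × ℂ) × ℂ → (ℂ × ℂ) × ℂ}
    {lam : (ℂ × ℂ) × ℂ → (ℂ × ℂ) × ℂ → ℝ} (hanti : ∀ a b, lam a b = - lam b a)
    (hquad : ∀ q ∈ N, ∀ q' ∈ N, quadrant (slope3 q - v) = quadrant (slope3 q' - v) → τ q = τ q')
    (hcint : ∀ a ∈ N, ∀ b ∈ N, ∀ c ∈ N, ∃ k : ℤ,
      coboundary (fun a b => lam (τ a) (τ b)) a b c = k) :
    ∃ e : (ℂ × ℂ) × ℂ → (ℂ × ℂ) × ℂ → ℤ, ∃ n : ℤ,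
      (∀ a ∈ N, ∀ b ∈ N, ∀ c ∈ N,
        coboundary (fun a b => lam (τ a) (τ b)) a b c = coboundary e a b c) ∧
      restrictTo N (coboundary e) - n • Ω ∈ lineCoboundaries W := by
  classical
  let τ₄ : Bool × Bool → (ℂ × ℂ) × ℂ := fun i => Classical.epsilon fun o =>
    ∃ q ∈ N, quadrant (slope3 q - v) = i ∧ τ q = o
  have hτ₄ : ∀ q ∈ N, τ₄ (quadrant (slope3 q - v)) = τ q := by
    intro q hq
    obtain ⟨q', hq', h1, h2⟩ := Classical.epsilon_spec
      (p := fun o => ∃ q' ∈ N, quadrant (slope3 q' - v) = quadrant (slope3 q - v) ∧ τ q' = o)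
      ⟨τ q, q, hq, rfl, rfl⟩
    exact h2.symm.trans (hquad q' hq' q hq h1)
  have hself : ∀ o, lam o o = 0 := fun o => by linarith [hanti o o]
  let A : Bool × Bool := (true, true)
  have hpA : quadrant (slope3 p - v) = A := by simp [hpv, quadrant, A]
  let e₄ : Bool × Bool → Bool × Bool → ℤ := fun i j =>
    round (lam (τ₄ i) (τ₄ j) - lam (τ₄ A) (τ₄ j) + lam (τ₄ A) (τ₄ i))
  have heself : ∀ i, e₄ i i = 0 := fun i => by simp [e₄, hself]
  have heA : ∀ i, e₄ A i = 0 := fun i => by simp [e₄, hself]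
  have heA' : ∀ i, e₄ i A = 0 := fun i => by simp [e₄, hself, hanti (τ₄ i) (τ₄ A)]
  let Q : (ℂ × ℂ) × ℂ → Bool × Bool := fun q => quadrant (slope3 q - v)
  have hev : ∀ a ∈ N, ∀ b ∈ N, (e₄ (Q a) (Q b) : ℝ) =
      lam (τ a) (τ b) - lam (τ p) (τ b) + lam (τ p) (τ a) := by
    intro a ha b hb
    obtain ⟨k, hk⟩ := hcint p hp a ha b hb
    have e1 : lam (τ a) (τ b) - lam (τ p) (τ b) + lam (τ p) (τ a) = k := by
      rw [← hk, coboundary]; ring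
    have e2 := hτ₄ p hp
    rw [hpA] at e2
    simp only [e₄, Q, hτ₄ a ha, hτ₄ b hb, e2, e1, round_intCast]
  have heanti : ∀ a ∈ N, ∀ b ∈ N, e₄ (Q a) (Q b) = - e₄ (Q b) (Q a) := by
    intro a ha b hb
    have : (e₄ (Q a) (Q b) : ℝ) = - (e₄ (Q b) (Q a) : ℝ) := by
      rw [hev a ha b hb, hev b hb a ha, hanti (τ b) (τ a)]; ring
    exact_mod_cast this
  let n : ℤ := -(e₄ (false, true) (false, false) + e₄ (false, false) (true, false))
  let B : Bool × Bool → ℤ := fun i =>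
    if i = (false, false) then - e₄ (false, false) (true, false) else 0
  refine ⟨fun a b => e₄ (Q a) (Q b), n, ?_, ?_⟩
  · intro a ha b hb c hc
    simp only [coboundary]
    push_cast
    rw [hev a ha b hb, hev b hb c hc, hev a ha c hc]
    ring
  · let m : (ℂ × ℂ) × ℂ → (ℂ × ℂ) × ℂ → ℤ := fun a b =>
      e₄ (Q a) (Q b) - n * argJump (slopeDiff v) a b - (B (Q b) - B (Q a))
    have hm : restrictTo N (coboundary m) ∈ lineCoboundaries W := by
      refine h.restrictTo_mem hN (half_lt_self hr) ?_ ?_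
      · intro a ha s hs
        have : Q (s • a) = Q a := by simp only [Q, slope3_smul hs]
        simp only [m, this, heself, argJump_smul_right hs]
        ring
      · obtain ⟨ε, hε, hsl⟩ := h.exists_near_slopeDiff (‖v‖ + r) v (half_pos hr)
        refine ⟨ε, hε, fun a ha b hb hab hfar => ?_⟩
        have hsm := hsl a (hN.subset ha) b (hN.subset hb) hab (norm_slope_le hN ha) hfar
        have hJ := argJump_eq (F := slopeDiff v) (slopeDiff_ne_zero v a) (slopeDiff_ne_zero v b)
        have hq := quadrant_jump hJ hsm
        rw [quadrant_slopeDiff, quadrant_slopeDiff] at hq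
        change (Q a = Q b ∧ _) ∨ (Q a = A ∧ Q b ≠ _ ∧ _) ∨ (Q b = A ∧ Q a ≠ _ ∧ _) ∨
          (Q a = _ ∧ Q b = _ ∧ _) ∨ (Q a = _ ∧ Q b = _ ∧ _) ∨ (Q a = _ ∧ Q b = _ ∧ _) ∨
          (Q a = _ ∧ Q b = _ ∧ _) at hq
        have han := heanti a ha b hb
        have hA : B A = 0 := by simp [B, A]
        rcases hq with ⟨h1, h2⟩ | ⟨h1, h2, h3⟩ | ⟨h1, h2, h3⟩ | ⟨h1, h2, h3⟩ | ⟨h1, h2, h3⟩ |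
          ⟨h1, h2, h3⟩ | ⟨h1, h2, h3⟩
        · simp only [m, h1, h2, heself]; ring
        · have : B (Q b) = 0 := if_neg h2
          simp only [m, h1, h3, heA, this, hA]; ring
        · have : B (Q a) = 0 := if_neg h2
          simp only [m, h1, h3, heA', this, hA]; ring
        · simp only [m, h1, h2, h3, B, n]; simp
        · rw [h1, h2] at han
          simp only [m, h1, h2, h3, B, n, han]; simp
        · simp only [m, h1, h2, h3, B, n]; simp
        · rw [h1, h2] at han
          simp only [m, h1, h2, h3, B, n, han]; simp
    have hpc := hΩ p (hN.subset hp) v r N hN hp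
    rw [hpv] at hpc
    have := AddSubgroup.add_mem _ hm (AddSubgroup.zsmul_mem _ hpc n)
    convert this using 1
    funext a b c
    simp only [Pi.sub_apply, Pi.add_apply, Pi.smul_apply, pointClass, restrictTo, smul_eq_mul]
    split_ifs
    · simp only [coboundary, m]; ring
    · ring

end ConeCover

theorem exists_pos_le_of_finite {ι : Type*} [Finite ι] {f : ι → ℝ} (hf : ∀ i, 0 < f i) :
    ∃ r > 0, ∀ i, r ≤ f i := by
  rcases isEmpty_or_nonempty ι with hι | hι
  · exact ⟨1, one_pos, fun i => hι.elim i⟩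
  · obtain ⟨i, hi⟩ := Finite.exists_min f
    exact ⟨f i, hf i, hi⟩

namespace ConeCover

variable {W : Set ((ℂ × ℂ) × ℂ)} {U : Set (ℂ × ℂ)} {d : ℕ}

theorem exists_near_sheets (h : ConeCover W U d) {v : ℂ} (hv : ((1 : ℂ), v) ∈ U) {ε : ℝ}
    (hε : 0 < ε) : ∃ R > 0, ∀ r > 0, r ≤ R →
    ∃ N : {z // (((1 : ℂ), v), z) ∈ W} → Set ((ℂ × ℂ) × ℂ),
      (∀ ζ, IsSheet W v r (N ζ)) ∧ (∀ ζ, (((1 : ℂ), v), ζ.1) ∈ N ζ) ∧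
      (∀ q ∈ W, ‖slope3 q - v‖ < r → ∃ ζ, q ∈ N ζ) ∧
      (∀ ζ ζ', ∀ q ∈ N ζ, q ∈ N ζ' → ζ = ζ') ∧
      ∀ ζ, ∀ q ∈ N ζ, ∀ q' ∈ N ζ, RelNear ε (normalize3 q) (normalize3 q') := by
  have : Finite {z // (((1 : ℂ), v), z) ∈ W} := h.finite_fiber hv
  obtain ⟨R₀, hR₀, hsh⟩ := h.exists_sheets hv
  obtain ⟨N₀, h1, h2, h3, h4⟩ := hsh R₀ hR₀ le_rfl
  have hε' : 0 < min 1 (ε / 3) := by positivity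
  choose ρ hρ hnear using fun ζ => h.sheet_continuous (h1 ζ) (h2 ζ) hε'
  obtain ⟨ρ₀, hρ₀, hle⟩ := exists_pos_le_of_finite hρ
  refine ⟨min R₀ ρ₀, by positivity, fun r hr hrR => ?_⟩
  have hrR₀ : r ≤ R₀ := hrR.trans (min_le_left _ _)
  refine ⟨fun ζ => {q ∈ N₀ ζ | ‖slope3 q - v‖ < r}, fun ζ => (h1 ζ).restrict hrR₀,
    fun ζ => ⟨h2 ζ, by simpa [slope3] using hr⟩, fun q hq hqr => ?_,
    fun ζ ζ' q hq hq' => h4 ζ ζ' q hq.1 hq'.1, fun ζ q hq q' hq' => ?_⟩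
  · obtain ⟨ζ, hζ⟩ := h3 q hq (hqr.trans_le hrR₀)
    exact ⟨ζ, hζ, hqr⟩
  · have key : ∀ q ∈ N₀ ζ, ‖slope3 q - v‖ < r →
        RelNear (min 1 (ε / 3)) (normalize3 (((1 : ℂ), v), ζ.1)) (normalize3 q) := by
      intro q hq hqr
      refine hnear ζ q hq ?_
      have : slope3 (((1 : ℂ), v), ζ.1) = v := by simp [slope3]
      rw [this]
      exact hqr.trans_le ((hrR.trans (min_le_right _ _)).trans (hle ζ))
    have := (key q hq.1 hq.2).symm.trans (key q' hq'.1 hq'.2) (min_le_left _ _)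
    exact this.mono (by linarith [min_le_right 1 (ε / 3)])

/-- The integral obstruction class of a cochain defined on the tiles of a tiling is a multiple
of the fundamental class. -/
theorem exists_tiling_multiple (h : ConeCover W U d)
    {Ω : (ℂ × ℂ) × ℂ → (ℂ × ℂ) × ℂ → (ℂ × ℂ) × ℂ → ℤ}
    (hΩ : ∀ p ∈ W, ∀ t₀ r N, IsSheet W t₀ r N → p ∈ N →
        pointClass (slope3 p) N - Ω ∈ lineCoboundaries W)
    {τ : (ℂ × ℂ) × ℂ → (ℂ × ℂ) × ℂ} {F : Finset ℂ} (hF : ∀ v ∈ F, ((1 : ℂ), v) ∈ U)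
    (hτ : ∀ q ∈ W, ∀ s : ℂ, s ≠ 0 → τ (s • q) = τ q)
    (hτ4 : ∀ v ∈ F, ∃ R > 0, ∃ ε' > 0, ∀ q ∈ W, ∀ q' ∈ W, ‖slope3 q - v‖ < R →
      ‖slope3 q' - v‖ < R → quadrant (slope3 q - v) = quadrant (slope3 q' - v) →
      RelNear ε' q q' → τ q = τ q')
    (hτ3 : ∀ ρ > 0, ∃ ε' > 0, ∀ a ∈ W, ∀ b ∈ W, ∀ c ∈ W, RelNear ε' a b → RelNear ε' b c →
        RelNear ε' a c → (∃ v ∈ F, ‖slope3 a - v‖ < ρ ∧ ‖slope3 b - v‖ < ρ ∧ ‖slope3 c - v‖ < ρ) ∨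
        τ a = τ b ∨ τ b = τ c ∨ τ a = τ c)
    {lam : (ℂ × ℂ) × ℂ → (ℂ × ℂ) × ℂ → ℝ} (hanti : ∀ a b, lam a b = - lam b a)
    {ε : ℝ} (hε : 0 < ε)
    (hcint : ∀ a ∈ W, ∀ b ∈ W, ∀ c ∈ W, RelNear ε a b → RelNear ε b c → RelNear ε a c →
      ∃ k : ℤ, coboundary (fun a b => lam (τ a) (τ b)) a b c = k) :
    ∃ n : ℤ, ∃ z, z - n • Ω ∈ lineCoboundaries W ∧ ∃ ε' > 0, ∀ a ∈ W, ∀ b ∈ W, ∀ c ∈ W,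
      RelNear ε' a b → RelNear ε' b c → RelNear ε' a c →
      coboundary (fun a b => lam (τ a) (τ b)) a b c = z a b c := by
  classical
  have hself : ∀ o, lam o o = 0 := fun o => by linarith [hanti o o]
  have hfib : ∀ v : F, Finite {z // (((1 : ℂ), v.1), z) ∈ W} := fun v => h.finite_fiber (hF v v.2)
  choose R₄ hR₄ ε₄ hε₄ hτ₄ using fun v : F => hτ4 v v.2
  choose R hR hsh using fun v : F => h.exists_near_sheets (hF v v.2) (lt_min hε (hε₄ v))
  obtain ⟨r₁, hr₁, hle₁⟩ := exists_pos_le_of_finite hR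
  obtain ⟨r₂, hr₂, hle₂⟩ := exists_pos_le_of_finite hR₄
  obtain ⟨r₃, hr₃, hle₃⟩ := exists_pos_le_of_finite
    (f := fun p : {p : F × F // p.1 ≠ p.2} => ‖p.1.1.1 - p.1.2.1‖ / 2) (fun p => by
      have : p.1.1.1 - p.1.2.1 ≠ 0 := sub_ne_zero.2 fun e => p.2 (Subtype.ext e)
      positivity)
  set r := min r₁ (min r₂ r₃) with hrdef
  have hr : 0 < r := by positivity
  have hrr₂ : r ≤ r₂ := (min_le_right _ _).trans (min_le_left _ _)
  have hrr₃ : r ≤ r₃ := (min_le_right _ _).trans (min_le_right _ _)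
  choose N hN hNc hNcov hNdis hNnear using
    fun v : F => hsh v r hr ((min_le_left _ _).trans (hle₁ v))
  let I := Σ v : F, {z // (((1 : ℂ), v.1), z) ∈ W}
  have hI : Finite I := inferInstance
  have := Fintype.ofFinite I
  have hNW : ∀ i : I, ∀ q ∈ N i.1 i.2, q ∈ W := fun i q hq => (hN i.1 i.2).subset hq
  have hτn : ∀ q ∈ W, τ (normalize3 q) = τ q := by
    intro q hq
    rw [normalize3_eq_smul (h.fst_fst_ne hq)]
    exact hτ q hq _ (inv_ne_zero (h.fst_fst_ne hq))
  choose e n he hen using fun i : I => h.exists_corner_multiple hΩ hr (hN i.1 i.2) (hNc i.1 i.2)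
    (by simp [slope3]) (τ := τ) hanti
    (by
      intro q hq q' hq' hqq
      rw [← hτn q (hNW i q hq), ← hτn q' (hNW i q' hq')]
      refine hτ₄ i.1 _ (h.normalize3_mem (hNW i q hq)) _ (h.normalize3_mem (hNW i q' hq'))
        ?_ ?_ ?_ ((hNnear i.1 i.2 q hq q' hq').mono (min_le_right _ _))
      · rw [slope3_normalize3]
        exact ((hN i.1 i.2).slope_lt q hq).trans_le (hrr₂.trans (hle₂ i.1))
      · rw [slope3_normalize3]
        exact ((hN i.1 i.2).slope_lt q' hq').trans_le (hrr₂.trans (hle₂ i.1))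
      · rw [slope3_normalize3, slope3_normalize3]; exact hqq)
    (by
      intro a ha b hb c hc
      obtain ⟨k, hk⟩ := hcint _ (h.normalize3_mem (hNW i a ha)) _ (h.normalize3_mem (hNW i b hb)) _
        (h.normalize3_mem (hNW i c hc))
        ((hNnear i.1 i.2 a ha b hb).mono (min_le_left _ _))
        ((hNnear i.1 i.2 b hb c hc).mono (min_le_left _ _))
        ((hNnear i.1 i.2 a ha c hc).mono (min_le_left _ _))
      refine ⟨k, ?_⟩
      simpa only [coboundary, hτn _ (hNW i a ha), hτn _ (hNW i b hb), hτn _ (hNW i c hc)] using hk)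
  have hdis : ∀ i j : I, ∀ q ∈ N i.1 i.2, q ∈ N j.1 j.2 → i = j := by
    rintro ⟨v, ζ⟩ ⟨v', ζ'⟩ q hq hq'
    obtain rfl : v = v' := by
      by_contra hne
      have h1 := (hN v ζ).slope_lt q hq
      have h2 := (hN v' ζ').slope_lt q hq'
      rw [norm_sub_rev] at h1
      have h3 := norm_sub_le_norm_sub_add_norm_sub v.1 (slope3 q) v'.1
      have h4 := hle₃ ⟨(v, v'), hne⟩
      simp only at h4
      linarith
    obtain rfl := hNdis v ζ ζ' q hq hq'
    rfl
  choose η hη hsep using fun i : I => (hN i.1 i.2).separated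
  obtain ⟨η₀, hη₀, hleη⟩ := exists_pos_le_of_finite hη
  obtain ⟨ε₃, hε₃, h3⟩ := hτ3 r hr
  refine ⟨∑ i, n i, ∑ i, restrictTo (N i.1 i.2) (coboundary (e i)), ?_, min η₀ ε₃, by positivity,
    fun a ha b hb c hc hab hbc hac => ?_⟩
  · rw [Finset.sum_smul, ← Finset.sum_sub_distrib]
    exact AddSubgroup.sum_mem _ fun i _ => hen i
  · simp only [Finset.sum_apply]
    by_cases hex : ∃ i : I, a ∈ N i.1 i.2 ∧ b ∈ N i.1 i.2 ∧ c ∈ N i.1 i.2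
    · obtain ⟨i, hai, hbi, hci⟩ := hex
      rw [Finset.sum_eq_single i]
      · rw [restrictTo, if_pos ⟨hai, hbi, hci⟩]
        exact he i a hai b hbi c hci
      · intro j _ hj
        exact if_neg fun hm => hj (hdis j i a hm.1 hai)
      · exact fun hm => absurd (Finset.mem_univ i) hm
    · have hz : ∀ i : I, restrictTo (N i.1 i.2) (coboundary (e i)) a b c = 0 :=
        fun i => if_neg fun hm => hex ⟨i, hm⟩
      rw [Finset.sum_eq_zero fun i _ => hz i]
      rcases h3 a ha b hb c hc (hab.mono (min_le_right _ _)) (hbc.mono (min_le_right _ _))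
        (hac.mono (min_le_right _ _)) with ⟨v, hv, k1, k2, k3⟩ | k | k | k
      · exfalso
        obtain ⟨ζ, hζ⟩ := hNcov ⟨v, hv⟩ a ha k1
        have hle := (min_le_left η₀ ε₃).trans (hleη ⟨⟨v, hv⟩, ζ⟩)
        exact hex ⟨⟨⟨v, hv⟩, ζ⟩, hζ, hsep ⟨⟨v, hv⟩, ζ⟩ a hζ b hb (hab.mono hle) k2,
          hsep ⟨⟨v, hv⟩, ζ⟩ a hζ c hc (hac.mono hle) k3⟩
      · simp [coboundary, k, hself]
      · simp [coboundary, k, hself]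
      · simp [coboundary, k, hself, hanti (τ b) (τ c)]

end ConeCover

section

variable {E A : Type*} [NormedAddCommGroup E] [NormedSpace ℂ E] [AddCommGroup A] {W : Set E}
  {ε δ : ℝ} {κ : E → E → A}

/-- A cocycle vanishing on short steps inside complex lines is invariant under scaling. -/
theorem IsCocycle.exists_smul_eq (hW : ∀ q ∈ W, ∀ r : ℂ, r ≠ 0 → r • q ∈ W) (h0 : (0 : E) ∉ W)
    (hκ : IsCocycle W ε κ) (hε : 0 < ε) (hδ : 0 < δ)
    (hline : ∀ q ∈ W, ∀ s : ℂ, RelNear δ 1 s → κ q (s • q) = 0) :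
    ∃ ε' > 0, ∀ a ∈ W, ∀ b ∈ W, RelNear ε' a b → ∀ s : ℂ, s ≠ 0 → κ (s • a) (s • b) = κ a b := by
  set ε₁ := min 1 (ε / 3)
  have hε₁ : 0 < ε₁ := by positivity
  have h3 : 3 * ε₁ ≤ ε := by linarith [min_le_right 1 (ε / 3)]
  obtain ⟨δ₁, hδ₁, hE⟩ := exists_near_exp (E := E) hε₁
  obtain ⟨δ₂, hδ₂, hC⟩ := exists_near_exp (E := ℂ) hδ
  have hstep : ∀ a ∈ W, ∀ b ∈ W, RelNear ε₁ a b → ∀ w : ℂ, ‖w‖ < min δ₁ δ₂ →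
      κ (Complex.exp w • a) (Complex.exp w • b) = κ a b := by
    intro a ha b hb hab w hw
    have hd : dist 0 w < min δ₁ δ₂ := by rwa [dist_zero_left]
    have hn : ∀ q ∈ W, RelNear ε₁ q (Complex.exp w • q) := fun q hq => by
      have := hE 0 w (hd.trans_le (min_le_left _ _)) q (fun h => h0 (h ▸ hq))
      simpa using this
    have hz : RelNear δ 1 (Complex.exp w) := by
      simpa using hC 0 w (hd.trans_le (min_le_right _ _)) 1 one_ne_zero
    have hle : ε₁ ≤ ε := by linarith
    have hsa := hW a ha _ (Complex.exp_ne_zero w)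
    have hsb := hW b hb _ (Complex.exp_ne_zero w)
    have hasb := (hab.trans (hn b hb) (min_le_left _ _)).mono h3
    have e1 := hκ a ha b hb _ hsb (hab.mono hle) ((hn b hb).mono hle) hasb
    have e2 := hκ a ha _ hsa _ hsb ((hn a ha).mono hle)
      ((hab.smul (Complex.exp_ne_zero w)).mono hle) hasb
    rw [hline b hb _ hz, add_zero] at e1
    rw [hline a ha _ hz, zero_add] at e2
    rw [e1, e2]
  refine ⟨ε₁, hε₁, fun a ha b hb hab s hs => ?_⟩
  obtain ⟨n, hn⟩ := exists_nat_gt (‖Complex.log s‖ / min δ₁ δ₂)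
  have hpos : 0 < min δ₁ δ₂ := lt_min hδ₁ hδ₂
  have hn0 : (0 : ℝ) < n := lt_of_le_of_lt (by positivity) hn
  have hw : ‖Complex.log s / n‖ < min δ₁ δ₂ := by
    rw [norm_div, Complex.norm_natCast, div_lt_comm₀ hn0 hpos]
    exact hn
  have hpow : ∀ k : ℕ, κ (Complex.exp (Complex.log s / n) ^ k • a)
      (Complex.exp (Complex.log s / n) ^ k • b) = κ a b := by
    intro k
    induction k with
    | zero => simp
    | succ k ih =>
      have hk : Complex.exp (Complex.log s / n) ^ k ≠ 0 := pow_ne_zero _ (Complex.exp_ne_zero _)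
      rw [pow_succ', mul_smul, mul_smul,
        hstep _ (hW a ha _ hk) _ (hW b hb _ hk) (hab.smul hk) _ hw, ih]
  have := hpow n
  rwa [← Complex.exp_nat_mul, mul_div_cancel₀ _ (by exact_mod_cast hn0.ne'), Complex.exp_log hs]
    at this

theorem RelNear.of_smul {r s : ℂ} {v : E} (hv : v ≠ 0) (h : RelNear ε (r • v) (s • v)) :
    RelNear ε r s := by
  have := norm_pos_iff.2 hv
  unfold RelNear at *
  rw [← sub_smul, norm_smul, norm_smul, norm_smul] at h
  constructor
  · nlinarith [h.1]
  · nlinarith [h.2]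

/-- An antisymmetric real lift of a circle-valued function. -/
theorem exists_antisymm_lift {X : Type*} (ℓ : X → X → UnitAddCircle) :
    ∃ lam : X → X → ℝ, (∀ a b, lam a b = - lam b a) ∧
      ∀ a b, ℓ a a = 0 → ℓ a b = - ℓ b a → (lam a b : UnitAddCircle) = ℓ a b := by
  classical
  have hsurj : Function.Surjective (fun x : ℝ => (x : UnitAddCircle)) :=
    QuotientAddGroup.mk_surjective
  set L := Function.surjInv hsurj
  have hL : ∀ x, ((L x : ℝ) : UnitAddCircle) = x := Function.surjInv_eq hsurj
  refine ⟨fun a b => if a = b then 0 else if WellOrderingRel a b then L (ℓ a b) else - L (ℓ b a),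
    fun a b => ?_, fun a b h1 h2 => ?_⟩
  · rcases trichotomous_of WellOrderingRel a b with h | h | h
    · have h' : ¬ WellOrderingRel b a := asymm h
      have hne : a ≠ b := fun e => h' (e ▸ e ▸ h)
      simp [h, h', hne, hne.symm]
    · simp [h]
    · have h' : ¬ WellOrderingRel a b := asymm h
      have hne : a ≠ b := fun e => h' (e ▸ e ▸ h)
      simp [h, h', hne, hne.symm]
  · simp only
    split_ifs with h h'
    · subst h; simp [h1]
    · exact hL _
    · rw [AddCircle.coe_neg, hL, h2]

/-- A scale-invariant cocycle is cohomologous to one which only depends on tiles. -/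
theorem IsCocycle.exists_tile_cochain {κ : E → E → UnitAddCircle}
    (hW : ∀ q ∈ W, ∀ r : ℂ, r ≠ 0 → r • q ∈ W) (h0 : (0 : E) ∉ W)
    (hκ : IsCocycle W ε κ) (hε : 0 < ε)
    (hline : ∀ q ∈ W, ∀ s : ℂ, RelNear ε 1 s → κ q (s • q) = 0)
    (hsmul : ∀ a ∈ W, ∀ b ∈ W, RelNear ε a b → ∀ s : ℂ, s ≠ 0 → κ (s • a) (s • b) = κ a b)
    (hδ : 27 * δ ≤ ε) (hδ1 : 27 * δ ≤ 1) {τ : E → E}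
    (hτ : ∀ q ∈ W, τ q ∈ W ∧ ∃ s : ℂ, s ≠ 0 ∧ RelNear δ q (s • τ q)) :
    ∃ β : E → UnitAddCircle, ∃ lam : E → E → ℝ, (∀ a b, lam a b = - lam b a) ∧
      ∀ p ∈ W, ∀ q ∈ W, RelNear δ p q → κ p q = β p - β q + (lam (τ p) (τ q) : UnitAddCircle) := by
  classical
  choose! s hs0 hs using fun q hq => (hτ q hq).2
  have hτW := fun q hq => (hτ q hq).1
  set ℓ : E → E → UnitAddCircle := fun o o' =>
    if h : ∃ r : ℂ, RelNear (9 * δ) o (r • o') then κ o (h.choose • o') else 0 with hℓ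
  have hne : ∀ q ∈ W, q ≠ 0 := fun q hq h => h0 (h ▸ hq)
  have hc0 : ∀ {o o' : E} {c : ℂ} {η : ℝ}, RelNear η o (c • o') → c ≠ 0 := by
    rintro o o' c η h rfl
    exact h.symm.ne_zero (zero_smul _ _)
  have hℓeq : ∀ o ∈ W, ∀ o' ∈ W, ∀ c : ℂ, RelNear (9 * δ) o (c • o') → ℓ o o' = κ o (c • o') := by
    intro o ho o' ho' c hc
    have hex : ∃ r : ℂ, RelNear (9 * δ) o (r • o') := ⟨c, hc⟩
    simp only [hℓ, dif_pos hex]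
    have hr := hex.choose_spec
    set r := hex.choose
    have hδ0 : 0 < 9 * δ := hr.pos
    have hcr := (hc.symm.trans hr (by linarith)).mono (show 3 * (9 * δ) ≤ ε by linarith)
    have h1 : RelNear ε 1 (r / c) := by
      have := (hcr.of_smul (hne o' ho')).smul (inv_ne_zero (hc0 hc))
      simpa [hc0 hc, div_eq_inv_mul] using this
    have h2 := hline _ (hW o' ho' c (hc0 hc)) _ h1
    rw [smul_smul, div_mul_cancel₀ _ (hc0 hc)] at h2
    have h3 := hκ o ho _ (hW o' ho' c (hc0 hc)) _ (hW o' ho' r (hc0 hr))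
      (hc.mono (by linarith)) hcr (hr.mono (by linarith))
    rw [← h3, h2, add_zero]
  have hself : ∀ o ∈ W, 0 < δ → ℓ o o = 0 := by
    intro o ho hpos
    have : RelNear (9 * δ) o ((1 : ℂ) • o) := by
      rw [one_smul]; exact RelNear.refl (by linarith) (hne o ho)
    rw [hℓeq o ho o ho 1 this, one_smul, hκ.self hε ho (hne o ho)]
  have hanti : ∀ o ∈ W, ∀ o' ∈ W, ∀ c : ℂ, RelNear (9 * δ) o (c • o') → ℓ o o' = - ℓ o' o := by
    intro o ho o' ho' c hc
    have hc' : RelNear (9 * δ) o' (c⁻¹ • o) := by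
      have := hc.symm.smul (inv_ne_zero (hc0 hc))
      rwa [smul_smul, inv_mul_cancel₀ (hc0 hc), one_smul] at this
    have hpos := hc.pos
    rw [hℓeq o ho o' ho' c hc, hℓeq o' ho' o ho _ hc',
      ← hsmul _ ho' _ (hW o ho _ (inv_ne_zero (hc0 hc))) (hc'.mono (by linarith)) c (hc0 hc),
      smul_smul, mul_inv_cancel₀ (hc0 hc), one_smul,
      hκ.symm ho (hW o' ho' c (hc0 hc)) (hc.mono (by linarith)), neg_neg]
  obtain ⟨lam, hlam, hlamℓ⟩ := exists_antisymm_lift ℓ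
  refine ⟨fun p => κ p (s p • τ p), lam, hlam, fun p hp q hq hpq => ?_⟩
  have hpos := hpq.pos
  have hsp := hW _ (hτW p hp) _ (hs0 p hp)
  have hsq := hW _ (hτW q hq) _ (hs0 q hq)
  have n1 : RelNear (3 * δ) p (s q • τ q) := hpq.trans (hs q hq) (by linarith)
  have n2 : RelNear (9 * δ) (s p • τ p) (s q • τ q) := by
    have := ((hs p hp).symm.mono (show δ ≤ 3 * δ by linarith)).trans n1 (by linarith)
    exact this.mono (by linarith)
  have n3 : RelNear (9 * δ) (τ p) ((s q / s p) • τ q) := by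
    have := n2.smul (inv_ne_zero (hs0 p hp))
    rwa [smul_smul, smul_smul, inv_mul_cancel₀ (hs0 p hp), one_smul, ← div_eq_inv_mul] at this
  rw [hlamℓ _ _ (hself _ (hτW p hp) hpos) (hanti _ (hτW p hp) _ (hτW q hq) _ n3),
    hℓeq _ (hτW p hp) _ (hτW q hq) _ n3,
    ← hsmul _ (hτW p hp) _ (hW _ (hτW q hq) _ (hc0 n3)) (n3.mono (by linarith)) _ (hs0 p hp),
    smul_smul, mul_div_cancel₀ _ (hs0 p hp)]
  have e1 := hκ p hp q hq _ hsq (hpq.mono (by linarith)) ((hs q hq).mono (by linarith))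
    (n1.mono (by linarith))
  have e2 := hκ p hp _ hsp _ hsq ((hs p hp).mono (by linarith)) (n2.mono (by linarith))
    (n1.mono (by linarith))
  have e3 : κ p q = κ p (s q • τ q) - κ q (s q • τ q) := by rw [← e1]; abel
  rw [e3, ← e2]
  abel

end

theorem UnitAddCircle.exists_nat_div_of_nsmul_eq_zero {d : ℕ} (hd : 0 < d) {x : UnitAddCircle}
    (hx : d • x = 0) : ∃ k : Fin d, x = ((k / d : ℝ) : UnitAddCircle) := by
  obtain ⟨r, rfl⟩ := QuotientAddGroup.mk_surjective x
  have h1 : ((d * r : ℝ) : UnitAddCircle) = 0 := by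
    rw [← hx, ← nsmul_eq_mul]
    exact AddCircle.coe_nsmul (1 : ℝ)
  obtain ⟨m, hm⟩ := UnitAddCircle.exists_int_of_coe_eq_zero h1
  have hd' : (d : ℝ) ≠ 0 := by exact_mod_cast hd.ne'
  have hdz : (d : ℤ) ≠ 0 := by exact_mod_cast hd.ne'
  have hnn := Int.emod_nonneg m hdz
  have hlt := Int.emod_lt_of_pos m (show (0 : ℤ) < d by exact_mod_cast hd)
  refine ⟨⟨(m % d).toNat, by omega⟩, ?_⟩
  have hc : (((m % d).toNat : ℕ) : ℝ) = ((m % d : ℤ) : ℝ) := by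
    exact_mod_cast congrArg (Int.cast : ℤ → ℝ) (Int.toNat_of_nonneg hnn)
  simp only [hc]
  change (r : UnitAddCircle) = _
  rw [← sub_eq_zero, ← AddCircle.coe_sub]
  refine (AddCircle.coe_eq_zero_iff (1 : ℝ)).2 ⟨m / d, ?_⟩
  have h2 : (d : ℝ) * ((m / d : ℤ) : ℝ) + ((m % d : ℤ) : ℝ) = m := by
    exact_mod_cast Int.mul_ediv_add_emod m d
  simp only [zsmul_eq_mul, mul_one]
  field_simp
  linarith

namespace ConeCover

variable {W : Set ((ℂ × ℂ) × ℂ)} {U : Set (ℂ × ℂ)} {d : ℕ}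

theorem nonempty (h : ConeCover W U d) : W.Nonempty := by
  obtain ⟨t, ht⟩ := h.exists_base
  have := h.finite_fiber ht
  have hne : Nonempty {z // (((1 : ℂ), t), z) ∈ W} := by
    apply (Nat.card_pos_iff.1 _).1
    rw [h.fiber _ ht]; exact h.pos
  obtain ⟨z, hz⟩ := hne
  exact ⟨_, hz⟩

/-- A cocycle with trivial holonomy can be normalised along complex lines. -/
theorem exists_line_correction (h : ConeCover W U d) {A : Type*} [AddCommGroup A] {ε : ℝ}
    (hε : 0 < ε) {κ : (ℂ × ℂ) × ℂ → (ℂ × ℂ) × ℂ → A} (hκ : IsCocycle W ε κ)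
    (hhol : ∃ᶠ n : ℕ in atTop, ∀ q ∈ W, holonomy n κ q = 0) :
    ∃ α : (ℂ × ℂ) × ℂ → A, ∃ δ > 0, ∀ q ∈ W, ∀ s : ℂ, RelNear δ 1 s →
      κ q (s • q) = α (s • q) - α q := by
  obtain ⟨δ, hδ, hpot⟩ := exists_line_potential h.smul_mem h.zero_notMem hκ hε hhol
  choose! H hH using hpot
  refine ⟨fun q => H (normalize3 q) q.1.1, δ, hδ, fun q hq s hs => ?_⟩
  have hs0 : s ≠ 0 := hs.symm.ne_zero
  have hx := h.fst_fst_ne hq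
  have hn : normalize3 (s • q) = normalize3 q := by
    simp only [normalize3, slope3_smul hs0, height3_smul hs0]
  have h1 : RelNear δ q.1.1 (s * q.1.1) := by
    have := hs.smul hx
    simpa [mul_comm] using this
  have := hH _ (h.normalize3_mem hq) _ _ h1
  rw [mul_smul, smul_normalize3 hx] at this
  simp only [hn, this, Prod.smul_fst, smul_eq_mul]

theorem torsionExponent (h : ConeCover W U d) : TorsionExponent W d := by
  intro ε hε χ hχ
  obtain ⟨Ω, hΩ, ε₀, hε₀, w, hw, hholw⟩ := h.exists_fundamentalClass
  obtain ⟨q₀, hq₀⟩ := h.nonempty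
  have hd : (d : ℝ) ≠ 0 := by exact_mod_cast h.pos.ne'
  have hwR : ∀ a ∈ W, ∀ b ∈ W, ∀ c ∈ W, RelNear ε₀ a b → RelNear ε₀ b c → RelNear ε₀ a c →
      (w a b + w b c - w a c : ℝ) = d * Ω a b c := by
    intro a ha b hb c hc h1 h2 h3
    have := congrArg (Int.cast : ℤ → ℝ) (hw a ha b hb c hc h1 h2 h3)
    simpa [coboundary] using this
  obtain ⟨k, hk⟩ : ∃ k : Fin d, ∃ᶠ n : ℕ in atTop,
      holonomy n (fun a b => (χ a b : UnitAddCircle)) q₀ = ((k / d : ℝ) : UnitAddCircle) := by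
    by_contra hcon
    push Not at hcon
    obtain ⟨n, hn1, hn2⟩ := ((eventually_all.2 fun k => hcon k).and
      (h.nsmul_holonomy hε hχ)).exists
    obtain ⟨k, hk⟩ := UnitAddCircle.exists_nat_div_of_nsmul_eq_zero h.pos (hn2 q₀ hq₀)
    exact hn1 k hk
  set χ₁ : (ℂ × ℂ) × ℂ → (ℂ × ℂ) × ℂ → ℝ := fun a b => χ a b + k / d * w a b with hχ₁
  set κ : (ℂ × ℂ) × ℂ → (ℂ × ℂ) × ℂ → UnitAddCircle := fun a b => (χ₁ a b : UnitAddCircle)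
      with hκdef
  set ε₁ := min ε ε₀
  have hε₁ : 0 < ε₁ := by positivity
  have hκ : IsCocycle W ε₁ κ := by
    intro a ha b hb c hc h1 h2 h3
    have e1 := hχ a ha b hb c hc (h1.mono (min_le_left _ _)) (h2.mono (min_le_left _ _))
      (h3.mono (min_le_left _ _))
    have e2 := hwR a ha b hb c hc (h1.mono (min_le_right _ _)) (h2.mono (min_le_right _ _))
      (h3.mono (min_le_right _ _))
    rw [← AddCircle.coe_add, ← sub_eq_zero, ← AddCircle.coe_sub] at e1
    obtain ⟨m, hm⟩ := UnitAddCircle.exists_int_of_coe_eq_zero e1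
    simp only [hκdef]
    rw [← AddCircle.coe_add, ← sub_eq_zero, ← AddCircle.coe_sub]
    refine (AddCircle.coe_eq_zero_iff (1 : ℝ)).2 ⟨m + k * Ω a b c, ?_⟩
    simp only [zsmul_eq_mul, mul_one, hχ₁]
    push_cast
    rw [← hm]
    have e3 : (k / d * (w a b + w b c - w a c) : ℝ) = k * Ω a b c := by
      rw [e2]; field_simp
    linarith
  have hholκ : ∃ᶠ n : ℕ in atTop, ∀ q ∈ W, holonomy n κ q = 0 := by
    refine (hk.and_eventually ((hholw q₀ hq₀).and
      (holonomy_const h.smul_mem h.zero_notMem h.preconnected hκ hε₁))).mono ?_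
    rintro n ⟨h1, h2, h3⟩ q hq
    rw [h3 q hq q₀ hq₀]
    have hsum : ∀ f : ℕ → ℝ, ((∑ i ∈ Finset.range n, f i : ℝ) : UnitAddCircle) =
        ∑ i ∈ Finset.range n, (f i : UnitAddCircle) := fun f =>
      map_sum (QuotientAddGroup.mk' (AddSubgroup.zmultiples (1 : ℝ))) f _
    simp only [holonomy] at h1 h2 ⊢
    simp only [hκdef, hχ₁, AddCircle.coe_add, Finset.sum_add_distrib]
    rw [h1, ← hsum, ← Finset.mul_sum, ← AddCircle.coe_add]
    have h2' : (∑ i ∈ Finset.range n, (w (gonPoint n i • q₀)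
        (gonPoint n (i + 1) • q₀) : ℝ)) = -1 := by
      exact_mod_cast h2
    rw [h2']
    simp
  obtain ⟨α, δ, hδ, hα⟩ := h.exists_line_correction hε₁ hκ hholκ
  set κ₂ : (ℂ × ℂ) × ℂ → (ℂ × ℂ) × ℂ → UnitAddCircle := fun a b => κ a b - α b + α a with hκ₂def
  have hκ₂ : IsCocycle W ε₁ κ₂ := by
    intro a ha b hb c hc h1 h2 h3
    simp only [hκ₂def]
    rw [← hκ a ha b hb c hc h1 h2 h3]
    abel
  have hline : ∀ q ∈ W, ∀ s : ℂ, RelNear δ 1 s → κ₂ q (s • q) = 0 := by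
    intro q hq s hs
    simp only [hκ₂def, hα q hq s hs]
    abel
  obtain ⟨ε₂, hε₂, hsm⟩ := hκ₂.exists_smul_eq h.smul_mem h.zero_notMem hε₁ hδ hline
  set ε₃ := min ε₁ (min δ ε₂)
  have hε₃ : 0 < ε₃ := by positivity
  set η := min 1 ε₃ / 27 with hη
  have hη0 : 0 < η := by positivity
  obtain ⟨τ, F, hF, hτ, hτs, hτ4, hτ3⟩ := h.exists_tiling hη0
  obtain ⟨β, lam, hanti, hlam⟩ := (hκ₂.mono (min_le_left _ _)).exists_tile_cochain h.smul_mem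
    h.zero_notMem hε₃
    (fun q hq s hs => hline q hq s (hs.mono ((min_le_right _ _).trans (min_le_left _ _))))
    (fun a ha b hb hab => hsm a ha b hb (hab.mono ((min_le_right _ _).trans (min_le_right _ _))))
    (δ := η) (by linarith [min_le_right 1 ε₃]) (by linarith [min_le_left 1 ε₃]) hτs
  choose γ hγ using fun p => QuotientAddGroup.mk_surjective (s := AddSubgroup.zmultiples (1 : ℝ))
    (α p - β p)
  have hM : ∀ p q, ∃ m : ℤ, p ∈ W → q ∈ W → RelNear η p q →
      χ₁ p q = γ q - γ p + lam (τ p) (τ q) + m := by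
    intro p q
    by_cases hpq : p ∈ W ∧ q ∈ W ∧ RelNear η p q
    · have e1 := hlam p hpq.1 q hpq.2.1 hpq.2.2
      have e2 : ((χ₁ p q - (γ q - γ p + lam (τ p) (τ q)) : ℝ) : UnitAddCircle) = 0 := by
        have hγ' : ∀ p, ((γ p : ℝ) : UnitAddCircle) = α p - β p := hγ
        have e3 : ((χ₁ p q - (γ q - γ p + lam (τ p) (τ q)) : ℝ) : UnitAddCircle) =
            κ p q - (((γ q : ℝ) : UnitAddCircle) - ((γ p : ℝ) : UnitAddCircle)
              + ((lam (τ p) (τ q) : ℝ) : UnitAddCircle)) := rfl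
        have e4 : κ p q = κ₂ p q + α q - α p := by simp only [hκ₂def]; abel
        rw [e3, e4, e1, hγ', hγ']
        abel
      obtain ⟨m, hm⟩ := UnitAddCircle.exists_int_of_coe_eq_zero e2
      exact ⟨m, fun _ _ _ => by linarith⟩
    · exact ⟨0, fun h1 h2 h3 => absurd ⟨h1, h2, h3⟩ hpq⟩
  choose M hM using hM
  have hηε : η ≤ ε₁ := by
    have := min_le_right 1 ε₃
    have := min_le_left ε₁ (min δ ε₂)
    linarith
  have hcob : ∀ a ∈ W, ∀ b ∈ W, ∀ c ∈ W, RelNear η a b → RelNear η b c → RelNear η a c →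
      coboundary χ₁ a b c = coboundary (fun a b => lam (τ a) (τ b)) a b c
        + (M a b + M b c - M a c : ℤ) := by
    intro a ha b hb c hc h1 h2 h3
    simp only [coboundary]
    rw [hM a b ha hb h1, hM b c hb hc h2, hM a c ha hc h3]
    push_cast
    ring
  obtain ⟨N, z, hz, ε₄, hε₄, hzc⟩ := h.exists_tiling_multiple hΩ hF hτ hτ4 hτ3 hanti hη0 (by
    intro a ha b hb c hc h1 h2 h3
    have e1 := hcob a ha b hb c hc h1 h2 h3
    have e2 := hκ a ha b hb c hc (h1.mono hηε) (h2.mono hηε) (h3.mono hηε)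
    simp only [hκdef] at e2
    rw [← AddCircle.coe_add, ← sub_eq_zero, ← AddCircle.coe_sub] at e2
    obtain ⟨m, hm⟩ := UnitAddCircle.exists_int_of_coe_eq_zero e2
    refine ⟨m - (M a b + M b c - M a c), ?_⟩
    rw [Int.cast_sub, ← hm]
    exact eq_sub_of_add_eq e1.symm)
  obtain ⟨ε₅, hε₅, n', -, hn'⟩ := hz
  refine ⟨min η (min ε₀ (min ε₄ ε₅)), by positivity,
    fun a b => (N - k) * w a b + d * n' a b + d * M a b, ?_⟩
  intro a ha b hb c hc h1 h2 h3
  have l1 : min η (min ε₀ (min ε₄ ε₅)) ≤ η := min_le_left _ _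
  have l2 : min η (min ε₀ (min ε₄ ε₅)) ≤ ε₀ := (min_le_right _ _).trans (min_le_left _ _)
  have l3 : min η (min ε₀ (min ε₄ ε₅)) ≤ ε₄ :=
    (min_le_right _ _).trans ((min_le_right _ _).trans (min_le_left _ _))
  have l4 : min η (min ε₀ (min ε₄ ε₅)) ≤ ε₅ :=
    (min_le_right _ _).trans ((min_le_right _ _).trans (min_le_right _ _))
  have e1 := hcob a ha b hb c hc (h1.mono l1) (h2.mono l1) (h3.mono l1)
  have e2 := hwR a ha b hb c hc (h1.mono l2) (h2.mono l2) (h3.mono l2)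
  have e3 := hzc a ha b hb c hc (h1.mono l3) (h2.mono l3) (h3.mono l3)
  have e4 := congrArg (Int.cast : ℤ → ℝ) (hn' a ha b hb c hc (h1.mono l4) (h2.mono l4) (h3.mono l4))
  simp only [coboundary, Pi.sub_apply, Pi.smul_apply, smul_eq_mul] at e4
  push_cast at e4
  rw [e3] at e1
  simp only [coboundary, hχ₁] at e1
  push_cast at e1
  push_cast
  have hkd : ∀ x : ℝ, (k / d * x : ℝ) * d = k * x := fun x => by field_simp
  have e5 : (d : ℝ) * (χ a b + χ b c - χ a c) + k * (w a b + w b c - w a c) =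
      d * ((z a b c : ℝ) + (M a b + M b c - M a c)) := by
    rw [← e1, ← hkd]
    ring
  have e6 : (z a b c : ℝ) = N * Ω a b c + (n' a b + n' b c - n' a c) := by linarith
  rw [e6] at e5
  have e7 : (N : ℝ) * (w a b + w b c - w a c) = N * (d * Ω a b c) := by rw [e2]
  linarith
end ConeCover

theorem Polynomial.exists_roots_eq_map {p : Polynomial ℂ} {d : ℕ} (hd : p.natDegree = d) :
    ∃ r : Fin d → ℂ, p.roots = Multiset.map r Finset.univ.val := by
  have hcard : p.roots.toList.length = d := by
    rw [Multiset.length_toList, IsAlgClosed.card_roots_eq_natDegree, hd]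
  refine ⟨fun j => p.roots.toList.get (j.cast hcard.symm), ?_⟩
  subst hcard
  rw [Fin.univ_val_map]
  conv_lhs => rw [← Multiset.coe_toList p.roots]
  congr 1
  exact (List.ofFn_get _).symm

theorem Polynomial.Monic.eq_prod_of_roots {p : Polynomial ℂ} {d : ℕ} (hm : p.Monic) {r : Fin d → ℂ}
    (hr : p.roots = Multiset.map r Finset.univ.val) :
    p = ∏ j, (Polynomial.X - Polynomial.C (r j)) := by
  rw [(IsAlgClosed.splits p).eq_prod_roots_of_monic hm, hr]
  simp [Finset.prod, Function.comp_def]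

theorem Polynomial.exists_tendsto_roots {ι : Type*} {d : ℕ} {p : ι → Polynomial ℂ}
    {p₀ : Polynomial ℂ} (hm : ∀ i, (p i).Monic) (hd : ∀ i, (p i).natDegree = d)
    (hd₀ : p₀.natDegree = d) (g : Ultrafilter ι)
    (h : ∀ k, Tendsto (fun i => (p i).coeff k) g (𝓝 (p₀.coeff k))) :
    ∃ r : ι → Fin d → ℂ, (∀ i, (p i).roots = Multiset.map (r i) Finset.univ.val) ∧
      ∃ a, Tendsto r g (𝓝 a) ∧ p₀.roots = Multiset.map a Finset.univ.val := by
  choose r hr using fun i => Polynomial.exists_roots_eq_map (hd i)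
  refine ⟨r, hr, ?_⟩
  obtain ⟨M, hM0, hM⟩ : ∃ M : ℝ, 0 ≤ M ∧ ∀ᶠ i in (g : Filter ι), ∀ j, ‖r i j‖ ≤ M := by
    have h1 : ∀ᶠ i in (g : Filter ι), ∀ k ∈ Finset.range d,
        ‖(p i).coeff k‖₊ < ‖p₀.coeff k‖₊ + 1 := by
      rw [Finset.eventually_all]
      intro k _
      exact (h k).nnnorm.eventually_lt_const (lt_add_one _)
    refine ⟨((Finset.range d).sup (fun k => ‖p₀.coeff k‖₊ + 1) + 1 : NNReal),
        NNReal.coe_nonneg _, ?_⟩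
    filter_upwards [h1] with i hi j
    have hroot : (p i).IsRoot (r i j) := by
      have : r i j ∈ (p i).roots := by
        rw [hr]; exact Multiset.mem_map_of_mem _ (Finset.mem_univ j)
      exact (Polynomial.mem_roots (hm i).ne_zero).1 this
    have h2 := hroot.norm_lt_cauchyBound (hm i).ne_zero
    refine h2.le.trans ?_
    unfold Polynomial.cauchyBound
    rw [(hm i).leadingCoeff, hd]
    simp only [nnnorm_one, div_one]
    gcongr with k hk
    exact (hi k hk).le
  have hc : IsCompact (Metric.closedBall (0 : Fin d → ℂ) M) := isCompact_closedBall _ _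
  have hle : ((g.map r : Ultrafilter _) : Filter _) ≤ 𝓟 (Metric.closedBall (0 : Fin d → ℂ) M) := by
    rw [le_principal_iff, Ultrafilter.mem_coe, Ultrafilter.mem_map]
    filter_upwards [hM] with i hi
    simpa [pi_norm_le_iff_of_nonneg hM0] using hi
  obtain ⟨a, -, ha⟩ := hc.ultrafilter_le_nhds _ hle
  have ha' : Tendsto r g (𝓝 a) := ha
  refine ⟨a, ha', ?_⟩
  have key : p₀ = ∏ j, (Polynomial.X - Polynomial.C (a j)) := by
    apply Polynomial.funext
    intro z
    have t1 : Tendsto (fun i => (p i).eval z) g (𝓝 (p₀.eval z)) := by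
      simp only [Polynomial.eval_eq_sum_range, hd, hd₀]
      exact tendsto_finsetSum _ fun k _ => (h k).mul_const _
    have t2 : Tendsto (fun i => (p i).eval z) g
        (𝓝 ((∏ j, (Polynomial.X - Polynomial.C (a j))).eval z)) := by
      have : (fun i => (p i).eval z) = fun i => ∏ j, (z - r i j) := by
        funext i
        conv_lhs => rw [(hm i).eq_prod_of_roots (hr i)]
        simp [Polynomial.eval_prod]
      rw [this]
      simp only [Polynomial.eval_prod, Polynomial.eval_sub, Polynomial.eval_X, Polynomial.eval_C]
      exact tendsto_finsetProd _ fun j _ => tendsto_const_nhds.sub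
          ((continuous_apply j).continuousAt.tendsto.comp ha')
    exact tendsto_nhds_unique t1 t2
  rw [key]
  have := Polynomial.roots_multiset_prod_X_sub_C (Multiset.map a Finset.univ.val)
  rw [← this]
  simp [Finset.prod, Function.comp_def]

theorem Polynomial.eventually_countP_roots {ι : Type*} {l : Filter ι} {d : ℕ}
    {p : ι → Polynomial ℂ} {p₀ : Polynomial ℂ} (hm : ∀ i, (p i).Monic)
    (hd : ∀ i, (p i).natDegree = d) (hd₀ : p₀.natDegree = d)
    (h : ∀ k, Tendsto (fun i => (p i).coeff k) l (𝓝 (p₀.coeff k))) {z : ℂ} {σ : ℝ} (hσ : 0 < σ)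
    (hz : ∀ b ∈ p₀.roots, b ≠ z → σ < dist b z) :
    ∀ᶠ i in l, (p i).roots.countP (fun b => dist b z < σ) = p₀.rootMultiplicity z := by
  classical
  refine mem_iff_ultrafilter.2 fun g hg => ?_
  obtain ⟨r, hr, a, ha, hp₀⟩ := exists_tendsto_roots hm hd hd₀ g fun k => (h k).mono_left hg
  have h1 : ∀ j, ∀ᶠ i in (g : Filter ι), (dist (r i j) z < σ ↔ a j = z) := by
    intro j
    have hj : Tendsto (fun i => dist (r i j) z) g (𝓝 (dist (a j) z)) :=
      ((continuous_apply j).continuousAt.tendsto.comp ha).dist tendsto_const_nhds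
    by_cases hj' : a j = z
    · rw [hj', dist_self] at hj
      filter_upwards [hj.eventually_lt_const hσ] with i hi
      simp [hi, hj']
    · have := hz (a j) (by rw [hp₀]; exact Multiset.mem_map_of_mem _ (Finset.mem_univ j)) hj'
      filter_upwards [hj.eventually_const_lt this] with i hi
      simp [hi.le, hj']
  have h2 := eventually_all.2 h1
  filter_upwards [h2] with i hi
  rw [hr, ← Polynomial.count_roots, hp₀, Multiset.count, Multiset.countP_map,
    Multiset.countP_map]
  congr 1
  refine Multiset.filter_congr fun j _ => ?_
  rw [hi j, eq_comm]

theorem Polynomial.eventually_exists_root_dist_lt {ι : Type*} {l : Filter ι} {d : ℕ}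
    {p : ι → Polynomial ℂ} {p₀ : Polynomial ℂ} (hm : ∀ i, (p i).Monic)
    (hd : ∀ i, (p i).natDegree = d) (hm₀ : p₀.Monic) (hd₀ : p₀.natDegree = d)
    (h : ∀ k, Tendsto (fun i => (p i).coeff k) l (𝓝 (p₀.coeff k))) {σ : ℝ} (hσ : 0 < σ) :
    ∀ᶠ i in l, ∀ z, (p i).eval z = 0 → ∃ a, p₀.eval a = 0 ∧ dist z a < σ := by
  refine mem_iff_ultrafilter.2 fun g hg => ?_
  obtain ⟨r, hr, a, ha, hp₀⟩ := exists_tendsto_roots hm hd hd₀ g fun k => (h k).mono_left hg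
  have h1 : ∀ᶠ i in (g : Filter ι), dist (r i) a < σ := by
    have := ha.dist (tendsto_const_nhds (x := a))
    rw [dist_self] at this
    exact this.eventually_lt_const hσ
  filter_upwards [h1] with i hi z hz
  have hz' : z ∈ (p i).roots := (Polynomial.mem_roots (hm i).ne_zero).2 hz
  rw [hr, Multiset.mem_map] at hz'
  obtain ⟨j, -, rfl⟩ := hz'
  refine ⟨a j, ?_, (dist_le_pi_dist _ _ j).trans_lt hi⟩
  have : a j ∈ p₀.roots := by rw [hp₀]; exact Multiset.mem_map_of_mem _ (Finset.mem_univ j)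
  exact ((Polynomial.mem_roots hm₀.ne_zero).1 this)

theorem Polynomial.eventually_exists_root_near {ι : Type*} {l : Filter ι} {d : ℕ}
    {p : ι → Polynomial ℂ} {p₀ : Polynomial ℂ} (hm : ∀ i, (p i).Monic)
    (hd : ∀ i, (p i).natDegree = d) (hm₀ : p₀.Monic) (hd₀ : p₀.natDegree = d)
    (h : ∀ k, Tendsto (fun i => (p i).coeff k) l (𝓝 (p₀.coeff k))) {z : ℂ} (hz : p₀.eval z = 0)
    {σ : ℝ} (hσ : 0 < σ) :
    ∀ᶠ i in l, ∃ w, (p i).eval w = 0 ∧ dist w z < σ := by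
  refine mem_iff_ultrafilter.2 fun g hg => ?_
  obtain ⟨r, hr, a, ha, hp₀⟩ := exists_tendsto_roots hm hd hd₀ g fun k => (h k).mono_left hg
  have hz' : z ∈ p₀.roots := (Polynomial.mem_roots hm₀.ne_zero).2 hz
  rw [hp₀, Multiset.mem_map] at hz'
  obtain ⟨j, -, rfl⟩ := hz'
  have hj : Tendsto (fun i => dist (r i j) (a j)) g (𝓝 (dist (a j) (a j))) :=
      ((continuous_apply j).continuousAt.tendsto.comp ha).dist tendsto_const_nhds
  rw [dist_self] at hj
  filter_upwards [hj.eventually_lt_const hσ] with i hi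
  refine ⟨r i j, ?_, hi⟩
  have : r i j ∈ (p i).roots := by rw [hr]; exact Multiset.mem_map_of_mem _ (Finset.mem_univ j)
  exact ((Polynomial.mem_roots (hm i).ne_zero).1 this)

/-- A continuous family of monic polynomials of degree `d`. -/
structure MonicFamily {B : Type*} [TopologicalSpace B] (p : B → Polynomial ℂ) (d : ℕ) : Prop where
  monic : ∀ b, (p b).Monic
  natDegree : ∀ b, (p b).natDegree = d
  continuous : ∀ k, Continuous fun b => (p b).coeff k

theorem Finset.exists_pos_lt_dist {α : Type*} [MetricSpace α] (s : Finset α) {η : ℝ} (hη : 0 < η) :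
    ∃ σ > 0, σ < η ∧ ∀ a ∈ s, ∀ b ∈ s, a ≠ b → 5 * σ < dist a b := by
  have h : ∀ᶠ σ in 𝓝[>] (0 : ℝ), ∀ a ∈ s, ∀ b ∈ s, a ≠ b → 5 * σ < dist a b := by
    rw [Finset.eventually_all]
    intro a _
    rw [Finset.eventually_all]
    intro b _
    by_cases hab : a = b
    · simp [hab]
    have : Tendsto (fun σ : ℝ => 5 * σ) (𝓝[>] 0) (𝓝 (5 * 0)) :=
      ((continuous_const.mul continuous_id).tendsto 0).mono_left nhdsWithin_le_nhds
    rw [mul_zero] at this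
    filter_upwards [this.eventually_lt_const (dist_pos.2 hab)] with σ hσ _
    exact hσ
  obtain ⟨σ, h1, h2, h3⟩ := (h.and (Ioo_mem_nhdsGT hη)).exists
  exact ⟨σ, h2, h3, h1⟩

theorem Polynomial.mem_toFinset_roots {p : Polynomial ℂ} (hp : p.Monic) {z : ℂ} :
    z ∈ p.roots.toFinset ↔ p.eval z = 0 := by
  rw [Multiset.mem_toFinset, Polynomial.mem_roots hp.ne_zero, Polynomial.IsRoot]

namespace MonicFamily

variable {B : Type*} [TopologicalSpace B] {p : B → Polynomial ℂ} {d : ℕ}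

theorem exists_sheets (hp : MonicFamily p d) {b₀ : B} {N : ℕ}
    (hN : ∀ᶠ b in 𝓝 b₀, (p b).roots.toFinset.card = N) {η : ℝ} (hη : 0 < η) :
    ∃ σ > 0, σ < η ∧ (∀ a a', (p b₀).eval a = 0 → (p b₀).eval a' = 0 → a ≠ a' →
        5 * σ < dist a a') ∧
      ∀ᶠ b in 𝓝 b₀, (∀ a, (p b₀).eval a = 0 → ∃! z, (p b).eval z = 0 ∧ dist z a < σ) ∧
        (∀ z, (p b).eval z = 0 → ∃ a, (p b₀).eval a = 0 ∧ dist z a < σ) ∧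
        ∀ a z, (p b₀).eval a = 0 → (p b).eval z = 0 → dist z a < σ →
          (p b).rootMultiplicity z = (p b₀).rootMultiplicity a := by
  classical
  obtain ⟨σ, hσ, hση, hsep⟩ := Finset.exists_pos_lt_dist (p b₀).roots.toFinset hη
  simp only [Polynomial.mem_toFinset_roots (hp.monic _)] at hsep
  refine ⟨σ, hσ, hση, fun a a' h h' => hsep a h a' h', ?_⟩
  have hcoeff : ∀ k, Tendsto (fun b => (p b).coeff k) (𝓝 b₀) (𝓝 ((p b₀).coeff k)) :=
    fun k => (hp.continuous k).tendsto b₀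
  have h1 := Polynomial.eventually_exists_root_dist_lt hp.monic hp.natDegree (hp.monic b₀)
    (hp.natDegree b₀) hcoeff hσ
  have h2 : ∀ᶠ b in 𝓝 b₀, ∀ a ∈ (p b₀).roots.toFinset, ∃ w, (p b).eval w = 0 ∧ dist w a < σ := by
    rw [Finset.eventually_all]
    intro a ha
    exact Polynomial.eventually_exists_root_near hp.monic hp.natDegree (hp.monic b₀)
      (hp.natDegree b₀) hcoeff ((Polynomial.mem_toFinset_roots (hp.monic _)).1 ha) hσ
  have h3 : ∀ᶠ b in 𝓝 b₀, ∀ a ∈ (p b₀).roots.toFinset,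
      (p b).roots.countP (fun b => dist b a < σ) = (p b₀).rootMultiplicity a := by
    rw [Finset.eventually_all]
    intro a ha
    refine Polynomial.eventually_countP_roots hp.monic hp.natDegree
      (hp.natDegree b₀) hcoeff hσ fun b hb hba => ?_
    have := hsep b ((Polynomial.mem_roots (hp.monic _).ne_zero).1 hb) a
      ((Polynomial.mem_toFinset_roots (hp.monic _)).1 ha) hba
    linarith
  have hN0 := hN.self_of_nhds
  filter_upwards [h1, h2, h3, hN] with b hb1 hb2 hb3 hbN
  choose! f hf hfd using hb1
  have huniq : ∀ a z, (p b₀).eval a = 0 → (p b).eval z = 0 → dist z a < σ → f z = a := by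
    intro a z ha hz hza
    by_contra hne
    have h4 := hsep (f z) (hf z hz) a ha hne
    have h5 := dist_triangle_left (f z) a z
    have := hfd z hz
    linarith
  have hinj : Set.InjOn f (p b).roots.toFinset := by
    apply Finset.injOn_of_surjOn_of_card_le f (t := (p b₀).roots.toFinset)
    · intro z hz
      rw [Finset.mem_coe, Polynomial.mem_toFinset_roots (hp.monic _)] at *
      exact hf z hz
    · intro a ha
      obtain ⟨w, hw, hwa⟩ := hb2 a ha
      rw [Finset.mem_coe, Polynomial.mem_toFinset_roots (hp.monic _)] at ha
      exact ⟨w, (Finset.mem_coe.2 ((Polynomial.mem_toFinset_roots (hp.monic _)).2 hw)),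
        huniq a w ha hw hwa⟩
    · rw [hbN, hN0]
  have hinj' : ∀ z w, (p b).eval z = 0 → (p b).eval w = 0 → f z = f w → z = w := by
    intro z w hz hw h
    exact hinj (Finset.mem_coe.2 ((Polynomial.mem_toFinset_roots (hp.monic _)).2 hz))
      (Finset.mem_coe.2 ((Polynomial.mem_toFinset_roots (hp.monic _)).2 hw)) h
  refine ⟨fun a ha => ?_, fun z hz => ⟨f z, hf z hz, hfd z hz⟩, fun a z ha hz hza => ?_⟩
  · obtain ⟨w, hw, hwa⟩ := hb2 a ((Polynomial.mem_toFinset_roots (hp.monic _)).2 ha)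
    refine ⟨w, ⟨hw, hwa⟩, ?_⟩
    rintro w' ⟨hw', hwa'⟩
    exact hinj' _ _ hw' hw ((huniq a w' ha hw' hwa').trans (huniq a w ha hw hwa).symm)
  · rw [← hb3 a ((Polynomial.mem_toFinset_roots (hp.monic _)).2 ha), ← Polynomial.count_roots,
      Multiset.count]
    refine Multiset.countP_congr rfl fun w hw => ?_
    have hw' : (p b).eval w = 0 := (Polynomial.mem_roots (hp.monic _).ne_zero).1 hw
    refine propext ⟨?_, ?_⟩
    · rintro rfl
      simpa using hza
    · intro h
      exact hinj' _ _ hz hw' ((huniq a z ha hz hza).trans (huniq a w ha hw'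
          (by simpa using h)).symm)

/-- The total space of the family of root sets. -/
abbrev RootSpace (p : B → Polynomial ℂ) : Type _ := {e : B × ℂ // (p e.1).eval e.2 = 0}

/-- The projection of the root space to the base. -/
def RootSpace.proj (e : RootSpace p) : B := e.1.1

theorem isCoveringMap (hp : MonicFamily p d) {N : ℕ} (hN : ∀ b, (p b).roots.toFinset.card = N) :
    IsCoveringMap (RootSpace.proj (p := p)) := by
  intro b₀
  obtain ⟨σ, hσ, -, hsep, hev⟩ := hp.exists_sheets (b₀ := b₀) (Eventually.of_forall hN) one_pos
  obtain ⟨O, hO, hOo, hOb⟩ := eventually_nhds_iff.1 hev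
  let I := {a : ℂ // (p b₀).eval a = 0}
  let : TopologicalSpace I := ⊥
  have : DiscreteTopology I := ⟨rfl⟩
  have hcont : Continuous (RootSpace.proj (p := p)) := continuous_fst.comp continuous_subtype_val
  have h1 : ∀ e : RootSpace.proj (p := p) ⁻¹' O, ∃ a : I, dist e.1.1.2 a.1 < σ := by
    intro e
    obtain ⟨a, ha, h⟩ := (hO _ e.2).2.1 e.1.1.2 e.1.2
    exact ⟨⟨a, ha⟩, h⟩
  choose f hf using h1
  have huniq : ∀ (e : RootSpace.proj (p := p) ⁻¹' O) (a : I), dist e.1.1.2 a.1 < σ → f e = a := by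
    intro e a ha
    by_contra hne
    have h4 := hsep _ _ (f e).2 a.2 (fun h => hne (Subtype.ext h))
    have h5 := dist_triangle_left (f e).1 a.1 e.1.1.2
    have := hf e
    linarith
  have h2 : ∀ x : O × I, ∃ z, (p x.1).eval z = 0 ∧ dist z x.2.1 < σ := fun x =>
    ((hO _ x.1.2).1 x.2.1 x.2.2).exists
  choose s hs hsd using h2
  have hsuniq : ∀ (x : O × I) z, (p x.1).eval z = 0 → dist z x.2.1 < σ → z = s x :=
      fun x z hz hzd =>
    ((hO _ x.1.2).1 x.2.1 x.2.2).unique ⟨hz, hzd⟩ ⟨hs x, hsd x⟩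
  have hscont : Continuous s := by
    rw [continuous_iff_continuousAt]
    intro x
    rw [ContinuousAt, Metric.tendsto_nhds]
    intro η hη
    have hpos : 0 < min η (σ - dist (s x) x.2.1) := lt_min hη (by linarith [hsd x])
    have := Polynomial.eventually_exists_root_near (l := 𝓝 (x.1 : B)) hp.monic hp.natDegree
      (hp.monic x.1) (hp.natDegree _) (fun k => (hp.continuous k).tendsto _) (hs x) hpos
    have hc : Tendsto (fun y : O × I => (y.1 : B)) (𝓝 x) (𝓝 x.1) :=
      (continuous_subtype_val.comp continuous_fst).tendsto x
    have hI : ∀ᶠ y : O × I in 𝓝 x, x.2 = y.2 :=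
      (continuous_snd.tendsto x).eventually (by
        rw [nhds_discrete]; exact eventually_pure.2 (rfl : x.2 = x.2))
    filter_upwards [hc.eventually this, hI] with y ⟨w, hw, hwd⟩ hy
    have : w = s y := by
      apply hsuniq y w hw
      rw [← hy]
      have h5 := dist_triangle w (s x) x.2.1
      have := lt_min_iff.1 hwd
      linarith
    rw [← this]
    exact (lt_min_iff.1 hwd).1
  refine IsEvenlyCovered.to_isEvenlyCovered_preimage (I := I) ⟨inferInstance, O, hOb, hOo,
      hOo.preimage hcont,
    { toFun := fun e => (⟨e.1.1.1, e.2⟩, f e)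
      invFun := fun x => ⟨⟨(x.1, s x), hs x⟩, x.1.2⟩
      left_inv := ?_
      right_inv := ?_
      continuous_toFun := ?_
      continuous_invFun := ?_ }, fun x => rfl⟩
  · intro e
    apply Subtype.ext
    apply Subtype.ext
    refine Prod.ext rfl ?_
    exact (hsuniq _ _ e.1.2 (hf e)).symm
  · intro x
    refine Prod.ext rfl ?_
    exact huniq _ _ (hsd x)
  · refine Continuous.prodMk ?_ ?_
    · exact Continuous.subtype_mk (hcont.comp continuous_subtype_val) _
    · apply continuous_discrete_rng.2
      intro a
      rw [isOpen_iff_mem_nhds]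
      rintro e rfl
      have hc : Continuous fun e' : RootSpace.proj (p := p) ⁻¹' O => dist e'.1.1.2 (f e).1 :=
        (continuous_snd.comp (continuous_subtype_val.comp continuous_subtype_val)).dist
          continuous_const
      filter_upwards [(hc.tendsto e).eventually_lt_const (hf e)] with e' he'
      exact huniq e' _ he'
  · refine Continuous.subtype_mk (Continuous.subtype_mk (Continuous.prodMk ?_ hscont) _) _
    exact continuous_subtype_val.comp continuous_fst

theorem exists_section [SimplyConnectedSpace B] [LocallyPathConnectedSpace B]
    (hp : MonicFamily p d) {N : ℕ} (hN : ∀ b, (p b).roots.toFinset.card = N) {b : B} {z : ℂ}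
    (hz : (p b).eval z = 0) :
    ∃ s : B → ℂ, Continuous s ∧ s b = z ∧ ∀ b', (p b').eval (s b') = 0 := by
  obtain ⟨F, ⟨h1, h2⟩, -⟩ := (hp.isCoveringMap hN).existsUnique_continuousMap_lifts
    (ContinuousMap.id B) b ⟨(b, z), hz⟩ rfl
  have h3 : ∀ b', (F b').1.1 = b' := fun b' => congrFun h2 b'
  refine ⟨fun b' => (F b').1.2, continuous_snd.comp (continuous_subtype_val.comp F.continuous),
    ?_, fun b' => ?_⟩
  · exact congrArg (fun e : RootSpace p => e.1.2) h1
  · have := (F b').2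
    rwa [h3] at this

theorem section_eq [PreconnectedSpace B]
    (hp : MonicFamily p d) {N : ℕ} (hN : ∀ b, (p b).roots.toFinset.card = N) {s t : B → ℂ}
    (hs : Continuous s) (ht : Continuous t) (hs' : ∀ b, (p b).eval (s b) = 0)
    (ht' : ∀ b, (p b).eval (t b) = 0) {b : B} (hb : s b = t b) : s = t := by
  have hcs : Continuous fun b => (⟨(b, s b), hs' b⟩ : RootSpace p) :=
    Continuous.subtype_mk (continuous_id.prodMk hs) _
  have hct : Continuous fun b => (⟨(b, t b), ht' b⟩ : RootSpace p) :=
    Continuous.subtype_mk (continuous_id.prodMk ht) _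
  have := (hp.isCoveringMap hN).eq_of_comp_eq hcs hct rfl b (by simp [hb])
  funext b'
  have h := congrFun this b'
  exact congrArg (fun e : RootSpace p => e.1.2) h

end MonicFamily

theorem locallyLipschitz_cone {E : Type*} [NormedAddCommGroup E] [NormedSpace ℝ E] (a : E) :
    LocallyLipschitz fun q : ℝ × E => a + q.1 • (q.2 - a) := by
  apply ContDiff.locallyLipschitz (𝕂 := ℝ)
  fun_prop

theorem dimH_cone_le {E : Type*} [NormedAddCommGroup E] [NormedSpace ℝ E] {g : ℂ → E} {K : NNReal}
    (hg : LipschitzWith K g) (a : E) :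
    dimH (Set.range fun q : ℝ × ℂ => a + q.1 • (g q.2 - a)) ≤ 3 := by
  have h2 : LocallyLipschitz fun q : ℝ × ℂ => (q.1, g q.2) :=
    (LipschitzWith.prodMk LipschitzWith.prod_fst (hg.comp LipschitzWith.prod_snd)).locallyLipschitz
  have h3 : LocallyLipschitz fun q : ℝ × ℂ => a + q.1 • (g q.2 - a) :=
    (locallyLipschitz_cone a).comp h2
  refine (dimH_range_le_of_locally_lipschitzOn h3).trans ?_
  rw [Real.dimH_univ_eq_finrank, Module.finrank_prod, Module.finrank_self,
    Complex.finrank_real_complex]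
  norm_num

theorem finrank_real_complex_prod : Module.finrank ℝ (ℂ × ℂ) = 4 := by
  rw [Module.finrank_prod, Complex.finrank_real_complex]

theorem dense_compl_of_subset_lipschitz {ι : Type*} [Countable ι] {g : ι → ℂ → ℂ × ℂ}
    (hg : ∀ i, ∃ K, LipschitzWith K (g i)) {T : Set (ℂ × ℂ)} (hT : T ⊆ ⋃ i, Set.range (g i)) :
    Dense Tᶜ := by
  apply _root_.dense_compl_of_dimH_lt_finrank
  rw [finrank_real_complex_prod]
  refine lt_of_le_of_lt (dimH_mono hT) ?_
  rw [dimH_iUnion]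
  refine lt_of_le_of_lt (iSup_le fun i => ?_) (show (3 : ENNReal) < (4 : ℕ) by norm_num)
  obtain ⟨K, hK⟩ := hg i
  refine hK.dimH_range_le.trans ?_
  rw [Real.dimH_univ_eq_finrank, Complex.finrank_real_complex]
  norm_num

theorem Convex.isPreconnected_diff_of_subset_lipschitz {ι : Type*} [Countable ι]
    {g : ι → ℂ → ℂ × ℂ} (hg : ∀ i, ∃ K, LipschitzWith K (g i)) {T B : Set (ℂ × ℂ)}
    (hT : T ⊆ ⋃ i, Set.range (g i)) (hB : Convex ℝ B) (hBo : IsOpen B) :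
    IsPreconnected (B \ T) := by
  apply isPreconnected_of_forall_pair
  intro a ha b hb
  let cone : (ℂ × ℂ) → Set (ℂ × ℂ) := fun a =>
    ⋃ i, Set.range fun q : ℝ × ℂ => a + q.1 • (g i q.2 - a)
  have hdim : ∀ a, dimH (cone a) ≤ 3 := by
    intro a
    rw [dimH_iUnion]
    refine iSup_le fun i => ?_
    obtain ⟨K, hK⟩ := hg i
    exact dimH_cone_le hK a
  have hd : Dense (cone a ∪ cone b)ᶜ := by
    apply _root_.dense_compl_of_dimH_lt_finrank
    rw [finrank_real_complex_prod, dimH_union]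
    exact lt_of_le_of_lt (max_le (hdim a) (hdim b)) (show (3 : ENNReal) < (4 : ℕ) by norm_num)
  obtain ⟨c, hcB, hc⟩ := hd.inter_open_nonempty B hBo ⟨a, ha.1⟩
  have hseg : ∀ a ∈ B \ T, c ∉ cone a → segment ℝ a c ⊆ B \ T := by
    intro a ha hca x hx
    refine ⟨hB.segment_subset ha.1 hcB hx, fun hxT => hca ?_⟩
    obtain ⟨θ, -, rfl⟩ := segment_eq_image' ℝ a c ▸ hx
    obtain ⟨i, s, hs⟩ := Set.mem_iUnion.1 (hT hxT)
    have hθ : θ ≠ 0 := by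
      rintro rfl
      apply ha.2
      simpa using hxT
    refine Set.mem_iUnion.2 ⟨i, (θ⁻¹, s), ?_⟩
    simp only [hs, add_sub_cancel_left, smul_smul, inv_mul_cancel₀ hθ, one_smul,
      add_sub_cancel]
  refine ⟨segment ℝ a c ∪ segment ℝ b c, Set.union_subset (hseg a ha fun h => hc (Or.inl h))
    (hseg b hb fun h => hc (Or.inr h)), Or.inl (left_mem_segment ℝ a c),
    Or.inr (left_mem_segment ℝ b c), ?_⟩
  exact IsPreconnected.union c (right_mem_segment ℝ a c) (right_mem_segment ℝ b c)
    (convex_segment a c).isPreconnected (convex_segment b c).isPreconnected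

theorem IsOpen.subset_closure_diff_of_subset_lipschitz {ι : Type*} [Countable ι]
    {g : ι → ℂ → ℂ × ℂ} (hg : ∀ i, ∃ K, LipschitzWith K (g i)) {T B : Set (ℂ × ℂ)}
    (hT : T ⊆ ⋃ i, Set.range (g i)) (hBo : IsOpen B) : B ⊆ closure (B \ T) :=
  (dense_compl_of_subset_lipschitz hg hT).open_subset_closure_inter hBo

/-- A homogeneous continuous family of monic polynomials over `ℂ²`, whose number of distinct
roots is constant on the complement of finitely many lines. -/
structure HomogFamily (P : ℂ × ℂ → Polynomial ℂ) (U : Set (ℂ × ℂ)) (d : ℕ) : Prop where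
  family : MonicFamily P d
  scale : ∀ (s : ℂ) (u : ℂ × ℂ), P (s • u) = (P u).scaleRoots s
  isOpen : IsOpen U
  smul_mem : ∀ u ∈ U, ∀ r : ℂ, r ≠ 0 → r • u ∈ U
  fst_ne : ∀ u ∈ U, u.1 ≠ 0
  finite : {t : ℂ | ((1 : ℂ), t) ∉ U}.Finite
  card : ∃ N, ∀ u ∈ U, (P u).roots.toFinset.card = N

/-- The zero set of a family of polynomials over `ℂ²`. -/
def rootCone (P : ℂ × ℂ → Polynomial ℂ) : Set ((ℂ × ℂ) × ℂ) := {q | (P q.1).eval q.2 = 0}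

/-- The part of the zero set of a family of polynomials lying over `U`. -/
def rootConeOver (P : ℂ × ℂ → Polynomial ℂ) (U : Set (ℂ × ℂ)) : Set ((ℂ × ℂ) × ℂ) :=
  {q | q.1 ∈ U ∧ (P q.1).eval q.2 = 0}

/-- Parametrizations of the lines through the origin of `ℂ²`. -/
noncomputable def lineParam {J : Set ℂ} (i : Option J) (s : ℂ) : ℂ × ℂ :=
  match i with
  | none => s • (0, 1)
  | some t => s • (1, (t : ℂ))

theorem lipschitzWith_lineParam {J : Set ℂ} (i : Option J) :
    ∃ K, LipschitzWith K (lineParam i) := by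
  have h : ∀ w : ℂ × ℂ, ∃ K, LipschitzWith K fun s : ℂ => s • w := fun w =>
    ⟨_, ((1 : ℂ →L[ℂ] ℂ).smulRight w).lipschitz⟩
  cases i with
  | none => exact h _
  | some t => exact h _

theorem lineParam_eq_smul {J : Set ℂ} (i : Option J) (s : ℂ) :
    lineParam i s = s • lineParam i 1 := by
  cases i <;> simp [lineParam]

namespace HomogFamily

variable {P : ℂ × ℂ → Polynomial ℂ} {U : Set (ℂ × ℂ)} {d : ℕ}

theorem compl_subset (h : HomogFamily P U d) :
    Uᶜ ⊆ ⋃ i : Option {t : ℂ | ((1 : ℂ), t) ∉ U}, Set.range (lineParam i) := by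
  intro u hu
  by_cases h0 : u.1 = 0
  · refine Set.mem_iUnion.2 ⟨none, u.2, ?_⟩
    ext <;> simp [lineParam, h0]
  · have hmem : ((1 : ℂ), u.2 / u.1) ∉ U := by
      intro hU
      apply hu
      have := h.smul_mem _ hU u.1 h0
      convert this using 1
      ext <;> simp [mul_div_cancel₀, h0]
    refine Set.mem_iUnion.2 ⟨some ⟨u.2 / u.1, hmem⟩, u.1, ?_⟩
    ext <;> simp [lineParam, mul_div_cancel₀, h0]

theorem countable_index (h : HomogFamily P U d) :
    Countable (Option {t : ℂ | ((1 : ℂ), t) ∉ U}) := by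
  have := h.finite.countable.to_subtype
  infer_instance

theorem isPreconnected_inter (h : HomogFamily P U d) {B : Set (ℂ × ℂ)} (hB : Convex ℝ B)
    (hBo : IsOpen B) : IsPreconnected (B ∩ U) := by
  have := h.countable_index
  have := hB.isPreconnected_diff_of_subset_lipschitz lipschitzWith_lineParam h.compl_subset hBo
  rwa [Set.sdiff_compl] at this

theorem dense (h : HomogFamily P U d) : Dense U := by
  have := h.countable_index
  have := dense_compl_of_subset_lipschitz lipschitzWith_lineParam h.compl_subset
  rwa [compl_compl] at this

theorem isPreconnected (h : HomogFamily P U d) : IsPreconnected U := by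
  simpa using h.isPreconnected_inter convex_univ isOpen_univ

theorem eval_smul (h : HomogFamily P U d) (s : ℂ) (u : ℂ × ℂ) (z : ℂ) :
    (P (s • u)).eval (s * z) = s ^ d * (P u).eval z := by
  rw [h.scale, Polynomial.scaleRoots_eval_mul, h.family.natDegree]

theorem smul_mem_rootCone (h : HomogFamily P U d) {q : (ℂ × ℂ) × ℂ} (hq : q ∈ rootCone P) (s : ℂ) :
    s • q ∈ rootCone P := by
  change (P (s • q.1)).eval (s * q.2) = 0
  rw [h.eval_smul, show (P q.1).eval q.2 = 0 from hq, mul_zero]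

theorem smul_mem_rootConeOver (h : HomogFamily P U d) {q : (ℂ × ℂ) × ℂ}
    (hq : q ∈ rootConeOver P U) {s : ℂ} (hs : s ≠ 0) : s • q ∈ rootConeOver P U :=
  ⟨h.smul_mem _ hq.1 s hs, h.smul_mem_rootCone hq.2 s⟩

theorem bound (h : HomogFamily P U d) : ∃ K, 0 < K ∧ ∀ q ∈ rootCone P, ‖q.2‖ ≤ K * ‖q.1‖ := by
  let M : ℂ × ℂ → ℝ := fun u => ∑ k ∈ Finset.range d, ‖(P u).coeff k‖ + 1
  have hM : Continuous M :=
    (continuous_finsetSum _ fun k _ => (h.family.continuous k).norm).add continuous_const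
  have hroot : ∀ u z, (P u).eval z = 0 → ‖z‖ ≤ M u := by
    intro u z hz
    have h1 : (P u).IsRoot z := hz
    have h2 := h1.norm_lt_cauchyBound (h.family.monic u).ne_zero
    have h3 : (P u).cauchyBound ≤ ∑ k ∈ Finset.range d, ‖(P u).coeff k‖₊ + 1 := by
      unfold Polynomial.cauchyBound
      rw [(h.family.monic u).leadingCoeff, h.family.natDegree]
      simp only [nnnorm_one, div_one]
      gcongr
      refine Finset.sup_le fun k hk => ?_
      exact Finset.single_le_sum (f := fun k => ‖(P u).coeff k‖₊) (fun _ _ => zero_le) hk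
    have h4 := h2.le.trans h3
    have h5 : (‖z‖₊ : ℝ) ≤ ((∑ k ∈ Finset.range d, ‖(P u).coeff k‖₊ + 1 : NNReal) : ℝ) := h4
    simpa [M] using h5
  obtain ⟨K, hK⟩ := (isCompact_sphere (0 : ℂ × ℂ) 1).bddAbove_image hM.continuousOn
  have hK' : ∀ u : ℂ × ℂ, ‖u‖ = 1 → M u ≤ K := fun u hu =>
    hK ⟨u, by simpa using hu, rfl⟩
  have hMpos : ∀ u, 0 < M u := fun u => by positivity
  have hKpos : 0 < K := (hMpos (1, 0)).trans_le (hK' (1, 0) (by simp [Prod.norm_def]))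
  refine ⟨K, hKpos, ?_⟩
  rintro ⟨u, z⟩ hq
  by_cases hu : u = 0
  · have h0 := h.family.monic u
    have hs := h.scale 0 u
    have hq' : (P u).eval z = 0 := hq
    have h1 : P u = Polynomial.X ^ d := by
      have : (0 : ℂ) • u = u := by simp [hu]
      rw [← this, hs]
      ext k
      rw [Polynomial.coeff_scaleRoots, Polynomial.coeff_X_pow, h.family.natDegree]
      rcases lt_trichotomy k d with hk | hk | hk
      · rw [zero_pow (by omega), mul_zero, if_neg (by omega)]
      · have := h0.coeff_natDegree
        rw [h.family.natDegree] at this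
        simp [hk, this]
      · rw [Polynomial.coeff_eq_zero_of_natDegree_lt (by rw [h.family.natDegree]; exact hk),
          zero_mul, if_neg (by omega)]
    rw [h1] at hq'
    have hz : z = 0 := by
      rw [Polynomial.eval_pow, Polynomial.eval_X] at hq'
      exact eq_zero_of_pow_eq_zero hq'
    simp [hz, hu]
  · have hn : 0 < ‖u‖ := norm_pos_iff.2 hu
    have h1 := h.smul_mem_rootCone hq ((‖u‖⁻¹ : ℝ) : ℂ)
    have h2 := (hroot _ _ h1).trans (hK' _ (by
      change ‖((‖u‖⁻¹ : ℝ) : ℂ) • u‖ = 1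
      rw [norm_smul, Complex.norm_real, norm_inv, norm_norm, inv_mul_cancel₀ hn.ne']))
    change ‖((‖u‖⁻¹ : ℝ) : ℂ) * z‖ ≤ K at h2
    rw [norm_mul, Complex.norm_real, norm_inv, norm_norm, inv_mul_le_iff₀ hn] at h2
    change ‖z‖ ≤ K * ‖u‖
    linarith

end HomogFamily

theorem MonicFamily.exists_section_ball {P : ℂ × ℂ → Polynomial ℂ} {d N : ℕ} (hp : MonicFamily P d)
    {u₀ : ℂ × ℂ} {r : ℝ} (hN : ∀ u ∈ Metric.ball u₀ r, (P u).roots.toFinset.card = N)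
    {u₁ : ℂ × ℂ} (hu₁ : u₁ ∈ Metric.ball u₀ r) {z : ℂ} (hz : (P u₁).eval z = 0) :
    ∃ s : ℂ × ℂ → ℂ, ContinuousOn s (Metric.ball u₀ r) ∧ s u₁ = z ∧
      ∀ u ∈ Metric.ball u₀ r, (P u).eval (s u) = 0 := by
  classical
  have hr : 0 < r := Metric.pos_of_mem_ball hu₁
  have : ContractibleSpace (Metric.ball u₀ r) :=
    (convex_ball u₀ r).contractibleSpace ⟨u₀, Metric.mem_ball_self hr⟩
  have : LocallyPathConnectedSpace (Metric.ball u₀ r) :=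
      Metric.isOpen_ball.locallyPathConnectedSpace
  have hp' : MonicFamily (fun b : Metric.ball u₀ r => P b) d :=
    ⟨fun b => hp.monic b, fun b => hp.natDegree b,
      fun k => (hp.continuous k).comp continuous_subtype_val⟩
  obtain ⟨s, hs, hsz, hs'⟩ := hp'.exists_section (fun b => hN b b.2) (b := ⟨u₁, hu₁⟩) hz
  refine ⟨fun u => if hu : u ∈ Metric.ball u₀ r then s ⟨u, hu⟩ else 0, ?_, ?_, ?_⟩
  · rw [continuousOn_iff_continuous_domRestrict]
    convert hs using 1
    funext u
    simp [Set.domRestrict]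
  · simp only [hu₁, dif_pos]
    exact hsz
  · intro u hu
    simp only [hu, dif_pos]
    exact hs' _

theorem MonicFamily.section_eq_ball {P : ℂ × ℂ → Polynomial ℂ} {d N : ℕ} (hp : MonicFamily P d)
    {u₀ : ℂ × ℂ} {r : ℝ} (hN : ∀ u ∈ Metric.ball u₀ r, (P u).roots.toFinset.card = N)
    {s t : ℂ × ℂ → ℂ} (hs : ContinuousOn s (Metric.ball u₀ r))
    (ht : ContinuousOn t (Metric.ball u₀ r))
    (hs' : ∀ u ∈ Metric.ball u₀ r, (P u).eval (s u) = 0)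
    (ht' : ∀ u ∈ Metric.ball u₀ r, (P u).eval (t u) = 0)
    {u₁ : ℂ × ℂ} (hu₁ : u₁ ∈ Metric.ball u₀ r) (h : s u₁ = t u₁) :
    ∀ u ∈ Metric.ball u₀ r, s u = t u := by
  have hp' : MonicFamily (fun b : Metric.ball u₀ r => P b) d :=
    ⟨fun b => hp.monic b, fun b => hp.natDegree b,
      fun k => (hp.continuous k).comp continuous_subtype_val⟩
  have : PreconnectedSpace (Metric.ball u₀ r) :=
    Subtype.preconnectedSpace (convex_ball u₀ r).isPreconnected
  have := hp'.section_eq (fun b => hN b b.2) (continuousOn_iff_continuous_domRestrict.1 hs)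
    (continuousOn_iff_continuous_domRestrict.1 ht) (fun b => hs' b b.2) (fun b => ht' b b.2)
    (b := ⟨u₁, hu₁⟩) h
  intro u hu
  exact congrFun this ⟨u, hu⟩

theorem exists_equiv_of_card_fiber_eq {α β γ : Type*} [Finite α] [Finite β] (f : α → γ) (g : β → γ)
    (h : ∀ c, Nat.card {x // f x = c} = Nat.card {y // g y = c}) :
    ∃ e : α ≃ β, ∀ x, g (e x) = f x := by
  have h1 : ∀ c, Nonempty ({x // f x = c} ≃ {y // g y = c}) := fun c =>
    Finite.card_eq.1 (h c)
  let e := fun c => (h1 c).some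
  refine ⟨(Equiv.sigmaFiberEquiv f).symm.trans ((Equiv.sigmaCongrRight e).trans
    (Equiv.sigmaFiberEquiv g)), fun x => ?_⟩
  exact (e (f x) ⟨x, rfl⟩).2

theorem graph_isPreconnected {s : ℂ × ℂ → ℂ} {B : Set (ℂ × ℂ)} (hB : IsPreconnected B)
    (hs : ContinuousOn s B) : IsPreconnected ((fun u => (u, s u)) '' B) :=
  hB.image _ (continuousOn_id.prodMk hs)

namespace HomogFamily

variable {P : ℂ × ℂ → Polynomial ℂ} {U : Set (ℂ × ℂ)} {d : ℕ}

theorem finite_roots (h : HomogFamily P U d) (u : ℂ × ℂ) : {z | (P u).eval z = 0}.Finite := by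
  refine (P u).roots.toFinset.finite_toSet.subset fun z hz => ?_
  exact (Polynomial.mem_toFinset_roots (h.family.monic u)).2 hz

theorem finite_fiber (h : HomogFamily P U d) {A : Set ((ℂ × ℂ) × ℂ)} (hA : A ⊆ rootConeOver P U)
    (u : ℂ × ℂ) : Finite {z // (u, z) ∈ A} :=
  ((h.finite_roots u).subset fun z (hz : (u, z) ∈ A) => (hA hz).2).to_subtype

/-- A union of sheets has fibers of constant cardinality over a connected base. -/
theorem card_fiber_eq (h : HomogFamily P U d) {A : Set ((ℂ × ℂ) × ℂ)} {D : Set (ℂ × ℂ)}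
    (hD : IsPreconnected D) (hDo : IsOpen D) (hDU : D ⊆ U) (hA : A ⊆ rootConeOver P U)
    (hAG : ∀ G : Set ((ℂ × ℂ) × ℂ), IsPreconnected G → (∀ q ∈ G, q.1 ∈ D) → G ⊆ rootConeOver P U →
      (G ∩ A).Nonempty → G ⊆ A) {u v : ℂ × ℂ} (hu : u ∈ D) (hv : v ∈ D) :
    Nat.card {z // (u, z) ∈ A} = Nat.card {z // (v, z) ∈ A} := by
  obtain ⟨N, hN⟩ := h.card
  refine hD.constant (f := fun u => Nat.card {z // (u, z) ∈ A}) ?_ hu hv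
  intro u₀ hu₀
  obtain ⟨r, hr, hball⟩ := Metric.isOpen_iff.1 hDo u₀ hu₀
  refine ContinuousAt.continuousWithinAt ?_
  have hloc : ∀ u₁ ∈ Metric.ball u₀ r,
      Nat.card {z // (u₀, z) ∈ A} = Nat.card {z // (u₁, z) ∈ A} := by
    intro u₁ hu₁
    have hNb : ∀ u ∈ Metric.ball u₀ r, (P u).roots.toFinset.card = N := fun u hu =>
      hN u (hDU (hball hu))
    have hu₀b := Metric.mem_ball_self (x := u₀) hr
    have hsec : ∀ z : {z // (u₀, z) ∈ A}, ∃ s : ℂ × ℂ → ℂ, ContinuousOn s (Metric.ball u₀ r) ∧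
        s u₀ = z.1 ∧ (∀ u ∈ Metric.ball u₀ r, (P u).eval (s u) = 0) :=
      fun z => h.family.exists_section_ball hNb hu₀b (hA z.2).2
    choose s hsc hsz hs using hsec
    have hsub : ∀ t : ℂ × ℂ → ℂ, ContinuousOn t (Metric.ball u₀ r) →
        (∀ u ∈ Metric.ball u₀ r, (P u).eval (t u) = 0) → ∀ u ∈ Metric.ball u₀ r, (u, t u) ∈ A →
        ∀ u' ∈ Metric.ball u₀ r, (u', t u') ∈ A := by
      intro t htc ht u hu hut u' hu'
      refine hAG _ (graph_isPreconnected (convex_ball u₀ r).isPreconnected htc) ?_ ?_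
        ⟨(u, t u), ⟨u, hu, rfl⟩, hut⟩ ⟨u', hu', rfl⟩
      · rintro _ ⟨w, hw, rfl⟩
        exact hball hw
      · rintro _ ⟨w, hw, rfl⟩
        exact ⟨hDU (hball hw), ht w hw⟩
    refine Nat.card_congr (Equiv.ofBijective (fun z => ⟨s z u₁, hsub _ (hsc z) (hs z) u₀ hu₀b
      (by rw [hsz]; exact z.2) u₁ hu₁⟩) ⟨?_, ?_⟩)
    · intro z w hzw
      have := h.family.section_eq_ball hNb (hsc z) (hsc w) (hs z) (hs w) hu₁
        (congrArg Subtype.val hzw) u₀ hu₀b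
      rw [hsz, hsz] at this
      exact Subtype.ext this
    · rintro ⟨w, hw⟩
      obtain ⟨t, htc, htw, ht⟩ := h.family.exists_section_ball hNb hu₁ (hA hw).2
      have ht0 := hsub t htc ht u₁ hu₁ (by rw [htw]; exact hw) u₀ hu₀b
      refine ⟨⟨t u₀, ht0⟩, Subtype.ext ?_⟩
      have := h.family.section_eq_ball hNb (hsc ⟨t u₀, ht0⟩) htc (hs _) ht hu₀b (hsz _) u₁ hu₁
      exact this.trans htw
  refine continuousAt_const.congr (f := fun _ => Nat.card {z // (u₀, z) ∈ A}) ?_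
  filter_upwards [Metric.ball_mem_nhds u₀ hr] with u₁ hu₁
  exact hloc u₁ hu₁

theorem component_closed (q : (ℂ × ℂ) × ℂ) {G : Set ((ℂ × ℂ) × ℂ)}
    (hG : IsPreconnected G) (hGU : G ⊆ rootConeOver P U)
    (hne : (G ∩ connectedComponentIn (rootConeOver P U) q).Nonempty) :
    G ⊆ connectedComponentIn (rootConeOver P U) q := by
  obtain ⟨p, hpG, hp⟩ := hne
  rw [connectedComponentIn_eq hp]
  exact hG.subset_connectedComponentIn hpG hGU

theorem smul_mem_component (h : HomogFamily P U d) (q : (ℂ × ℂ) × ℂ) {p : (ℂ × ℂ) × ℂ}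
    (hp : p ∈ connectedComponentIn (rootConeOver P U) q) {r : ℂ} (hr : r ≠ 0) :
    r • p ∈ connectedComponentIn (rootConeOver P U) q := by
  have hpC := connectedComponentIn_subset _ _ hp
  have hpre : IsPreconnected ({0}ᶜ : Set ℂ) :=
    (isConnected_compl_singleton_of_one_lt_rank (by simp) (0 : ℂ)).isPreconnected
  refine component_closed q (hpre.image (fun s : ℂ => s • p) (by fun_prop)) ?_
    ⟨p, ⟨1, by simp, by simp⟩, hp⟩ ⟨r, hr, rfl⟩
  rintro _ ⟨s, hs, rfl⟩
  exact h.smul_mem_rootConeOver hpC hs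

theorem eventually_roots_near (h : HomogFamily P U d) (u₀ : ℂ × ℂ) {η : ℝ} (hη : 0 < η) :
    ∃ σ > 0, σ < η ∧ (∀ a b, (P u₀).eval a = 0 → (P u₀).eval b = 0 → a ≠ b → 5 * σ < dist a b) ∧
      ∃ r > 0, ∀ q ∈ rootCone P, dist q.1 u₀ < r → ∃ a, (P u₀).eval a = 0 ∧ dist q.2 a < σ / 2 := by
  classical
  obtain ⟨σ, hσ, hση, hsep⟩ := Finset.exists_pos_lt_dist (P u₀).roots.toFinset hη
  simp only [Polynomial.mem_toFinset_roots (h.family.monic _)] at hsep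
  have h1 := Polynomial.eventually_exists_root_dist_lt (l := 𝓝 u₀) h.family.monic h.family.natDegree
    (h.family.monic u₀) (h.family.natDegree u₀) (fun k => (h.family.continuous k).tendsto u₀)
    (half_pos hσ)
  obtain ⟨r, hr, hball⟩ := Metric.eventually_nhds_iff.1 h1
  exact ⟨σ, hσ, hση, fun a b ha hb => hsep a ha b hb, r, hr, fun q hq hqr => hball hqr _ hq⟩

theorem local_matching (h : HomogFamily P U d) (q₀ : (ℂ × ℂ) × ℂ) (u₀ : ℂ × ℂ)
    {η : ℝ} (hη : 0 < η) :
    ∃ r > 0, ∀ u ∈ U, ∀ v ∈ U, dist u u₀ < r → dist v u₀ < r →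
      ∃ e : {z // (u, z) ∈ connectedComponentIn (rootConeOver P U) q₀} ≃
        {z // (v, z) ∈ connectedComponentIn (rootConeOver P U) q₀}, ∀ z, dist z.1 (e z).1 < η := by
  set W := connectedComponentIn (rootConeOver P U) q₀ with hW
  have hWsub : W ⊆ rootConeOver P U := connectedComponentIn_subset _ _
  obtain ⟨σ, hσ, hση, hsep, r, hr, hnear⟩ := h.eventually_roots_near u₀ hη
  refine ⟨r, hr, fun u hu v hv hur hvr => ?_⟩
  have hfu := h.finite_fiber hWsub u
  have hfv := h.finite_fiber hWsub v
  choose! c hc hcd using hnear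
  have hcuniq : ∀ q ∈ rootCone P, dist q.1 u₀ < r → ∀ a, (P u₀).eval a = 0 → dist q.2 a < σ →
      c q = a := by
    intro q hq hqr a ha hqa
    by_contra hne
    have h1 := hsep _ _ (hc q hq hqr) ha hne
    have h2 := hcd q hq hqr
    have h3 := dist_triangle_left (c q) a q.2
    linarith
  obtain ⟨e, he⟩ := exists_equiv_of_card_fiber_eq
    (fun z : {z // (u, z) ∈ W} => c (u, z.1)) (fun z : {z // (v, z) ∈ W} => c (v, z.1)) (by
      intro a
      by_cases ha : (P u₀).eval a = 0
      swap
      · have h1 : ∀ w, dist w u₀ < r → IsEmpty {z : {z // (w, z) ∈ W} // c (w, z.1) = a} := by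
          intro w hw
          refine ⟨fun z => ha ?_⟩
          rw [← z.2]
          exact hc _ (hWsub z.1.2).2 hw
        have := h1 u hur
        have := h1 v hvr
        rw [Nat.card_of_isEmpty, Nat.card_of_isEmpty]
      let A : Set ((ℂ × ℂ) × ℂ) := {q | q ∈ W ∧ dist q.1 u₀ < r ∧ dist q.2 a < σ}
      have hcA : ∀ w, dist w u₀ < r →
          Nat.card {z : {z // (w, z) ∈ W} // c (w, z.1) = a} = Nat.card {z // (w, z) ∈ A} := by
        intro w hw
        refine Nat.card_congr ⟨fun z => ⟨z.1.1, z.1.2, hw, ?_⟩, fun z => ⟨⟨z.1, z.2.1⟩, ?_⟩,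
          fun z => rfl, fun z => rfl⟩
        · have := hcd _ (hWsub z.1.2).2 hw
          rw [z.2] at this
          change dist z.1.1 a < σ
          exact this.trans (by linarith)
        · exact hcuniq _ (hWsub z.2.1).2 hw a ha z.2.2.2
      rw [hcA u hur, hcA v hvr]
      refine h.card_fiber_eq (D := Metric.ball u₀ r ∩ U)
        (h.isPreconnected_inter (convex_ball u₀ r) Metric.isOpen_ball)
        (Metric.isOpen_ball.inter h.isOpen) Set.inter_subset_right (fun q hq => hWsub hq.1) ?_
        ⟨hur, hu⟩ ⟨hvr, hv⟩
      rintro G hG hGD hGU ⟨p, hpG, hpA⟩ q hqG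
      have hGW : G ⊆ W := component_closed q₀ hG hGU ⟨p, hpG, hpA.1⟩
      refine ⟨hGW hqG, (hGD q hqG).1, ?_⟩
      by_contra hqa
      have hpre := hG {q | dist q.2 a < σ} {q | σ < dist q.2 a}
        (isOpen_lt (by fun_prop) (by fun_prop)) (isOpen_lt (by fun_prop) (by fun_prop)) (by
          intro x hx
          by_cases hxa : dist x.2 a < σ
          · exact Or.inl hxa
          · right
            have hxC := (hGU hx).2
            have hxr := (hGD x hx).1
            have h2 := hcd x hxC hxr
            have hne : c x ≠ a := by
              intro h3
              rw [h3] at h2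
              exact hxa (h2.trans (by linarith))
            have h1 := hsep _ _ (hc x hxC hxr) ha hne
            have h3 := dist_triangle_left (c x) a x.2
            change σ < dist x.2 a
            linarith)
        ⟨p, hpG, hpA.2.2⟩ ⟨q, hqG, by
          have hxC := (hGU hqG).2
          have hxr := (hGD q hqG).1
          have h2 := hcd q hxC hxr
          have hne : c q ≠ a := by
            intro h3
            rw [h3] at h2
            exact hqa (h2.trans (by linarith))
          have h1 := hsep _ _ (hc q hxC hxr) ha hne
          have h3 := dist_triangle_left (c q) a q.2
          change σ < dist q.2 a
          linarith⟩
      obtain ⟨x, -, hx1, hx2⟩ := hpre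
      exact lt_asymm (show dist x.2 a < σ from hx1) hx2)
  refine ⟨e, fun z => ?_⟩
  have h1 := hcd _ (hWsub z.2).2 hur
  have h2 := hcd _ (hWsub (e z).2).2 hvr
  have h3 := he z
  rw [h3] at h2
  have := dist_triangle_right z.1 (e z).1 (c (u, z.1))
  linarith

theorem coneCover (h : HomogFamily P U d) {q₀ : (ℂ × ℂ) × ℂ} (hq₀ : q₀ ∈ rootConeOver P U) :
    ConeCover (connectedComponentIn (rootConeOver P U) q₀) U
      (Nat.card {z // (q₀.1, z) ∈ connectedComponentIn (rootConeOver P U) q₀}) := by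
  set W := connectedComponentIn (rootConeOver P U) q₀ with hW
  have hWsub : W ⊆ rootConeOver P U := connectedComponentIn_subset _ _
  have hq₀W : q₀ ∈ W := mem_connectedComponentIn hq₀
  refine ⟨fun q hq r hr => h.smul_mem_component q₀ hq hr, h.smul_mem, fun q hq => (hWsub hq).1,
    h.fst_ne, h.finite, ?_, isPreconnected_connectedComponentIn, ?_, ?_, ?_, ?_⟩
  · obtain ⟨K, -, hK⟩ := h.bound
    exact ⟨K, fun q hq => hK q (hWsub hq).2⟩
  · have := h.finite_fiber hWsub q₀.1
    have : Nonempty {z // (q₀.1, z) ∈ W} := ⟨⟨q₀.2, hq₀W⟩⟩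
    exact Nat.card_pos
  · intro u hu
    exact h.card_fiber_eq h.isPreconnected h.isOpen subset_rfl hWsub
      (fun G hG _ hGU hne => component_closed q₀ hG hGU hne) hu (hWsub hq₀W).1
  · intro u₀ _ η hη
    obtain ⟨σ, hσ, hση, hsep, r, hr, hnear⟩ := h.eventually_roots_near u₀ hη
    refine ⟨σ, hσ, hση, r, hr, fun q hq q' hq' hqr hqr' => ?_⟩
    obtain ⟨a, ha, hqa⟩ := hnear q (hWsub hq).2 hqr
    obtain ⟨b, hb, hqb⟩ := hnear q' (hWsub hq').2 hqr'
    by_cases hab : a = b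
    · subst hab
      left
      have := dist_triangle_right q.2 q'.2 a
      linarith
    · right
      have h1 := hsep a b ha hb hab
      have h2 := dist_triangle4_left q.2 q'.2 a b
      have h3 := dist_triangle4 a q.2 q'.2 b
      rw [dist_comm a q.2] at h3
      linarith
  · intro ε hε
    have hη : 0 < ε / 2 := by positivity
    choose r hr hmatch using fun u₀ : ℂ × ℂ => h.local_matching q₀ u₀ hη
    obtain ⟨δ₀, hδ₀, hleb⟩ := lebesgue_number_lemma_of_metric (isCompact_sphere (0 : ℂ × ℂ) 1)
      (c := fun u₀ : ℂ × ℂ => Metric.ball u₀ (r u₀)) (fun _ => Metric.isOpen_ball)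
      (fun u _ => Set.mem_iUnion.2 ⟨u, Metric.mem_ball_self (hr u)⟩)
    refine ⟨min δ₀ (min (ε / 2) (1 / 4)), by positivity, fun u hu v hv huv => ?_⟩
    have hu0 : u ≠ 0 := huv.ne_zero
    have hn : 0 < ‖u‖ := norm_pos_iff.2 hu0
    set t : ℂ := ((‖u‖⁻¹ : ℝ) : ℂ) with ht
    have htn : ‖t‖ = ‖u‖⁻¹ := by rw [ht, Complex.norm_real, norm_inv, norm_norm]
    have ht0 : t ≠ 0 := by
      rw [← norm_ne_zero_iff, htn]
      exact inv_ne_zero hn.ne'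
    have huv0 : ‖u - v‖ < min δ₀ (min (ε / 2) (1 / 4)) * ‖u‖ := huv.1
    have hd1 : ‖u - v‖ < δ₀ * ‖u‖ := huv0.trans_le (by gcongr; exact min_le_left _ _)
    have hd2 : ‖u - v‖ < ε / 2 * ‖u‖ := huv0.trans_le (by
      gcongr; exact (min_le_right _ _).trans (min_le_left _ _))
    have hd3 : ‖u - v‖ < 1 / 4 * ‖u‖ := huv0.trans_le (by
      gcongr; exact (min_le_right _ _).trans (min_le_right _ _))
    have htu : t • u ∈ Metric.sphere (0 : ℂ × ℂ) 1 := by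
      rw [mem_sphere_zero_iff_norm, norm_smul, htn, inv_mul_cancel₀ hn.ne']
    obtain ⟨u₀, hu₀⟩ := hleb _ htu
    have htv : t • v ∈ Metric.ball (t • u) δ₀ := by
      rw [Metric.mem_ball, dist_comm, dist_eq_norm, ← smul_sub, norm_smul, htn,
        inv_mul_lt_iff₀ hn]
      linarith
    obtain ⟨e, he⟩ := hmatch u₀ (t • u) (h.smul_mem u hu t ht0) (t • v) (h.smul_mem v hv t ht0)
      (hu₀ (Metric.mem_ball_self hδ₀)) (hu₀ htv)
    have hs : ∀ w : ℂ × ℂ, ∃ f : {z // (w, z) ∈ W} ≃ {z // (t • w, z) ∈ W},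
        ∀ z, (f z).1 = t * z.1 := by
      intro w
      refine ⟨⟨fun z => ⟨t * z.1, h.smul_mem_component q₀ z.2 ht0⟩,
        fun z => ⟨t⁻¹ * z.1, ?_⟩, fun z => ?_, fun z => ?_⟩, fun z => rfl⟩
      · have := h.smul_mem_component q₀ z.2 (inv_ne_zero ht0)
        rwa [Prod.smul_mk, smul_smul, inv_mul_cancel₀ ht0, one_smul] at this
      · exact Subtype.ext (inv_mul_cancel_left₀ ht0 _)
      · exact Subtype.ext (mul_inv_cancel_left₀ ht0 _)
    obtain ⟨fu, hfu⟩ := hs u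
    obtain ⟨fv, hfv⟩ := hs v
    refine ⟨fu.trans (e.trans fv.symm), fun z => ?_⟩
    set w := (fu.trans (e.trans fv.symm)) z with hw
    have h1 : e (fu z) = fv w := by simp [hw]
    have h2 := he (fu z)
    rw [h1, hfu, hfv, dist_eq_norm, ← mul_sub, norm_mul, htn, inv_mul_lt_iff₀ hn] at h2
    have h3 : ‖(u, z.1) - (v, w.1)‖ < ε / 2 * ‖u‖ := by
      rw [Prod.mk_sub_mk, Prod.norm_mk]
      exact max_lt hd2 (by linarith)
    have h4 : ‖u‖ ≤ 2 * ‖v‖ := by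
      have := norm_sub_norm_le u v
      linarith
    constructor
    · refine h3.trans_le ?_
      have : ‖u‖ ≤ ‖(u, z.1)‖ := le_max_left _ _
      nlinarith
    · refine h3.trans_le ?_
      have : ‖v‖ ≤ ‖(v, w.1)‖ := le_max_left _ _
      nlinarith

end HomogFamily

section TangentMap

variable {V V' : Type*} [NormedAddCommGroup V] [NormedSpace ℂ V] [NormedAddCommGroup V']
  [NormedSpace ℂ V']

/-- `C` is the asymptotic cone of `X` along the ultrafilter `ω`. -/
structure IsAsymptoticCone (ω : Ultrafilter ℕ) (X C : Set V) : Prop where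
  le_atTop : (ω : Filter ℕ) ≤ atTop
  exists_seq : ∀ v ∈ C, ∃ x : ℕ → V, (∀ᶠ n in (ω : Filter ℕ), x n ∈ X) ∧
    Tendsto (fun n : ℕ => (n : ℂ)⁻¹ • x n) ω (𝓝 v)
  mem : ∀ v, ∀ x : ℕ → V, (∀ᶠ n in (ω : Filter ℕ), x n ∈ X) →
    Tendsto (fun n : ℕ => (n : ℂ)⁻¹ • x n) ω (𝓝 v) → v ∈ C

theorem norm_inv_smul_sub_le {n : ℕ} {a b : V} {a' b' : V'} {C : ℝ}
    (h : dist a b ≤ C * dist a' b') :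
    dist ((n : ℂ)⁻¹ • a) ((n : ℂ)⁻¹ • b) ≤ C * dist ((n : ℂ)⁻¹ • a') ((n : ℂ)⁻¹ • b') := by
  rw [dist_smul₀, dist_smul₀]
  calc _ ≤ ‖(n : ℂ)⁻¹‖ * (C * dist a' b') := by gcongr
    _ = _ := by ring

theorem tendsto_inv_smul_const {ω : Ultrafilter ℕ} (hω : (ω : Filter ℕ) ≤ atTop) (y : V) :
    Tendsto (fun n : ℕ => (n : ℂ)⁻¹ • y) ω (𝓝 0) := by
  simpa using ((tendsto_inv_atTop_nhds_zero_nat (𝕜 := ℂ)).mono_left hω).smul_const y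

/-- A Lipschitz map induces a map of asymptotic cones. -/
theorem IsAsymptoticCone.exists_map [ProperSpace V'] {ω : Ultrafilter ℕ} {X C : Set V}
    {X' C' : Set V'} (h : IsAsymptoticCone ω X C) (h' : IsAsymptoticCone ω X' C')
    {φ : V → V'} (hφ : Set.MapsTo φ X X') {L : ℝ} (hL : 0 < L)
    (hLip : ∀ a ∈ X, ∀ b ∈ X, dist (φ a) (φ b) ≤ L * dist a b) :
    ∃ ψ : V → V', Set.MapsTo ψ C C' ∧ (∀ a ∈ C, ∀ b ∈ C, dist (ψ a) (ψ b) ≤ L * dist a b) ∧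
      ∀ v ∈ C, ∀ x : ℕ → V, (∀ᶠ n in (ω : Filter ℕ), x n ∈ X) →
        Tendsto (fun n : ℕ => (n : ℂ)⁻¹ • x n) ω (𝓝 v) →
        Tendsto (fun n : ℕ => (n : ℂ)⁻¹ • φ (x n)) ω (𝓝 (ψ v)) := by
  classical
  have key : ∀ v : C, ∃ w : V', ∀ x : ℕ → V, (∀ᶠ n in (ω : Filter ℕ), x n ∈ X) →
      Tendsto (fun n : ℕ => (n : ℂ)⁻¹ • x n) ω (𝓝 v) →
      Tendsto (fun n : ℕ => (n : ℂ)⁻¹ • φ (x n)) ω (𝓝 w) := by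
    rintro ⟨v, hv⟩
    obtain ⟨x, hx, hxv⟩ := h.exists_seq v hv
    obtain ⟨n₀, hn₀⟩ := hx.exists
    have hbdd : ∀ᶠ n : ℕ in (ω : Filter ℕ), (n : ℂ)⁻¹ • φ (x n) ∈
        Metric.closedBall (0 : V') (1 + L * (‖v‖ + 2)) := by
      have h1 : Tendsto (fun n : ℕ => (n : ℂ)⁻¹ • φ (x n₀)) ω (𝓝 0) :=
        tendsto_inv_smul_const h.le_atTop _
      have h2 : Tendsto (fun n : ℕ => (n : ℂ)⁻¹ • x n₀) ω (𝓝 0) :=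
        tendsto_inv_smul_const h.le_atTop _
      filter_upwards [hx, Metric.tendsto_nhds.1 h1 1 one_pos, Metric.tendsto_nhds.1 h2 1 one_pos,
        Metric.tendsto_nhds.1 hxv 1 one_pos] with n a1 a2 a3 a4
      rw [Metric.mem_closedBall]
      have a5 := norm_inv_smul_sub_le (n := n) (hLip _ a1 _ hn₀)
      have a6 : dist ((n : ℂ)⁻¹ • x n) ((n : ℂ)⁻¹ • x n₀) ≤ ‖v‖ + 2 := by
        have := dist_triangle4 ((n : ℂ)⁻¹ • x n) v 0 ((n : ℂ)⁻¹ • x n₀)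
        rw [dist_zero_right, dist_comm (0 : V)] at this
        linarith
      have a7 := dist_triangle ((n : ℂ)⁻¹ • φ (x n)) ((n : ℂ)⁻¹ • φ (x n₀)) 0
      have := mul_le_mul_of_nonneg_left a6 hL.le
      linarith
    obtain ⟨w, -, hw⟩ := (isCompact_closedBall (0 : V') (1 + L * (‖v‖ + 2))).ultrafilter_le_nhds
      (ω.map fun n : ℕ => (n : ℂ)⁻¹ • φ (x n)) (Filter.le_principal_iff.2 hbdd)
    have hw' : Tendsto (fun n : ℕ => (n : ℂ)⁻¹ • φ (x n)) ω (𝓝 w) := hw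
    refine ⟨w, fun y hy hyv => ?_⟩
    have hd : Tendsto (fun n : ℕ => L * dist ((n : ℂ)⁻¹ • y n) ((n : ℂ)⁻¹ • x n)) ω (𝓝 0) := by
      simpa using (hyv.dist hxv).const_mul L
    refine tendsto_of_tendsto_of_dist hw' (squeeze_zero' (Eventually.of_forall fun _ =>
      dist_nonneg) ?_ hd)
    filter_upwards [hx, hy] with n a1 a2
    rw [dist_comm]
    exact norm_inv_smul_sub_le (hLip _ a2 _ a1)
  choose ψ hψ using key
  refine ⟨fun v => if hv : v ∈ C then ψ ⟨v, hv⟩ else 0, fun v hv => ?_, fun a ha b hb => ?_,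
    fun v hv x hx hxv => ?_⟩
  · obtain ⟨x, hx, hxv⟩ := h.exists_seq v hv
    simp only [hv, dif_pos]
    exact h'.mem _ (fun n => φ (x n)) (hx.mono fun n hn => hφ hn) (hψ _ x hx hxv)
  · obtain ⟨x, hx, hxv⟩ := h.exists_seq a ha
    obtain ⟨y, hy, hyv⟩ := h.exists_seq b hb
    simp only [ha, hb, dif_pos]
    refine le_of_tendsto_of_tendsto ((hψ ⟨a, ha⟩ x hx hxv).dist (hψ ⟨b, hb⟩ y hy hyv))
      ((hxv.dist hyv).const_mul L) ?_
    filter_upwards [hx, hy] with n a1 a2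
    exact norm_inv_smul_sub_le (hLip _ a1 _ a2)
  · simp only [hv, dif_pos]
    exact hψ ⟨v, hv⟩ x hx hxv

/-- The map between asymptotic cones induced by a bi-Lipschitz map, with its inverse. -/
structure ConeMap (ω : Ultrafilter ℕ) (X C : Set V) (X' C' : Set V') (φ : V → V') (φ' : V' → V)
    (ψ : V → V') (ψ' : V' → V) (L : ℝ) : Prop where
  pos : 0 < L
  cone : IsAsymptoticCone ω X C
  mapsTo : Set.MapsTo φ X X'
  leftInv : ∀ x ∈ X, φ' (φ x) = x
  dist_le : ∀ a ∈ X, ∀ b ∈ X, dist (φ a) (φ b) ≤ L * dist a b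
  map_mem : Set.MapsTo ψ C C'
  leftInv_map : ∀ x ∈ C, ψ' (ψ x) = x
  dist_map_le : ∀ a ∈ C, ∀ b ∈ C, dist (ψ a) (ψ b) ≤ L * dist a b
  tendsto : ∀ v ∈ C, ∀ x : ℕ → V, (∀ᶠ n in (ω : Filter ℕ), x n ∈ X) →
    Tendsto (fun n : ℕ => (n : ℂ)⁻¹ • x n) ω (𝓝 v) →
    Tendsto (fun n : ℕ => (n : ℂ)⁻¹ • φ (x n)) ω (𝓝 (ψ v))
  map_zero : 0 ∈ C → ψ 0 = 0

theorem IsAsymptoticCone.exists_coneMap [ProperSpace V] [ProperSpace V'] {ω : Ultrafilter ℕ}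
    {X C : Set V} {X' C' : Set V'} (h : IsAsymptoticCone ω X C) (h' : IsAsymptoticCone ω X' C')
    (hX : X.Nonempty) {φ : V → V'} (hφ : Set.BijOn φ X X')
    (hL₁ : ∃ L > 0, ∀ a ∈ X, ∀ b ∈ X, dist (φ a) (φ b) ≤ L * dist a b)
    (hL₂ : ∃ L > 0, ∀ a ∈ X, ∀ b ∈ X, dist a b ≤ L * dist (φ a) (φ b)) :
    ∃ φ' ψ ψ' L, ConeMap ω X C X' C' φ φ' ψ ψ' L ∧ ConeMap ω X' C' X C φ' φ ψ' ψ L := by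
  obtain ⟨L₁, hL₁, hLip₁⟩ := hL₁
  obtain ⟨L₂, hL₂, hLip₂⟩ := hL₂
  have : Nonempty V := ⟨0⟩
  let φ' := Function.invFunOn φ X
  have hinv : Set.InvOn φ' φ X X' := hφ.invOn_invFunOn
  have hφ' : Set.MapsTo φ' X' X := hφ.surjOn.mapsTo_invFunOn
  have hLip₁' : ∀ a ∈ X, ∀ b ∈ X, dist (φ a) (φ b) ≤ max L₁ L₂ * dist a b := fun a ha b hb =>
    (hLip₁ a ha b hb).trans (by gcongr; exact le_max_left _ _)
  have hLip₂' : ∀ a ∈ X', ∀ b ∈ X', dist (φ' a) (φ' b) ≤ max L₁ L₂ * dist a b := by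
    intro a ha b hb
    have := hLip₂ _ (hφ' ha) _ (hφ' hb)
    rw [hinv.2 ha, hinv.2 hb] at this
    exact this.trans (by gcongr; exact le_max_right _ _)
  have hL : 0 < max L₁ L₂ := lt_max_of_lt_left hL₁
  obtain ⟨ψ, hψ, hψL, hψt⟩ := h.exists_map h' hφ.mapsTo hL hLip₁'
  obtain ⟨ψ', hψ', hψL', hψt'⟩ := h'.exists_map h hφ' hL hLip₂'
  obtain ⟨x₀, hx₀⟩ := hX
  refine ⟨φ', ψ, ψ', max L₁ L₂, ⟨hL, h, hφ.mapsTo, hinv.1, hLip₁', hψ, fun v hv => ?_, hψL, hψt,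
    fun h0 => ?_⟩, ⟨hL, h', hφ', hinv.2, hLip₂', hψ', fun v hv => ?_, hψL', hψt', fun h0 => ?_⟩⟩
  · obtain ⟨x, hx, hxv⟩ := h.exists_seq v hv
    have h1 := hψt v hv x hx hxv
    have h2 := hψt' _ (hψ hv) (fun n => φ (x n)) (hx.mono fun n hn => hφ.mapsTo hn) h1
    refine tendsto_nhds_unique (h2.congr' ?_) hxv
    filter_upwards [hx] with n hn
    rw [hinv.1 hn]
  · exact tendsto_nhds_unique (hψt 0 h0 (fun _ => x₀) (Eventually.of_forall fun _ => hx₀)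
      (tendsto_inv_smul_const h.le_atTop _)) (tendsto_inv_smul_const h.le_atTop _)
  · obtain ⟨x, hx, hxv⟩ := h'.exists_seq v hv
    have h1 := hψt' v hv x hx hxv
    have h2 := hψt _ (hψ' hv) (fun n => φ' (x n)) (hx.mono fun n hn => hφ' hn) h1
    refine tendsto_nhds_unique (h2.congr' ?_) hxv
    filter_upwards [hx] with n hn
    rw [hinv.2 hn]
  · exact tendsto_nhds_unique (hψt' 0 h0 (fun _ => φ x₀) (Eventually.of_forall fun _ =>
      hφ.mapsTo hx₀) (tendsto_inv_smul_const h.le_atTop _)) (tendsto_inv_smul_const h.le_atTop _)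

end TangentMap

/-- The family of polynomials whose zero set is the zero set of `F` scaled by `n⁻¹`. -/
noncomputable def rescale (F : ℂ × ℂ → Polynomial ℂ) (n : ℕ) (u : ℂ × ℂ) : Polynomial ℂ :=
  (F ((n : ℂ) • u)).scaleRoots (n : ℂ)⁻¹

/-- A family of monic polynomials which is asymptotic to a homogeneous family, and has only
simple roots near infinity over the good directions. -/
structure AsymptoticFamily (F P : ℂ × ℂ → Polynomial ℂ) (U : Set (ℂ × ℂ)) (d : ℕ) : Prop
    extends HomogFamily P U d where
  pos : 0 < d
  family' : MonicFamily F d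
  tendsto : ∀ k u₀, Tendsto (fun i : ℕ × (ℂ × ℂ) => (rescale F i.1 i.2).coeff k) (atTop ×ˢ 𝓝 u₀)
    (𝓝 ((P u₀).coeff k))
  sep : ∀ u₀ ∈ U, ∀ᶠ i : ℕ × (ℂ × ℂ) in atTop ×ˢ 𝓝 u₀,
    (F ((i.1 : ℂ) • i.2)).roots.toFinset.card = d

namespace MonicFamily

variable {F : ℂ × ℂ → Polynomial ℂ} {d : ℕ}

theorem rescale (h : MonicFamily F d) (n : ℕ) : MonicFamily (rescale F n) d where
  monic u := (Polynomial.monic_scaleRoots_iff _).2 (h.monic _)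
  natDegree u := (Polynomial.natDegree_scaleRoots _ _).trans (h.natDegree _)
  continuous k := by
    simp only [_root_.rescale, Polynomial.coeff_scaleRoots, h.natDegree]
    exact ((h.continuous k).comp (continuous_const_smul _)).mul continuous_const

theorem eval_rescale_eq_zero {n : ℕ} (hn : n ≠ 0) (u : ℂ × ℂ) (z : ℂ) :
    (_root_.rescale F n u).eval z = 0 ↔ ((n : ℂ) • (u, z)) ∈ rootCone F := by
  have hn' : (n : ℂ) ≠ 0 := Nat.cast_ne_zero.2 hn
  have h1 := Polynomial.scaleRoots_eval₂_mul (p := F ((n : ℂ) • u)) (RingHom.id ℂ) ((n : ℂ) * z)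
    ((n : ℂ)⁻¹)
  simp only [RingHom.id_apply, Polynomial.eval₂_id, inv_mul_cancel_left₀ hn'] at h1
  change _ ↔ (F ((n : ℂ) • u)).eval ((n : ℂ) * z) = 0
  rw [_root_.rescale, h1, mul_eq_zero]
  simp [hn']

theorem mem_rootCone_iff {n : ℕ} (hn : n ≠ 0) (q : (ℂ × ℂ) × ℂ) :
    q ∈ rootCone F ↔
      (_root_.rescale F n ((n : ℂ)⁻¹ • q).1).eval ((n : ℂ)⁻¹ • q).2 = 0 := by
  have hn' : (n : ℂ) ≠ 0 := Nat.cast_ne_zero.2 hn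
  rw [eval_rescale_eq_zero hn]
  change _ ↔ (n : ℂ) • ((n : ℂ)⁻¹ • q) ∈ _
  rw [smul_inv_smul₀ hn']

theorem card_roots_rescale (h : MonicFamily F d) {n : ℕ} (hn : n ≠ 0) (u : ℂ × ℂ) :
    (_root_.rescale F n u).roots.toFinset.card = (F ((n : ℂ) • u)).roots.toFinset.card := by
  have hn' : (n : ℂ) ≠ 0 := Nat.cast_ne_zero.2 hn
  refine Finset.card_bij (fun z _ => (n : ℂ) * z) (fun z hz => ?_) (fun z _ w _ h => ?_)
    (fun z hz => ⟨(n : ℂ)⁻¹ * z, ?_, mul_inv_cancel_left₀ hn' _⟩)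
  · rw [Polynomial.mem_toFinset_roots ((h.rescale n).monic _), eval_rescale_eq_zero hn] at hz
    rwa [Polynomial.mem_toFinset_roots (h.monic _)]
  · exact mul_left_cancel₀ hn' h
  · rw [Polynomial.mem_toFinset_roots (h.monic _)] at hz
    rw [Polynomial.mem_toFinset_roots ((h.rescale n).monic _), eval_rescale_eq_zero hn]
    change (F ((n : ℂ) • u)).eval ((n : ℂ) * _) = 0
    rwa [mul_inv_cancel_left₀ hn']

end MonicFamily

namespace AsymptoticFamily

variable {F P : ℂ × ℂ → Polynomial ℂ} {U : Set (ℂ × ℂ)} {d : ℕ}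

theorem exists_root (h : AsymptoticFamily F P U d) (u : ℂ × ℂ) : ∃ z, (P u).eval z = 0 :=
  Complex.exists_root (Polynomial.natDegree_pos_iff_degree_pos.1
    (by rw [h.family.natDegree]; exact h.pos))

theorem tendsto_comp (h : AsymptoticFamily F P U d) {l : Filter ℕ} (hl : l ≤ atTop) (k : ℕ)
    {u : ℕ → ℂ × ℂ} {u₀ : ℂ × ℂ} (hu : Tendsto u l (𝓝 u₀)) :
    Tendsto (fun n : ℕ => (rescale F n (u n)).coeff k) l (𝓝 ((P u₀).coeff k)) := by
  have h1 : Tendsto (fun n : ℕ => n) l atTop := hl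
  have h2 : Tendsto (fun n : ℕ => (n, u n)) l (atTop ×ˢ 𝓝 u₀) := h1.prodMk hu
  have h3 := h.tendsto k u₀
  generalize 𝓝 ((P u₀).coeff k) = L at h3 ⊢
  have h4 := h3.comp h2
  rw [Function.comp_def] at h4
  exact h4

theorem exists_seq (h : AsymptoticFamily F P U d) {ω : Ultrafilter ℕ} (hω : (ω : Filter ℕ) ≤ atTop)
    {K : Set ((ℂ × ℂ) × ℂ)} (hK : Bornology.IsBounded K) {v : (ℂ × ℂ) × ℂ} (hv : v ∈ rootCone P)
    (hv0 : v ≠ 0) :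
    ∃ x : ℕ → (ℂ × ℂ) × ℂ, (∀ᶠ n in (ω : Filter ℕ), x n ∈ rootCone F \ K) ∧
      Tendsto (fun n : ℕ => (n : ℂ)⁻¹ • x n) ω (𝓝 v) := by
  have hcoeff : ∀ k, Tendsto (fun n : ℕ => (rescale F n v.1).coeff k) ω (𝓝 ((P v.1).coeff k)) :=
    fun k => h.tendsto_comp hω k tendsto_const_nhds
  obtain ⟨r, hr, a, ha, hp₀⟩ := Polynomial.exists_tendsto_roots
    (fun n => (h.family'.rescale n).monic v.1) (fun n => (h.family'.rescale n).natDegree v.1)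
    (h.family.natDegree v.1) ω hcoeff
  have hz : v.2 ∈ (P v.1).roots := (Polynomial.mem_roots (h.family.monic _).ne_zero).2 hv
  rw [hp₀, Multiset.mem_map] at hz
  obtain ⟨j, -, hj⟩ := hz
  have hlim : Tendsto (fun n : ℕ => (v.1, r n j)) ω (𝓝 v) := by
    have h1 : Tendsto (fun n : ℕ => r n j) ω (𝓝 (a j)) :=
      ((continuous_apply j).continuousAt.tendsto.comp ha)
    rw [hj] at h1
    exact tendsto_const_nhds.prodMk_nhds h1
  have hne : ∀ᶠ n in (ω : Filter ℕ), n ≠ 0 := hω (eventually_ne_atTop 0)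
  refine ⟨fun n => (n : ℂ) • (v.1, r n j), ?_, hlim.congr' ?_⟩
  · obtain ⟨R, hR⟩ := hK.subset_closedBall 0
    have hbig : Tendsto (fun n : ℕ => (n : ℝ) * ‖(v.1, r n j)‖) ω atTop :=
      (tendsto_natCast_atTop_atTop.mono_left hω).atTop_mul_pos (norm_pos_iff.2 hv0) hlim.norm
    filter_upwards [hne, hbig.eventually_gt_atTop R] with n hn hn'
    refine ⟨?_, fun hmem => ?_⟩
    · rw [← MonicFamily.eval_rescale_eq_zero hn, ← Polynomial.IsRoot.def,
        ← Polynomial.mem_roots ((h.family'.rescale n).monic _).ne_zero, hr]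
      exact Multiset.mem_map_of_mem _ (Finset.mem_univ j)
    · have := hR hmem
      rw [mem_closedBall_zero_iff, norm_smul, Complex.norm_natCast] at this
      linarith
  · filter_upwards [hne] with n hn
    rw [inv_smul_smul₀ (Nat.cast_ne_zero.2 hn)]

theorem isAsymptoticCone (h : AsymptoticFamily F P U d) {ω : Ultrafilter ℕ}
    (hω : (ω : Filter ℕ) ≤ atTop) {K : Set ((ℂ × ℂ) × ℂ)} (hK : Bornology.IsBounded K) :
    IsAsymptoticCone ω (rootCone F \ K) (rootCone P) ∧ (rootCone F \ K).Nonempty := by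
  have hne : (rootCone F \ K).Nonempty := by
    obtain ⟨z, hz⟩ := h.exists_root (1, 0)
    obtain ⟨x, hx, -⟩ := h.exists_seq hω hK (v := ((1, 0), z)) hz (by simp [Prod.ext_iff])
    obtain ⟨n, hn⟩ := hx.exists
    exact ⟨_, hn⟩
  refine ⟨⟨hω, fun v hv => ?_, fun v x hx hxv => ?_⟩, hne⟩
  · by_cases hv0 : v = 0
    · obtain ⟨x, hx⟩ := hne
      exact ⟨fun _ => x, Eventually.of_forall fun _ => hx, hv0 ▸ tendsto_inv_smul_const hω x⟩
    · exact h.exists_seq hω hK hv hv0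
  · have hn : ∀ᶠ n in (ω : Filter ℕ), n ≠ 0 := hω (eventually_ne_atTop 0)
    have h1 : ∀ k, Tendsto (fun n : ℕ => (rescale F n ((n : ℂ)⁻¹ • x n).1).coeff k) ω
        (𝓝 ((P v.1).coeff k)) := fun k =>
      h.tendsto_comp hω k ((continuous_fst.tendsto v).comp hxv)
    have h2 : Tendsto (fun n : ℕ => (rescale F n ((n : ℂ)⁻¹ • x n).1).eval ((n : ℂ)⁻¹ • x n).2) ω
        (𝓝 ((P v.1).eval v.2)) := by
      simp only [Polynomial.eval_eq_sum_range, (h.family'.rescale _).natDegree,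
        h.family.natDegree]
      exact tendsto_finsetSum _ fun k _ => (h1 k).mul (((continuous_snd.tendsto v).comp hxv).pow k)
    refine tendsto_nhds_unique h2 (tendsto_const_nhds.congr' ?_)
    filter_upwards [hn, hx] with n hn hxn
    exact ((MonicFamily.mem_rootCone_iff hn _).1 hxn.1).symm

end AsymptoticFamily

theorem TorsionExponent.of_dense {E F : Type*} [NormedAddCommGroup E] [NormedAddCommGroup F]
    {W A : Set E} {W' A' : Set F} {e : ℕ} {ψ : E → F} {ψ' : F → E} {M : ℝ} (hM : 1 ≤ M)
    (hA : A ⊆ W) (hA' : A' ⊆ W') (hψ : Set.MapsTo ψ A A') (hψ' : Set.MapsTo ψ' A' A)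
    (hinv : ∀ y ∈ A', ψ (ψ' y) = y)
    (hn : ∀ η, ∀ x ∈ A, ∀ y ∈ A, RelNear η x y → RelNear (M * η) (ψ x) (ψ y))
    (hn' : ∀ η, ∀ x ∈ A', ∀ y ∈ A', RelNear η x y → RelNear (M * η) (ψ' x) (ψ' y))
    (hd : ∀ η > 0, ∀ a ∈ W, ∃ x ∈ A, RelNear η x a)
    (hd' : ∀ η > 0, ∀ a ∈ W', ∃ x ∈ A', RelNear η x a) (h : TorsionExponent W e) :
    TorsionExponent W' e := by
  classical
  have hM0 : 0 < M := by linarith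
  have scale : ∀ ε > 0, ∃ η > 0, 3 * η ≤ 1 ∧ M * (9 * η) ≤ ε ∧ M * (3 * η) ≤ 1 := by
    intro ε hε
    refine ⟨min ε 1 / (9 * M), by positivity, ?_, ?_, ?_⟩
    · rw [mul_div_assoc', div_le_one (by positivity)]
      nlinarith [min_le_right ε 1]
    · calc M * (9 * (min ε 1 / (9 * M))) = min ε 1 := by field_simp
        _ ≤ ε := min_le_left _ _
    · calc M * (3 * (min ε 1 / (9 * M))) = min ε 1 / 3 := by field_simp; ring
        _ ≤ 1 := by linarith [min_le_right ε 1]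
  refine TorsionExponent.transport (fun ε hε => ?_) h
  obtain ⟨η, hη, h3, h9, hM3⟩ := scale ε hε
  have hMη : η ≤ M * η := le_mul_of_one_le_left hη.le hM
  choose! x hxA hx using hd η hη
  refine ⟨fun a => ψ (x a), fun a ha => hA' (hψ (hxA a ha)), ⟨η, hη, fun a ha b hb hab => ?_⟩,
    fun ε' hε' => ?_⟩
  · refine (hn _ _ (hxA a ha) _ (hxA b hb) ?_).mono h9
    have := ((hx a ha).trans hab (by linarith)).trans ((hx b hb).symm.mono (by linarith)) h3
    exact this.mono (by linarith)
  · obtain ⟨η', hη', h3', h9', hM3'⟩ := scale ε' hε'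
    have hmin : 0 < min η η' := lt_min hη hη'
    choose! y hyA hy using hd' (min η η') hmin
    refine ⟨fun p => ψ' (y p), fun p hp => hA (hψ' (hyA p hp)),
      ⟨η', hη', fun a ha b hb hab => ?_⟩, fun p hp => ?_⟩
    · refine (hn' _ _ (hyA a ha) _ (hyA b hb) ?_).mono h9'
      have := (((hy a ha).mono (min_le_right _ _)).trans hab (by linarith)).trans
        (((hy b hb).mono (min_le_right _ _)).symm.mono (by linarith)) h3'
      exact this.mono (by linarith)
    · have h1 := hψ' (hyA p hp)
      have h2 := hn _ _ (hxA _ (hA h1)) _ h1 (hx _ (hA h1))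
      rw [hinv _ (hyA p hp)] at h2
      refine (h2.trans (((hy p hp).mono (min_le_left _ _)).mono hMη) ?_).mono ?_
      · linarith
      · linarith

theorem IsPreconnected.eq_of_locally_eq {X β : Type*} [TopologicalSpace X] {W S : Set X}
    (hW : IsPreconnected W) (κ : X → β)
    (h : ∀ q ∈ W, q ∈ closure S ∧ ∃ O, IsOpen O ∧ q ∈ O ∧ ∀ x ∈ S ∩ O, ∀ y ∈ S ∩ O, κ x = κ y)
    {x y : X} (hx : x ∈ W ∩ S) (hy : y ∈ W ∩ S) : κ x = κ y := by
  let Λ : X → β → Prop := fun q c => ∃ O, IsOpen O ∧ q ∈ O ∧ ∀ x ∈ S ∩ O, κ x = c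
  have huniq : ∀ q ∈ W, ∀ c c', Λ q c → Λ q c' → c = c' := by
    rintro q hq c c' ⟨O, hO, hqO, hc⟩ ⟨O', hO', hqO', hc'⟩
    obtain ⟨z, hz, hzS⟩ := mem_closure_iff.1 (h q hq).1 (O ∩ O') (hO.inter hO') ⟨hqO, hqO'⟩
    rw [← hc z ⟨hzS, hz.1⟩, hc' z ⟨hzS, hz.2⟩]
  have hex : ∀ q ∈ W, ∃ O, IsOpen O ∧ q ∈ O ∧ ∃ c, ∀ y ∈ O, Λ y c := by
    intro q hq
    obtain ⟨hcl, O, hO, hqO, hc⟩ := h q hq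
    obtain ⟨z, hz, hzS⟩ := mem_closure_iff.1 hcl O hO hqO
    exact ⟨O, hO, hqO, κ z, fun y hy => ⟨O, hO, hy, fun x hx => hc _ hx _ ⟨hzS, hz⟩⟩⟩
  have key : ∀ c, Λ x c ↔ Λ y c := by
    refine hW.induction₂ (fun a b => ∀ c, Λ a c ↔ Λ b c) (fun q hq => ?_)
      (fun a b c _ _ _ hab hbc e => (hab e).trans (hbc e)) (fun a b _ _ hab e => (hab e).symm)
      hx.1 hy.1
    obtain ⟨O, hO, hqO, c, hc⟩ := hex q hq
    filter_upwards [mem_nhdsWithin_of_mem_nhds (hO.mem_nhds hqO), self_mem_nhdsWithin] with y hy hyW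
    refine fun e => ⟨fun he => ?_, fun he => ?_⟩
    · rw [huniq q hq e c he (hc q hqO)]
      exact hc y hy
    · rw [huniq y hyW e c he (hc y hy)]
      exact hc q hqO
  obtain ⟨O, hO, hxO, c, hc⟩ := hex x hx.1
  obtain ⟨O₁, -, hx₁, h₁⟩ := hc x hxO
  obtain ⟨O₂, -, hy₂, h₂⟩ := (key c).1 (hc x hxO)
  rw [h₁ x ⟨hx.2, hx₁⟩, h₂ y ⟨hy.2, hy₂⟩]

theorem HomogFamily.exists_local_section {P : ℂ × ℂ → Polynomial ℂ} {U : Set (ℂ × ℂ)} {d : ℕ}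
    (h : HomogFamily P U d) {q : (ℂ × ℂ) × ℂ} (hq : q ∈ rootConeOver P U) :
    ∃ r > 0, ∃ s : ℂ × ℂ → ℂ, ContinuousOn s (Metric.ball q.1 r) ∧ s q.1 = q.2 ∧
      ∃ O, IsOpen O ∧ q ∈ O ∧ rootConeOver P U ∩ O = (fun u => (u, s u)) '' Metric.ball q.1 r := by
  obtain ⟨N, hN⟩ := h.card
  obtain ⟨σ, hσ, -, -, hev⟩ := h.family.exists_sheets (b₀ := q.1)
    (eventually_of_mem (h.isOpen.mem_nhds hq.1) hN) one_pos
  obtain ⟨r, hr, hball⟩ := Metric.eventually_nhds_iff_ball.1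
    (hev.and (h.isOpen.mem_nhds hq.1))
  obtain ⟨s, hs, hsq, hs0⟩ := h.family.exists_section_ball
    (fun u hu => hN u (hball u hu).2) (Metric.mem_ball_self hr) hq.2
  have hsn : ∀ᶠ u in 𝓝 q.1, dist (s u) q.2 < σ := by
    have h1 := (hs.continuousAt (Metric.ball_mem_nhds _ hr)).tendsto
    rw [hsq] at h1
    exact Metric.tendsto_nhds.1 h1 σ hσ
  obtain ⟨r', hr', hball'⟩ := Metric.eventually_nhds_iff_ball.1 hsn
  have hsub : Metric.ball q.1 (min r r') ⊆ Metric.ball q.1 r :=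
    Metric.ball_subset_ball (min_le_left _ _)
  have hsub' : Metric.ball q.1 (min r r') ⊆ Metric.ball q.1 r' :=
    Metric.ball_subset_ball (min_le_right _ _)
  refine ⟨min r r', lt_min hr hr', s, hs.mono hsub, hsq,
    Metric.ball q.1 (min r r') ×ˢ Metric.ball q.2 σ, Metric.isOpen_ball.prod Metric.isOpen_ball,
    ⟨Metric.mem_ball_self (lt_min hr hr'), Metric.mem_ball_self hσ⟩, ?_⟩
  ext y
  constructor
  · rintro ⟨hy, hy1, hy2⟩
    refine ⟨y.1, hy1, Prod.ext rfl ?_⟩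
    exact ((hball _ (hsub hy1)).1.1 q.2 hq.2).unique ⟨hs0 _ (hsub hy1), hball' _ (hsub' hy1)⟩
      ⟨hy.2, hy2⟩
  · rintro ⟨u, hu, rfl⟩
    exact ⟨⟨(hball u (hsub hu)).2, hs0 u (hsub hu)⟩, hu, hball' u (hsub' hu)⟩

/-- A bi-Lipschitz embedding between cones fixing the origin. -/
structure ConeHom {V V' : Type*} [NormedAddCommGroup V] [NormedAddCommGroup V'] (C : Set V)
    (C' : Set V') (ψ : V → V') (ψ' : V' → V) (L : ℝ) : Prop where
  one_le : 1 ≤ L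
  mapsTo : Set.MapsTo ψ C C'
  leftInv : ∀ x ∈ C, ψ' (ψ x) = x
  dist_le : ∀ a ∈ C, ∀ b ∈ C, dist (ψ a) (ψ b) ≤ L * dist a b
  zero_mem : 0 ∈ C
  map_zero : ψ 0 = 0

namespace ConeHom

section

variable {V V' : Type*} [NormedAddCommGroup V] [NormedAddCommGroup V'] {C : Set V}
  {C' : Set V'} {ψ : V → V'} {ψ' : V' → V} {L : ℝ}

theorem continuousOn (h : ConeHom C C' ψ ψ' L) : ContinuousOn ψ C :=
  (LipschitzOnWith.of_dist_le_mul (K := ⟨L, zero_le_one.trans h.one_le⟩) h.dist_le).continuousOn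

theorem norm_le (h : ConeHom C C' ψ ψ' L) {x : V} (hx : x ∈ C) : ‖ψ x‖ ≤ L * ‖x‖ := by
  simpa [h.map_zero] using h.dist_le x hx 0 h.zero_mem

theorem le_norm (h : ConeHom C C' ψ ψ' L) (h' : ConeHom C' C ψ' ψ L) {x : V} (hx : x ∈ C) :
    ‖x‖ ≤ L * ‖ψ x‖ := by
  simpa [h.leftInv x hx] using h'.norm_le (h.mapsTo hx)

theorem relNear (h : ConeHom C C' ψ ψ' L) (h' : ConeHom C' C ψ' ψ L) {η : ℝ} {x y : V}
    (hx : x ∈ C) (hy : y ∈ C) (hxy : RelNear η x y) : RelNear (L ^ 2 * η) (ψ x) (ψ y) := by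
  have hL : 0 < L := zero_lt_one.trans_le h.one_le
  have h1 := h.dist_le x hx y hy
  have h2 := h.le_norm h' hx
  have h3 := h.le_norm h' hy
  have hη := hxy.pos
  rw [dist_eq_norm, dist_eq_norm] at h1
  constructor
  · calc ‖ψ x - ψ y‖ ≤ L * ‖x - y‖ := h1
      _ < L * (η * ‖x‖) := by gcongr; exact hxy.1
      _ ≤ L * (η * (L * ‖ψ x‖)) := by gcongr
      _ = _ := by ring
  · calc ‖ψ x - ψ y‖ ≤ L * ‖x - y‖ := h1
      _ < L * (η * ‖y‖) := by gcongr; exact hxy.2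
      _ ≤ L * (η * (L * ‖ψ y‖)) := by gcongr
      _ = _ := by ring

end

variable {P P' : ℂ × ℂ → Polynomial ℂ} {U U' : Set (ℂ × ℂ)} {d d' : ℕ}
  {ψ ψ' : (ℂ × ℂ) × ℂ → (ℂ × ℂ) × ℂ} {L : ℝ}

/-- The points over good directions which are mapped to points over good directions. -/
def goodSet (P P' : ℂ × ℂ → Polynomial ℂ) (U U' : Set (ℂ × ℂ))
    (ψ : (ℂ × ℂ) × ℂ → (ℂ × ℂ) × ℂ) : Set ((ℂ × ℂ) × ℂ) :=
  {q | q ∈ rootConeOver P U ∧ ψ q ∈ rootConeOver P' U'}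

theorem exists_lipschitz_cover (hψ : ConeHom (rootCone P) (rootCone P') ψ ψ' L)
    (hψ' : ConeHom (rootCone P') (rootCone P) ψ' ψ L) (h : HomogFamily P U d)
    (h' : HomogFamily P' U' d') :
    ∃ (ι : Type) (_ : Countable ι) (g : ι → ℂ → ℂ × ℂ), (∀ i, ∃ K, LipschitzWith K (g i)) ∧
      ∀ q ∈ rootConeOver P U, q ∉ goodSet P P' U U' ψ → q.1 ∈ ⋃ i, Set.range (g i) := by
  have := h'.countable_index
  have hL : 0 ≤ L := zero_le_one.trans hψ.one_le
  let J := Option {t : ℂ | ((1 : ℂ), t) ∉ U'}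
  have hfin : ∀ u, Countable {z // (P' u).eval z = 0} := fun u =>
    (h'.finite_roots u).countable.to_subtype
  have hmem : ∀ (i : J) (z : {z // (P' (lineParam i 1)).eval z = 0}) (s : ℂ),
      s • (lineParam i 1, z.1) ∈ rootCone P' := fun i z s => h'.smul_mem_rootCone z.2 s
  refine ⟨Σ i : J, {z // (P' (lineParam i 1)).eval z = 0}, inferInstance,
    fun j s => (ψ' (s • (lineParam j.1 1, j.2.1))).1, fun j => ?_, fun q hq hqS => ?_⟩
  · refine ⟨⟨L * ‖(lineParam j.1 1, j.2.1)‖, by positivity⟩, LipschitzWith.of_dist_le_mul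
      fun s t => ?_⟩
    calc _ ≤ dist (ψ' (s • (lineParam j.1 1, j.2.1))) (ψ' (t • (lineParam j.1 1, j.2.1))) := by
          rw [Prod.dist_eq]; exact le_max_left _ _
      _ ≤ L * dist (s • (lineParam j.1 1, j.2.1)) (t • (lineParam j.1 1, j.2.1)) :=
          hψ'.dist_le _ (hmem _ _ _) _ (hmem _ _ _)
      _ = L * ‖(lineParam j.1 1, j.2.1)‖ * dist s t := by
          rw [dist_eq_norm, ← sub_smul, norm_smul, dist_eq_norm]; ring
  · have hqC : q ∈ rootCone P := hq.2
    have hψq : ψ q ∈ rootCone P' := hψ.mapsTo hqC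
    have hbad : (ψ q).1 ∉ U' := fun hU => hqS ⟨hq, hU, hψq⟩
    obtain ⟨i, s, hs⟩ := Set.mem_iUnion.1 (h'.compl_subset hbad)
    rw [lineParam_eq_smul] at hs
    have hs0 : s ≠ 0 := by
      rintro rfl
      rw [zero_smul] at hs
      obtain ⟨K, -, hK⟩ := h'.bound
      have h1 := hK _ hψq
      rw [← hs, norm_zero, mul_zero, norm_le_zero_iff] at h1
      have h2 : ψ q = 0 := Prod.ext hs.symm h1
      have h3 := hψ.leftInv q hqC
      rw [h2, hψ'.map_zero] at h3
      exact h.fst_ne _ hq.1 (by rw [← h3]; rfl)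
    have hz : (P' (lineParam i 1)).eval (s⁻¹ * (ψ q).2) = 0 := by
      have h1 := h'.smul_mem_rootCone hψq s⁻¹
      have h2 : s⁻¹ • ψ q = (lineParam i 1, s⁻¹ * (ψ q).2) :=
        Prod.ext (by rw [Prod.smul_fst, ← hs, inv_smul_smul₀ hs0]) rfl
      rw [h2] at h1
      exact h1
    refine Set.mem_iUnion.2 ⟨⟨i, s⁻¹ * (ψ q).2, hz⟩, s, ?_⟩
    have h2 : s • (lineParam i 1, s⁻¹ * (ψ q).2) = ψ q :=
      Prod.ext hs (mul_inv_cancel_left₀ hs0 _)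
    change (ψ' (s • (lineParam i 1, s⁻¹ * (ψ q).2))).1 = _
    rw [h2, hψ.leftInv q hqC]

theorem exists_local_goodSet (hψ : ConeHom (rootCone P) (rootCone P') ψ ψ' L)
    (hψ' : ConeHom (rootCone P') (rootCone P) ψ' ψ L) (h : HomogFamily P U d)
    (h' : HomogFamily P' U' d') {q : (ℂ × ℂ) × ℂ} (hq : q ∈ rootConeOver P U) :
    ∃ O, IsOpen O ∧ q ∈ O ∧ IsPreconnected (rootConeOver P U ∩ O) ∧
      IsPreconnected (goodSet P P' U U' ψ ∩ O) ∧ q ∈ closure (goodSet P P' U U' ψ ∩ O) := by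
  obtain ⟨r, hr, s, hs, hsq, O, hO, hqO, hOe⟩ := h.exists_local_section hq
  obtain ⟨ι, _, g, hg, hcov⟩ := hψ.exists_lipschitz_cover hψ' h h'
  let T : Set (ℂ × ℂ) := {u | u ∈ Metric.ball q.1 r ∧ (u, s u) ∉ goodSet P P' U U' ψ}
  have hgr : ∀ u ∈ Metric.ball q.1 r, (u, s u) ∈ rootConeOver P U := by
    intro u hu
    have : (u, s u) ∈ rootConeOver P U ∩ O := hOe ▸ ⟨u, hu, rfl⟩
    exact this.1
  have hT : T ⊆ ⋃ i, Set.range (g i) := fun u hu => hcov (u, s u) (hgr u hu.1) hu.2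
  have hS : goodSet P P' U U' ψ ∩ O = (fun u => (u, s u)) '' (Metric.ball q.1 r \ T) := by
    ext y
    constructor
    · rintro ⟨hy, hyO⟩
      have : y ∈ rootConeOver P U ∩ O := ⟨hy.1, hyO⟩
      rw [hOe] at this
      obtain ⟨u, hu, rfl⟩ := this
      exact ⟨u, ⟨hu, fun hT => hT.2 hy⟩, rfl⟩
    · rintro ⟨u, ⟨hu, hnT⟩, rfl⟩
      have : (u, s u) ∈ rootConeOver P U ∩ O := hOe ▸ ⟨u, hu, rfl⟩
      exact ⟨by_contra fun hb => hnT ⟨hu, hb⟩, this.2⟩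
  refine ⟨O, hO, hqO, ?_, ?_, ?_⟩
  · rw [hOe]
    exact graph_isPreconnected (convex_ball _ _).isPreconnected hs
  · rw [hS]
    exact graph_isPreconnected ((convex_ball q.1 r).isPreconnected_diff_of_subset_lipschitz hg hT
      Metric.isOpen_ball) (hs.mono Set.sdiff_subset)
  · rw [hS]
    have h1 := (Metric.isOpen_ball (x := q.1)).subset_closure_diff_of_subset_lipschitz hg hT
      (Metric.mem_ball_self hr)
    have h2 : ContinuousWithinAt (fun u => (u, s u)) (Metric.ball q.1 r \ T) q.1 :=
      (continuousWithinAt_id.prodMk (hs q.1 (Metric.mem_ball_self hr))).mono Set.sdiff_subset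
    have h3 := h2.mem_closure_image h1
    rwa [hsq] at h3

theorem map_component_eq (hψ : ConeHom (rootCone P) (rootCone P') ψ ψ' L)
    (hψ' : ConeHom (rootCone P') (rootCone P) ψ' ψ L) (h : HomogFamily P U d)
    (h' : HomogFamily P' U' d') {p q : (ℂ × ℂ) × ℂ} (hp : p ∈ goodSet P P' U U' ψ)
    (hq : q ∈ goodSet P P' U U' ψ) (hpq : p ∈ connectedComponentIn (rootConeOver P U) q) :
    connectedComponentIn (rootConeOver P' U') (ψ p) =
      connectedComponentIn (rootConeOver P' U') (ψ q) := by
  refine (isPreconnected_connectedComponentIn (F := rootConeOver P U) (x := q)).eq_of_locally_eq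
    (S := goodSet P P' U U' ψ) (fun p => connectedComponentIn (rootConeOver P' U') (ψ p))
    (fun w hw => ?_) ⟨hpq, hp⟩ ⟨mem_connectedComponentIn hq.1, hq⟩
  obtain ⟨O, hO, hwO, -, hpre, hcl⟩ := hψ.exists_local_goodSet hψ' h h'
    (connectedComponentIn_subset _ _ hw)
  refine ⟨closure_mono Set.inter_subset_left hcl, O, hO, hwO, fun x hx y hy => ?_⟩
  have h1 : IsPreconnected (ψ '' (goodSet P P' U U' ψ ∩ O)) :=
    hpre.image _ (hψ.continuousOn.mono fun z hz => hz.1.1.2)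
  have h2 : ψ '' (goodSet P P' U U' ψ ∩ O) ⊆ rootConeOver P' U' := by
    rintro _ ⟨z, hz, rfl⟩
    exact hz.1.2
  exact connectedComponentIn_eq (h1.subset_connectedComponentIn ⟨y, hy, rfl⟩ h2
      ⟨x, hx, rfl⟩) |>.symm

theorem map_goodSet (hψ : ConeHom (rootCone P) (rootCone P') ψ ψ' L) {q : (ℂ × ℂ) × ℂ}
    (hq : q ∈ goodSet P P' U U' ψ) : ψ q ∈ goodSet P' P U' U ψ' :=
  ⟨hq.2, by rw [hψ.leftInv q hq.1.2]; exact hq.1⟩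

theorem exists_mem_goodSet_near (hψ : ConeHom (rootCone P) (rootCone P') ψ ψ' L)
    (hψ' : ConeHom (rootCone P') (rootCone P) ψ' ψ L) (h : HomogFamily P U d)
    (h' : HomogFamily P' U' d') {p q : (ℂ × ℂ) × ℂ}
    (hpq : p ∈ connectedComponentIn (rootConeOver P U) q) {η : ℝ} (hη : 0 < η) :
    ∃ x ∈ connectedComponentIn (rootConeOver P U) q ∩ goodSet P P' U U' ψ, RelNear η x p := by
  have hp := connectedComponentIn_subset _ _ hpq
  obtain ⟨O, hO, hpO, hpre, -, hcl⟩ := hψ.exists_local_goodSet hψ' h h' hp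
  have hp0 : p ≠ 0 := fun h0 => h.fst_ne _ hp.1 (by rw [h0]; rfl)
  obtain ⟨x, hx, hxS⟩ := (mem_closure_iff_frequently.1 hcl).and_eventually
    (eventually_relNear hp0 hη) |>.exists
  refine ⟨x, ⟨HomogFamily.component_closed q hpre Set.inter_subset_left ⟨p, ⟨hp, hpO⟩, hpq⟩
    ⟨hx.1.1, hx.2⟩, hx.1⟩, hxS.symm⟩

theorem card_component_dvd (hψ : ConeHom (rootCone P) (rootCone P') ψ ψ' L)
    (hψ' : ConeHom (rootCone P') (rootCone P) ψ' ψ L) (h : HomogFamily P U d)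
    (h' : HomogFamily P' U' d') {q : (ℂ × ℂ) × ℂ} (hq : q ∈ goodSet P P' U U' ψ) :
    Nat.card {z // ((ψ q).1, z) ∈ connectedComponentIn (rootConeOver P' U') (ψ q)} ∣
      Nat.card {z // (q.1, z) ∈ connectedComponentIn (rootConeOver P U) q} := by
  refine (h'.coneCover hq.2).dvd_of_torsionExponent ?_
  have hM : 1 ≤ L ^ 2 := one_le_pow₀ hψ.one_le
  refine TorsionExponent.of_dense hM
    (A := connectedComponentIn (rootConeOver P U) q ∩ goodSet P P' U U' ψ)
    (A' := connectedComponentIn (rootConeOver P' U') (ψ q) ∩ goodSet P' P U' U ψ')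
    (ψ := ψ) (ψ' := ψ') Set.inter_subset_left Set.inter_subset_left
    (fun x hx => ⟨?_, hψ.map_goodSet hx.2⟩) (fun x hx => ⟨?_, hψ'.map_goodSet hx.2⟩)
    (fun y hy => hψ'.leftInv y hy.2.1.2)
    (fun η x hx y hy => hψ.relNear hψ' hx.2.1.2 hy.2.1.2)
    (fun η x hx y hy => hψ'.relNear hψ hx.2.1.2 hy.2.1.2)
    (fun η hη a ha => hψ.exists_mem_goodSet_near hψ' h h' ha hη)
    (fun η hη a ha => hψ'.exists_mem_goodSet_near hψ h' h ha hη)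
    (h.coneCover hq.1).torsionExponent
  · rw [← hψ.map_component_eq hψ' h h' hx.2 hq hx.1]
    exact mem_connectedComponentIn hx.2.2
  · have h1 := hψ'.map_component_eq hψ h' h hx.2 (hψ.map_goodSet hq) hx.1
    rw [hψ.leftInv q hq.1.2] at h1
    rw [← h1]
    exact mem_connectedComponentIn hx.2.2

theorem card_component_eq (hψ : ConeHom (rootCone P) (rootCone P') ψ ψ' L)
    (hψ' : ConeHom (rootCone P') (rootCone P) ψ' ψ L) (h : HomogFamily P U d)
    (h' : HomogFamily P' U' d') {q : (ℂ × ℂ) × ℂ} (hq : q ∈ goodSet P P' U U' ψ) :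
    Nat.card {z // ((ψ q).1, z) ∈ connectedComponentIn (rootConeOver P' U') (ψ q)} =
      Nat.card {z // (q.1, z) ∈ connectedComponentIn (rootConeOver P U) q} := by
  have h1 := hψ'.card_component_dvd hψ h' h (hψ.map_goodSet hq)
  rw [hψ.leftInv q hq.1.2] at h1
  exact Nat.dvd_antisymm (hψ.card_component_dvd hψ' h h' hq) h1

end ConeHom

theorem MonicFamily.card_le_card_of_leftInv {Q Q' : ℂ × ℂ → Polynomial ℂ} {d d' N N' : ℕ}
    (hQ : MonicFamily Q d) (hQ' : MonicFamily Q' d') {u₀ u₀' : ℂ × ℂ} {r r' : ℝ}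
    (hr : 0 < r) (hr' : 0 < r')
    (hN : ∀ u ∈ Metric.ball u₀ r, (Q u).roots.toFinset.card = N)
    (hN' : ∀ u ∈ Metric.ball u₀' r', (Q' u).roots.toFinset.card = N') {z₀' : ℂ} {σ' : ℝ}
    (hσ' : ∀ u ∈ Metric.ball u₀' r', ∀ z, (Q' u).eval z = 0 → dist z z₀' ≠ σ')
    {χ χ' : (ℂ × ℂ) × ℂ → (ℂ × ℂ) × ℂ} {D' : Set ((ℂ × ℂ) × ℂ)}
    (hD' : ∀ q, q ∈ D' ↔ q ∈ rootCone Q' ∧ q.1 ∈ Metric.ball u₀' r' ∧ dist q.2 z₀' < σ')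
    {Z : Finset ℂ} (hZ : ∀ z ∈ Z, (Q u₀).eval z = 0 ∧ χ (u₀, z) ∈ D' ∧ χ' (χ (u₀, z)) = (u₀, z))
    (hχ' : ContinuousOn χ' D')
    (hmaps : ∀ q ∈ D', χ' q ∈ rootCone Q ∧ (χ' q).1 ∈ Metric.ball u₀ r) :
    Z.card ≤ ((Q' u₀').roots.toFinset.filter fun b => dist b z₀' < σ').card := by
  classical
  have hex : ∀ z ∈ Z, ∃ s : ℂ × ℂ → ℂ, ContinuousOn s (Metric.ball u₀' r') ∧
      s (χ (u₀, z)).1 = (χ (u₀, z)).2 ∧ ∀ u ∈ Metric.ball u₀' r', (u, s u) ∈ D' := by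
    intro z hz
    obtain ⟨-, hzD, -⟩ := hZ z hz
    rw [hD'] at hzD
    obtain ⟨s, hs, hs1, hs0⟩ := hQ'.exists_section_ball hN' hzD.2.1 hzD.1
    refine ⟨s, hs, hs1, fun u hu => (hD' _).2 ⟨hs0 u hu, hu, ?_⟩⟩
    by_contra hcon
    have h1 := (convex_ball u₀' r').isPreconnected.intermediate_value hzD.2.1 hu
      (continuous_dist.comp_continuousOn (hs.prodMk (continuousOn_const (c := z₀'))))
    have h2 : σ' ∈ Set.Icc (dist (s (χ (u₀, z)).1) z₀') (dist (s u) z₀') :=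
      ⟨by rw [hs1]; exact hzD.2.2.le, not_lt.1 hcon⟩
    obtain ⟨u', hu', he⟩ := h1 h2
    exact hσ' u' hu' _ (hs0 u' hu') he
  choose! s hs hs1 hsD using hex
  have hu₀' : u₀' ∈ Metric.ball u₀' r' := Metric.mem_ball_self hr'
  refine Finset.card_le_card_of_injOn (fun z => s z u₀') (fun z hz => ?_) (fun z hz w hw hzw => ?_)
  · have h1 := (hD' _).1 (hsD z hz u₀' hu₀')
    exact Finset.mem_filter.2 ⟨(Polynomial.mem_toFinset_roots (hQ'.monic _)).2 h1.1, h1.2.2⟩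
  · obtain ⟨hz0, hzD, hzi⟩ := hZ z hz
    obtain ⟨hw0, hwD, hwi⟩ := hZ w hw
    have heq := hQ'.section_eq_ball hN' (hs z hz) (hs w hw)
      (fun u hu => ((hD' _).1 (hsD z hz u hu)).1) (fun u hu => ((hD' _).1 (hsD w hw u hu)).1)
      hu₀' hzw
    obtain ⟨t, ht, ht1, ht0⟩ := hQ.exists_section_ball hN (Metric.mem_ball_self hr) hz0
    let γ : Metric.ball u₀' r' → (ℂ × ℂ) × ℂ := fun b => χ' (b, s z b)
    have hγD : ∀ b : Metric.ball u₀' r', ((b : ℂ × ℂ), s z b) ∈ D' := fun b => hsD z hz b b.2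
    have hγ : Continuous γ := hχ'.comp_continuous
      (continuous_subtype_val.prodMk (hs z hz).domRestrict) hγD
    have hfam : MonicFamily (fun b => Q (γ b).1) d :=
      ⟨fun b => hQ.monic _, fun b => hQ.natDegree _,
        fun k => (hQ.continuous k).comp (continuous_fst.comp hγ)⟩
    have : PreconnectedSpace (Metric.ball u₀' r') :=
      Subtype.preconnectedSpace (convex_ball u₀' r').isPreconnected
    have hzb := ((hD' _).1 hzD).2.1
    have hwb := ((hD' _).1 hwD).2.1
    have hγz : γ ⟨_, hzb⟩ = (u₀, z) := by
      change χ' (_, s z _) = _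
      rw [hs1 z hz]
      exact hzi
    have hγw : γ ⟨_, hwb⟩ = (u₀, w) := by
      change χ' (_, s z _) = _
      rw [heq _ hwb, hs1 w hw]
      exact hwi
    have hfun := hfam.section_eq (fun b => hN _ (hmaps _ (hγD b)).2)
      (s := fun b => (γ b).2) (t := fun b => t (γ b).1) (continuous_snd.comp hγ)
      (ht.comp_continuous (continuous_fst.comp hγ) fun b => (hmaps _ (hγD b)).2)
      (fun b => (hmaps _ (hγD b)).1) (fun b => ht0 _ (hmaps _ (hγD b)).2)
      (b := ⟨_, hzb⟩) (by simp only [hγz, ht1])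
    have := congrFun hfun ⟨_, hwb⟩
    simp only [hγw, ht1] at this
    exact this.symm

theorem Polynomial.card_filter_toFinset_roots_le (p : Polynomial ℂ) (z : ℂ) (σ : ℝ) :
    (p.roots.toFinset.filter fun b => dist b z < σ).card ≤
      p.roots.countP fun b => dist b z < σ := by
  classical
  rw [← Multiset.toFinset_filter, Multiset.countP_eq_card_filter]
  exact Multiset.toFinset_card_le _

theorem Polynomial.card_filter_toFinset_roots {p : Polynomial ℂ}
    (hp : p.roots.toFinset.card = p.natDegree) (z : ℂ) (σ : ℝ) :
    (p.roots.toFinset.filter fun b => dist b z < σ).card =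
      p.roots.countP fun b => dist b z < σ := by
  classical
  rw [← IsAlgClosed.card_roots_eq_natDegree, Multiset.toFinset_card_eq_card_iff_nodup] at hp
  rw [← Multiset.toFinset_filter, Multiset.countP_eq_card_filter]
  exact Multiset.toFinset_card_of_nodup (hp.filter _)

theorem Filter.Eventually.exists_ball {X : Type*} [PseudoMetricSpace X] {l : Filter ℕ}
    {p : ℕ × X → Prop} {x₀ : X} (h : ∀ᶠ i in atTop ×ˢ 𝓝 x₀, p i) (hl : l ≤ atTop) :
    ∃ r > 0, ∀ᶠ n in l, ∀ x ∈ Metric.ball x₀ r, p (n, x) := by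
  obtain ⟨pa, ha, pb, hb, hab⟩ := eventually_prod_iff.1 h
  obtain ⟨r, hr, hball⟩ := Metric.eventually_nhds_iff_ball.1 hb
  exact ⟨r, hr, (ha.filter_mono hl).mono fun n hn x hx => hab hn (hball x hx)⟩

theorem Bornology.IsBounded.eventually_smul_notMem {V : Type*} [NormedAddCommGroup V]
    [NormedSpace ℂ V] {K : Set V} (hK : Bornology.IsBounded K) {ρ : ℝ} (hρ : 0 < ρ) :
    ∀ᶠ n : ℕ in atTop, ∀ v : V, ρ ≤ ‖v‖ → (n : ℂ) • v ∉ K := by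
  obtain ⟨R, hR⟩ := hK.subset_closedBall 0
  filter_upwards [(tendsto_natCast_atTop_atTop.atTop_mul_const hρ).eventually_gt_atTop R] with n hn
    v hv hmem
  have h1 := hR hmem
  rw [mem_closedBall_zero_iff, norm_smul, Complex.norm_natCast] at h1
  have := mul_le_mul_of_nonneg_left hv (Nat.cast_nonneg n : (0 : ℝ) ≤ n)
  linarith

namespace AsymptoticFamily

variable {F P : ℂ × ℂ → Polynomial ℂ} {U : Set (ℂ × ℂ)} {d : ℕ}

theorem eventually_root_near (h : AsymptoticFamily F P U d) (u₀ : ℂ × ℂ) {σ : ℝ} (hσ : 0 < σ) :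
    ∀ᶠ i : ℕ × (ℂ × ℂ) in atTop ×ˢ 𝓝 u₀, ∀ z, (rescale F i.1 i.2).eval z = 0 →
      ∃ a, (P u₀).eval a = 0 ∧ dist z a < σ :=
  Polynomial.eventually_exists_root_dist_lt (p := fun i : ℕ × (ℂ × ℂ) => rescale F i.1 i.2)
    (fun i => (h.family'.rescale i.1).monic i.2) (fun i => (h.family'.rescale i.1).natDegree i.2)
    (h.family.monic u₀) (h.family.natDegree u₀) (fun k => h.tendsto k u₀) hσ

/-- Near a point over a good direction, the rescaled families have only simple roots, and as many
of them as the multiplicity of the limit root. -/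
theorem exists_local (h : AsymptoticFamily F P U d) {ω : Ultrafilter ℕ}
    (hω : (ω : Filter ℕ) ≤ atTop) {K : Set ((ℂ × ℂ) × ℂ)} (hK : Bornology.IsBounded K)
    {v : (ℂ × ℂ) × ℂ} (hv : v ∈ rootConeOver P U) {η : ℝ} (hη : 0 < η) :
    ∃ σ > 0, σ < η ∧ ∃ r > 0, r ≤ η ∧ ∀ᶠ n : ℕ in (ω : Filter ℕ), n ≠ 0 ∧
      (∀ u ∈ Metric.ball v.1 r, (rescale F n u).roots.toFinset.card = d) ∧
      (∀ u ∈ Metric.ball v.1 r, ∀ z, (rescale F n u).eval z = 0 → dist z v.2 ≠ σ) ∧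
      (rescale F n v.1).roots.countP (fun b => dist b v.2 < σ) =
        (P v.1).rootMultiplicity v.2 ∧
      ∀ q ∈ rootCone (rescale F n), dist q v ≤ ‖v‖ / 2 → (n : ℂ) • q ∈ rootCone F \ K := by
  classical
  have hv0 : 0 < ‖v‖ := norm_pos_iff.2 fun h0 => h.fst_ne _ hv.1 (by rw [h0]; rfl)
  obtain ⟨σ, hσ, hση, hsep⟩ := Finset.exists_pos_lt_dist (P v.1).roots.toFinset hη
  simp only [Polynomial.mem_toFinset_roots (h.family.monic _)] at hsep
  obtain ⟨r₁, hr₁, hcard⟩ := (h.sep _ hv.1).exists_ball hω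
  obtain ⟨r₂, hr₂, hnear⟩ := (h.eventually_root_near v.1 hσ).exists_ball hω
  have hcount : ∀ᶠ n : ℕ in (ω : Filter ℕ), (rescale F n v.1).roots.countP
      (fun b => dist b v.2 < σ) = (P v.1).rootMultiplicity v.2 :=
    Polynomial.eventually_countP_roots (fun n => (h.family'.rescale n).monic _)
      (fun n => (h.family'.rescale n).natDegree _) (h.family.natDegree _)
      (fun k => h.tendsto_comp hω k tendsto_const_nhds) hσ fun b hb hbv => by
        have := hsep b (Polynomial.isRoot_of_mem_roots hb) v.2 hv.2 hbv
        linarith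
  refine ⟨σ, hσ, hση, min η (min r₁ r₂), lt_min hη (lt_min hr₁ hr₂), min_le_left _ _, ?_⟩
  filter_upwards [hcard, hnear, hcount, (eventually_ne_atTop 0).filter_mono hω,
    (hK.eventually_smul_notMem (half_pos hv0)).filter_mono hω] with n hcard hnear hcount hn hK
  have hsub₁ : Metric.ball v.1 (min η (min r₁ r₂)) ⊆ Metric.ball v.1 r₁ :=
    Metric.ball_subset_ball ((min_le_right _ _).trans (min_le_left _ _))
  have hsub₂ : Metric.ball v.1 (min η (min r₁ r₂)) ⊆ Metric.ball v.1 r₂ :=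
    Metric.ball_subset_ball ((min_le_right _ _).trans (min_le_right _ _))
  refine ⟨hn, fun u hu => ?_, fun u hu z hz heq => ?_, hcount, fun q hq hqv => ⟨?_, hK q ?_⟩⟩
  · rw [h.family'.card_roots_rescale hn]
    exact hcard u (hsub₁ hu)
  · obtain ⟨a, ha, hza⟩ := hnear u (hsub₂ hu) z hz
    rcases eq_or_ne a v.2 with rfl | hav
    · exact hza.ne heq
    · have h1 := hsep a ha v.2 hv.2 hav
      have h2 := dist_triangle_left a v.2 z
      linarith
  · exact (MonicFamily.eval_rescale_eq_zero hn q.1 q.2).1 hq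
  · have := norm_sub_norm_le v q
    rw [← dist_eq_norm, dist_comm] at this
    linarith

end AsymptoticFamily

theorem ConeMap.rootMultiplicity_le {F P F' P' : ℂ × ℂ → Polynomial ℂ} {U U' : Set (ℂ × ℂ)}
    {d d' : ℕ} (h : AsymptoticFamily F P U d) (h' : AsymptoticFamily F' P' U' d')
    {ω : Ultrafilter ℕ} {K K' : Set ((ℂ × ℂ) × ℂ)} (hK : Bornology.IsBounded K)
    (hK' : Bornology.IsBounded K') {φ φ' ψ ψ' : (ℂ × ℂ) × ℂ → (ℂ × ℂ) × ℂ} {L : ℝ}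
    (hφ : ConeMap ω (rootCone F \ K) (rootCone P) (rootCone F' \ K') (rootCone P') φ φ' ψ ψ' L)
    (hφ' : ConeMap ω (rootCone F' \ K') (rootCone P') (rootCone F \ K) (rootCone P) φ' φ ψ' ψ L)
    {v : (ℂ × ℂ) × ℂ} (hv : v ∈ rootConeOver P U) (hw : ψ v ∈ rootConeOver P' U') :
    (P v.1).rootMultiplicity v.2 ≤ (P' (ψ v).1).rootMultiplicity (ψ v).2 := by
  classical
  have hω := hφ.cone.le_atTop
  have hL := hφ.pos
  set w := ψ v with hwdef
  have hv0 : 0 < ‖v‖ := norm_pos_iff.2 fun h0 => h.fst_ne _ hv.1 (by rw [h0]; rfl)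
  have hw0 : 0 < ‖w‖ := norm_pos_iff.2 fun h0 => h'.fst_ne _ hw.1 (by rw [h0]; rfl)
  obtain ⟨x, hx, hxv⟩ := hφ.cone.exists_seq v hv.2
  have hxw := hφ.tendsto v hv.2 x hx hxv
  rw [← hwdef] at hxw
  obtain ⟨_, -, -, r, hr, -, hloc₁⟩ := h.exists_local hω hK hv one_pos
  have hη : 0 < min (‖w‖ / 2) (r / (2 * L + 1)) := by positivity
  set η := min (‖w‖ / 2) (r / (2 * L + 1)) with hηdef
  have hηw : η ≤ ‖w‖ / 2 := min_le_left _ _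
  have hηr : η * (2 * L + 1) ≤ r := (le_div_iff₀ (by positivity)).1 (min_le_right _ _)
  obtain ⟨σ', hσ', hση', r', hr', hrη', hloc'⟩ := h'.exists_local hω hK' hw hη
  have hε : 0 < min (min η (‖v‖ / 2)) (min r' σ' / (2 * L + 1)) := by positivity
  set ε := min (min η (‖v‖ / 2)) (min r' σ' / (2 * L + 1)) with hεdef
  have hεη : ε ≤ η := (min_le_left _ _).trans (min_le_left _ _)
  have hεv : ε ≤ ‖v‖ / 2 := (min_le_left _ _).trans (min_le_right _ _)
  have hεr : ε * (2 * L + 1) ≤ min r' σ' := (le_div_iff₀ (by positivity)).1 (min_le_right _ _)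
  obtain ⟨ρ, hρ, hρε, _, -, -, hloc⟩ := h.exists_local hω hK hv hε
  obtain ⟨n, ⟨hn, hcard, -, -, hmem⟩, ⟨-, hcard', hne', hcount', hmem'⟩, ⟨-, -, -, hcount, -⟩,
      hxX, hxv, hxw⟩ :=
    (hloc₁.and (hloc'.and (hloc.and (hx.and ((Metric.tendsto_nhds.1 hxv ε hε).and
      (Metric.tendsto_nhds.1 hxw ε hε)))))).exists
  have hn' : (n : ℂ) ≠ 0 := Nat.cast_ne_zero.2 hn
  let χ : (ℂ × ℂ) × ℂ → (ℂ × ℂ) × ℂ := fun q => (n : ℂ)⁻¹ • φ ((n : ℂ) • q)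
  let χ' : (ℂ × ℂ) × ℂ → (ℂ × ℂ) × ℂ := fun q => (n : ℂ)⁻¹ • φ' ((n : ℂ) • q)
  let D' : Set ((ℂ × ℂ) × ℂ) := {q | q ∈ rootCone (rescale F' n) ∧ q.1 ∈ Metric.ball w.1 r' ∧
    dist q.2 w.2 < σ'}
  have hD'w : ∀ q ∈ D', dist q w < η := fun q hq => by
    rw [Prod.dist_eq]
    exact max_lt (lt_of_lt_of_le hq.2.1 hrη') (hq.2.2.trans hση')
  have hD'X : ∀ q ∈ D', (n : ℂ) • q ∈ rootCone F' \ K' := fun q hq =>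
    hmem' q hq.1 ((hD'w q hq).le.trans hηw)
  have hχ'le : ∀ p ∈ D', ∀ q ∈ D', dist (χ' p) (χ' q) ≤ L * dist p q := fun p hp q hq => by
    have := norm_inv_smul_sub_le (n := n) (hφ'.dist_le _ (hD'X p hp) _ (hD'X q hq))
    rwa [inv_smul_smul₀ hn', inv_smul_smul₀ hn'] at this
  have hcountZ : ((rescale F n v.1).roots.toFinset.filter fun b => dist b v.2 < ρ).card =
      (P v.1).rootMultiplicity v.2 := by
    rw [Polynomial.card_filter_toFinset_roots, hcount]
    rw [(h.family'.rescale n).natDegree]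
    exact hcard _ (Metric.mem_ball_self hr)
  rw [← hcountZ, ← hcount']
  refine (MonicFamily.card_le_card_of_leftInv (h.family'.rescale n) (h'.family'.rescale n) hr hr'
    hcard hcard' hne' (χ := χ) (χ' := χ') (D' := D') (fun q => Iff.rfl) (fun z hz => ?_) ?_
    fun q hq => ⟨?_, ?_⟩).trans (Polynomial.card_filter_toFinset_roots_le _ _ _)
  · rw [Finset.mem_filter, Polynomial.mem_toFinset_roots ((h.family'.rescale n).monic _)] at hz
    have hzv : dist (v.1, z) v < ε := by
      rw [Prod.dist_eq, dist_self]
      exact max_lt hε (hz.2.trans hρε)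
    have hzX := hmem (v.1, z) hz.1 (hzv.le.trans hεv)
    have hinv : χ' (χ (v.1, z)) = (v.1, z) := by
      simp only [χ, χ', smul_inv_smul₀ hn', hφ.leftInv _ hzX, inv_smul_smul₀ hn']
    have hle := norm_inv_smul_sub_le (n := n) (hφ.dist_le _ hzX _ hxX)
    rw [inv_smul_smul₀ hn'] at hle
    have hdist : dist (χ (v.1, z)) w < min r' σ' := by
      calc dist (χ (v.1, z)) w ≤ dist (χ (v.1, z)) ((n : ℂ)⁻¹ • φ (x n)) +
            dist ((n : ℂ)⁻¹ • φ (x n)) w := dist_triangle _ _ _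
        _ ≤ L * dist (v.1, z) ((n : ℂ)⁻¹ • x n) + dist ((n : ℂ)⁻¹ • φ (x n)) w := by gcongr
        _ ≤ L * (dist (v.1, z) v + dist ((n : ℂ)⁻¹ • x n) v) + dist ((n : ℂ)⁻¹ • φ (x n)) w := by
          gcongr
          exact dist_triangle_right _ _ _
        _ < L * (ε + ε) + ε := by gcongr
        _ = ε * (2 * L + 1) := by ring
        _ ≤ _ := hεr
    rw [Prod.dist_eq] at hdist
    refine ⟨hz.1, ⟨?_, ?_, ?_⟩, hinv⟩
    · exact (MonicFamily.mem_rootCone_iff hn _).1 (hφ.mapsTo hzX).1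
    · exact ((le_max_left _ _).trans_lt hdist).trans_le (min_le_left _ _)
    · exact ((le_max_right _ _).trans_lt hdist).trans_le (min_le_right _ _)
  · exact (LipschitzOnWith.of_dist_le_mul (K := ⟨L, hL.le⟩) hχ'le).continuousOn
  · exact (MonicFamily.mem_rootCone_iff hn _).1 (hφ'.mapsTo (hD'X q hq)).1
  · have hle := norm_inv_smul_sub_le (n := n) (hφ'.dist_le _ (hD'X q hq) _ (hφ.mapsTo hxX))
    rw [inv_smul_smul₀ hn', hφ.leftInv _ hxX] at hle
    have hdist : dist (χ' q) v < r := by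
      calc dist (χ' q) v ≤ dist (χ' q) ((n : ℂ)⁻¹ • x n) + dist ((n : ℂ)⁻¹ • x n) v :=
            dist_triangle _ _ _
        _ ≤ L * dist q ((n : ℂ)⁻¹ • φ (x n)) + dist ((n : ℂ)⁻¹ • x n) v := by gcongr
        _ ≤ L * (dist q w + dist ((n : ℂ)⁻¹ • φ (x n)) w) + dist ((n : ℂ)⁻¹ • x n) v := by
          gcongr
          exact dist_triangle_right _ _ _
        _ < L * (η + η) + η := by
          have := hD'w q hq
          gcongr
          · exact hxw.trans_le hεη
          · exact hxv.trans_le hεη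
        _ = η * (2 * L + 1) := by ring
        _ ≤ _ := hηr
    rw [Prod.dist_eq] at hdist
    exact (le_max_left _ _).trans_lt hdist

namespace HomogFamily

variable {P : ℂ × ℂ → Polynomial ℂ} {U : Set (ℂ × ℂ)} {d : ℕ}

theorem rootMultiplicity_eq (h : HomogFamily P U d) {p q : (ℂ × ℂ) × ℂ}
    (hq : q ∈ rootConeOver P U) (hpq : p ∈ connectedComponentIn (rootConeOver P U) q) :
    (P p.1).rootMultiplicity p.2 = (P q.1).rootMultiplicity q.2 := by
  have hsub := connectedComponentIn_subset (rootConeOver P U) q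
  obtain ⟨N, hN⟩ := h.card
  refine isPreconnected_connectedComponentIn.eq_of_locally_eq (S := rootConeOver P U)
    (fun q : (ℂ × ℂ) × ℂ => (P q.1).rootMultiplicity q.2) (fun p₀ hp₀ => ?_) ⟨hpq, hsub hpq⟩
    ⟨mem_connectedComponentIn hq, hq⟩
  have hp₀E := hsub hp₀
  refine ⟨subset_closure hp₀E, ?_⟩
  obtain ⟨σ, hσ, -, -, hev⟩ := h.family.exists_sheets
    (Filter.mem_of_superset (h.isOpen.mem_nhds hp₀E.1) fun u hu => hN u hu) one_pos
  have hev' : ∀ᶠ x : (ℂ × ℂ) × ℂ in 𝓝 p₀, x ∈ rootConeOver P U →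
      (P x.1).rootMultiplicity x.2 = (P p₀.1).rootMultiplicity p₀.2 := by
    filter_upwards [continuous_fst.tendsto p₀ |>.eventually hev,
      continuous_snd.tendsto p₀ |>.eventually (Metric.ball_mem_nhds _ hσ)] with x hx hx2 hxE
    exact hx.2.2 _ _ hp₀E.2 hxE.2 hx2
  obtain ⟨O, hO, hOo, hp₀O⟩ := mem_nhds_iff.1 hev'
  exact ⟨O, hOo, hp₀O, fun x hx y hy => (hO hx.2 hx.1).trans (hO hy.2 hy.1).symm⟩

/-- The components of the zero set over `U`, read off from the roots over the point `u`. -/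
noncomputable def components (P : ℂ × ℂ → Polynomial ℂ) (U : Set (ℂ × ℂ)) (u : ℂ × ℂ) :
    Finset (Set ((ℂ × ℂ) × ℂ)) :=
  open Classical in
  (P u).roots.toFinset.image fun z => connectedComponentIn (rootConeOver P U) (u, z)

/-- The number of roots over the point `u` lying in `W`, counted with multiplicities. -/
noncomputable def weight (P : ℂ × ℂ → Polynomial ℂ) (U : Set (ℂ × ℂ)) (u : ℂ × ℂ)
    (W : Set ((ℂ × ℂ) × ℂ)) : ℕ :=
  open Classical in
  ∑ z ∈ (P u).roots.toFinset with connectedComponentIn (rootConeOver P U) (u, z) = W,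
    (P u).rootMultiplicity z

theorem sum_weight (h : HomogFamily P U d) (u : ℂ × ℂ) :
    ∑ W ∈ components P U u, weight P U u W = d := by
  classical
  have h1 : ∑ z ∈ (P u).roots.toFinset, (P u).rootMultiplicity z = d := by
    rw [← h.family.natDegree u, ← IsAlgClosed.card_roots_eq_natDegree,
      ← Multiset.toFinset_sum_count_eq]
    exact Finset.sum_congr rfl fun z _ => (Polynomial.count_roots _).symm
  rw [← h1]
  exact Finset.sum_fiberwise_of_maps_to (fun z hz => Finset.mem_image_of_mem _ hz) _

theorem mem_components (h : HomogFamily P U d) {u : ℂ × ℂ} (hu : u ∈ U) {q : (ℂ × ℂ) × ℂ}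
    (hq : q ∈ rootConeOver P U) :
    connectedComponentIn (rootConeOver P U) q ∈ components P U u := by
  classical
  have hsub := connectedComponentIn_subset (rootConeOver P U) q
  have hW := h.coneCover hq
  have : Nonempty {z // (u, z) ∈ connectedComponentIn (rootConeOver P U) q} :=
    (Nat.card_pos_iff.1 (by rw [hW.fiber u hu]; exact hW.pos)).1
  obtain ⟨z, hz⟩ := this
  exact Finset.mem_image.2 ⟨z, (Polynomial.mem_toFinset_roots (h.family.monic _)).2 (hsub hz).2,
    (connectedComponentIn_eq hz).symm⟩

theorem weight_component (h : HomogFamily P U d) {u : ℂ × ℂ} (hu : u ∈ U) {q : (ℂ × ℂ) × ℂ}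
    (hq : q ∈ rootConeOver P U) :
    weight P U u (connectedComponentIn (rootConeOver P U) q) =
      Nat.card {z // (q.1, z) ∈ connectedComponentIn (rootConeOver P U) q} *
        (P q.1).rootMultiplicity q.2 := by
  classical
  have hsub := connectedComponentIn_subset (rootConeOver P U) q
  have hmem : ∀ z, z ∈ (P u).roots.toFinset.filter (fun z =>
      connectedComponentIn (rootConeOver P U) (u, z) = connectedComponentIn (rootConeOver P U) q) ↔
      (u, z) ∈ connectedComponentIn (rootConeOver P U) q := by
    intro z
    rw [Finset.mem_filter, Polynomial.mem_toFinset_roots (h.family.monic _)]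
    refine ⟨fun hz => ?_, fun hz => ⟨(hsub hz).2, (connectedComponentIn_eq hz).symm⟩⟩
    rw [← hz.2]
    exact mem_connectedComponentIn ⟨hu, hz.1⟩
  rw [weight, Finset.sum_congr rfl (fun z hz => h.rootMultiplicity_eq hq ((hmem z).1 hz)),
    Finset.sum_const, smul_eq_mul, ← (h.coneCover hq).fiber u hu,
    ← Nat.card_eq_finsetCard]
  congr 1
  exact Nat.card_congr (Equiv.subtypeEquivRight hmem)

end HomogFamily

theorem ConeMap.coneHom {V V' : Type*} [NormedAddCommGroup V] [NormedSpace ℂ V]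
    [NormedAddCommGroup V'] [NormedSpace ℂ V'] {ω : Ultrafilter ℕ} {X C : Set V} {X' C' : Set V'}
    {φ ψ : V → V'} {φ' ψ' : V' → V} {L : ℝ} (h : ConeMap ω X C X' C' φ φ' ψ ψ' L)
    (h0 : 0 ∈ C) : ConeHom C C' ψ ψ' (max L 1) where
  one_le := le_max_right _ _
  mapsTo := h.map_mem
  leftInv := h.leftInv_map
  dist_le a ha b hb := (h.dist_map_le a ha b hb).trans (by gcongr; exact le_max_left _ _)
  zero_mem := h0
  map_zero := h.map_zero h0

theorem AsymptoticFamily.zero_mem {F P : ℂ × ℂ → Polynomial ℂ} {U : Set (ℂ × ℂ)} {d : ℕ}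
    (h : AsymptoticFamily F P U d) : 0 ∈ rootCone P := by
  obtain ⟨z, hz⟩ := h.exists_root 0
  simpa using h.smul_mem_rootCone (q := (0, z)) hz 0

theorem ConeMap.degree_eq {F P F' P' : ℂ × ℂ → Polynomial ℂ} {U U' : Set (ℂ × ℂ)}
    {d d' : ℕ} (h : AsymptoticFamily F P U d) (h' : AsymptoticFamily F' P' U' d')
    {ω : Ultrafilter ℕ} {K K' : Set ((ℂ × ℂ) × ℂ)} (hK : Bornology.IsBounded K)
    (hK' : Bornology.IsBounded K') {φ φ' ψ ψ' : (ℂ × ℂ) × ℂ → (ℂ × ℂ) × ℂ} {L : ℝ}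
    (hφ : ConeMap ω (rootCone F \ K) (rootCone P) (rootCone F' \ K') (rootCone P') φ φ' ψ ψ' L)
    (hφ' : ConeMap ω (rootCone F' \ K') (rootCone P') (rootCone F \ K) (rootCone P) φ' φ ψ' ψ L) :
    d = d' := by
  classical
  have hψ := hφ.coneHom h.zero_mem
  have hψ' := hφ'.coneHom h'.zero_mem
  have hH := h.toHomogFamily
  have hH' := h'.toHomogFamily
  obtain ⟨u, hu⟩ := hH.dense.nonempty
  obtain ⟨u', hu'⟩ := hH'.dense.nonempty
  have hmult : ∀ v ∈ ConeHom.goodSet P P' U U' ψ,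
      (P v.1).rootMultiplicity v.2 = (P' (ψ v).1).rootMultiplicity (ψ v).2 := by
    intro v hv
    refine (hφ.rootMultiplicity_le h h' hK hK' hφ' hv.1 hv.2).antisymm ?_
    have hv' := hψ.map_goodSet hv
    have := hφ'.rootMultiplicity_le h' h hK' hK hφ hv'.1 hv'.2
    rwa [hψ.leftInv v hv.1.2] at this
  have hrep : ∀ W ∈ HomogFamily.components P U u, ∃ x ∈ ConeHom.goodSet P P' U U' ψ,
      W = connectedComponentIn (rootConeOver P U) x := by
    intro W hW
    obtain ⟨z, hz, rfl⟩ := Finset.mem_image.1 hW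
    have hzE : (u, z) ∈ rootConeOver P U :=
      ⟨hu, (Polynomial.mem_toFinset_roots (hH.family.monic _)).1 hz⟩
    obtain ⟨x, hx, -⟩ := hψ.exists_mem_goodSet_near hψ' hH hH' (mem_connectedComponentIn hzE)
      one_pos
    exact ⟨x, hx.2, connectedComponentIn_eq hx.1⟩
  have hrep' : ∀ W ∈ HomogFamily.components P' U' u', ∃ x ∈ ConeHom.goodSet P' P U' U ψ',
      W = connectedComponentIn (rootConeOver P' U') x := by
    intro W hW
    obtain ⟨z, hz, rfl⟩ := Finset.mem_image.1 hW
    have hzE : (u', z) ∈ rootConeOver P' U' :=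
      ⟨hu', (Polynomial.mem_toFinset_roots (hH'.family.monic _)).1 hz⟩
    obtain ⟨x, hx, -⟩ := hψ'.exists_mem_goodSet_near hψ hH' hH (mem_connectedComponentIn hzE)
      one_pos
    exact ⟨x, hx.2, connectedComponentIn_eq hx.1⟩
  choose! g hg hgW using hrep
  choose! g' hg' hgW' using hrep'
  have hmem : ∀ W ∈ HomogFamily.components P U u,
      connectedComponentIn (rootConeOver P' U') (ψ (g W)) ∈ HomogFamily.components P' U' u' :=
    fun W hW => hH'.mem_components hu' (hg W hW).2
  have hmem' : ∀ W ∈ HomogFamily.components P' U' u',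
      connectedComponentIn (rootConeOver P U) (ψ' (g' W)) ∈ HomogFamily.components P U u :=
    fun W hW => hH.mem_components hu (hg' W hW).2
  have hself : ∀ W ∈ HomogFamily.components P U u, g W ∈ W := fun W hW => by
    have := mem_connectedComponentIn (hg W hW).1
    rwa [← hgW W hW] at this
  have hself' : ∀ W ∈ HomogFamily.components P' U' u', g' W ∈ W := fun W hW => by
    have := mem_connectedComponentIn (hg' W hW).1
    rwa [← hgW' W hW] at this
  rw [← hH.sum_weight u, ← hH'.sum_weight u']
  refine Finset.sum_nbij' (fun W => connectedComponentIn (rootConeOver P' U') (ψ (g W)))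
    (fun W => connectedComponentIn (rootConeOver P U) (ψ' (g' W))) hmem hmem' (fun W hW => ?_)
    (fun W hW => ?_) (fun W hW => ?_)
  · have h1 := hmem W hW
    have h3 := hψ'.map_component_eq hψ hH' hH (hg' _ h1) (hψ.map_goodSet (hg W hW))
      (hself' _ h1)
    rw [hψ.leftInv _ (hg W hW).1.2, ← hgW W hW] at h3
    exact h3
  · have h1 := hmem' W hW
    have h3 := hψ.map_component_eq hψ' hH hH' (hg _ h1) (hψ'.map_goodSet (hg' W hW))
      (hself _ h1)
    rw [hψ'.leftInv _ (hg' W hW).1.2, ← hgW' W hW] at h3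
    exact h3
  · have h1 := hg W hW
    rw [hH'.weight_component hu' h1.2, hψ.card_component_eq hψ' hH hH' h1, ← hmult _ h1,
      ← hH.weight_component hu h1.1, ← hgW W hW]

/-- A bi-Lipschitz map at infinity between two asymptotically homogeneous hypersurfaces forces
them to have the same degree. -/
theorem AsymptoticFamily.degree_eq {F P F' P' : ℂ × ℂ → Polynomial ℂ} {U U' : Set (ℂ × ℂ)}
    {d d' : ℕ} (h : AsymptoticFamily F P U d) (h' : AsymptoticFamily F' P' U' d')
    (hφ : OuterBiLipAtInfty (rootCone F) (rootCone F')) : d = d' := by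
  obtain ⟨K, K', φ, hK, hK', hbij, h1, h2⟩ := hφ
  have hω : (hyperfilter ℕ : Filter ℕ) ≤ atTop := Nat.hyperfilter_le_atTop
  obtain ⟨hc, hne⟩ := h.isAsymptoticCone hω hK.isBounded
  obtain ⟨hc', -⟩ := h'.isAsymptoticCone hω hK'.isBounded
  obtain ⟨φ', ψ, ψ', L, hψ, hψ'⟩ := hc.exists_coneMap hc' hne hbij h1 h2
  exact hψ.degree_eq h h' hK.isBounded hK'.isBounded hψ'

namespace Polynomial

/-- A squarefree monic polynomial over an integrally closed domain of characteristic zero satisfies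
a Bézout identity with its derivative, up to a nonzero constant. -/
theorem Monic.exists_bezout_derivative {A : Type*} [CommRing A] [IsDomain A]
    [IsIntegrallyClosed A] [CharZero A] {h : Polynomial A} (hm : h.Monic) (hsq : Squarefree h) :
    ∃ a b : Polynomial A, ∃ R ≠ 0, a * h + b * derivative h = C R := by
  let K := FractionRing A
  have hinj : Function.Injective (algebraMap A K) := IsFractionRing.injective A K
  have : CharZero K := charZero_of_injective_algebraMap hinj
  have hmK := hm.map (algebraMap A K)
  have hsqK : Squarefree (h.map (algebraMap A K)) := by
    intro q hq
    obtain ⟨q', hq'⟩ := IsIntegrallyClosed.eq_map_mul_C_of_dvd K hm (dvd_of_mul_left_dvd hq)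
    have hq0 : q ≠ 0 := by
      rintro rfl
      rw [zero_mul, zero_dvd_iff] at hq
      exact hmK.ne_zero hq
    have hlc : q.leadingCoeff ≠ 0 := leadingCoeff_ne_zero.2 hq0
    have hlcu : IsUnit (C q.leadingCoeff) := isUnit_C.2 hlc.isUnit
    have hq'm : q'.Monic := by
      have h1 := congrArg Polynomial.leadingCoeff hq'
      rw [leadingCoeff_mul, leadingCoeff_C, leadingCoeff_map_of_injective hinj] at h1
      have h2 := mul_right_cancel₀ hlc (h1.trans (one_mul _).symm)
      exact hinj (h2.trans (map_one _).symm)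
    have hdvd : q' * q' ∣ h := by
      refine Monic.dvd_of_fraction_map_dvd_fraction_map (K := K) hm (hq'm.mul hq'm) ?_
      rw [Polynomial.map_mul]
      exact (mul_dvd_mul ⟨_, hq'.symm⟩ ⟨_, hq'.symm⟩).trans hq
    rw [← hq']
    exact ((hsq q' hdvd).map (mapRingHom (algebraMap A K))).mul hlcu
  obtain ⟨a, b, hab⟩ := PerfectField.separable_iff_squarefree.2 hsqK
  obtain ⟨s, hs, ha⟩ := IsLocalization.integerNormalization_spec (nonZeroDivisors A) a
  obtain ⟨t, ht, hb⟩ := IsLocalization.integerNormalization_spec (nonZeroDivisors A) b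
  refine ⟨C t * IsLocalization.integerNormalization (nonZeroDivisors A) a,
    C s * IsLocalization.integerNormalization (nonZeroDivisors A) b, s * t,
    mul_ne_zero (nonZeroDivisors.ne_zero hs) (nonZeroDivisors.ne_zero ht),
    map_injective _ hinj ?_⟩
  rw [derivative_map] at hab
  simp only [Polynomial.map_add, Polynomial.map_mul, ha, hb, map_C, map_mul]
  rw [algebra_compatible_smul K s a, algebra_compatible_smul K t b, smul_eq_C_mul, smul_eq_C_mul]
  linear_combination (C (algebraMap A K s) * C (algebraMap A K t)) * hab

theorem Monic.exists_card_roots_map_eval {σ : Type*} {h : Polynomial (MvPolynomial σ ℂ)}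
    (hm : h.Monic) (hsq : Squarefree h) :
    ∃ R : MvPolynomial σ ℂ, R ≠ 0 ∧ ∀ u, MvPolynomial.eval u R ≠ 0 →
      (h.map (MvPolynomial.eval u)).roots.toFinset.card = h.natDegree := by
  obtain ⟨a, b, R, hR, hab⟩ := hm.exists_bezout_derivative hsq
  refine ⟨R, hR, fun u hu => ?_⟩
  have hsep : (h.map (MvPolynomial.eval u)).Separable := by
    have h1 := congrArg (Polynomial.map (MvPolynomial.eval u)) hab
    simp only [Polynomial.map_add, Polynomial.map_mul, map_C, ← derivative_map] at h1
    refine ⟨C (MvPolynomial.eval u R)⁻¹ * a.map (MvPolynomial.eval u),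
        C (MvPolynomial.eval u R)⁻¹ * b.map (MvPolynomial.eval u), ?_⟩
    rw [mul_assoc, mul_assoc, ← mul_add, h1, ← C_mul, inv_mul_cancel₀ hu, C_1]
  rw [Multiset.toFinset_card_of_nodup (nodup_roots hsep),
    IsAlgClosed.card_roots_eq_natDegree, hm.natDegree_map]

theorem Monic.exists_card_roots_map_eval_eq {σ : Type*} {p : Polynomial (MvPolynomial σ ℂ)}
    (hp : p.Monic) :
    ∃ N, ∃ R : MvPolynomial σ ℂ, R ≠ 0 ∧ ∀ u, MvPolynomial.eval u R ≠ 0 →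
      (p.map (MvPolynomial.eval u)).roots.toFinset.card = N := by
  obtain ⟨h, n, hsq, hdvd, hdvd'⟩ := exists_squarefree_dvd_pow_of_ne_zero hp.ne_zero
  have hlc : IsUnit h.leadingCoeff := by
    obtain ⟨q, hq⟩ := hdvd
    have h1 := congrArg Polynomial.leadingCoeff hq
    rw [hp.leadingCoeff, leadingCoeff_mul] at h1
    exact IsUnit.of_mul_eq_one _ h1.symm
  obtain ⟨c, hc⟩ := hlc
  have hcu : IsUnit (C ((c⁻¹ : (MvPolynomial σ ℂ)ˣ) : MvPolynomial σ ℂ)) := isUnit_C.2 c⁻¹.isUnit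
  have hass : Associated (C ((c⁻¹ : (MvPolynomial σ ℂ)ˣ) : MvPolynomial σ ℂ) * h) h :=
    associated_unit_mul_left _ _ hcu
  have hm : (C ((c⁻¹ : (MvPolynomial σ ℂ)ˣ) : MvPolynomial σ ℂ) * h).Monic := by
    rw [Monic, leadingCoeff_mul, leadingCoeff_C, ← hc, Units.inv_mul]
  generalize C ((c⁻¹ : (MvPolynomial σ ℂ)ˣ) : MvPolynomial σ ℂ) * h = g at hass hm
  obtain ⟨R, hR, hcard⟩ := hm.exists_card_roots_map_eval (hass.squarefree_iff.2 hsq)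
  refine ⟨g.natDegree, R, hR, fun u hu => ?_⟩
  rw [← hcard u hu]
  congr 1
  have h1 := (hass.dvd.trans hdvd)
  have h2 := hdvd'.trans (pow_dvd_pow_of_dvd hass.symm.dvd n)
  ext z
  rw [mem_toFinset_roots (hp.map _), mem_toFinset_roots (hm.map _)]
  constructor
  · intro hz
    have h3 := Polynomial.map_dvd (MvPolynomial.eval u) h2
    rw [Polynomial.map_pow] at h3
    have h4 := eval_dvd (x := z) h3
    rw [hz, zero_dvd_iff, eval_pow] at h4
    exact eq_zero_of_pow_eq_zero h4
  · intro hz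
    have h4 := eval_dvd (x := z) (Polynomial.map_dvd (MvPolynomial.eval u) h1)
    rwa [hz, zero_dvd_iff] at h4

end Polynomial

namespace MvPolynomial

variable {σ : Type*}

theorem IsHomogeneous.eval_smul {p : MvPolynomial σ ℂ} {m : ℕ} (hp : p.IsHomogeneous m) (s : ℂ)
    (x : σ → ℂ) : eval (s • x) p = s ^ m * eval x p := by
  rw [eval_eq, eval_eq, Finset.mul_sum]
  refine Finset.sum_congr rfl fun d hd => ?_
  have hdm : ∑ i ∈ d.support, d i = m := by
    have := hp (mem_support_iff.1 hd)
    simpa [Finsupp.weight_apply, Finsupp.sum] using this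
  rw [← hdm, ← Finset.prod_pow_eq_pow_sum]
  simp only [Pi.smul_apply, smul_eq_mul, mul_pow, Finset.prod_mul_distrib]
  ring

theorem sum_homogeneousComponent_of_le {p : MvPolynomial σ ℂ} {m : ℕ} (hm : p.totalDegree ≤ m) :
    ∑ j ∈ Finset.range (m + 1), homogeneousComponent j p = p := by
  conv_rhs => rw [← sum_homogeneousComponent p]
  refine (Finset.sum_subset (Finset.range_mono (Nat.succ_le_succ hm)) fun j _ hj => ?_).symm
  exact homogeneousComponent_eq_zero _ _ (by simpa using hj)

theorem eval_smul_eq_sum {p : MvPolynomial σ ℂ} {m : ℕ} (hm : p.totalDegree ≤ m) (s : ℂ)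
    (x : σ → ℂ) :
    eval (s • x) p = ∑ j ∈ Finset.range (m + 1), s ^ j * eval x (homogeneousComponent j p) := by
  conv_lhs => rw [← sum_homogeneousComponent_of_le hm, map_sum]
  exact Finset.sum_congr rfl fun j _ =>
    (homogeneousComponent_isHomogeneous j p).eval_smul s x

theorem tendsto_eval_smul {p : MvPolynomial σ ℂ} {m : ℕ} (hm : p.totalDegree ≤ m) (x₀ : σ → ℂ) :
    Tendsto (fun i : ℕ × (σ → ℂ) => eval ((i.1 : ℂ) • i.2) p * ((i.1 : ℂ)⁻¹) ^ m)
      (atTop ×ˢ 𝓝 x₀) (𝓝 (eval x₀ (homogeneousComponent m p))) := by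
  have hfst : Tendsto (fun i : ℕ × (σ → ℂ) => i.1) (atTop ×ˢ 𝓝 x₀) atTop := tendsto_fst
  have hsnd : Tendsto (fun i : ℕ × (σ → ℂ) => i.2) (atTop ×ˢ 𝓝 x₀) (𝓝 x₀) := tendsto_snd
  have hinv : Tendsto (fun i : ℕ × (σ → ℂ) => ((i.1 : ℂ))⁻¹) (atTop ×ˢ 𝓝 x₀) (𝓝 0) :=
    (tendsto_inv_atTop_nhds_zero_nat (𝕜 := ℂ)).comp hfst
  have hcont : ∀ q : MvPolynomial σ ℂ,
      Tendsto (fun i : ℕ × (σ → ℂ) => eval i.2 q) (atTop ×ˢ 𝓝 x₀) (𝓝 (eval x₀ q)) :=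
    fun q => ((continuous_eval q).tendsto x₀).comp hsnd
  have hlim : Tendsto (fun i : ℕ × (σ → ℂ) => ∑ j ∈ Finset.range (m + 1),
      ((i.1 : ℂ)⁻¹) ^ (m - j) * eval i.2 (homogeneousComponent j p)) (atTop ×ˢ 𝓝 x₀)
      (𝓝 (∑ j ∈ Finset.range (m + 1), (0 : ℂ) ^ (m - j) * eval x₀ (homogeneousComponent j p))) :=
    tendsto_finsetSum _ fun j _ => (hinv.pow _).mul (hcont _)
  have hval : ∑ j ∈ Finset.range (m + 1), (0 : ℂ) ^ (m - j) * eval x₀ (homogeneousComponent j p) =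
      eval x₀ (homogeneousComponent m p) := by
    rw [Finset.sum_range_succ, Finset.sum_eq_zero, zero_add, Nat.sub_self, pow_zero, one_mul]
    intro j hj
    rw [zero_pow (by have := Finset.mem_range.1 hj; omega), zero_mul]
  rw [hval] at hlim
  refine hlim.congr' ?_
  filter_upwards [hfst.eventually (eventually_ne_atTop 0)] with i hi
  have hi' : (i.1 : ℂ) ≠ 0 := Nat.cast_ne_zero.2 hi
  rw [eval_smul_eq_sum hm, Finset.sum_mul]
  refine Finset.sum_congr rfl fun j hj => ?_
  have hjm : j ≤ m := Nat.lt_succ_iff.1 (Finset.mem_range.1 hj)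
  obtain ⟨k, rfl⟩ := Nat.exists_eq_add_of_le hjm
  rw [Nat.add_sub_cancel_left, pow_add, inv_pow, inv_pow]
  field_simp

theorem homogeneousComponent_totalDegree_ne_zero {p : MvPolynomial σ ℂ} (hp : p ≠ 0) :
    homogeneousComponent p.totalDegree p ≠ 0 := by
  obtain ⟨d, hd, hdeg⟩ := Finset.exists_mem_eq_sup p.support (support_nonempty.2 hp)
    (fun s => s.sum fun _ e => e)
  intro h0
  have h1 := congrArg (coeff d) h0
  rw [coeff_homogeneousComponent, if_pos, coeff_zero] at h1
  · exact mem_support_iff.1 hd h1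
  · exact hdeg.symm

end MvPolynomial

/-- The coordinates of a point of `ℂ²`. -/
def planeCoords (u : ℂ × ℂ) : Fin 2 → ℂ := ![u.1, u.2]

theorem planeCoords_smul (s : ℂ) (u : ℂ × ℂ) : planeCoords (s • u) = s • planeCoords u := by
  simp [planeCoords]

theorem continuous_planeCoords : Continuous planeCoords := by
  refine continuous_pi fun i => ?_
  fin_cases i
  · exact continuous_fst
  · exact continuous_snd

/-- The slopes along which a nonzero homogeneous polynomial in two variables vanishes. -/
theorem MvPolynomial.IsHomogeneous.finite_slopes {p : MvPolynomial (Fin 2) ℂ} {m : ℕ}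
    (hp : p.IsHomogeneous m) (hp0 : p ≠ 0) :
    {t : ℂ | eval (planeCoords (1, t)) p = 0}.Finite := by
  let q : Polynomial ℂ := MvPolynomial.aeval ![1, Polynomial.X] p
  have hq : ∀ t, q.eval t = eval (planeCoords (1, t)) p := by
    intro t
    have h1 : ((Polynomial.aeval t).comp (MvPolynomial.aeval ![(1 : Polynomial ℂ), Polynomial.X])) =
        (MvPolynomial.aeval (planeCoords (1, t)) : MvPolynomial (Fin 2) ℂ →ₐ[ℂ] ℂ) := by
      ext i
      fin_cases i <;> simp [planeCoords]
    have h2 := DFunLike.congr_fun h1 p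
    rw [AlgHom.comp_apply, Polynomial.coe_aeval_eq_eval] at h2
    exact h2.trans (congrArg (fun φ => φ p) (coe_aeval_eq_eval (planeCoords (1, t))))
  have hq0 : q ≠ 0 := by
    intro h0
    have h1 : p * X 0 = 0 := by
      refine MvPolynomial.funext fun x => ?_
      rw [map_mul, map_zero, eval_X]
      rcases eq_or_ne (x 0) 0 with hx | hx
      · rw [hx, mul_zero]
      · have h2 : x = x 0 • planeCoords (1, (x 0)⁻¹ * x 1) := by
          ext i
          fin_cases i <;> simp [planeCoords, hx]
        conv_lhs => rw [h2, hp.eval_smul, ← hq, h0, Polynomial.eval_zero]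
        simp
    exact hp0 ((mul_eq_zero.1 h1).resolve_right (X_ne_zero 0))
  exact (q.roots.toFinset.finite_toSet).subset fun t ht => by
    simpa [hq0, hq] using ht

/-- The part of a polynomial with polynomial coefficients which is homogeneous of degree `d` in all
the variables. -/
noncomputable def Polynomial.homogPart {σ : Type*} (h : Polynomial (MvPolynomial σ ℂ)) (d : ℕ) :
    Polynomial (MvPolynomial σ ℂ) :=
  ∑ k ∈ Finset.range (d + 1), Polynomial.monomial k (homogeneousComponent (d - k) (h.coeff k))

theorem Polynomial.coeff_homogPart {σ : Type*} (h : Polynomial (MvPolynomial σ ℂ)) (d k : ℕ) :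
    (h.homogPart d).coeff k =
      if k ≤ d then homogeneousComponent (d - k) (h.coeff k) else 0 := by
  simp [Polynomial.homogPart, Polynomial.finsetSum_coeff, Polynomial.coeff_monomial]

theorem Polynomial.monic_homogPart {σ : Type*} {h : Polynomial (MvPolynomial σ ℂ)}
    (hm : h.Monic) : (h.homogPart h.natDegree).Monic ∧
      (h.homogPart h.natDegree).natDegree = h.natDegree := by
  have hle : (h.homogPart h.natDegree).natDegree ≤ h.natDegree :=
    Polynomial.natDegree_le_iff_coeff_eq_zero.2 fun k hk => by
      rw [Polynomial.coeff_homogPart, if_neg (by omega)]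
  have hc : (h.homogPart h.natDegree).coeff h.natDegree = 1 := by
    rw [Polynomial.coeff_homogPart, if_pos le_rfl, hm.coeff_natDegree, Nat.sub_self,
      homogeneousComponent_zero]
    simp
  refine ⟨Polynomial.monic_of_natDegree_le_of_coeff_eq_one _ hle hc, le_antisymm hle ?_⟩
  exact Polynomial.le_natDegree_of_ne_zero (by rw [hc]; exact one_ne_zero)

/-- The family of polynomials over `ℂ²` obtained by evaluating the coefficients. -/
noncomputable def evalFamily (h : Polynomial (MvPolynomial (Fin 2) ℂ)) (u : ℂ × ℂ) :
    Polynomial ℂ :=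
  h.map (eval (planeCoords u))

theorem monicFamily_evalFamily {h : Polynomial (MvPolynomial (Fin 2) ℂ)} (hm : h.Monic) :
    MonicFamily (evalFamily h) h.natDegree where
  monic u := hm.map _
  natDegree u := hm.natDegree_map _
  continuous k := by
    simp only [evalFamily, Polynomial.coeff_map]
    exact (continuous_eval _).comp continuous_planeCoords

theorem evalFamily_homogPart_smul {h : Polynomial (MvPolynomial (Fin 2) ℂ)} (hm : h.Monic)
    (s : ℂ) (u : ℂ × ℂ) : evalFamily (h.homogPart h.natDegree) (s • u) =
      (evalFamily (h.homogPart h.natDegree) u).scaleRoots s := by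
  obtain ⟨hm', hd'⟩ := Polynomial.monic_homogPart hm
  ext k
  rw [Polynomial.coeff_scaleRoots, (monicFamily_evalFamily hm').natDegree, hd', evalFamily,
    evalFamily, Polynomial.coeff_map, Polynomial.coeff_map, Polynomial.coeff_homogPart]
  split_ifs with hk
  · rw [planeCoords_smul, (homogeneousComponent_isHomogeneous _ _).eval_smul, mul_comm]
  · simp

theorem tendsto_planeCoords_prod (u₀ : ℂ × ℂ) :
    Tendsto (fun i : ℕ × (ℂ × ℂ) => (i.1, planeCoords i.2)) (atTop ×ˢ 𝓝 u₀)
      (atTop ×ˢ 𝓝 (planeCoords u₀)) :=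
  tendsto_fst.prodMk ((continuous_planeCoords.tendsto u₀).comp tendsto_snd)

theorem MvPolynomial.eventually_eval_planeCoords_ne_zero {p : MvPolynomial (Fin 2) ℂ}
    {u₀ : ℂ × ℂ} (hp : eval (planeCoords u₀) (homogeneousComponent p.totalDegree p) ≠ 0) :
    ∀ᶠ i : ℕ × (ℂ × ℂ) in atTop ×ˢ 𝓝 u₀, eval (planeCoords ((i.1 : ℂ) • i.2)) p ≠ 0 := by
  have h1 := (tendsto_eval_smul (le_refl p.totalDegree) (planeCoords u₀)).eventually_ne hp
  filter_upwards [(tendsto_planeCoords_prod u₀).eventually h1] with i hi h0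
  rw [planeCoords_smul] at h0
  exact hi (by rw [h0, zero_mul])

theorem tendsto_rescale_evalFamily {h : Polynomial (MvPolynomial (Fin 2) ℂ)} (hm : h.Monic)
    (htd : ∀ k ≤ h.natDegree, (h.coeff k).totalDegree ≤ h.natDegree - k) (k : ℕ) (u₀ : ℂ × ℂ) :
    Tendsto (fun i : ℕ × (ℂ × ℂ) => (rescale (evalFamily h) i.1 i.2).coeff k) (atTop ×ˢ 𝓝 u₀)
      (𝓝 ((evalFamily (h.homogPart h.natDegree) u₀).coeff k)) := by
  simp only [rescale, Polynomial.coeff_scaleRoots, (monicFamily_evalFamily hm).natDegree]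
  rw [evalFamily, Polynomial.coeff_map, Polynomial.coeff_homogPart]
  simp only [evalFamily, Polynomial.coeff_map, planeCoords_smul]
  split_ifs with hk
  · have h1 := tendsto_eval_smul (htd k hk) (planeCoords u₀)
    generalize eval (planeCoords u₀) (homogeneousComponent (h.natDegree - k) (h.coeff k)) = w at *
    have h2 := h1.comp (tendsto_planeCoords_prod u₀)
    simpa only [Function.comp_def] using h2
  · rw [Polynomial.coeff_eq_zero_of_natDegree_lt (not_le.1 hk)]
    simp

theorem Polynomial.card_roots_scaleRoots {p : Polynomial ℂ} (hp : p.Monic) {s : ℂ} (hs : s ≠ 0) :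
    (p.scaleRoots s).roots.toFinset.card = p.roots.toFinset.card := by
  refine (Finset.card_bij' (fun z _ => s * z) (fun z _ => s⁻¹ * z) ?_ ?_ ?_ ?_).symm
  · intro z hz
    rw [Polynomial.mem_toFinset_roots hp] at hz
    rw [Polynomial.mem_toFinset_roots ((Polynomial.monic_scaleRoots_iff _).2 hp)]
    rw [Polynomial.scaleRoots_eval_mul, hz, mul_zero]
  · intro z hz
    rw [Polynomial.mem_toFinset_roots ((Polynomial.monic_scaleRoots_iff _).2 hp)] at hz
    rw [Polynomial.mem_toFinset_roots hp]
    have h1 := Polynomial.scaleRoots_eval_mul p (s⁻¹ * z) s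
    rw [mul_inv_cancel_left₀ hs, hz] at h1
    exact (mul_eq_zero.1 h1.symm).resolve_left (pow_ne_zero _ hs)
  · intro z _
    rw [inv_mul_cancel_left₀ hs]
  · intro z _
    rw [mul_inv_cancel_left₀ hs]

/-- A squarefree polynomial, monic in the last variable and of total degree equal to its degree in
that variable, defines an asymptotic family. -/
theorem exists_asymptoticFamily_evalFamily {h : Polynomial (MvPolynomial (Fin 2) ℂ)}
    (hm : h.Monic) (hpos : 0 < h.natDegree) (hsq : Squarefree h)
    (htd : ∀ k ≤ h.natDegree, (h.coeff k).totalDegree ≤ h.natDegree - k) :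
    ∃ P U, AsymptoticFamily (evalFamily h) P U h.natDegree := by
  obtain ⟨hm', hd'⟩ := Polynomial.monic_homogPart hm
  obtain ⟨R, hR, hcard⟩ := hm.exists_card_roots_map_eval hsq
  obtain ⟨N, R', hR', hcard'⟩ := hm'.exists_card_roots_map_eval_eq
  have hfam := monicFamily_evalFamily hm'
  rw [hd'] at hfam
  let T := homogeneousComponent (R * R').totalDegree (R * R')
  have hT : T ≠ 0 := homogeneousComponent_totalDegree_ne_zero (mul_ne_zero hR hR')
  have hTh : T.IsHomogeneous (R * R').totalDegree := homogeneousComponent_isHomogeneous _ _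
  have hev : ∀ u₀ : ℂ × ℂ, eval (planeCoords u₀) T ≠ 0 →
      ∀ᶠ i : ℕ × (ℂ × ℂ) in atTop ×ˢ 𝓝 u₀, eval (planeCoords ((i.1 : ℂ) • i.2)) R ≠ 0 ∧
        eval (planeCoords ((i.1 : ℂ) • i.2)) R' ≠ 0 := by
    intro u₀ hu₀
    filter_upwards [eventually_eval_planeCoords_ne_zero hu₀] with i hi
    rw [map_mul] at hi
    exact mul_ne_zero_iff.1 hi
  refine ⟨evalFamily (h.homogPart h.natDegree), {u | u.1 ≠ 0 ∧ eval (planeCoords u) T ≠ 0},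
    { family := hfam
      scale := evalFamily_homogPart_smul hm
      isOpen := ?_
      smul_mem := ?_
      fst_ne := fun u hu => hu.1
      finite := ?_
      card := ⟨N, ?_⟩
      pos := hpos
      family' := monicFamily_evalFamily hm
      tendsto := tendsto_rescale_evalFamily hm htd
      sep := ?_ }⟩
  · exact (isOpen_ne_fun continuous_fst continuous_const).inter
      (isOpen_ne_fun ((continuous_eval T).comp continuous_planeCoords) continuous_const)
  · rintro u ⟨h1, h2⟩ r hr
    refine ⟨mul_ne_zero hr h1, ?_⟩
    rw [planeCoords_smul, hTh.eval_smul]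
    exact mul_ne_zero (pow_ne_zero _ hr) h2
  · refine (hTh.finite_slopes hT).subset fun t ht => ?_
    by_contra h0
    exact ht ⟨one_ne_zero, h0⟩
  · intro u hu
    have hlim : Tendsto (fun n : ℕ => (n, u)) atTop (atTop ×ˢ 𝓝 u) :=
      tendsto_id.prodMk tendsto_const_nhds
    obtain ⟨n, hn, hn0⟩ :=
      ((hlim.eventually (hev u hu.2)).and (eventually_ne_atTop 0)).exists
    have h1 := hcard' _ hn.2
    change (evalFamily (h.homogPart h.natDegree) ((n : ℂ) • u)).roots.toFinset.card = N at h1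
    rw [evalFamily_homogPart_smul hm, Polynomial.card_roots_scaleRoots (hfam.monic u)
      (Nat.cast_ne_zero.2 hn0)] at h1
    exact h1
  · intro u₀ hu₀
    filter_upwards [hev u₀ hu₀.2] with i hi
    exact hcard _ hi.1

theorem Squarefree.map_mulEquiv {M N : Type*} [Monoid M] [Monoid N] {x : M} (hx : Squarefree x)
    (e : M ≃* N) : Squarefree (e x) := by
  rintro y ⟨z, hz⟩
  have h1 : IsUnit (e.symm y) := hx _
    ⟨e.symm z, by rw [← map_mul, ← map_mul, ← hz, e.symm_apply_apply]⟩
  simpa using h1.map e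

theorem ContinuousLinearMap.exists_pos_dist_le {E F : Type*} [NormedAddCommGroup E]
    [NormedAddCommGroup F] [NormedSpace ℂ E] [NormedSpace ℂ F] (e : E →L[ℂ] F) :
    ∃ L > (0 : ℝ), ∀ x y, dist (e x) (e y) ≤ L * dist x y := by
  refine ⟨‖e‖ + 1, by positivity, fun x y => (e.lipschitz.dist_le_mul x y).trans ?_⟩
  gcongr
  simp

/-- The outer bi-Lipschitz type at infinity is invariant under linear changes of coordinates. -/
theorem OuterBiLipAtInfty.congr {E F E' F' : Type*} [NormedAddCommGroup E] [NormedAddCommGroup F]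
    [NormedAddCommGroup E'] [NormedAddCommGroup F'] [NormedSpace ℂ E] [NormedSpace ℂ F]
    [NormedSpace ℂ E'] [NormedSpace ℂ F'] {X : Set E} {Y : Set F} {X' : Set E'} {Y' : Set F'}
    (e : E ≃L[ℂ] E') (e₂ : F ≃L[ℂ] F') (hX : ∀ x, e x ∈ X' ↔ x ∈ X) (hY : ∀ y, e₂ y ∈ Y' ↔ y ∈ Y)
    (h : OuterBiLipAtInfty X Y) : OuterBiLipAtInfty X' Y' := by
  obtain ⟨K, K', φ, hK, hK', hφ, ⟨C, hC, hC'⟩, ⟨c, hc, hc'⟩⟩ := h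
  obtain ⟨L₁, hL₁, h₁⟩ := (e : E →L[ℂ] E').exists_pos_dist_le
  obtain ⟨L₂, hL₂, h₂⟩ := (e.symm : E' →L[ℂ] E).exists_pos_dist_le
  obtain ⟨L₃, hL₃, h₃⟩ := (e₂ : F →L[ℂ] F').exists_pos_dist_le
  obtain ⟨L₄, hL₄, h₄⟩ := (e₂.symm : F' →L[ℂ] F).exists_pos_dist_le
  have hmem : ∀ a ∈ X' \ e '' K, e.symm a ∈ X \ K := fun a ha =>
    ⟨(hX _).1 (by simpa using ha.1), fun hk => ha.2 ⟨_, hk, e.apply_symm_apply a⟩⟩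
  refine ⟨e '' K, e₂ '' K', fun a => e₂ (φ (e.symm a)), hK.image e.continuous,
    hK'.image e₂.continuous, ⟨?_, ?_, ?_⟩, ⟨L₃ * (C * L₂), by positivity, ?_⟩,
    ⟨L₁ * (c * L₄), by positivity, ?_⟩⟩
  · intro a ha
    have h1 := hφ.mapsTo (hmem a ha)
    refine ⟨(hY _).2 h1.1, ?_⟩
    rintro ⟨k, hk, hk'⟩
    exact h1.2 (e₂.injective hk' ▸ hk)
  · intro a ha b hb hab
    exact e.symm.injective (hφ.injOn (hmem a ha) (hmem b hb) (e₂.injective hab))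
  · intro b hb
    have h1 : e₂.symm b ∈ Y \ K' :=
      ⟨(hY _).1 (by simpa using hb.1), fun hk => hb.2 ⟨_, hk, e₂.apply_symm_apply b⟩⟩
    obtain ⟨x, hx, hxb⟩ := hφ.surjOn h1
    refine ⟨e x, ⟨(hX x).2 hx.1, ?_⟩, ?_⟩
    · rintro ⟨k, hk, hk'⟩
      exact hx.2 (e.injective hk' ▸ hk)
    · simp [hxb]
  · intro a ha b hb
    calc dist (e₂ (φ (e.symm a))) (e₂ (φ (e.symm b)))
        ≤ L₃ * dist (φ (e.symm a)) (φ (e.symm b)) := h₃ _ _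
      _ ≤ L₃ * (C * dist (e.symm a) (e.symm b)) := by
          gcongr
          exact hC' _ (hmem a ha) _ (hmem b hb)
      _ ≤ L₃ * (C * (L₂ * dist a b)) := by
          gcongr
          exact h₂ _ _
      _ = L₃ * (C * L₂) * dist a b := by ring
  · intro a ha b hb
    have h5 := h₁ (e.symm a) (e.symm b)
    have h6 := h₄ (e₂ (φ (e.symm a))) (e₂ (φ (e.symm b)))
    simp only [ContinuousLinearEquiv.coe_coe, ContinuousLinearEquiv.apply_symm_apply,
      ContinuousLinearEquiv.symm_apply_apply] at h5 h6
    calc dist a b ≤ L₁ * dist (e.symm a) (e.symm b) := h5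
      _ ≤ L₁ * (c * dist (φ (e.symm a)) (φ (e.symm b))) := by
          gcongr
          exact hc' _ (hmem a ha) _ (hmem b hb)
      _ ≤ L₁ * (c * (L₄ * dist (e₂ (φ (e.symm a))) (e₂ (φ (e.symm b))))) := by
          gcongr
      _ = L₁ * (c * L₄) * dist (e₂ (φ (e.symm a))) (e₂ (φ (e.symm b))) := by ring

namespace MvPolynomial

theorem totalDegree_aeval_le {σ τ : Type*} [Fintype σ] (p : MvPolynomial σ ℂ)
    {g : σ → MvPolynomial τ ℂ} (hg : ∀ i, (g i).totalDegree ≤ 1) :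
    (aeval g p).totalDegree ≤ p.totalDegree := by
  rw [aeval_def, eval₂_eq']
  refine totalDegree_finsetSum_le fun d hd => ?_
  refine (totalDegree_mul _ _).trans ?_
  rw [algebraMap_eq, totalDegree_C, zero_add]
  refine (totalDegree_finsetProd _ _).trans (le_trans ?_ (le_totalDegree hd))
  rw [Finsupp.sum_fintype _ _ fun _ => rfl]
  refine Finset.sum_le_sum fun i _ => (totalDegree_pow _ _).trans ?_
  exact (Nat.mul_le_mul_left _ (hg i)).trans (mul_one _).le

/-- A homogeneous polynomial in three variables does not vanish identically on an affine chart. -/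
theorem IsHomogeneous.exists_eval_ne_zero {p : MvPolynomial (Fin 3) ℂ} {m : ℕ}
    (hp : p.IsHomogeneous m) (hp0 : p ≠ 0) : ∃ a : ℂ × ℂ, eval ![1, a.1, a.2] p ≠ 0 := by
  by_contra! h
  have h1 : p * X 0 = 0 := by
    refine MvPolynomial.funext fun x => ?_
    rw [map_mul, map_zero, eval_X]
    rcases eq_or_ne (x 0) 0 with hx | hx
    · rw [hx, mul_zero]
    · have h2 : x = x 0 • ![1, (x 0)⁻¹ * x 1, (x 0)⁻¹ * x 2] := by
        ext i
        fin_cases i <;> simp [hx]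
      have h3 := h ((x 0)⁻¹ * x 1, (x 0)⁻¹ * x 2)
      have h4 := hp.eval_smul (x 0) ![1, (x 0)⁻¹ * x 1, (x 0)⁻¹ * x 2]
      rw [← h2, h3, mul_zero] at h4
      rw [h4, zero_mul]
  exact hp0 ((mul_eq_zero.1 h1).resolve_right (X_ne_zero 0))

/-- The images of the coordinates under a shear. -/
noncomputable def shearFun (a : ℂ × ℂ) : Fin 3 → MvPolynomial (Fin 3) ℂ :=
  ![X 0, X 1 + C a.1 * X 0, X 2 + C a.2 * X 0]

theorem aeval_shearFun_neg (a : ℂ × ℂ) :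
    (aeval (shearFun a)).comp (aeval (shearFun (-a))) = AlgHom.id ℂ (MvPolynomial (Fin 3) ℂ) := by
  ext1 i
  fin_cases i <;> simp [shearFun, MvPolynomial.algebraMap_eq]

/-- The linear change of coordinates fixing the first coordinate and adding multiples of it to the
other two. -/
noncomputable def shear (a : ℂ × ℂ) : MvPolynomial (Fin 3) ℂ ≃ₐ[ℂ] MvPolynomial (Fin 3) ℂ :=
  AlgEquiv.ofAlgHom (aeval (shearFun a)) (aeval (shearFun (-a))) (aeval_shearFun_neg a)
    (by simpa using aeval_shearFun_neg (-a))

theorem eval_shear (a : ℂ × ℂ) (x : Fin 3 → ℂ) (p : MvPolynomial (Fin 3) ℂ) :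
    eval x (shear a p) = eval ![x 0, x 1 + a.1 * x 0, x 2 + a.2 * x 0] p := by
  have h1 : ((aeval x).comp (aeval (shearFun a)) : MvPolynomial (Fin 3) ℂ →ₐ[ℂ] ℂ) =
      aeval ![x 0, x 1 + a.1 * x 0, x 2 + a.2 * x 0] := by
    ext1 i
    fin_cases i <;> simp [shearFun]
  have h2 := DFunLike.congr_fun h1 p
  have h3 : ∀ (y : Fin 3 → ℂ) (q : MvPolynomial (Fin 3) ℂ), aeval y q = eval y q :=
    fun y q => congrArg (fun φ => φ q) (coe_aeval_eq_eval y)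
  rwa [AlgHom.comp_apply, h3, h3] at h2

theorem totalDegree_shear_le (a : ℂ × ℂ) (p : MvPolynomial (Fin 3) ℂ) :
    (shear a p).totalDegree ≤ p.totalDegree := by
  refine totalDegree_aeval_le p fun i => ?_
  have hX : ∀ (c : ℂ) (j : Fin 3),
      (X j + C c * X 0 : MvPolynomial (Fin 3) ℂ).totalDegree ≤ 1 := by
    intro c j
    refine (totalDegree_add _ _).trans (max_le (totalDegree_X j).le ?_)
    refine (totalDegree_mul _ _).trans ?_
    rw [totalDegree_C, totalDegree_X]
  fin_cases i
  · exact (totalDegree_X (0 : Fin 3)).le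
  · exact hX _ _
  · exact hX _ _

/-- The polynomial in the first coordinate obtained from a polynomial by a shear. -/
noncomputable def shearPoly (a : ℂ × ℂ) (p : MvPolynomial (Fin 3) ℂ) :
    Polynomial (MvPolynomial (Fin 2) ℂ) :=
  finSuccEquiv ℂ 2 (shear a p)

theorem eval_evalFamily_shearPoly (a : ℂ × ℂ) (p : MvPolynomial (Fin 3) ℂ) (u : ℂ × ℂ) (z : ℂ) :
    (evalFamily (shearPoly a p) u).eval z = eval ![z, u.1 + a.1 * z, u.2 + a.2 * z] p := by
  rw [evalFamily, shearPoly, ← eval_eq_eval_mv_eval', eval_shear]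
  rfl

theorem totalDegree_coeff_shearPoly (a : ℂ × ℂ) (p : MvPolynomial (Fin 3) ℂ) (k : ℕ)
    (hk : (shearPoly a p).coeff k ≠ 0) :
    ((shearPoly a p).coeff k).totalDegree + k ≤ p.totalDegree :=
  (totalDegree_coeff_finSuccEquiv_add_le _ _ hk).trans (totalDegree_shear_le a p)

theorem coeff_evalFamily_shearPoly_zero (a : ℂ × ℂ) (p : MvPolynomial (Fin 3) ℂ) :
    (evalFamily (shearPoly a p) 0).coeff p.totalDegree =
      eval ![1, a.1, a.2] (homogeneousComponent p.totalDegree p) := by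
  have h1 : evalFamily (shearPoly a p) 0 = ∑ j ∈ Finset.range (p.totalDegree + 1),
      Polynomial.monomial j (eval ![1, a.1, a.2] (homogeneousComponent j p)) := by
    refine Polynomial.funext fun t => ?_
    have h2 : ![t, (0 : ℂ × ℂ).1 + a.1 * t, (0 : ℂ × ℂ).2 + a.2 * t] = t • ![1, a.1, a.2] := by
      ext i
      fin_cases i <;> simp [mul_comm]
    rw [eval_evalFamily_shearPoly, h2, eval_smul_eq_sum le_rfl, Polynomial.eval_finsetSum]
    exact Finset.sum_congr rfl fun j _ => by rw [Polynomial.eval_monomial, mul_comm]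
  rw [h1, Polynomial.finsetSum_coeff]
  simp [Polynomial.coeff_monomial]

theorem coeff_shearPoly_totalDegree (a : ℂ × ℂ) (p : MvPolynomial (Fin 3) ℂ) :
    (shearPoly a p).coeff p.totalDegree =
      C (eval ![1, a.1, a.2] (homogeneousComponent p.totalDegree p)) := by
  have h0 : ((shearPoly a p).coeff p.totalDegree).totalDegree = 0 := by
    by_cases h : (shearPoly a p).coeff p.totalDegree = 0
    · rw [h, totalDegree_zero]
    · have := totalDegree_coeff_shearPoly a p _ h
      omega
  have h1 := totalDegree_eq_zero_iff_eq_C.1 h0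
  rw [← coeff_evalFamily_shearPoly_zero, evalFamily, Polynomial.coeff_map]
  rw [h1]
  simp

end MvPolynomial

/-- The coordinates on `ℂ³` adapted to a shear. -/
noncomputable def shearCoords (a : ℂ × ℂ) : EuclideanSpace ℂ (Fin 3) ≃L[ℂ] (ℂ × ℂ) × ℂ :=
  LinearEquiv.toContinuousLinearEquiv
    { toFun := fun x => ((x 1 - a.1 * x 0, x 2 - a.2 * x 0), x 0)
      invFun := fun q => !₂[q.2, q.1.1 + a.1 * q.2, q.1.2 + a.2 * q.2]
      map_add' := fun x y => by
        ext <;> simp <;> ring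
      map_smul' := fun s x => by
        ext <;> simp <;> ring
      left_inv := fun x => by
        ext i
        fin_cases i <;> simp
      right_inv := fun q => by
        ext <;> simp }

theorem shearCoords_apply (a : ℂ × ℂ) (x : EuclideanSpace ℂ (Fin 3)) :
    shearCoords a x = ((x 1 - a.1 * x 0, x 2 - a.2 * x 0), x 0) := rfl

/-- In suitable linear coordinates, a reduced affine surface is the zero set of an asymptotic
family of polynomials of the same degree. -/
theorem exists_asymptoticFamily_of_squarefree {f : MvPolynomial (Fin 3) ℂ}
    (hd : 0 < f.totalDegree) (hsq : Squarefree f) :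
    ∃ (F P : ℂ × ℂ → Polynomial ℂ) (U : Set (ℂ × ℂ))
      (e : EuclideanSpace ℂ (Fin 3) ≃L[ℂ] (ℂ × ℂ) × ℂ),
      AsymptoticFamily F P U f.totalDegree ∧ ∀ x, e x ∈ rootCone F ↔ x ∈ mvZeroSet f := by
  have hf0 : f ≠ 0 := by
    rintro rfl
    simp at hd
  obtain ⟨a, ha⟩ := (homogeneousComponent_isHomogeneous f.totalDegree f).exists_eval_ne_zero
    (homogeneousComponent_totalDegree_ne_zero hf0)
  set c := eval ![1, a.1, a.2] (homogeneousComponent f.totalDegree f) with hc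
  let h : Polynomial (MvPolynomial (Fin 2) ℂ) := Polynomial.C (C c⁻¹) * shearPoly a f
  have hcoeff : ∀ k, h.coeff k = C c⁻¹ * (shearPoly a f).coeff k := fun k =>
    Polynomial.coeff_C_mul _
  have hle : h.natDegree ≤ f.totalDegree :=
    Polynomial.natDegree_le_iff_coeff_eq_zero.2 fun k hk => by
      rw [hcoeff]
      by_contra h0
      have := totalDegree_coeff_shearPoly a f k (right_ne_zero_of_mul h0)
      omega
  have hone : h.coeff f.totalDegree = 1 := by
    rw [hcoeff, coeff_shearPoly_totalDegree, ← hc, ← C_mul, inv_mul_cancel₀ ha, C_1]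
  have hmon : h.Monic := Polynomial.monic_of_natDegree_le_of_coeff_eq_one _ hle hone
  have hdeg : h.natDegree = f.totalDegree :=
    le_antisymm hle (Polynomial.le_natDegree_of_ne_zero (by rw [hone]; exact one_ne_zero))
  have hunit : IsUnit (Polynomial.C (C c⁻¹) : Polynomial (MvPolynomial (Fin 2) ℂ)) :=
    ((IsUnit.mk0 _ (inv_ne_zero ha)).map C).map Polynomial.C
  have hsq1 : Squarefree (shearPoly a f) :=
    (hsq.map_mulEquiv (shear a).toMulEquiv).map_mulEquiv (finSuccEquiv ℂ 2).toMulEquiv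
  have hsqh : Squarefree h :=
    (associated_unit_mul_left (shearPoly a f) _ hunit).symm.squarefree_iff.1 hsq1
  have htd : ∀ k ≤ h.natDegree, (h.coeff k).totalDegree ≤ h.natDegree - k := by
    intro k hk
    rw [hdeg, hcoeff]
    refine (totalDegree_mul _ _).trans ?_
    rw [totalDegree_C, zero_add]
    by_cases h0 : (shearPoly a f).coeff k = 0
    · rw [h0, totalDegree_zero]
      exact Nat.zero_le _
    · have := totalDegree_coeff_shearPoly a f k h0
      omega
  obtain ⟨P, U, hPU⟩ := exists_asymptoticFamily_evalFamily hmon (hdeg ▸ hd) hsqh htd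
  rw [hdeg] at hPU
  refine ⟨evalFamily h, P, U, shearCoords a, hPU, fun x => ?_⟩
  have heval : ∀ u z, (evalFamily h u).eval z = c⁻¹ * (evalFamily (shearPoly a f) u).eval z := by
    intro u z
    simp [h, evalFamily]
  have hx : ![x 0, x 1 - a.1 * x 0 + a.1 * x 0, x 2 - a.2 * x 0 + a.2 * x 0] =
      (x : Fin 3 → ℂ) := by
    ext i
    fin_cases i <;> simp
  change (evalFamily h (shearCoords a x).1).eval (shearCoords a x).2 = 0 ↔
    eval (x : Fin 3 → ℂ) f = 0
  rw [heval, shearCoords_apply, eval_evalFamily_shearPoly, mul_eq_zero,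
    or_iff_right (inv_ne_zero ha), hx]

/-- the degree of complex algebraic surfaces in `ℂ³` is an outer
bi-Lipschitz invariant at infinity. -/
theorem degree_surfaces_biLipschitz_invariant_at_infinity
    (f g : MvPolynomial (Fin 3) ℂ)
    (hfdeg : 0 < f.totalDegree) (hgdeg : 0 < g.totalDegree)
    (hfsqf : Squarefree f) (hgsqf : Squarefree g)
    (hbilip : OuterBiLipAtInfty (mvZeroSet f) (mvZeroSet g)) :
    f.totalDegree = g.totalDegree := by
  obtain ⟨F, P, U, e, hF, he⟩ := exists_asymptoticFamily_of_squarefree hfdeg hfsqf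
  obtain ⟨G, Q, V, e', hG, he'⟩ := exists_asymptoticFamily_of_squarefree hgdeg hgsqf
  exact hF.degree_eq hG (hbilip.congr e e' he he')
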